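/- (Modified local theory) Fix s ∈ (1/2, 1) and a cutoff η as in the definition of I_N. Then there exist δ > 0, N₀ ≥ 1 and C > 0 such that: for every N ≥ N₀, every T > 0, and every smooth decaying solution φ of the cubic defocusing NLS on [0,T] × ℝ³ with E(I_N φ(0,·)) ≤ 1, if ‖φ‖_{L⁴_{x,t}([0,T]×ℝ³)} ≤ δ then for every Schrödinger admissible pair (q,r), ‖∇ I_N φ‖_{L^q_t L^r_x([0,T]×ℝ³)} ≤ C. -/

import Mathlib

open MeasureTheory Real Complex Filter
open scoped FourierTransform ContDiff ENNReal

noncomputable section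

abbrev E3 := EuclideanSpace ℝ (Fin 3)

/-- the `i`-th standard basis vector of `ℝ³`. -/
def e3 (i : Fin 3) : E3 := EuclideanSpace.single i (1 : ℝ)

/-- the `i`-th spatial partial derivative. -/
def pd (g : E3 → ℂ) (i : Fin 3) (x : E3) : ℂ := fderiv ℝ g x (e3 i)

/-- the (spatial) Laplacian. -/
def lap (g : E3 → ℂ) (x : E3) : ℂ := ∑ i : Fin 3, fderiv ℝ (fun y => pd g i y) x (e3 i)

/-- the antiderivative `F(z) = ∫₀^z f(s) ds` of `f`. -/
def Fa (f : ℝ → ℝ) (z : ℝ) : ℝ := ∫ s in (0:ℝ)..z, f s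

/-- `u` is a smooth decaying solution of the gNLS `i ∂ₜ u + α Δ u = μ f(|u|²) u`
on `[0,T] × ℝ³`: it is jointly smooth, every time derivative slice is a Schwartz
function of `x`, and the equation holds pointwise on `[0,T] × ℝ³`. -/
structure IsSolution (α μ : ℝ) (f : ℝ → ℝ) (T : ℝ) (u : ℝ → E3 → ℂ) : Prop where
  smooth : ContDiff ℝ ∞ (fun p : ℝ × E3 => u p.1 p.2)
  schwartz : ∀ (k : ℕ) (t : ℝ), ∃ g : SchwartzMap E3 ℂ,
      ∀ x, iteratedDeriv k (fun s => u s x) t = g x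
  eqn : ∀ t ∈ Set.Icc (0:ℝ) T, ∀ x : E3,
      Complex.I * deriv (fun s => u s x) t + (α : ℂ) * lap (u t) x
        = ((μ * f (Complex.normSq (u t x)) : ℝ) : ℂ) * u t x

/-- the `i`-th component of the mass current `Im (conj u ∇u)`. -/
def massCur (g : E3 → ℂ) (i : Fin 3) (x : E3) : ℝ := ((starRingEnd ℂ) (g x) * pd g i x).im

/-- the Morawetz action centered at `y`. -/
def morAction (g : E3 → ℂ) (y : E3) : ℝ :=
  ∫ x : E3, ∑ i : Fin 3, massCur g i x * ((x i - y i) / ‖x - y‖)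

/-- `|∇̸_y g(x)|²`, the squared norm of the angular part of the gradient. -/
def angGradSq (g : E3 → ℂ) (y x : E3) : ℝ :=
  ∑ i : Fin 3, Complex.normSq (pd g i x -
    (((x i - y i) / ‖x - y‖ : ℝ) : ℂ) *
      ∑ j : Fin 3, (((x j - y j) / ‖x - y‖ : ℝ) : ℂ) * pd g j x)

/-- squared homogeneous Sobolev norm `‖g‖²_{Ḣ^σ}`. -/
def sobSq (σ : ℝ) (g : E3 → ℂ) : ℝ := ∫ ξ : E3, ‖ξ‖ ^ (2 * σ) * ‖𝓕 g ξ‖ ^ 2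


/-- `η` is an admissible cutoff for the smoothing operator `I_N` at regularity `s`:
a smooth nonincreasing function on `[0,∞)` with values in `(0,1]`, equal to `1` for
`r ≤ 1` and to `r^{s−1}` for `r ≥ 2`. -/
def IsCutoff (s : ℝ) (η : ℝ → ℝ) : Prop :=
  ContDiff ℝ ∞ η ∧ AntitoneOn η (Set.Ici 0) ∧ (∀ r ≥ (0:ℝ), 0 < η r ∧ η r ≤ 1) ∧
    (∀ r ≤ (1:ℝ), η r = 1) ∧ (∀ r ≥ (2:ℝ), η r = r ^ (s - 1))

/-- the smoothing operator `I_N`, a Fourier multiplier with symbol `η(|ξ|/N)`. -/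
def Iop (η : ℝ → ℝ) (N : ℝ) (g : E3 → ℂ) : E3 → ℂ :=
  fun x => 𝓕⁻ (fun ξ : E3 => (η (‖ξ‖ / N) : ℂ) * 𝓕 g ξ) x

/-- the Littlewood–Paley type projection `P_M`, a Fourier multiplier with symbol `ψ(ξ/M)`. -/
def PM (ψ : E3 → ℝ) (M : ℝ) (g : E3 → ℂ) : E3 → ℂ :=
  fun x => 𝓕⁻ (fun ξ : E3 => (ψ (M⁻¹ • ξ) : ℂ) * 𝓕 g ξ) x

/-- pointwise norm `|∇g(x)|` of the spatial gradient. -/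
def gradNorm (g : E3 → ℂ) (x : E3) : ℝ := Real.sqrt (∑ i : Fin 3, Complex.normSq (pd g i x))

/-- `(q,r)` is a Schrödinger admissible pair for `ℝ^{3+1}`: `q, r ≥ 2` and
`1/q + 3/(2r) = 3/4`. -/
def SAdmissible (q r : ℝ≥0∞) : Prop := 2 ≤ q ∧ 2 ≤ r ∧ 1 / q + 3 / (2 * r) = 3 / 4

/-- the mixed spacetime norm `‖G‖_{L^q_t L^r_x([0,T] × ℝ³)}` (of a scalar function). -/
def LqLr (q r : ℝ≥0∞) (T : ℝ) (G : ℝ → E3 → ℝ) : ℝ≥0∞ :=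
  eLpNorm (fun t => (eLpNorm (G t) r volume).toReal) q (volume.restrict (Set.Icc (0:ℝ) T))

/-- `Z = sup_{(q,r) admissible} ‖∇ I_N φ‖_{L^q_t L^r_x([0,T] × ℝ³)}`. -/
def Znorm (η : ℝ → ℝ) (N T : ℝ) (φ : ℝ → E3 → ℂ) : ℝ≥0∞ :=
  ⨆ (q : ℝ≥0∞) (r : ℝ≥0∞) (_ : SAdmissible q r),
    LqLr q r T (fun t x => gradNorm (Iop η N (φ t)) x)

/-- the modified energy `E(w) = ∫ (1/2)|∇w|² + (1/4)|w|⁴ dx`. -/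
def energyE (w : E3 → ℂ) : ℝ :=
  ∫ x : E3, (1/2) * (∑ i : Fin 3, Complex.normSq (pd w i x)) + (1/4) * ‖w x‖ ^ 4

/-- squared inhomogeneous Sobolev norm `‖g‖²_{H^s}`. -/
def inhomSobSq (s : ℝ) (g : E3 → ℂ) : ℝ :=
  ∫ ξ : E3, (1 + ‖ξ‖ ^ 2) ^ s * ‖𝓕 g ξ‖ ^ 2


/-- (Modified local theory.) Fix `s ∈ (1/2, 1)` and a cutoff `η` for
`I_N`.  There exist `δ > 0`, `N₀ ≥ 1` and `C > 0` such that for every `N ≥ N₀`, `T > 0`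
and every smooth decaying solution `φ` of the cubic defocusing NLS on `[0,T] × ℝ³` with
`E(I_N φ(0)) ≤ 1` and `‖φ‖_{L⁴_{x,t}([0,T]×ℝ³)} ≤ δ`, one has
`‖∇ I_N φ‖_{L^q_t L^r_x([0,T]×ℝ³)} ≤ C` for every Schrödinger admissible pair `(q,r)`. -/
lemma fourier_continuous {F : E3 → ℂ} (h : Integrable F) : Continuous (𝓕 F) :=
  VectorFourier.fourierIntegral_continuous Real.continuous_fourierChar
    (by exact continuous_inner) h

lemma fourier_selfadj {F G : E3 → ℂ} (hF : Integrable F) (hG : Integrable G) :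
    ∫ ξ, 𝓕 F ξ * G ξ = ∫ x, F x * 𝓕 G x := by
  have := VectorFourier.integral_bilin_fourierIntegral_eq_flip (μ := volume) (ν := volume)
    (L := innerₗ E3) (ContinuousLinearMap.mul ℂ ℂ)
    Real.continuous_fourierChar (by exact continuous_inner) hF hG
  simp only [flip_innerₗ] at this
  exact this

lemma fourier_ae_eq {F : E3 → ℂ} (h1 : Integrable F) (h2 : MemLp F 2) :
    𝓕 F =ᵐ[volume] (𝓕 (h2.toLp F) : Lp (α := E3) ℂ 2) := by
  apply ae_eq_of_integral_contDiff_smul_eq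
  · exact (fourier_continuous h1).locallyIntegrable
  · exact (Lp.memLp _).locallyIntegrable (by norm_num)
  intro g hg hgc
  have hgc' : HasCompactSupport (fun x => (g x : ℂ)) := hgc.comp_left (g := fun x : ℝ => (x : ℂ)) (by simp)
  have hg' : ContDiff ℝ ∞ (fun x => (g x : ℂ)) := Complex.ofRealCLM.contDiff.comp hg
  set S : SchwartzMap E3 ℂ := hgc'.toSchwartzMap hg' with hS
  have e1 := congrArg (fun T => T S) (Lp.fourier_toTemperedDistribution_eq (h2.toLp F))
  simp only [Lp.toTemperedDistribution_apply, TemperedDistribution.fourier_apply] at e1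
  have hSg : ∀ x, S x = (g x : ℂ) := fun x => by simp [hS]
  have e2 : ∫ x, 𝓕 F x * S x = ∫ x, F x * 𝓕 (⇑S) x := fourier_selfadj h1 S.integrable
  have e3 : ∫ x, (𝓕 S) x • (h2.toLp F) x = ∫ x, F x * 𝓕 (⇑S) x := by
    apply integral_congr_ae
    filter_upwards [h2.coeFn_toLp] with x hx
    rw [hx, SchwartzMap.fourier_coe, smul_eq_mul, mul_comm]
  rw [e3, ← e2] at e1
  calc ∫ x, g x • 𝓕 F x = ∫ x, 𝓕 F x * S x := by
        congr 1; ext x; rw [hSg, Complex.real_smul, mul_comm]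
    _ = _ := by
        rw [e1]; congr 1

lemma fourier_memLp {F : E3 → ℂ} (h1 : Integrable F) (h2 : MemLp F 2) : MemLp (𝓕 F) 2 :=
  (memLp_congr_ae (fourier_ae_eq h1 h2)).2 (Lp.memLp _)

lemma eLpNorm_fourier {F : E3 → ℂ} (h1 : Integrable F) (h2 : MemLp F 2) :
    eLpNorm (𝓕 F) 2 volume = eLpNorm F 2 volume := by
  rw [eLpNorm_congr_ae (fourier_ae_eq h1 h2)]
  have := Lp.norm_fourier_eq (h2.toLp F)
  rw [Lp.norm_def, Lp.norm_toLp] at this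
  exact (ENNReal.toReal_eq_toReal_iff' (Lp.memLp _).2.ne h2.2.ne).1 this

lemma inner_fourier {F G : E3 → ℂ} (h1 : Integrable F) (h2 : MemLp F 2)
    (h1' : Integrable G) (h2' : MemLp G 2) :
    ∫ ξ, (starRingEnd ℂ) (𝓕 F ξ) * 𝓕 G ξ = ∫ x, (starRingEnd ℂ) (F x) * G x := by
  have := Lp.inner_fourier_eq (h2.toLp F) (h2'.toLp G)
  rw [L2.inner_def, L2.inner_def] at this
  convert this using 1
  · apply integral_congr_ae
    filter_upwards [fourier_ae_eq h1 h2, fourier_ae_eq h1' h2'] with x hx hy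
    rw [hx, hy]; simp [mul_comm]
  · apply integral_congr_ae
    filter_upwards [h2.coeFn_toLp, h2'.coeFn_toLp] with x hx hy
    rw [hx, hy]; simp [mul_comm]

lemma eLpNorm_fourierInv {F : E3 → ℂ} (h1 : Integrable F) (h2 : MemLp F 2) :
    eLpNorm (𝓕⁻ F) 2 volume = eLpNorm F 2 volume := by
  rw [← eLpNorm_fourier h1 h2]
  have : (𝓕⁻ F) = (𝓕 F) ∘ (fun x => -x) := by
    ext x; exact Real.fourierInv_eq_fourier_neg F x
  rw [this]
  exact eLpNorm_comp_measurePreserving (fourier_continuous h1).aestronglyMeasurable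
    (Measure.measurePreserving_neg volume)

lemma fourierInv_continuous {F : E3 → ℂ} (h : Integrable F) : Continuous (𝓕⁻ F) := by
  have : (𝓕⁻ F) = (𝓕 F) ∘ (fun x => -x) := by
    ext x; exact Real.fourierInv_eq_fourier_neg F x
  rw [this]; exact (fourier_continuous h).comp continuous_neg

lemma gauss_norm_le {b : ℂ} (hb : 0 < b.re) (w : E3) :
    ‖∫ v : E3, Complex.exp (-b * ‖v‖ ^ 2 + (2 * π * I) * (inner ℝ w v : ℝ))‖
      ≤ (π / ‖b‖) ^ ((3:ℝ)/2) := by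
  have hb0 : b ≠ 0 := by intro h; simp [h] at hb
  rw [GaussianFourier.integral_cexp_neg_mul_sq_norm_add hb, norm_mul]
  have h1 : ‖((π:ℂ) / b) ^ ((Module.finrank ℝ E3 : ℂ) / 2)‖ = (π / ‖b‖) ^ ((3:ℝ)/2) := by
    have : ((Module.finrank ℝ E3 : ℂ) / 2) = (((3:ℝ)/2 : ℝ) : ℂ) := by
      simp
    rw [this, Complex.norm_cpow_real]
    simp [abs_of_pos Real.pi_pos]
  rw [h1]
  have h2 : ‖Complex.exp ((2 * π * I) ^ 2 * (‖w‖:ℂ) ^ 2 / (4 * b))‖ ≤ 1 := by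
    rw [Complex.norm_exp]
    rw [Real.exp_le_one_iff]
    have : (2 * π * I) ^ 2 * (‖w‖:ℂ) ^ 2 / (4 * b) = ((-(π ^ 2 * ‖w‖ ^ 2) : ℝ) : ℂ) * b⁻¹ := by
      rw [mul_pow, I_sq]; push_cast; field_simp; ring
    rw [this, Complex.re_ofReal_mul, Complex.inv_re]
    have : 0 ≤ b.re / normSq b := div_nonneg hb.le (normSq_nonneg _)
    nlinarith [mul_nonneg (by positivity : 0 ≤ π ^ 2 * ‖w‖ ^ 2) this]
  exact mul_le_of_le_one_right (by positivity) h2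

lemma integrable_gauss {b : ℂ} (hb : 0 < b.re) (w : E3) :
    Integrable (fun v : E3 => Complex.exp (-b * ‖v‖ ^ 2 + (2 * π * I) * (inner ℝ w v : ℝ))) :=
  GaussianFourier.integrable_cexp_neg_mul_sq_norm_add hb _ _

lemma norm_fourier_le {F : E3 → ℂ} (ξ : E3) : ‖𝓕 F ξ‖ ≤ ∫ x, ‖F x‖ :=
  VectorFourier.norm_fourierIntegral_le_integral_norm _ _ _ _ _

lemma fourier_conj (F : E3 → ℂ) (ξ : E3) :
    (starRingEnd ℂ) (𝓕 F ξ) = 𝓕 (fun x => (starRingEnd ℂ) (F x)) (-ξ) := by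
  rw [Real.fourier_eq', Real.fourier_eq', ← integral_conj]
  congr 1; ext x
  simp only [smul_eq_mul, map_mul, ← Complex.exp_conj, Complex.conj_ofReal, Complex.conj_I,
    inner_neg_right]
  congr 2; push_cast; ring

lemma gauss_pair_le {b : ℂ} (hb : 0 < b.re) {F G : E3 → ℂ} (hF : Integrable F) (hG : Integrable G) :
    ‖∫ ξ, (starRingEnd ℂ) (𝓕 F ξ) * (𝓕 G ξ * Complex.exp (-b * ‖ξ‖ ^ 2))‖
      ≤ (π / ‖b‖) ^ ((3:ℝ)/2) * (∫ x, ‖F x‖) * ∫ x, ‖G x‖ := by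
  set M := (π / ‖b‖) ^ ((3:ℝ)/2)
  have hFc : Integrable (fun x => (starRingEnd ℂ) (F x)) :=
    (integrable_norm_iff (Complex.continuous_conj.comp_aestronglyMeasurable hF.1)).1 (by simpa using hF.norm)
  set H : E3 → ℂ := fun ξ => 𝓕 G (-ξ) * Complex.exp (-b * ‖ξ‖ ^ 2)
  have hg0 := integrable_gauss hb (0 : E3)
  simp only [inner_zero_left, Complex.ofReal_zero, mul_zero, add_zero] at hg0
  have hH : Integrable H := by
    apply hg0.bdd_mul (c := ∫ x, ‖G x‖) (((fourier_continuous hG).comp continuous_neg).aestronglyMeasurable)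
    exact Filter.Eventually.of_forall fun ξ => norm_fourier_le _
  have e1 : ∫ ξ, (starRingEnd ℂ) (𝓕 F ξ) * (𝓕 G ξ * Complex.exp (-b * ‖ξ‖ ^ 2))
      = ∫ ξ, 𝓕 (fun x => (starRingEnd ℂ) (F x)) ξ * H ξ := by
    rw [← integral_neg_eq_self]
    congr 1; ext ξ
    simp only [H, fourier_conj, neg_neg, norm_neg]
  rw [e1, fourier_selfadj hFc hH]
  have key : ∀ x, ‖𝓕 H x‖ ≤ M * ∫ x, ‖G x‖ := by
    intro x
    have e2 : 𝓕 H x = ∫ ξ, 𝓕 G ξ * Complex.exp (-b * ‖ξ‖ ^ 2 + (2 * π * I) * (inner ℝ x ξ : ℝ)) := by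
      rw [Real.fourier_eq', ← integral_neg_eq_self]
      congr 1; ext ξ
      simp only [H, neg_neg, norm_neg, inner_neg_left, smul_eq_mul, real_inner_comm ξ x, Complex.exp_add]
      rw [mul_comm, mul_assoc]; congr 3
      push_cast; ring
    rw [e2, fourier_selfadj hG (integrable_gauss hb x)]
    calc _ ≤ ∫ y, ‖G y * 𝓕 (fun ξ => Complex.exp (-b * ‖ξ‖ ^ 2 + (2 * π * I) * (inner ℝ x ξ : ℝ))) y‖ :=
          norm_integral_le_integral_norm _
      _ ≤ ∫ y, M * ‖G y‖ := by
          apply integral_mono_of_nonneg (Filter.Eventually.of_forall fun _ => norm_nonneg _)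
            (hG.norm.const_mul _)
          refine Filter.Eventually.of_forall fun y => ?_
          simp only [norm_mul]
          rw [mul_comm]
          refine mul_le_mul_of_nonneg_right ?_ (norm_nonneg _)
          refine le_trans (le_of_eq ?_) (gauss_norm_le hb (x - y))
          rw [Real.fourier_eq']
          congr 2; ext ξ
          rw [smul_eq_mul, ← Complex.exp_add, inner_sub_left, real_inner_comm y ξ]
          congr 1; push_cast; ring
      _ = _ := integral_const_mul _ _
  calc _ ≤ ∫ y, ‖(starRingEnd ℂ) (F y) * 𝓕 H y‖ := norm_integral_le_integral_norm _
    _ ≤ ∫ y, ‖F y‖ * (M * ∫ x, ‖G x‖) := by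
        apply integral_mono_of_nonneg (Filter.Eventually.of_forall fun _ => norm_nonneg _)
            (hF.norm.mul_const _)
        refine Filter.Eventually.of_forall fun y => ?_
        simp only [norm_mul, RCLike.norm_conj]
        exact mul_le_mul_of_nonneg_left (key y) (norm_nonneg _)
    _ = _ := by rw [integral_mul_const]; ring

lemma dispersive {τ : ℝ} (hτ : τ ≠ 0) {F G : E3 → ℂ} (hF : Integrable F) (hG : Integrable G)
    (hF2 : MemLp F 2) (hG2 : MemLp G 2) :
    ‖∫ ξ, (starRingEnd ℂ) (𝓕 F ξ) * (𝓕 G ξ * Complex.exp ((τ * ‖ξ‖ ^ 2 : ℝ) * I))‖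
      ≤ (π / |τ|) ^ ((3:ℝ)/2) * (∫ x, ‖F x‖) * ∫ x, ‖G x‖ := by
  set A : E3 → ℂ := fun ξ => (starRingEnd ℂ) (𝓕 F ξ) * (𝓕 G ξ * Complex.exp ((τ * ‖ξ‖ ^ 2 : ℝ) * I))
  set b : ℕ → ℂ := fun n => ((1 / ((n:ℝ) + 1) : ℝ) : ℂ) - τ * I
  have hbre : ∀ n, (b n).re = 1 / ((n:ℝ)+1) := by
    intro n; simp only [b, Complex.sub_re, Complex.ofReal_re]; simp
  have hbim : ∀ n, (b n).im = -τ := by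
    intro n; simp only [b, Complex.sub_im, Complex.ofReal_im]; simp
  have hb : ∀ n, 0 < (b n).re := fun n => by rw [hbre]; positivity
  have hIntg : Integrable (fun ξ => ‖𝓕 F ξ‖ * ‖𝓕 G ξ‖) :=
    (fourier_memLp hF hF2).norm.integrable_mul (fourier_memLp hG hG2).norm
  have hlim : Tendsto (fun n => ∫ ξ, (starRingEnd ℂ) (𝓕 F ξ) * (𝓕 G ξ * Complex.exp (-(b n) * ‖ξ‖ ^ 2)))
      atTop (nhds (∫ ξ, A ξ)) := by
    apply tendsto_integral_of_dominated_convergence _ _ hIntg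
    · intro n
      refine Filter.Eventually.of_forall fun ξ => ?_
      rw [norm_mul, norm_mul, RCLike.norm_conj, Complex.norm_exp]
      refine mul_le_mul_of_nonneg_left ?_ (norm_nonneg _)
      refine mul_le_of_le_one_right (norm_nonneg _) ?_
      rw [Real.exp_le_one_iff]
      have : (-(b n) * (‖ξ‖:ℂ) ^ 2).re = - ((b n).re * ‖ξ‖ ^ 2) := by
        rw [← Complex.ofReal_pow, mul_comm, Complex.re_ofReal_mul]; simp [mul_comm]
      rw [this]
      have := mul_nonneg (hb n).le (sq_nonneg ‖ξ‖)
      linarith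
    · refine Filter.Eventually.of_forall fun ξ => ?_
      refine Tendsto.const_mul _ (Tendsto.const_mul _ ?_)
      refine (Complex.continuous_exp.tendsto _).comp ?_
      have h0 : Tendsto b atTop (nhds (0 - τ * I)) := by
        refine Tendsto.sub ?_ tendsto_const_nhds
        rw [← Complex.ofReal_zero]
        exact (Complex.continuous_ofReal.tendsto 0).comp tendsto_one_div_add_atTop_nhds_zero_nat
      have := (h0.neg).mul_const ((‖ξ‖:ℂ) ^ 2)
      convert this using 2
      push_cast; ring
    · intro n
      refine Continuous.aestronglyMeasurable ?_
      have := fourier_continuous hF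
      have := fourier_continuous hG
      fun_prop
  refine le_of_tendsto hlim.norm (Filter.Eventually.of_forall fun n => ?_)
  refine (gauss_pair_le (hb n) hF hG).trans ?_
  gcongr
  rw [← abs_neg, ← hbim n]
  exact Complex.abs_im_le_norm _

lemma lint_cs {α : Type*} [MeasurableSpace α] (μ : Measure α) {f g : α → ℝ≥0∞}
    (hf : AEMeasurable f μ) (hg : AEMeasurable g μ) :
    (∫⁻ a, f a * g a ∂μ) ^ 2 ≤ (∫⁻ a, f a ^ 2 ∂μ) * ∫⁻ a, g a ^ 2 ∂μ := by
  have h := ENNReal.lintegral_mul_le_Lp_mul_Lq μ (p := 2) (q := 2)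
    (by constructor <;> norm_num) hf hg
  simp only [ENNReal.rpow_two] at h
  calc _ ≤ ((∫⁻ a, f a ^ 2 ∂μ) ^ (1/2:ℝ) * (∫⁻ a, g a ^ 2 ∂μ) ^ (1/2:ℝ)) ^ 2 := by
        gcongr; exact h
    _ = _ := by
        rw [mul_pow, ← ENNReal.rpow_natCast, ← ENNReal.rpow_natCast, ← ENNReal.rpow_mul,
          ← ENNReal.rpow_mul]; norm_num

lemma lint_sq_le {α : Type*} [MeasurableSpace α] (μ : Measure α) {f : α → ℝ≥0∞}
    (hf : AEMeasurable f μ) :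
    (∫⁻ a, f a ∂μ) ^ 2 ≤ μ Set.univ * ∫⁻ a, f a ^ 2 ∂μ := by
  have := lint_cs μ (f := fun _ => 1) aemeasurable_const hf
  simpa using this

lemma eLpNorm_two_sq {α : Type*} [MeasurableSpace α] (μ : Measure α) (f : α → ℂ) :
    eLpNorm f 2 μ ^ 2 = ∫⁻ a, ‖f a‖ₑ ^ 2 ∂μ := by
  have := eLpNorm_nnreal_pow_eq_lintegral (p := 2) (f := f) (μ := μ) (by norm_num)
  simpa using this

lemma memLp_two_iff {α : Type*} [MeasurableSpace α] (μ : Measure α) {f : α → ℂ}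
    (hf : AEStronglyMeasurable f μ) : MemLp f 2 μ ↔ ∫⁻ a, ‖f a‖ₑ ^ 2 ∂μ < ⊤ := by
  rw [← eLpNorm_two_sq, MemLp, and_iff_right hf]
  simp [lt_top_iff_ne_top]

/-- hermitian pairing -/
def br (g h : E3 → ℂ) : ℂ := ∫ ξ, (starRingEnd ℂ) (g ξ) * h ξ

lemma br_comm (g h : E3 → ℂ) : ‖br g h‖ₑ = ‖br h g‖ₑ := by
  have : br g h = (starRingEnd ℂ) (br h g) := by
    rw [br, br, ← integral_conj]; congr 1; ext ξ; simp [mul_comm]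
  rw [this, ← ofReal_norm, ← ofReal_norm, RCLike.norm_conj]

lemma enorm_conj' (z : ℂ) : ‖(starRingEnd ℂ) z‖ₑ = ‖z‖ₑ := by
  rw [← ofReal_norm, ← ofReal_norm, RCLike.norm_conj]

lemma br_cs {g h : E3 → ℂ} (hg : AEStronglyMeasurable g volume) (hh : AEStronglyMeasurable h volume) :
    ‖br g h‖ₑ ^ 2 ≤ (∫⁻ ξ, ‖g ξ‖ₑ ^ 2) * ∫⁻ ξ, ‖h ξ‖ₑ ^ 2 := by
  refine le_trans ?_ (lint_cs volume hg.enorm hh.enorm)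
  gcongr
  refine (enorm_integral_le_lintegral_enorm _).trans (le_of_eq ?_)
  congr 1; ext ξ; rw [enorm_mul, enorm_conj']

lemma br_integrable {g h : E3 → ℂ} (hg : MemLp g 2) (hh : MemLp h 2) :
    Integrable (fun ξ => (starRingEnd ℂ) (g ξ) * h ξ) := by
  have : MemLp (fun ξ => (starRingEnd ℂ) (g ξ)) 2 :=
    (memLp_norm_iff (Complex.continuous_conj.comp_aestronglyMeasurable hg.1)).1 (by simpa using hg.norm)
  exact this.integrable_mul hh

lemma br_self {g : E3 → ℂ} (hg : MemLp g 2) : ‖br g g‖ₑ = ∫⁻ ξ, ‖g ξ‖ₑ ^ 2 := by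
  have h : br g g = ((∫ ξ, ‖g ξ‖ ^ 2 : ℝ) : ℂ) := by
    refine Eq.trans ?_ (integral_ofReal (𝕜 := ℂ))
    unfold br; congr 1; ext ξ
    rw [← Complex.normSq_eq_conj_mul_self, Complex.normSq_eq_norm_sq]; rfl
  rw [h, ← ofReal_norm, Complex.norm_real, Real.norm_eq_abs,
    abs_of_nonneg (integral_nonneg fun _ => sq_nonneg _),
    ofReal_integral_eq_lintegral_ofReal _ (Filter.Eventually.of_forall fun _ => sq_nonneg _)]
  · congr 1; ext ξ; rw [← ofReal_norm, ENNReal.ofReal_pow (norm_nonneg _)]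
  · exact hg.norm.integrable_sq

lemma amgm {a b c e : ℝ≥0∞} (h : a ^ 2 ≤ b * c) (he : e ≠ 0) (he' : e ≠ ⊤) :
    a ≤ e * b + e⁻¹ * c := by
  have h1 : b * c = (e * b) * (e⁻¹ * c) := by
    calc b * c = (e * e⁻¹) * (b * c) := by rw [ENNReal.mul_inv_cancel he he', one_mul]
      _ = _ := by ring
  have h2 : a ^ 2 ≤ (e * b + e⁻¹ * c) ^ 2 := by
    rw [h1] at h
    refine h.trans ?_
    rw [sq]; exact mul_le_mul' le_self_add le_add_self
  exact (ENNReal.pow_le_pow_left_iff (by norm_num)).1 h2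

/-- time integral of v over the set A -/
def tint (v : ℝ → E3 → ℂ) (A : Set ℝ) (ξ : E3) : ℂ := ∫ s in A, v s ξ

lemma tint_meas {v : ℝ → E3 → ℂ} (hv : Measurable (fun p : ℝ × E3 => v p.1 p.2)) (A : Set ℝ) :
    StronglyMeasurable (tint v A) := by
  have : StronglyMeasurable (fun p : E3 × ℝ => v p.2 p.1) := (hv.comp measurable_swap).stronglyMeasurable
  exact this.integral_prod_right

lemma tint_l2 {v : ℝ → E3 → ℂ} (hv : Measurable (fun p : ℝ × E3 => v p.1 p.2)) {A : Set ℝ} :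
    ∫⁻ ξ, ‖tint v A ξ‖ₑ ^ 2 ≤ volume A * ∫⁻ s in A, ∫⁻ ξ, ‖v s ξ‖ₑ ^ 2 := by
  have hm : Measurable (fun p : ℝ × E3 => ‖v p.1 p.2‖ₑ ^ 2) := hv.enorm.pow_const 2
  rw [lintegral_lintegral_swap hm.aemeasurable]
  calc _ ≤ ∫⁻ ξ, volume A * ∫⁻ s in A, ‖v s ξ‖ₑ ^ 2 := by
        apply lintegral_mono; intro ξ
        have hmξ : Measurable (fun s => ‖v s ξ‖ₑ) := (hv.comp (measurable_id.prodMk measurable_const)).enorm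
        have := lint_sq_le (volume.restrict A) hmξ.aemeasurable
        rw [Measure.restrict_apply_univ] at this
        refine le_trans ?_ this
        exact pow_le_pow_left' (enorm_integral_le_lintegral_enorm _) 2
    _ = _ := by
        rw [lintegral_const_mul]
        exact (hm.comp measurable_swap).lintegral_prod_right'

lemma tint_memLp {v : ℝ → E3 → ℂ} (hv : Measurable (fun p : ℝ × E3 => v p.1 p.2)) {A : Set ℝ}
    (hA : volume A ≠ ⊤) (hfin : ∫⁻ s in A, ∫⁻ ξ, ‖v s ξ‖ₑ ^ 2 ≠ ⊤) : MemLp (tint v A) 2 := by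
  rw [memLp_two_iff _ (tint_meas hv A).aestronglyMeasurable]
  exact (tint_l2 hv).trans_lt (ENNReal.mul_lt_top hA.lt_top hfin.lt_top)

/-- pairing of a time integral with a fixed function -/
lemma br_tint_le {v : ℝ → E3 → ℂ} (hv : Measurable (fun p : ℝ × E3 => v p.1 p.2)) {A : Set ℝ}
    (hA : volume A ≠ ⊤) (hfin : ∫⁻ s in A, ∫⁻ ξ, ‖v s ξ‖ₑ ^ 2 ≠ ⊤) {g : E3 → ℂ} (hg : MemLp g 2) :
    ‖br (tint v A) g‖ₑ ≤ ∫⁻ s in A, ‖br (v s) g‖ₑ := by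
  have hIntg : Integrable (fun p : ℝ × E3 => (starRingEnd ℂ) (v p.1 p.2) * g p.2)
      ((volume.restrict A).prod volume) := by
    have hgm : AEStronglyMeasurable (fun p : ℝ × E3 => g p.2) ((volume.restrict A).prod volume) :=
      hg.1.comp_snd
    have hgl := (memLp_two_iff _ hg.1).1 hg
    have h1 : AEStronglyMeasurable (fun p : ℝ × E3 => (starRingEnd ℂ) (v p.1 p.2)) ((volume.restrict A).prod volume) :=
      (Complex.continuous_conj.measurable.comp hv).aestronglyMeasurable
    refine ⟨h1.mul hgm, ?_⟩
    rw [hasFiniteIntegral_iff_enorm]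
    have hcs := lint_cs ((volume.restrict A).prod volume) (f := fun p : ℝ × E3 => ‖v p.1 p.2‖ₑ)
      (g := fun p => ‖g p.2‖ₑ) hv.enorm.aemeasurable hgm.enorm
    have e1 : ∫⁻ p, ‖v p.1 p.2‖ₑ ^ 2 ∂((volume.restrict A).prod volume) = ∫⁻ s in A, ∫⁻ ξ, ‖v s ξ‖ₑ ^ 2 :=
      lintegral_prod _ (hv.enorm.pow_const 2).aemeasurable
    have e2 : ∫⁻ p : ℝ × E3, ‖g p.2‖ₑ ^ 2 ∂((volume.restrict A).prod volume) = (∫⁻ ξ, ‖g ξ‖ₑ ^ 2) * volume A := by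
      rw [lintegral_prod _ (hgm.enorm.pow_const 2)]; simp
    rw [e1, e2] at hcs
    have hlt := hcs.trans_lt (ENNReal.mul_lt_top hfin.lt_top (ENNReal.mul_lt_top hgl hA.lt_top))
    have : ∫⁻ p, ‖v p.1 p.2‖ₑ * ‖g p.2‖ₑ ∂((volume.restrict A).prod volume) < ⊤ := by
      by_contra h
      rw [not_lt, top_le_iff] at h
      rw [h] at hlt; simp at hlt
    refine lt_of_eq_of_lt ?_ this
    congr 1; ext p; rw [enorm_mul, enorm_conj']
  have e : br (tint v A) g = ∫ s in A, br (v s) g := by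
    unfold br
    rw [integral_integral_swap (by exact hIntg)]
    congr 1; ext ξ
    rw [tint, ← integral_conj, integral_mul_const]
  rw [e]
  exact enorm_integral_le_lintegral_enorm _

lemma lint_far (ρ : ℝ) (hρ : 0 < ρ) :
    ∫⁻ τ : ℝ in {τ : ℝ | ρ ≤ |τ|}, ENNReal.ofReal (|τ| ^ (-(3/2) : ℝ)) ≤ ENNReal.ofReal (4 * ρ ^ (-(1/2) : ℝ)) := by
  have h1 : ∫⁻ τ : ℝ in Set.Ioi ρ, ENNReal.ofReal (|τ| ^ (-(3/2) : ℝ)) = ENNReal.ofReal (2 * ρ ^ (-(1/2) : ℝ)) := by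
    have e : ∫⁻ τ : ℝ in Set.Ioi ρ, ENNReal.ofReal (|τ| ^ (-(3/2) : ℝ)) = ∫⁻ τ : ℝ in Set.Ioi ρ, ENNReal.ofReal (τ ^ (-(3/2) : ℝ)) := by
      apply setLIntegral_congr_fun measurableSet_Ioi
      intro τ hτ
      simp only [abs_of_pos (hρ.trans hτ)]
    rw [e, ← ofReal_integral_eq_lintegral_ofReal]
    · rw [integral_Ioi_rpow_of_lt (by norm_num) hρ]
      congr 1; norm_num; ring
    · exact integrableOn_Ioi_rpow_of_lt (by norm_num) hρ
    · filter_upwards [ae_restrict_mem measurableSet_Ioi] with τ hτ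
      exact Real.rpow_nonneg (hρ.le.trans (le_of_lt hτ)) _
  have h1' : ∫⁻ τ : ℝ in Set.Ici ρ, ENNReal.ofReal (|τ| ^ (-(3/2) : ℝ)) = ENNReal.ofReal (2 * ρ ^ (-(1/2) : ℝ)) := by
    rw [← h1]; exact setLIntegral_congr Ioi_ae_eq_Ici.symm
  have h2 : ∫⁻ τ : ℝ in Set.Iic (-ρ), ENNReal.ofReal (|τ| ^ (-(3/2) : ℝ)) = ENNReal.ofReal (2 * ρ ^ (-(1/2) : ℝ)) := by
    rw [← h1', ← lintegral_indicator measurableSet_Iic, ← lintegral_indicator measurableSet_Ici,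
      ← lintegral_neg_eq_self]
    congr 1; ext τ
    simp only [Set.indicator, Set.mem_Iic, Set.mem_Ici, neg_le_neg_iff, abs_neg]
  have hs : {τ : ℝ | ρ ≤ |τ|} ⊆ Set.Ici ρ ∪ Set.Iic (-ρ) := by
    intro τ hτ
    rcases le_abs.1 (show ρ ≤ |τ| from hτ) with h | h
    · left; exact h
    · right; simp only [Set.mem_Iic]; linarith
  calc _ ≤ _ := lintegral_mono_set hs
    _ ≤ _ := lintegral_union_le _ _ _
    _ = _ := by
      rw [h1', h2, ← ENNReal.ofReal_add (by positivity) (by positivity)]; congr 1; ring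

lemma schur_le {A : Set ℝ} {κ f g : ℝ → ℝ≥0∞} (hκ : Measurable κ) (hf : Measurable f) (hg : Measurable g) :
    ∫⁻ t in A, ∫⁻ s in A, κ (s - t) * (f s * g t)
      ≤ (∫⁻ τ, κ τ) * ((∫⁻ s in A, f s ^ 2) + ∫⁻ s in A, g s ^ 2) := by
  have hfg : ∀ s t, f s * g t ≤ f s ^ 2 + g t ^ 2 := by
    intro s t
    rcases le_total (f s) (g t) with h | h
    · exact (mul_le_mul_left h _).trans (by rw [sq (g t)]; exact le_add_self)
    · exact (mul_le_mul_right h _).trans (by rw [sq (f s)]; exact le_self_add)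
  have m1 : Measurable (fun p : ℝ × ℝ => κ (p.2 - p.1) * f p.2 ^ 2) := by fun_prop
  have m2 : Measurable (fun p : ℝ × ℝ => κ (p.2 - p.1) * g p.1 ^ 2) := by fun_prop
  calc _ ≤ ∫⁻ t in A, ∫⁻ s in A, (κ (s - t) * f s ^ 2 + κ (s - t) * g t ^ 2) := by
        gcongr with t s
        rw [← mul_add]; gcongr; exact hfg _ _
    _ = (∫⁻ t in A, ∫⁻ s in A, κ (s - t) * f s ^ 2) + ∫⁻ t in A, ∫⁻ s in A, κ (s - t) * g t ^ 2 := by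
        rw [← lintegral_add_left m1.lintegral_prod_right']
        congr 1; ext t
        rw [← lintegral_add_left (by fun_prop)]
    _ ≤ (∫⁻ τ, κ τ) * (∫⁻ s in A, f s ^ 2) + (∫⁻ τ, κ τ) * ∫⁻ s in A, g s ^ 2 := by
        gcongr
        · rw [lintegral_lintegral_swap m1.aemeasurable, ← lintegral_const_mul _ (by fun_prop)]
          gcongr with s
          rw [lintegral_mul_const _ (by fun_prop)]
          refine mul_le_mul_left ?_ _
          calc _ ≤ ∫⁻ t, κ (s - t) := setLIntegral_le_lintegral _ _
            _ = _ := lintegral_sub_left_eq_self _ s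
        · rw [← lintegral_const_mul _ (by fun_prop)]
          gcongr with s
          rw [lintegral_mul_const _ (by fun_prop)]
          refine mul_le_mul_left ?_ _
          calc _ ≤ ∫⁻ t, κ (t - s) := setLIntegral_le_lintegral _ _
            _ = _ := lintegral_sub_right_eq_self _ s
    _ = _ := by rw [mul_add]

/-- hypotheses of the abstract endpoint argument -/
structure KT (C : ℝ) (v : ℤ → ℝ → E3 → ℂ) (f : ℤ → ℝ → ℝ≥0∞) : Prop where
  hC : 0 ≤ C
  vm : ∀ k, Measurable (fun p : ℝ × E3 => v k p.1 p.2)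
  fm : ∀ k, Measurable (f k)
  l2 : ∀ k s, ∫⁻ ξ, ‖v k s ξ‖ₑ ^ 2 ≤ ENNReal.ofReal ((2:ℝ) ^ (-(2 * (k:ℝ) / 3))) * f k s ^ 2
  di : ∀ k m s t, s ≠ t → ‖br (v k s) (v m t)‖ₑ ≤
    ENNReal.ofReal (C * |s - t| ^ (-(3/2) : ℝ) * 2 ^ (((k:ℝ) + m) / 6)) * (f k s * f m t)

lemma KT.fin {C : ℝ} {v : ℤ → ℝ → E3 → ℂ} {f : ℤ → ℝ → ℝ≥0∞} (h : KT C v f) {A : Set ℝ} {k : ℤ}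
    (hk : ∫⁻ s in A, f k s ^ 2 ≠ ⊤) : ∫⁻ s in A, ∫⁻ ξ, ‖v k s ξ‖ₑ ^ 2 ≠ ⊤ := by
  refine ne_top_of_le_ne_top ?_ (lintegral_mono (h.l2 k))
  rw [lintegral_const_mul _ ((h.fm k).pow_const 2)]
  exact ENNReal.mul_ne_top ENNReal.ofReal_ne_top hk

lemma KT.vmem {C : ℝ} {v : ℤ → ℝ → E3 → ℂ} {f : ℤ → ℝ → ℝ≥0∞} (h : KT C v f) {k : ℤ} {s : ℝ}
    (hk : f k s ≠ ⊤) : MemLp (v k s) 2 := by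
  rw [memLp_two_iff]
  · exact (h.l2 k s).trans_lt (ENNReal.mul_lt_top ENNReal.ofReal_lt_top (ENNReal.pow_lt_top hk.lt_top))
  · exact ((h.vm k).comp (measurable_const.prodMk measurable_id)).aestronglyMeasurable

lemma KT.diag {C : ℝ} {v : ℤ → ℝ → E3 → ℂ} {f : ℤ → ℝ → ℝ≥0∞} (h : KT C v f) {A : Set ℝ}
    (hA : volume A ≠ ⊤) {k : ℤ} (hfin : ∀ s, f k s ≠ ⊤)
    (hk : ∫⁻ s in A, f k s ^ 2 ≠ ⊤) :
    ∫⁻ ξ, ‖tint (v k) A ξ‖ₑ ^ 2 ≤ ENNReal.ofReal (4 + 8 * C) * ∫⁻ s in A, f k s ^ 2 := by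
  have hC := h.hC
  have hW := tint_memLp (h.vm k) hA (h.fin hk)
  set ρ : ℝ := 2 ^ (2 * (k:ℝ) / 3) with hρ
  have hρ0 : 0 < ρ := by positivity
  set κ : ℝ → ℝ≥0∞ := fun τ => (Set.Ioo (-ρ) ρ).indicator (fun _ => ENNReal.ofReal ((2:ℝ) ^ (-(2 * (k:ℝ) / 3)))) τ
    + {τ : ℝ | ρ ≤ |τ|}.indicator (fun τ => ENNReal.ofReal (C * 2 ^ (((k:ℝ) + k) / 6)) * ENNReal.ofReal (|τ| ^ (-(3/2) : ℝ))) τ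
  have hms : MeasurableSet {τ : ℝ | ρ ≤ |τ|} := measurableSet_le measurable_const (by fun_prop)
  have hκm : Measurable κ := by
    refine Measurable.add (measurable_const.indicator measurableSet_Ioo) (Measurable.indicator ?_ hms)
    fun_prop
  have hκ : ∫⁻ τ, κ τ ≤ ENNReal.ofReal (2 + 4 * C) := by
    rw [lintegral_add_left (measurable_const.indicator measurableSet_Ioo), lintegral_indicator measurableSet_Ioo,
      lintegral_indicator hms, lintegral_const, lintegral_const_mul _ (by fun_prop),
      ENNReal.ofReal_add (by norm_num) (by positivity)]
    gcongr
    · rw [Measure.restrict_apply_univ, Real.volume_Ioo, ← ENNReal.ofReal_mul (by positivity)]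
      apply ENNReal.ofReal_le_ofReal
      rw [hρ, Real.rpow_neg (by norm_num)]
      field_simp; norm_num
    · refine (mul_le_mul_right (lint_far ρ hρ0) _).trans ?_
      rw [← ENNReal.ofReal_mul (by positivity)]
      apply ENNReal.ofReal_le_ofReal
      have : (2:ℝ) ^ (((k:ℝ) + k) / 6) * ρ ^ (-(1/2) : ℝ) = 1 := by
        rw [hρ, ← Real.rpow_mul (by norm_num), ← Real.rpow_add (by norm_num)]
        rw [show ((k:ℝ) + k) / 6 + 2 * (k:ℝ) / 3 * -(1 / 2) = 0 by ring, Real.rpow_zero]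
      nlinarith
  have hbr : ∀ s t, ‖br (v k s) (v k t)‖ₑ ≤ κ (s - t) * (f k s * f k t) := by
    intro s t
    by_cases hst : |s - t| < ρ
    · have e1 : ENNReal.ofReal ((2:ℝ) ^ (-(2 * (k:ℝ) / 3))) ≤ κ (s - t) := by
        simp only [κ]
        rw [Set.indicator_of_mem (show s - t ∈ Set.Ioo (-ρ) ρ from abs_lt.1 hst)]
        exact le_self_add
      refine le_trans ?_ (mul_le_mul_left e1 _)
      rw [← ENNReal.pow_le_pow_left_iff (two_ne_zero)]
      refine (br_cs (h.vmem (hfin s)).1 (h.vmem (hfin t)).1).trans ?_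
      refine (mul_le_mul' (h.l2 k s) (h.l2 k t)).trans (le_of_eq ?_)
      ring
    · have e1 : κ (s - t) = ENNReal.ofReal (C * 2 ^ (((k:ℝ) + k) / 6)) * ENNReal.ofReal (|s - t| ^ (-(3/2) : ℝ)) := by
        simp only [κ]
        rw [Set.indicator_of_notMem (show s - t ∉ Set.Ioo (-ρ) ρ from fun hm => hst (abs_lt.2 hm)), Set.indicator_of_mem (by simpa using hst), zero_add]
      rw [e1]
      have hne : s ≠ t := by
        rintro rfl; simp [hρ0] at hst
      refine (h.di k k s t hne).trans (le_of_eq ?_)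
      rw [← ENNReal.ofReal_mul (by positivity)]
      congr 2; ring
  calc ∫⁻ ξ, ‖tint (v k) A ξ‖ₑ ^ 2 = ‖br (tint (v k) A) (tint (v k) A)‖ₑ := (br_self hW).symm
    _ ≤ ∫⁻ t in A, ‖br (v k t) (tint (v k) A)‖ₑ := br_tint_le (h.vm k) hA (h.fin hk) hW
    _ ≤ ∫⁻ t in A, ∫⁻ s in A, κ (s - t) * (f k s * f k t) := by
        gcongr with t
        rw [br_comm]
        refine (br_tint_le (h.vm k) hA (h.fin hk) (h.vmem (hfin t))).trans ?_
        gcongr with s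
        exact hbr s t
    _ ≤ _ := schur_le hκm (h.fm k) (h.fm k)
    _ ≤ ENNReal.ofReal (2 + 4 * C) * ((∫⁻ s in A, f k s ^ 2) + ∫⁻ s in A, f k s ^ 2) := by gcongr
    _ = _ := by
        rw [← two_mul, ← mul_assoc, ← ENNReal.ofReal_ofNat, ← ENNReal.ofReal_mul (by positivity)]
        congr 2; ring

lemma tint_split {v : ℝ → E3 → ℂ} (hv : Measurable (fun p : ℝ × E3 => v p.1 p.2)) {A : Set ℝ}
    (hA : volume A ≠ ⊤) (hfin : ∫⁻ s in A, ∫⁻ ξ, ‖v s ξ‖ₑ ^ 2 ≠ ⊤) {B : Set ℝ} (hB : MeasurableSet B) :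
    ∀ᵐ ξ, tint v A ξ = tint v (A ∩ B) ξ + tint v (A \ B) ξ := by
  have hm : Measurable (fun p : ℝ × E3 => ‖v p.1 p.2‖ₑ ^ 2) := hv.enorm.pow_const 2
  rw [lintegral_lintegral_swap hm.aemeasurable] at hfin
  have := ae_lt_top (hm.comp measurable_swap).lintegral_prod_right' hfin
  filter_upwards [this] with ξ hξ
  have hmξ : Measurable (fun s => v s ξ) := hv.comp (measurable_id.prodMk measurable_const)
  have hi : IntegrableOn (fun s => v s ξ) A := by
    refine ⟨hmξ.aestronglyMeasurable, ?_⟩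
    rw [hasFiniteIntegral_iff_enorm]
    have h2 := lint_sq_le (volume.restrict A) hmξ.enorm.aemeasurable
    rw [Measure.restrict_apply_univ] at h2
    have h3 := h2.trans_lt (ENNReal.mul_lt_top hA.lt_top hξ)
    by_contra h
    rw [not_lt, top_le_iff] at h
    rw [h] at h3; simp at h3
  exact (integral_inter_add_diff hB hi).symm

lemma lint_near {A : Set ℝ} {f : ℝ → ℝ≥0∞} (hf : Measurable f) (τ : ℝ) :
    ∫⁻ t in A, ∫⁻ s in A ∩ {s | |s - t| < τ}, f s ≤ ENNReal.ofReal (2 * τ) * ∫⁻ s in A, f s := by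
  have hms : ∀ t, MeasurableSet {s : ℝ | |s - t| < τ} := fun t =>
    measurableSet_lt (by fun_prop) measurable_const
  have hms2 : MeasurableSet {p : ℝ × ℝ | |p.2 - p.1| < τ} := measurableSet_lt (by fun_prop) measurable_const
  have m1 : Measurable (fun p : ℝ × ℝ => {p : ℝ × ℝ | |p.2 - p.1| < τ}.indicator (fun p => f p.2) p) :=
    Measurable.indicator (by fun_prop) hms2
  calc _ = ∫⁻ t in A, ∫⁻ s in A, {p : ℝ × ℝ | |p.2 - p.1| < τ}.indicator (fun p => f p.2) (t, s) := by
        congr 1; ext t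
        rw [Set.inter_comm, ← Measure.restrict_restrict (hms t), ← lintegral_indicator (hms t)]
        rfl
    _ = ∫⁻ s in A, ∫⁻ t in A, {p : ℝ × ℝ | |p.2 - p.1| < τ}.indicator (fun p => f p.2) (t, s) :=
        lintegral_lintegral_swap m1.aemeasurable
    _ ≤ ∫⁻ s in A, ENNReal.ofReal (2 * τ) * f s := by
        gcongr with s
        calc _ ≤ ∫⁻ t, {p : ℝ × ℝ | |p.2 - p.1| < τ}.indicator (fun p => f p.2) (t, s) :=
              setLIntegral_le_lintegral _ _
          _ = ∫⁻ t, (Set.Ioo (s - τ) (s + τ)).indicator (fun _ => f s) t := by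
              congr 1; ext t
              have : |s - t| < τ ↔ s - τ < t ∧ t < s + τ := by
                rw [abs_lt]; constructor <;> rintro ⟨h1, h2⟩ <;> constructor <;> linarith
              simp only [Set.indicator, Set.mem_setOf_eq, Set.mem_Ioo, this]
          _ = _ := by
              rw [lintegral_indicator measurableSet_Ioo, lintegral_const, Measure.restrict_apply_univ, Real.volume_Ioo,
                mul_comm]; congr 2; ring
    _ = _ := lintegral_const_mul _ hf

lemma KT.off {C : ℝ} {v : ℤ → ℝ → E3 → ℂ} {f : ℤ → ℝ → ℝ≥0∞} (h : KT C v f) {A : Set ℝ}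
    (hA : volume A ≠ ⊤) (hfin : ∀ k s, f k s ≠ ⊤) {k m : ℤ}
    (hk : ∫⁻ s in A, f k s ^ 2 ≠ ⊤) (hm : ∫⁻ s in A, f m s ^ 2 ≠ ⊤) :
    ‖br (tint (v m) A) (tint (v k) A)‖ₑ ≤
      ENNReal.ofReal ((9 + 20 * C) * 2 ^ (((k:ℝ) - m) / 12)) * ((∫⁻ s in A, f k s ^ 2) + ∫⁻ s in A, f m s ^ 2) := by
  have hC := h.hC
  set τ : ℝ := 2 ^ (((k:ℝ) + 3 * m) / 6) with hτ
  have hτ0 : 0 < τ := by positivity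
  set γ : ℝ := 2 ^ (((k:ℝ) - m) / 12) with hγ
  have hγ0 : 0 < γ := by positivity
  set a := ∫⁻ s in A, f k s ^ 2
  set b := ∫⁻ s in A, f m s ^ 2
  have hWk := tint_memLp (h.vm k) hA (h.fin hk)
  set κ : ℝ → ℝ≥0∞ := fun r => 
    {r : ℝ | τ ≤ |r|}.indicator (fun r => ENNReal.ofReal (C * 2 ^ (((k:ℝ) + m) / 6)) * ENNReal.ofReal (|r| ^ (-(3/2) : ℝ))) r
  have hms : MeasurableSet {r : ℝ | τ ≤ |r|} := measurableSet_le measurable_const (by fun_prop)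
  have hκm : Measurable κ := by
    refine Measurable.indicator ?_ hms
    fun_prop
  have hκ : ∫⁻ r, κ r ≤ ENNReal.ofReal (4 * C * γ) := by
    rw [lintegral_indicator hms, lintegral_const_mul _ (by fun_prop)]
    refine (mul_le_mul_right (lint_far τ hτ0) _).trans ?_
    rw [← ENNReal.ofReal_mul (by positivity)]
    apply ENNReal.ofReal_le_ofReal
    have : (2:ℝ) ^ (((k:ℝ) + m) / 6) * τ ^ (-(1/2) : ℝ) = γ := by
      rw [hτ, hγ, ← Real.rpow_mul (by norm_num), ← Real.rpow_add (by norm_num)]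
      congr 1; ring
    rw [← this]; apply le_of_eq; ring
  set N : ℝ → Set ℝ := fun t => {s | |s - t| < τ}
  have hNm : ∀ t, MeasurableSet (N t) := fun t => measurableSet_lt (by fun_prop) measurable_const
  have hsub1 : ∀ t, volume (A ∩ N t) ≠ ⊤ := fun t => ne_top_of_le_ne_top hA (measure_mono Set.inter_subset_left)
  have hsub2 : ∀ t, volume (A \ N t) ≠ ⊤ := fun t => ne_top_of_le_ne_top hA (measure_mono Set.diff_subset)
  have hk1 : ∀ t, ∫⁻ s in A ∩ N t, f k s ^ 2 ≠ ⊤ := fun t =>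
    ne_top_of_le_ne_top hk (lintegral_mono_set Set.inter_subset_left)
  have hk2 : ∀ t, ∫⁻ s in A \ N t, f k s ^ 2 ≠ ⊤ := fun t =>
    ne_top_of_le_ne_top hk (lintegral_mono_set Set.diff_subset)
  set e : ℝ := 2 ^ (2 * (m:ℝ) / 3 + ((k:ℝ) - m) / 12) with he
  have he0 : 0 < e := by positivity
  have step : ∀ t, ‖br (v m t) (tint (v k) A)‖ₑ ≤
      (ENNReal.ofReal γ * f m t ^ 2 + ENNReal.ofReal (e⁻¹ * (4 + 8 * C)) * ∫⁻ s in A ∩ {s | |s - t| < τ}, f k s ^ 2)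
        + ∫⁻ s in A, κ (s - t) * (f k s * f m t) := by
    intro t
    have hv := h.vmem (hfin m t)
    have hW1 := tint_memLp (h.vm k) (hsub1 t) (h.fin (hk1 t))
    have hW2 := tint_memLp (h.vm k) (hsub2 t) (h.fin (hk2 t))
    have e1 : br (v m t) (tint (v k) A) = br (v m t) (tint (v k) (A ∩ N t)) + br (v m t) (tint (v k) (A \ N t)) := by
      unfold br
      rw [← integral_add (br_integrable hv hW1) (br_integrable hv hW2)]
      apply integral_congr_ae
      filter_upwards [tint_split (h.vm k) hA (h.fin hk) (hNm t)] with ξ hξ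
      rw [hξ, mul_add]
    rw [e1]
    refine (enorm_add_le _ _).trans (add_le_add ?_ ?_)
    · have hcs := br_cs hv.1 hW1.1
      have := amgm hcs (e := ENNReal.ofReal e) (by simpa using he0) ENNReal.ofReal_ne_top
      refine this.trans (add_le_add ?_ ?_)
      · refine (mul_le_mul_right (h.l2 m t) _).trans ?_
        rw [← mul_assoc, ← ENNReal.ofReal_mul he0.le]
        gcongr
        rw [he, hγ, ← Real.rpow_add (by norm_num)]
        apply le_of_eq; congr 1; ring
      · refine (mul_le_mul_right (h.diag (hsub1 t) (hfin k) (hk1 t)) _).trans ?_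
        rw [← mul_assoc, ← ENNReal.ofReal_inv_of_pos he0, ← ENNReal.ofReal_mul (by positivity)]
    · rw [br_comm]
      refine (br_tint_le (h.vm k) (hsub2 t) (h.fin (hk2 t)) hv).trans ?_
      refine le_trans ?_ (lintegral_mono_set (Set.diff_subset (s := A) (t := N t)))
      rw [Set.diff_eq, Set.inter_comm, ← Measure.restrict_restrict (hNm t).compl]
      apply lintegral_mono_ae
      filter_upwards [ae_restrict_mem (hNm t).compl] with s hs
      have hs' : τ ≤ |s - t| := by simpa [N] using hs
      have hne : s ≠ t := by
        rintro rfl; simp at hs'; linarith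
      refine (h.di k m s t hne).trans (le_of_eq ?_)
      simp only [κ]
      rw [Set.indicator_of_mem (show s - t ∈ {r : ℝ | τ ≤ |r|} from hs'), ← ENNReal.ofReal_mul (by positivity)]
      congr 2; ring
  have mn : Measurable (fun t => ∫⁻ s in A, κ (s - t) * (f k s * f m t)) := by
    have h1 := h.fm k
    have h2 := h.fm m
    have : Measurable (fun p : ℝ × ℝ => κ (p.2 - p.1) * (f k p.2 * f m p.1)) := by fun_prop
    exact this.lintegral_prod_right'
  calc _ ≤ ∫⁻ t in A, ‖br (v m t) (tint (v k) A)‖ₑ := br_tint_le (h.vm m) hA (h.fin hm) hWk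
    _ ≤ ∫⁻ t in A, ((ENNReal.ofReal γ * f m t ^ 2 + ENNReal.ofReal (e⁻¹ * (4 + 8 * C)) * ∫⁻ s in A ∩ {s | |s - t| < τ}, f k s ^ 2)
        + ∫⁻ s in A, κ (s - t) * (f k s * f m t)) := lintegral_mono step
    _ = (ENNReal.ofReal γ * b + ENNReal.ofReal (e⁻¹ * (4 + 8 * C)) * ∫⁻ t in A, ∫⁻ s in A ∩ {s | |s - t| < τ}, f k s ^ 2)
        + ∫⁻ t in A, ∫⁻ s in A, κ (s - t) * (f k s * f m t) := by
        rw [lintegral_add_right _ mn, lintegral_add_left (((h.fm m).pow_const 2).const_mul _),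
          lintegral_const_mul _ ((h.fm m).pow_const 2), lintegral_const_mul' _ _ ENNReal.ofReal_ne_top]
    _ ≤ (ENNReal.ofReal γ * b + ENNReal.ofReal (e⁻¹ * (4 + 8 * C)) * (ENNReal.ofReal (2 * τ) * a))
        + ENNReal.ofReal (4 * C * γ) * (a + b) := by
        gcongr
        · exact lint_near ((h.fm k).pow_const 2) τ
        · exact (schur_le hκm (h.fm k) (h.fm m)).trans (mul_le_mul_left hκ _)
    _ = (ENNReal.ofReal γ * b + ENNReal.ofReal (γ * (8 + 16 * C)) * a)
        + ENNReal.ofReal (4 * C * γ) * (a + b) := by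
        rw [← mul_assoc, ← ENNReal.ofReal_mul (by positivity)]
        congr 4
        have : e⁻¹ * τ = γ := by
          rw [he, hτ, hγ, ← Real.rpow_neg (by norm_num), ← Real.rpow_add (by norm_num)]
          congr 1; ring
        rw [← this]; ring
    _ ≤ (ENNReal.ofReal (γ * (8 + 16 * C)) * (a + b) + ENNReal.ofReal γ * (a + b)) + ENNReal.ofReal (4 * C * γ) * (a + b) := by
        rw [add_comm (ENNReal.ofReal γ * b)]
        gcongr
        · exact le_self_add
        · exact le_add_self
    _ = _ := by
        rw [← add_mul, ← add_mul, ← ENNReal.ofReal_add (by positivity) (by positivity),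
          ← ENNReal.ofReal_add (by positivity) (by positivity)]
        congr 2; ring

def Cgeo : ℝ≥0∞ := ∑' n : ℤ, ENNReal.ofReal (2 ^ (-|(n:ℝ)| / 12))

lemma Cgeo_lt : Cgeo ≠ ⊤ := by
  have hs : Summable (fun n : ℤ => (2:ℝ) ^ (-|(n:ℝ)| / 12)) := by
    have h1 : Summable (fun n : ℕ => ((2:ℝ) ^ (-(1:ℝ) / 12)) ^ n) :=
      summable_geometric_of_lt_one (by positivity) (Real.rpow_lt_one_of_one_lt_of_neg (by norm_num) (by norm_num))
    have h2 : ∀ n : ℕ, ((2:ℝ) ^ (-(1:ℝ) / 12)) ^ n = (2:ℝ) ^ (-(n:ℝ) / 12) := by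
      intro n; rw [← Real.rpow_natCast, ← Real.rpow_mul (by norm_num)]; congr 1; ring
    simp only [h2] at h1
    apply Summable.of_nat_of_neg
    · simpa using h1
    · simpa using h1
  exact hs.tsum_ofReal_ne_top

lemma geo_row (S : Finset ℤ) (k : ℤ) : ∑ m ∈ S, ENNReal.ofReal (2 ^ (-|(k:ℝ) - m| / 12)) ≤ Cgeo := by
  refine (ENNReal.sum_le_tsum S).trans (le_of_eq ?_)
  rw [Cgeo, ← (Equiv.subLeft k).tsum_eq]
  congr 1; ext m; simp

lemma KT.main {C : ℝ} {v : ℤ → ℝ → E3 → ℂ} {f : ℤ → ℝ → ℝ≥0∞} (h : KT C v f) {A : Set ℝ}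
    (hA : volume A ≠ ⊤) (hfin : ∀ k s, f k s ≠ ⊤) (S : Finset ℤ)
    (hk : ∀ k ∈ S, ∫⁻ s in A, f k s ^ 2 ≠ ⊤) :
    ∫⁻ ξ, ‖∑ k ∈ S, tint (v k) A ξ‖ₑ ^ 2 ≤
      ENNReal.ofReal (9 + 20 * C) * (2 * Cgeo) * ∑ k ∈ S, ∫⁻ s in A, f k s ^ 2 := by
  have hC := h.hC
  have hW : ∀ k ∈ S, MemLp (tint (v k) A) 2 := fun k hkS => tint_memLp (h.vm k) hA (h.fin (hk k hkS))
  set a : ℤ → ℝ≥0∞ := fun k => ∫⁻ s in A, f k s ^ 2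
  have hoff : ∀ k ∈ S, ∀ m ∈ S, ‖br (tint (v m) A) (tint (v k) A)‖ₑ ≤
      ENNReal.ofReal (9 + 20 * C) * (ENNReal.ofReal (2 ^ (-|(k:ℝ) - m| / 12)) * (a k + a m)) := by
    intro k hkS m hmS
    rw [← mul_assoc, ← ENNReal.ofReal_mul (by positivity)]
    rcases le_total k m with hle | hle
    · have : (k:ℝ) ≤ m := by exact_mod_cast hle
      rw [abs_of_nonpos (by linarith), neg_neg]
      exact h.off hA hfin (hk k hkS) (hk m hmS)
    · have : (m:ℝ) ≤ k := by exact_mod_cast hle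
      rw [abs_of_nonneg (by linarith), neg_sub, br_comm, add_comm (a k)]
      exact h.off hA hfin (hk m hmS) (hk k hkS)
  have hsum : MemLp (fun ξ => ∑ k ∈ S, tint (v k) A ξ) 2 := memLp_finsetSum S hW
  rw [← br_self hsum]
  have e : br (fun ξ => ∑ k ∈ S, tint (v k) A ξ) (fun ξ => ∑ k ∈ S, tint (v k) A ξ)
      = ∑ m ∈ S, ∑ k ∈ S, br (tint (v m) A) (tint (v k) A) := by
    unfold br
    simp only [map_sum, Finset.sum_mul_sum]
    rw [integral_finsetSum]
    · refine Finset.sum_congr rfl fun m hm => ?_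
      rw [integral_finsetSum]
      intro k hk'
      exact br_integrable (hW m hm) (hW k hk')
    · intro m hm
      exact integrable_finsetSum _ fun k hk' => br_integrable (hW m hm) (hW k hk')
  rw [e]
  calc _ ≤ ∑ m ∈ S, ∑ k ∈ S, ‖br (tint (v m) A) (tint (v k) A)‖ₑ :=
        (enorm_sum_le _ _).trans (Finset.sum_le_sum fun m _ => enorm_sum_le _ _)
    _ ≤ ∑ m ∈ S, ∑ k ∈ S, ENNReal.ofReal (9 + 20 * C) * (ENNReal.ofReal (2 ^ (-|(k:ℝ) - m| / 12)) * (a k + a m)) :=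
        Finset.sum_le_sum fun m hm => Finset.sum_le_sum fun k hk' => hoff k hk' m hm
    _ = ENNReal.ofReal (9 + 20 * C) * (∑ k ∈ S, a k * ∑ m ∈ S, ENNReal.ofReal (2 ^ (-|(k:ℝ) - m| / 12))
          + ∑ m ∈ S, a m * ∑ k ∈ S, ENNReal.ofReal (2 ^ (-|(m:ℝ) - k| / 12))) := by
        simp only [Finset.mul_sum, mul_add]
        rw [Finset.sum_comm]
        simp only [Finset.sum_add_distrib]
        congr 1
        · refine Finset.sum_congr rfl fun m _ => Finset.sum_congr rfl fun k _ => ?_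
          ring
        · rw [Finset.sum_comm]
          refine Finset.sum_congr rfl fun m _ => Finset.sum_congr rfl fun k _ => ?_
          rw [abs_sub_comm]
          ring
    _ ≤ ENNReal.ofReal (9 + 20 * C) * (∑ k ∈ S, a k * Cgeo + ∑ m ∈ S, a m * Cgeo) := by
        gcongr with k _ k _
        · exact geo_row S k
        · exact geo_row S k
    _ = _ := by rw [← Finset.sum_mul]; ring

/-- the L² norm -/
def n2 (g : E3 → ℂ) : ℝ≥0∞ := (∫⁻ ξ, ‖g ξ‖ₑ ^ 2) ^ (1/2 : ℝ)

lemma n2_sq (g : E3 → ℂ) : n2 g ^ 2 = ∫⁻ ξ, ‖g ξ‖ₑ ^ 2 := by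
  rw [n2, ← ENNReal.rpow_natCast, ← ENNReal.rpow_mul]; norm_num

lemma n2_eq (g : E3 → ℂ) : n2 g = eLpNorm g 2 volume := by
  have h : n2 g ^ 2 = eLpNorm g 2 volume ^ 2 := by rw [n2_sq, eLpNorm_two_sq]
  exact le_antisymm ((ENNReal.pow_le_pow_left_iff two_ne_zero).1 h.le)
    ((ENNReal.pow_le_pow_left_iff two_ne_zero).1 h.ge)

lemma n2_ne_top {g : E3 → ℂ} (hg : MemLp g 2) : n2 g ≠ ⊤ := by
  rw [n2_eq]; exact hg.2.ne

lemma n2_congr {g h : E3 → ℂ} (hgh : g =ᵐ[volume] h) : n2 g = n2 h := by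
  rw [n2_eq, n2_eq, eLpNorm_congr_ae hgh]

lemma br_le {g h : E3 → ℂ} (hg : AEStronglyMeasurable g volume) (hh : AEStronglyMeasurable h volume) :
    ‖br g h‖ₑ ≤ n2 g * n2 h := by
  rw [← ENNReal.pow_le_pow_left_iff (two_ne_zero), mul_pow, n2_sq, n2_sq]
  exact br_cs hg hh

lemma slice_meas {v : ℝ → E3 → ℂ} (hv : Measurable (fun p : ℝ × E3 => v p.1 p.2)) (s : ℝ) :
    Measurable (v s) := hv.comp (measurable_const.prodMk measurable_id)

lemma n2_meas {v : ℝ → E3 → ℂ} (hv : Measurable (fun p : ℝ × E3 => v p.1 p.2)) :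
    Measurable (fun s => n2 (v s)) := by
  have : Measurable (fun s => ∫⁻ ξ, ‖v s ξ‖ₑ ^ 2) := (hv.enorm.pow_const 2).lintegral_prod_right'
  exact this.pow_const _

lemma br_meas {v w : ℝ → E3 → ℂ} (hv : Measurable (fun p : ℝ × E3 => v p.1 p.2))
    (hw : Measurable (fun p : ℝ × E3 => w p.1 p.2)) :
    StronglyMeasurable (fun p : ℝ × ℝ => br (v p.1) (w p.2)) := by
  have : Measurable (fun q : (ℝ × ℝ) × E3 => (starRingEnd ℂ) (v q.1.1 q.2) * w q.1.2 q.2) := by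
    have h1 : Measurable (fun q : (ℝ × ℝ) × E3 => v q.1.1 q.2) :=
      hv.comp ((measurable_fst.comp measurable_fst).prodMk measurable_snd)
    have h2 : Measurable (fun q : (ℝ × ℝ) × E3 => w q.1.2 q.2) :=
      hw.comp ((measurable_snd.comp measurable_fst).prodMk measurable_snd)
    exact (Complex.continuous_conj.measurable.comp h1).mul h2
  exact this.stronglyMeasurable.integral_prod_right

lemma n2_tint_of {v : ℝ → E3 → ℂ} (hv : Measurable (fun p : ℝ × E3 => v p.1 p.2)) {A : Set ℝ}
    (hfin : ∫⁻ s in A, n2 (v s) ≠ ⊤) {g : E3 → ℂ} (hg : MemLp g 2) :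
    Integrable (fun p : ℝ × E3 => (starRingEnd ℂ) (v p.1 p.2) * g p.2) ((volume.restrict A).prod volume) := by
  have hgm : AEStronglyMeasurable (fun p : ℝ × E3 => g p.2) ((volume.restrict A).prod volume) :=
    hg.1.comp_snd
  have h1 : AEStronglyMeasurable (fun p : ℝ × E3 => (starRingEnd ℂ) (v p.1 p.2)) ((volume.restrict A).prod volume) :=
    (Complex.continuous_conj.measurable.comp hv).aestronglyMeasurable
  refine ⟨h1.mul hgm, ?_⟩
  rw [hasFiniteIntegral_iff_enorm]
  rw [lintegral_prod _ (by exact (h1.mul hgm).enorm)]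
  have : ∫⁻ s in A, n2 (v s) * n2 g < ⊤ := by
    rw [lintegral_mul_const _ (n2_meas hv)]
    exact ENNReal.mul_lt_top hfin.lt_top (n2_ne_top hg).lt_top
  refine lt_of_le_of_lt (lintegral_mono fun s => ?_) this
  rw [← ENNReal.pow_le_pow_left_iff (two_ne_zero), mul_pow, n2_sq, n2_sq]
  refine le_trans (le_of_eq ?_) (lint_cs volume (slice_meas hv s).enorm.aemeasurable hg.1.enorm)
  simp only [enorm_mul, enorm_conj']

lemma br_tint_eq {v : ℝ → E3 → ℂ} (hv : Measurable (fun p : ℝ × E3 => v p.1 p.2)) {A : Set ℝ}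
    (hfin : ∫⁻ s in A, n2 (v s) ≠ ⊤) {g : E3 → ℂ} (hg : MemLp g 2) :
    br (tint v A) g = ∫ s in A, br (v s) g := by
  unfold br
  rw [integral_integral_swap (by exact n2_tint_of hv hfin hg)]
  congr 1; ext ξ
  rw [tint, ← integral_conj, integral_mul_const]

lemma br_conj (g h : E3 → ℂ) : br g h = (starRingEnd ℂ) (br h g) := by
  rw [br, br, ← integral_conj]; congr 1; ext ξ; simp [mul_comm]

lemma br_tint_eq' {v : ℝ → E3 → ℂ} (hv : Measurable (fun p : ℝ × E3 => v p.1 p.2)) {A : Set ℝ}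
    (hfin : ∫⁻ s in A, n2 (v s) ≠ ⊤) {g : E3 → ℂ} (hg : MemLp g 2) :
    br g (tint v A) = ∫ s in A, br g (v s) := by
  rw [br_conj, br_tint_eq hv hfin hg, ← integral_conj]
  congr 1; ext s; rw [← br_conj]

/-- Minkowski, given a priori finiteness -/
lemma n2_tint_le {v : ℝ → E3 → ℂ} (hv : Measurable (fun p : ℝ × E3 => v p.1 p.2)) {A : Set ℝ}
    (hW : MemLp (tint v A) 2) : n2 (tint v A) ≤ ∫⁻ s in A, n2 (v s) := by
  by_cases hfin : ∫⁻ s in A, n2 (v s) = ⊤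
  · rw [hfin]; exact le_top
  by_cases h0 : n2 (tint v A) = 0
  · rw [h0]; exact zero_le
  have : n2 (tint v A) * n2 (tint v A) ≤ (∫⁻ s in A, n2 (v s)) * n2 (tint v A) := by
    rw [← sq, n2_sq, ← br_self hW, br_tint_eq hv hfin hW, ← lintegral_mul_const _ (n2_meas hv)]
    refine (enorm_integral_le_lintegral_enorm _).trans (lintegral_mono fun s => ?_)
    exact br_le (slice_meas hv s).aestronglyMeasurable hW.1
  exact (ENNReal.mul_le_mul_iff_left h0 (n2_ne_top hW)).1 this

/-- the Duhamel pairing -/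
lemma duhamel_pair {v g U : ℝ → E3 → ℂ} {a : E3 → ℂ} {t1 t2 : ℝ}
    (hv : Measurable (fun p : ℝ × E3 => v p.1 p.2)) (hg : Measurable (fun p : ℝ × E3 => g p.1 p.2))
    (hvL : ∀ t, MemLp (v t) 2) (hgL : ∀ t, MemLp (g t) 2) (ha : MemLp a 2)
    (hU : ∀ t, MemLp (U t) 2)
    (hvfin : ∫⁻ s in Set.Ioc t1 t2, n2 (v s) ≠ ⊤) (hgfin : ∫⁻ s in Set.Ioc t1 t2, n2 (g s) ≠ ⊤)
    (hUeq : ∀ t ∈ Set.Ioc t1 t2, U t =ᵐ[volume] fun ξ => a ξ - I * tint g (Set.Ioc t1 t) ξ) :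
    ∫ t in Set.Ioc t1 t2, br (v t) (U t) = br (tint v (Set.Ioc t1 t2)) a
      - I * ∫ s in Set.Ioc t1 t2, br (tint v (Set.Ioc t1 t2 ∩ Set.Ici s)) (g s) := by
  set A := Set.Ioc t1 t2
  have hAsub : ∀ t ∈ A, Set.Ioc t1 t = A ∩ Set.Iic t := by
    intro t ht; ext s; simp only [A, Set.mem_Ioc, Set.mem_inter_iff, Set.mem_Iic]
    constructor
    · rintro ⟨h1, h2⟩; exact ⟨⟨h1, h2.trans ht.2⟩, h2⟩
    · rintro ⟨⟨h1, _⟩, h2⟩; exact ⟨h1, h2⟩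
  have hsubfin : ∀ {w : ℝ → E3 → ℂ} {B : Set ℝ}, ∫⁻ s in A, n2 (w s) ≠ ⊤ → ∫⁻ s in A ∩ B, n2 (w s) ≠ ⊤ :=
    fun h => ne_top_of_le_ne_top h (lintegral_mono_set Set.inter_subset_left)
  -- the kernel
  set H : ℝ × ℝ → ℂ := fun p => {p : ℝ × ℝ | p.2 ≤ p.1}.indicator (fun p => br (v p.1) (g p.2)) p with hH
  have hHms : MeasurableSet {p : ℝ × ℝ | p.2 ≤ p.1} := measurableSet_le measurable_snd measurable_fst
  have hHm : StronglyMeasurable H := (br_meas hv hg).indicator hHms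
  have hHint : Integrable H ((volume.restrict A).prod (volume.restrict A)) := by
    refine ⟨hHm.aestronglyMeasurable, ?_⟩
    rw [hasFiniteIntegral_iff_enorm, lintegral_prod _ hHm.enorm.aemeasurable]
    have : ∫⁻ t in A, ∫⁻ s in A, n2 (v t) * n2 (g s) < ⊤ := by
      have : ∀ t, ∫⁻ s in A, n2 (v t) * n2 (g s) = n2 (v t) * ∫⁻ s in A, n2 (g s) :=
        fun t => lintegral_const_mul _ (n2_meas hg)
      simp only [this]
      rw [lintegral_mul_const _ (n2_meas hv)]
      exact ENNReal.mul_lt_top hvfin.lt_top hgfin.lt_top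
    refine lt_of_le_of_lt (lintegral_mono fun t => lintegral_mono fun s => ?_) this
    simp only [hH]
    rw [Set.indicator]
    split_ifs
    · exact br_le (hvL t).1 (hgL s).1
    · simp
  have e1 : ∀ t ∈ A, br (v t) (U t) = br (v t) a - I * ∫ s in A, H (t, s) := by
    intro t ht
    have hT : MemLp (tint g (Set.Ioc t1 t)) 2 := by
      have : tint g (Set.Ioc t1 t) =ᵐ[volume] fun ξ => I * (U t ξ - a ξ) := by
        filter_upwards [hUeq t ht] with ξ hξ
        rw [hξ, sub_sub_cancel_left, mul_neg, ← mul_assoc, I_mul_I]; ring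
      rw [memLp_congr_ae this]
      exact ((hU t).sub ha).const_mul I
    have : br (v t) (U t) = br (v t) a - I * br (v t) (tint g (Set.Ioc t1 t)) := by
      unfold br
      rw [← integral_const_mul, ← integral_sub (br_integrable (hvL t) ha) ((br_integrable (hvL t) hT).const_mul _)]
      apply integral_congr_ae
      filter_upwards [hUeq t ht] with ξ hξ
      rw [hξ]; ring
    rw [this, hAsub t ht, br_tint_eq' hg (hsubfin hgfin) (hvL t), Set.inter_comm,
      ← Measure.restrict_restrict measurableSet_Iic, ← integral_indicator measurableSet_Iic]
    rfl
  have e2 : ∀ s, br (tint v (A ∩ Set.Ici s)) (g s) = ∫ t in A, H (t, s) := by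
    intro s
    rw [br_tint_eq hv (hsubfin hvfin) (hgL s), Set.inter_comm,
      ← Measure.restrict_restrict measurableSet_Ici, ← integral_indicator measurableSet_Ici]
    rfl
  have i1 : Integrable (fun t => br (v t) a) (volume.restrict A) := by
    have := (n2_tint_of hv hvfin ha).integral_prod_left
    exact this
  have i2 : Integrable (fun t => ∫ s in A, H (t, s)) (volume.restrict A) := hHint.integral_prod_left
  rw [setIntegral_congr_fun measurableSet_Ioc e1]
  simp only [e2]
  rw [integral_sub i1 (i2.const_mul _), integral_const_mul, br_tint_eq hv hvfin ha,
    integral_integral_swap (f := fun t s => H (t, s)) (by exact hHint)]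

lemma tint_finsum {v : ℤ → ℝ → E3 → ℂ} (hv : ∀ k, Measurable (fun p : ℝ × E3 => v k p.1 p.2)) {A : Set ℝ}
    (hA : volume A ≠ ⊤) (S : Finset ℤ) (hfin : ∀ k ∈ S, ∫⁻ s in A, ∫⁻ ξ, ‖v k s ξ‖ₑ ^ 2 ≠ ⊤) :
    ∀ᵐ ξ, tint (fun s ξ => ∑ k ∈ S, v k s ξ) A ξ = ∑ k ∈ S, tint (v k) A ξ := by
  have : ∀ k ∈ S, ∀ᵐ ξ, IntegrableOn (fun s => v k s ξ) A := by
    intro k hk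
    have hm : Measurable (fun p : ℝ × E3 => ‖v k p.1 p.2‖ₑ ^ 2) := (hv k).enorm.pow_const 2
    have hf := hfin k hk
    rw [lintegral_lintegral_swap hm.aemeasurable] at hf
    filter_upwards [ae_lt_top (hm.comp measurable_swap).lintegral_prod_right' hf] with ξ hξ
    have hmξ : Measurable (fun s => v k s ξ) := (hv k).comp (measurable_id.prodMk measurable_const)
    refine ⟨hmξ.aestronglyMeasurable, ?_⟩
    rw [hasFiniteIntegral_iff_enorm]
    have h2 := lint_sq_le (volume.restrict A) hmξ.enorm.aemeasurable
    rw [Measure.restrict_apply_univ] at h2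
    have h3 := h2.trans_lt (ENNReal.mul_lt_top hA.lt_top hξ)
    by_contra h
    rw [not_lt, top_le_iff] at h
    rw [h] at h3; simp at h3
  have h := (Filter.eventually_all_finset S).2 this
  filter_upwards [h] with ξ hξ
  exact integral_finsetSum S hξ

lemma n2_add_le {g h : E3 → ℂ} (hg : AEStronglyMeasurable g volume) (hh : AEStronglyMeasurable h volume) :
    n2 (fun ξ => g ξ + h ξ) ≤ n2 g + n2 h := by
  rw [n2_eq, n2_eq, n2_eq]; exact eLpNorm_add_le hg hh (by norm_num)

lemma pow_half_le {x y : ℝ≥0∞} (h : x ^ 2 ≤ y) : x ≤ y ^ (1/2:ℝ) := by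
  rw [← ENNReal.pow_le_pow_left_iff two_ne_zero, ← ENNReal.rpow_natCast (y ^ (1/2:ℝ)), ← ENNReal.rpow_mul]
  norm_num; exact h

/-- retarded pairing estimate -/
lemma KT.pair {C : ℝ} {v : ℤ → ℝ → E3 → ℂ} {f : ℤ → ℝ → ℝ≥0∞} (h : KT C v f)
    (hfin : ∀ k s, f k s ≠ ⊤) {t1 t2 : ℝ} (S : Finset ℤ)
    (hk : ∀ k ∈ S, ∫⁻ s in Set.Ioc t1 t2, f k s ^ 2 ≠ ⊤)
    {g U : ℝ → E3 → ℂ} {a : E3 → ℂ} (hg : Measurable (fun p : ℝ × E3 => g p.1 p.2))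
    (hgL : ∀ t, MemLp (g t) 2) (ha : MemLp a 2) (hU : ∀ t, MemLp (U t) 2)
    (hgfin : ∫⁻ s in Set.Ioc t1 t2, n2 (g s) ≠ ⊤)
    (hUeq : ∀ t ∈ Set.Ioc t1 t2, U t =ᵐ[volume] fun ξ => a ξ - I * tint g (Set.Ioc t1 t) ξ) :
    ‖∫ t in Set.Ioc t1 t2, br (fun ξ => ∑ k ∈ S, v k t ξ) (U t)‖ₑ ≤
      (ENNReal.ofReal (9 + 20 * C) * (2 * Cgeo) * ∑ k ∈ S, ∫⁻ s in Set.Ioc t1 t2, f k s ^ 2) ^ (1/2:ℝ)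
      * (n2 a + ∫⁻ s in Set.Ioc t1 t2, n2 (g s)) := by
  set A := Set.Ioc t1 t2 with hAdef
  have hA : volume A ≠ ⊤ := by simp [A]
  set V : ℝ → E3 → ℂ := fun t ξ => ∑ k ∈ S, v k t ξ with hVdef
  have hVm : Measurable (fun p : ℝ × E3 => V p.1 p.2) := by
    simp only [hVdef]; exact Finset.measurable_fun_sum S fun k _ => h.vm k
  have hVL : ∀ t, MemLp (V t) 2 := fun t => by
    have := memLp_finsetSum S fun k _ => h.vmem (hfin k t)
    exact this
  set R := (ENNReal.ofReal (9 + 20 * C) * (2 * Cgeo) * ∑ k ∈ S, ∫⁻ s in A, f k s ^ 2) ^ (1/2:ℝ) with hR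
  have hsub : ∀ B, B ⊆ A → n2 (tint V B) ≤ R := by
    intro B hB
    have hBv : volume B ≠ ⊤ := ne_top_of_le_ne_top hA (measure_mono hB)
    have hk' : ∀ k ∈ S, ∫⁻ s in B, f k s ^ 2 ≠ ⊤ := fun k hkS =>
      ne_top_of_le_ne_top (hk k hkS) (lintegral_mono_set hB)
    have hae := tint_finsum h.vm hBv S (fun k hkS => h.fin (hk' k hkS))
    apply pow_half_le
    rw [n2_congr hae, n2_sq]
    refine (h.main hBv hfin S hk').trans ?_
    refine mul_le_mul_right ?_ _
    exact Finset.sum_le_sum fun k _ => lintegral_mono_set hB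
  have hVfin : ∫⁻ s in A, n2 (V s) ≠ ⊤ := by
    have h1 : ∀ s, n2 (V s) ≤ ∑ k ∈ S, (1 + ∫⁻ ξ, ‖v k s ξ‖ₑ ^ 2) := by
      intro s
      have h2 : n2 (V s) ≤ ∑ k ∈ S, n2 (v k s) := by
        rw [n2_eq]; simp only [n2_eq]
        have := eLpNorm_sum_le (s := S) (f := fun k => v k s) (p := 2) (μ := volume)
          (fun k _ => (slice_meas (h.vm k) s).aestronglyMeasurable) (by norm_num)
        convert this using 2
        ext ξ; simp [V]
      refine h2.trans (Finset.sum_le_sum fun k _ => ?_)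
      rw [← n2_sq]
      rcases le_total (n2 (v k s)) 1 with h3 | h3
      · exact h3.trans le_self_add
      · refine le_trans ?_ le_add_self
        rw [sq]; exact le_mul_of_one_le_left' h3
    refine ne_top_of_le_ne_top ?_ (lintegral_mono h1)
    rw [lintegral_finsetSum S fun k _ => ((h.vm k).enorm.pow_const 2).lintegral_prod_right'.const_add 1]
    refine (ENNReal.sum_lt_top.2 fun k hkS => ?_).ne
    rw [lintegral_add_left measurable_const]
    refine ENNReal.add_lt_top.2 ⟨?_, (h.fin (hk k hkS)).lt_top⟩
    simpa using hA.lt_top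
  have := duhamel_pair hVm hg hVL hgL ha hU hVfin hgfin hUeq
  rw [this]
  refine (enorm_sub_le).trans ?_
  rw [mul_add]
  refine add_le_add ?_ ?_
  · refine (br_le (tint_meas hVm A).aestronglyMeasurable ha.1).trans (mul_le_mul_left (hsub A subset_rfl) _)
  · rw [enorm_mul, show ‖I‖ₑ = 1 by rw [← ofReal_norm]; simp, one_mul, ← lintegral_const_mul _ (n2_meas hg)]
    refine (enorm_integral_le_lintegral_enorm _).trans (lintegral_mono fun s => ?_)
    exact (br_le (tint_meas hVm _).aestronglyMeasurable (hgL s).1).trans (mul_le_mul_left (hsub _ Set.inter_subset_left) _)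

/-- dyadic level of the modulus -/
def lev (g : E3 → ℂ) (x : E3) : ℤ := ⌊Real.logb 2 ‖g x‖⌋
/-- measure of a dyadic level set -/
def lvV (g : E3 → ℂ) (n : ℤ) : ℝ≥0∞ := volume {y | g y ≠ 0 ∧ lev g y = n}
/-- dyadic size of the level set of a point -/
def lvk (g : E3 → ℂ) (x : E3) : ℤ := ⌊Real.logb 2 (lvV g (lev g x)).toReal⌋
/-- points whose level set has measure about `2^k` -/
def lvS (g : E3 → ℂ) (k : ℤ) : Set E3 := {x | g x ≠ 0 ∧ 0 < (lvV g (lev g x)).toReal ∧ lvk g x = k}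
/-- sixth power of the sixth norm -/
def Bt (g : E3 → ℂ) : ℝ≥0∞ := ∫⁻ x, ‖g x‖ₑ ^ 6

lemma floor_logb {y : ℝ} (hy : 0 < y) {n : ℤ} (h : ⌊Real.logb 2 y⌋ = n) :
    (2:ℝ) ^ (n:ℝ) ≤ y ∧ y ≤ 2 * 2 ^ (n:ℝ) := by
  rw [Int.floor_eq_iff, Real.le_logb_iff_rpow_le (by norm_num) hy,
    Real.logb_lt_iff_lt_rpow (by norm_num) hy, Real.rpow_add (by norm_num)] at h
  refine ⟨h.1, ?_⟩
  have := h.2.le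
  rw [Real.rpow_one] at this; linarith

lemma measurable_lev {g : E3 → ℂ} (hg : Measurable g) : Measurable (lev g) := by
  unfold lev; simp only [Real.logb]
  exact Int.measurable_floor.comp ((Real.measurable_log.comp hg.norm).div_const _)

lemma measurableSet_lvl {g : E3 → ℂ} (hg : Measurable g) (n : ℤ) :
    MeasurableSet {y | g y ≠ 0 ∧ lev g y = n} := by
  apply MeasurableSet.inter
  · exact (hg (measurableSet_singleton 0)).compl
  · exact measurable_lev hg (measurableSet_singleton n)

lemma lv_cheb (g : E3 → ℂ) (hg : Measurable g) (n : ℤ) :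
    ENNReal.ofReal ((2:ℝ) ^ (6 * (n:ℝ))) * lvV g n ≤ Bt g := by
  rw [lvV, ← setLIntegral_const]
  refine le_trans ?_ (setLIntegral_le_lintegral {y | g y ≠ 0 ∧ lev g y = n} _)
  apply setLIntegral_mono (hg.enorm.pow_const 6)
  rintro x ⟨h0, h1⟩
  have := (floor_logb (norm_pos_iff.2 h0) h1).1
  rw [← ofReal_norm, ← ENNReal.ofReal_pow (norm_nonneg _)]
  apply ENNReal.ofReal_le_ofReal
  rw [mul_comm, Real.rpow_mul (by norm_num)]
  calc _ = ((2:ℝ) ^ (n:ℝ)) ^ 6 := by norm_cast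
    _ ≤ _ := by gcongr

lemma lv_ne_top {g : E3 → ℂ} (hg : Measurable g) (hB : Bt g ≠ ⊤) (n : ℤ) : lvV g n ≠ ⊤ := by
  intro h
  have := lv_cheb g hg n
  rw [h, ENNReal.mul_top (by simp; positivity)] at this
  exact hB (top_le_iff.1 this)

lemma lv_act {g : E3 → ℂ} (hg : Measurable g) (hB : Bt g ≠ ⊤) {k : ℤ} {x : E3} (hx : x ∈ lvS g k) :
    ENNReal.ofReal ((2:ℝ) ^ (4 * (lev g x:ℝ))) ≤ ENNReal.ofReal ((2:ℝ) ^ (-(2 * (k:ℝ) / 3))) * Bt g ^ (2/3:ℝ)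
     ∧ lvV g (lev g x) ≤ ENNReal.ofReal (2 * 2 ^ (k:ℝ)) := by
  obtain ⟨h0, h1, h2⟩ := hx
  have h3 := floor_logb h1 h2
  have hfin := lv_ne_top hg hB (lev g x)
  constructor
  · have h4 := lv_cheb g hg (lev g x)
    have h5 : ENNReal.ofReal ((2:ℝ) ^ (6 * (lev g x:ℝ)) * 2 ^ (k:ℝ)) ≤ Bt g := by
      rw [ENNReal.ofReal_mul (by positivity)]
      refine le_trans (mul_le_mul_right ?_ _) h4
      rw [ENNReal.ofReal_le_iff_le_toReal hfin]; exact h3.1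
    have h6 := ENNReal.rpow_le_rpow h5 (show (0:ℝ) ≤ 2/3 by norm_num)
    rw [ENNReal.ofReal_rpow_of_pos (by positivity)] at h6
    refine le_trans (le_of_eq ?_) (mul_le_mul_right h6 _)
    rw [← ENNReal.ofReal_mul (by positivity)]
    congr 1
    rw [← Real.rpow_add (by norm_num), ← Real.rpow_mul (by norm_num), ← Real.rpow_add (by norm_num)]
    congr 1; ring
  · rw [← ENNReal.ofReal_toReal hfin]; exact ENNReal.ofReal_le_ofReal h3.2

lemma lv_four {g : E3 → ℂ} {x : E3} {n : ℤ} (hx : g x ≠ 0) (hn : lev g x = n) :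
    ‖g x‖ₑ ^ 4 ≤ 16 * ENNReal.ofReal ((2:ℝ) ^ (4 * (n:ℝ))) := by
  have := (floor_logb (norm_pos_iff.2 hx) hn).2
  rw [← ofReal_norm, ← ENNReal.ofReal_pow (norm_nonneg _), ← ENNReal.ofReal_ofNat 16, ← ENNReal.ofReal_mul (by norm_num)]
  apply ENNReal.ofReal_le_ofReal
  rw [mul_comm 4 (n:ℝ), Real.rpow_mul (by norm_num)]
  calc _ ≤ (2 * (2:ℝ) ^ (n:ℝ)) ^ 4 := by gcongr
    _ = 16 * ((2:ℝ) ^ (n:ℝ)) ^ 4 := by ring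
    _ = _ := by norm_cast

lemma lv_est1 {g : E3 → ℂ} (hg : Measurable g) (hB : Bt g ≠ ⊤) {k : ℤ} {x : E3} (hx : x ∈ lvS g k) :
    ‖g x‖ₑ ^ 4 ≤ 16 * (ENNReal.ofReal ((2:ℝ) ^ (-(2 * (k:ℝ) / 3))) * Bt g ^ (2/3:ℝ)) :=
  (lv_four hx.1 rfl).trans (mul_le_mul_right (lv_act hg hB hx).1 _)

lemma Cgeo_pos : Cgeo ≠ 0 := by
  intro h
  have := (ENNReal.tsum_eq_zero.1 h) 0
  simp at this

open Classical in
lemma geo_act (P : ℤ → Prop) (M : ℝ≥0∞) (h : ∀ n, P n → ENNReal.ofReal ((2:ℝ) ^ (4 * (n:ℝ))) ≤ M) :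
    ∑' n : ℤ, (if P n then ENNReal.ofReal ((2:ℝ) ^ (4 * (n:ℝ))) else 0) ≤ Cgeo * M := by
  by_cases hM : M = ⊤
  · rw [hM, ENNReal.mul_top Cgeo_pos]; exact le_top
  by_cases hP : ∃ n, P n
  swap
  · push Not at hP; simp [hP]
  have hbd : ∃ b : ℤ, ∀ z, P z → z ≤ b := by
    refine ⟨⌈M.toReal⌉, fun z hz => ?_⟩
    have h1 := h z hz
    rw [ENNReal.ofReal_le_iff_le_toReal hM] at h1
    have h2 : (z:ℝ) ≤ (2:ℝ) ^ (4 * (z:ℝ)) := by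
      rcases le_total (z:ℝ) 0 with h0 | h0
      · exact h0.trans (by positivity)
      · have h3 : (0:ℤ) ≤ z := by exact_mod_cast h0
        lift z to ℕ using h3
        push_cast
        rw [Real.rpow_mul (by norm_num), Real.rpow_natCast]
        have : (z:ℝ) < 2 ^ z := by exact_mod_cast Nat.lt_two_pow_self
        refine this.le.trans (pow_le_pow_left₀ (by norm_num) (by norm_num) _)
    exact_mod_cast (h2.trans h1).trans (Int.le_ceil _)
  obtain ⟨m, hm, hmax⟩ := Int.exists_greatest_of_bdd hbd hP
  have e : Cgeo = ∑' n : ℤ, ENNReal.ofReal ((2:ℝ) ^ (-|((m - n : ℤ):ℝ)| / 12)) := by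
    rw [Cgeo]; exact ((Equiv.subLeft m).tsum_eq _).symm
  rw [e, ← ENNReal.tsum_mul_right]
  refine ENNReal.tsum_le_tsum fun n => ?_
  split_ifs with hn
  · have h1 := hmax n hn
    refine le_trans ?_ (mul_le_mul_right (h m hm) _)
    rw [← ENNReal.ofReal_mul (by positivity), ← Real.rpow_add (by norm_num)]
    apply ENNReal.ofReal_le_ofReal
    apply Real.rpow_le_rpow_of_exponent_le (by norm_num)
    have h2 : (n:ℝ) ≤ m := by exact_mod_cast h1
    push_cast
    rw [abs_of_nonneg (by linarith)]; linarith
  · exact zero_le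

lemma lv_est2 {g : E3 → ℂ} (hg : Measurable g) (hB : Bt g ≠ ⊤) (k : ℤ) :
    ∫⁻ x in lvS g k, ‖g x‖ₑ ^ 4 ≤ 32 * Cgeo * (ENNReal.ofReal ((2:ℝ) ^ ((k:ℝ) / 3)) * Bt g ^ (2/3:ℝ)) := by
  classical
  have hU : lvS g k = ⋃ n : ℤ, (lvS g k ∩ {x | lev g x = n}) := by
    rw [← Set.inter_iUnion]; ext x; simp
  rw [hU]
  refine (lintegral_iUnion_le _ _).trans ?_
  set P : ℤ → Prop := fun n => ∃ x ∈ lvS g k, lev g x = n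
  have h1 : ∀ n : ℤ, ∫⁻ x in lvS g k ∩ {x | lev g x = n}, ‖g x‖ₑ ^ 4 ≤
      (if P n then ENNReal.ofReal ((2:ℝ) ^ (4 * (n:ℝ))) else 0) * (16 * ENNReal.ofReal (2 * 2 ^ (k:ℝ))) := by
    intro n
    split_ifs with hn
    · obtain ⟨x0, hx0, hn0⟩ := hn
      have hsub : lvS g k ∩ {x | lev g x = n} ⊆ {y | g y ≠ 0 ∧ lev g y = n} := fun y hy => ⟨hy.1.1, hy.2⟩
      refine (lintegral_mono_set hsub).trans ?_
      refine (setLIntegral_mono (g := fun _ => 16 * ENNReal.ofReal ((2:ℝ) ^ (4 * (n:ℝ)))) measurable_const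
        (fun y hy => lv_four hy.1 hy.2)).trans ?_
      rw [setLIntegral_const]
      have := (lv_act hg hB hx0).2
      rw [hn0] at this
      calc _ ≤ 16 * ENNReal.ofReal ((2:ℝ) ^ (4 * (n:ℝ))) * ENNReal.ofReal (2 * 2 ^ (k:ℝ)) := mul_le_mul_right this _
        _ = _ := by ring
    · rw [zero_mul]
      have : lvS g k ∩ {x | lev g x = n} = ∅ := by
        ext x; simp only [Set.mem_inter_iff, Set.mem_empty_iff_false, iff_false]
        rintro ⟨ha, hb⟩; exact hn ⟨x, ha, hb⟩
      rw [this]; simp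
  refine (ENNReal.tsum_le_tsum h1).trans ?_
  rw [ENNReal.tsum_mul_right]
  refine (mul_le_mul_left (geo_act P (ENNReal.ofReal ((2:ℝ) ^ (-(2 * (k:ℝ) / 3))) * Bt g ^ (2/3:ℝ)) ?_) _).trans ?_
  · rintro n ⟨x, hx, rfl⟩; exact (lv_act hg hB hx).1
  · have e : ENNReal.ofReal ((2:ℝ) ^ ((k:ℝ) / 3)) = ENNReal.ofReal ((2:ℝ) ^ (-(2 * (k:ℝ) / 3))) * ENNReal.ofReal ((2:ℝ) ^ (k:ℝ)) := by
      rw [← ENNReal.ofReal_mul (by positivity), ← Real.rpow_add (by norm_num)]; congr 2; ring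
    rw [e, ENNReal.ofReal_mul (by norm_num), ENNReal.ofReal_ofNat]
    apply le_of_eq; ring

lemma lv_est3 {g : E3 → ℂ} (hg : Measurable g) (hB : Bt g ≠ ⊤) (k : ℤ) :
    (∫⁻ x in lvS g k, ‖g x‖ₑ ^ 5) ^ 2 ≤ (∫⁻ x in lvS g k, ‖g x‖ₑ ^ 6) *
      (32 * Cgeo * (ENNReal.ofReal ((2:ℝ) ^ ((k:ℝ) / 3)) * Bt g ^ (2/3:ℝ))) := by
  have := lint_cs (volume.restrict (lvS g k)) (f := fun x => ‖g x‖ₑ ^ 3) (g := fun x => ‖g x‖ₑ ^ 2)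
    (hg.enorm.pow_const 3).aemeasurable (hg.enorm.pow_const 2).aemeasurable
  simp only [← pow_add, ← pow_mul] at this
  exact this.trans (mul_le_mul_right (lv_est2 hg hB k) _)

lemma lv_est4 {g : E3 → ℂ} (hg : Measurable g) (hB : Bt g ≠ ⊤) (k : ℤ) (hm : MeasurableSet (lvS g k)) :
    (∫⁻ x in lvS g k, ‖g x‖ₑ ^ 10) ≤ (∫⁻ x in lvS g k, ‖g x‖ₑ ^ 6) *
      (16 * (ENNReal.ofReal ((2:ℝ) ^ (-(2 * (k:ℝ) / 3))) * Bt g ^ (2/3:ℝ))) := by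
  rw [← lintegral_mul_const _ (hg.enorm.pow_const 6)]
  apply setLIntegral_mono' hm
  intro x hx
  rw [show 10 = 6 + 4 by rfl, pow_add]
  exact mul_le_mul_right (lv_est1 hg hB hx) _

/-- a.e. coverage -/
lemma lv_cover {g : E3 → ℂ} (hg : Measurable g) (hB : Bt g ≠ ⊤) :
    ∀ᵐ x, g x ≠ 0 → 0 < (lvV g (lev g x)).toReal := by
  have h1 : ∀ n : ℤ, ∀ᵐ x, lvV g n = 0 → ¬ (g x ≠ 0 ∧ lev g x = n) := by
    intro n
    by_cases h : lvV g n = 0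
    · have : ∀ᵐ x, ¬ (g x ≠ 0 ∧ lev g x = n) := by
        rw [ae_iff]; simp only [not_not]; exact h
      filter_upwards [this] with x hx _ using hx
    · exact Filter.Eventually.of_forall fun x h' => absurd h' h
  filter_upwards [ae_all_iff.2 h1] with x hx h0
  refine ENNReal.toReal_pos (fun h => hx _ h ⟨h0, rfl⟩) (lv_ne_top hg hB _)

section joint
variable {u : ℝ → E3 → ℂ}

lemma meas_levj (hu : Measurable (fun p : ℝ × E3 => u p.1 p.2)) :
    Measurable (fun p : ℝ × E3 => lev (u p.1) p.2) := by
  unfold lev; simp only [Real.logb]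
  exact Int.measurable_floor.comp ((Real.measurable_log.comp hu.norm).div_const _)

lemma meas_lvVj (hu : Measurable (fun p : ℝ × E3 => u p.1 p.2)) :
    Measurable (fun p : ℝ × E3 => (lvV (u p.1) (lev (u p.1) p.2)).toReal) := by
  have h1 : Measurable (fun q : ℝ × ℤ => lvV (u q.1) q.2) := by
    apply measurable_from_prod_countable_left
    intro n
    have hms : MeasurableSet {p : ℝ × E3 | u p.1 p.2 ≠ 0 ∧ lev (u p.1) p.2 = n} := by
      apply MeasurableSet.inter
      · exact (hu (measurableSet_singleton 0)).compl
      · exact meas_levj hu (measurableSet_singleton n)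
    exact measurable_measure_prodMk_left hms
  exact (h1.comp (measurable_fst.prodMk (meas_levj hu))).ennreal_toReal

lemma meas_lvkj (hu : Measurable (fun p : ℝ × E3 => u p.1 p.2)) :
    Measurable (fun p : ℝ × E3 => lvk (u p.1) p.2) := by
  unfold lvk; simp only [Real.logb]
  exact Int.measurable_floor.comp ((Real.measurable_log.comp (meas_lvVj hu)).div_const _)

lemma meas_lvSj (hu : Measurable (fun p : ℝ × E3 => u p.1 p.2)) (k : ℤ) :
    MeasurableSet {p : ℝ × E3 | p.2 ∈ lvS (u p.1) k} := by
  apply MeasurableSet.inter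
  · exact (hu (measurableSet_singleton 0)).compl
  · apply MeasurableSet.inter
    · exact (meas_lvVj hu) measurableSet_Ioi
    · exact meas_lvkj hu (measurableSet_singleton k)

lemma meas_lvS (hu : Measurable (fun p : ℝ × E3 => u p.1 p.2)) (t : ℝ) (k : ℤ) :
    MeasurableSet (lvS (u t) k) := by
  have : lvS (u t) k = (fun x => (t, x)) ⁻¹' {p : ℝ × E3 | p.2 ∈ lvS (u p.1) k} := rfl
  rw [this]; exact (measurable_const.prodMk measurable_id) (meas_lvSj hu k)

lemma meas_Bt (hu : Measurable (fun p : ℝ × E3 => u p.1 p.2)) : Measurable (fun t => Bt (u t)) :=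
  (hu.enorm.pow_const 6).lintegral_prod_right'

end joint

/-- the Schroedinger phase -/
def ph (t : ℝ) (ξ : E3) : ℂ := Complex.exp (((4 * π ^ 2 * t * ‖ξ‖ ^ 2 : ℝ) : ℂ) * I)

lemma ph_norm (t : ℝ) (ξ : E3) : ‖ph t ξ‖ = 1 := Complex.norm_exp_ofReal_mul_I _
lemma ph_enorm (t : ℝ) (ξ : E3) : ‖ph t ξ‖ₑ = 1 := by rw [← ofReal_norm, ph_norm]; simp

lemma ph_cont : Continuous (fun p : ℝ × E3 => ph p.1 p.2) := by unfold ph; fun_prop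

lemma ph_conj_mul (s t : ℝ) (ξ : E3) : (starRingEnd ℂ) (ph s ξ) * ph t ξ = ph (t - s) ξ := by
  unfold ph
  rw [← Complex.exp_conj, ← Complex.exp_add]
  congr 1; rw [map_mul, conj_ofReal, conj_I]; push_cast; ring

lemma ph_zero (ξ : E3) : ph 0 ξ = 1 := by simp [ph]

lemma n2_ph (t : ℝ) (g : E3 → ℂ) : n2 (fun ξ => ph t ξ * g ξ) = n2 g := by
  simp only [n2, enorm_mul, ph_enorm, one_mul]

lemma memLp_ph (t : ℝ) {g : E3 → ℂ} (hg : MemLp g 2) : MemLp (fun ξ => ph t ξ * g ξ) 2 := by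
  refine hg.of_le ?_ (Filter.Eventually.of_forall fun ξ => by rw [norm_mul, ph_norm, one_mul])
  exact (by unfold ph; fun_prop : Continuous (ph t)).aestronglyMeasurable.mul hg.1

lemma fourier_meas {G : ℝ → E3 → ℂ} (hG : Measurable (fun p : ℝ × E3 => G p.1 p.2)) :
    Measurable (fun p : ℝ × E3 => 𝓕 (G p.1) p.2) := by
  simp only [Real.fourier_eq']
  have : Measurable (fun q : (ℝ × E3) × E3 => Complex.exp ((-2 * π * inner ℝ q.2 q.1.2 : ℝ) * I) • G q.1.1 q.2) := by
    simp only [smul_eq_mul]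
    apply Measurable.mul
    · exact (by fun_prop : Continuous _).measurable
    · exact hG.comp ((measurable_fst.comp measurable_fst).prodMk measurable_snd)
  exact this.stronglyMeasurable.integral_prod_right.measurable

lemma pair_fourier {G uh : E3 → ℂ} (hG : Integrable G) (hu : Integrable uh) :
    br (𝓕 G) uh = br G (𝓕⁻ uh) := by
  unfold br
  have hGc : Integrable (fun x => (starRingEnd ℂ) (G x)) := by
    refine hG.congr' (Complex.continuous_conj.comp_aestronglyMeasurable hG.1) (Filter.Eventually.of_forall fun x => by simp)
  have e1 : ∫ ξ, (starRingEnd ℂ) (𝓕 G ξ) * uh ξ = ∫ ξ, 𝓕 (fun x => (starRingEnd ℂ) (G x)) ξ * uh (-ξ) := by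
    rw [← integral_neg_eq_self]
    simp only [fourier_conj, neg_neg]
  rw [e1, fourier_selfadj hGc hu.comp_neg]
  congr 1; ext x
  congr 1
  rw [Real.fourierInv_eq_fourier_neg, Real.fourier_eq', Real.fourier_eq', ← integral_neg_eq_self]
  simp

lemma kt_disp {s t : ℝ} (hst : s ≠ t) {F G : E3 → ℂ} (hF : Integrable F) (hG : Integrable G)
    (hF2 : MemLp F 2) (hG2 : MemLp G 2) :
    ‖br (fun ξ => ph s ξ * 𝓕 F ξ) (fun ξ => ph t ξ * 𝓕 G ξ)‖ₑ ≤
      ENNReal.ofReal (|s - t| ^ (-(3/2):ℝ)) * ((∫⁻ x, ‖F x‖ₑ) * ∫⁻ x, ‖G x‖ₑ) := by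
  have e : br (fun ξ => ph s ξ * 𝓕 F ξ) (fun ξ => ph t ξ * 𝓕 G ξ)
      = ∫ ξ, (starRingEnd ℂ) (𝓕 F ξ) * (𝓕 G ξ * Complex.exp (((4 * π ^ 2 * (t - s)) * ‖ξ‖ ^ 2 : ℝ) * I)) := by
    unfold br; congr 1; ext ξ
    have := ph_conj_mul s t ξ
    rw [show Complex.exp (((4 * π ^ 2 * (t - s)) * ‖ξ‖ ^ 2 : ℝ) * I) = ph (t - s) ξ from rfl, ← this, map_mul]
    ring
  have hpi := Real.pi_pos
  have hst' : 0 < |s - t| := abs_pos.2 (sub_ne_zero.2 hst)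
  have h := dispersive (τ := 4 * π ^ 2 * (t - s)) (by
    have : t - s ≠ 0 := sub_ne_zero.2 (Ne.symm hst)
    positivity) hF hG hF2 hG2
  rw [← e] at h
  rw [← ofReal_norm, ← ofReal_integral_norm_eq_lintegral_enorm hF, ← ofReal_integral_norm_eq_lintegral_enorm hG,
    ← ENNReal.ofReal_mul (integral_nonneg fun _ => norm_nonneg _), ← ENNReal.ofReal_mul (by positivity)]
  apply ENNReal.ofReal_le_ofReal
  refine h.trans ?_
  rw [mul_assoc]
  apply mul_le_mul_of_nonneg_right _ (mul_nonneg (integral_nonneg fun _ => norm_nonneg _) (integral_nonneg fun _ => norm_nonneg _))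
  rw [abs_mul, abs_of_pos (by positivity : (0:ℝ) < 4 * π ^ 2), abs_sub_comm t s,
    Real.rpow_neg hst'.le, ← Real.inv_rpow hst'.le]
  apply Real.rpow_le_rpow (by positivity) _ (by norm_num)
  rw [div_le_iff₀ (by positivity), inv_mul_eq_div, le_div_iff₀ hst']
  have : (1:ℝ) < π := by linarith [Real.pi_gt_three]
  nlinarith [mul_pos hpi hst', mul_lt_mul_of_pos_right this (mul_pos hpi hst')]

/-- truncated time weight -/
def bK (u : ℝ → E3 → ℂ) (K : ℕ) (t : ℝ) : ℝ≥0∞ :=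
  {t | (K:ℝ≥0∞)⁻¹ ≤ Bt (u t) ∧ Bt (u t) ≤ K}.indicator (fun t => Bt (u t) ^ (-(2/3):ℝ)) t

/-- atoms -/
def GK (u : ℝ → E3 → ℂ) (K : ℕ) (k : ℤ) (t : ℝ) (x : E3) : ℂ :=
  (lvS (u t) k).indicator (fun x => (((bK u K t).toReal * ‖u t x‖ ^ 4 : ℝ) : ℂ) * u t x) x

/-- sixth power mass of the pieces -/
def YK (u : ℝ → E3 → ℂ) (k : ℤ) (t : ℝ) : ℝ≥0∞ := ∫⁻ x in lvS (u t) k, ‖u t x‖ₑ ^ 6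

/-- size function -/
def fK (u : ℝ → E3 → ℂ) (K : ℕ) (k : ℤ) (t : ℝ) : ℝ≥0∞ :=
  ENNReal.ofReal ((2:ℝ) ^ (-((k:ℝ) / 6))) * (∫⁻ x, ‖GK u K k t x‖ₑ) + ENNReal.ofReal ((2:ℝ) ^ ((k:ℝ) / 3)) * n2 (GK u K k t)

section
variable {u : ℝ → E3 → ℂ}

lemma meas_bK (hu : Measurable (fun p : ℝ × E3 => u p.1 p.2)) (K : ℕ) : Measurable (bK u K) := by
  apply Measurable.indicator ((meas_Bt hu).pow_const _)
  exact (measurableSet_le measurable_const (meas_Bt hu)).inter (measurableSet_le (meas_Bt hu) measurable_const)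

lemma bK_ne_top (K : ℕ) (t : ℝ) : bK u K t ≠ ⊤ := by
  unfold bK; rw [Set.indicator]; split_ifs with h
  · refine ENNReal.rpow_ne_top_of_ne_zero ?_ (ne_top_of_le_ne_top (by simp) h.2)
    intro h0; have := h.1; rw [h0] at this; simp at this
  · simp

lemma bK_sq_le (K : ℕ) (t : ℝ) (hB : Bt (u t) ≠ ⊤) : bK u K t ^ 2 * Bt (u t) ^ (2/3:ℝ) ≤ bK u K t := by
  unfold bK; rw [Set.indicator]; split_ifs with h
  · have h0 : Bt (u t) ≠ 0 := by intro h0; have := h.1; rw [h0] at this; simp at this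
    rw [sq, mul_assoc, ← ENNReal.rpow_add _ _ h0 hB]; simp
  · simp

lemma bK_Y_le (K : ℕ) (k : ℤ) (t : ℝ) : bK u K t * YK u k t ≤ ((K:ℝ≥0∞)⁻¹) ^ (-(2/3):ℝ) * K := by
  unfold bK; rw [Set.indicator]; split_ifs with h
  · apply mul_le_mul'
    · rw [ENNReal.rpow_neg, ENNReal.rpow_neg, ENNReal.inv_le_inv]; exact ENNReal.rpow_le_rpow h.1 (by norm_num)
    · exact (setLIntegral_le_lintegral _ _).trans h.2
  · simp

lemma cK_ne_top (K : ℕ) : ((K:ℝ≥0∞)⁻¹) ^ (-(2/3):ℝ) * K ≠ ⊤ := by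
  apply ENNReal.mul_ne_top _ (by simp)
  rw [ENNReal.inv_rpow, ← ENNReal.rpow_neg]; simp; intro _; norm_num

lemma meas_GK (hu : Measurable (fun p : ℝ × E3 => u p.1 p.2)) (K : ℕ) (k : ℤ) :
    Measurable (fun p : ℝ × E3 => GK u K k p.1 p.2) := by
  have : (fun p : ℝ × E3 => GK u K k p.1 p.2) = {p : ℝ × E3 | p.2 ∈ lvS (u p.1) k}.indicator
      (fun p => (((bK u K p.1).toReal * ‖u p.1 p.2‖ ^ 4 : ℝ) : ℂ) * u p.1 p.2) := rfl
  rw [this]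
  refine Measurable.indicator ?_ (meas_lvSj hu k)
  exact (Complex.measurable_ofReal.comp ((((meas_bK hu K).ennreal_toReal.comp measurable_fst)).mul
    (hu.norm.pow_const 4))).mul hu

lemma meas_YK (hu : Measurable (fun p : ℝ × E3 => u p.1 p.2)) (k : ℤ) : Measurable (YK u k) := by
  have : YK u k = fun t => ∫⁻ x, {p : ℝ × E3 | p.2 ∈ lvS (u p.1) k}.indicator (fun p => ‖u p.1 p.2‖ₑ ^ 6) (t, x) := by
    ext t
    rw [YK, ← lintegral_indicator (meas_lvS hu t k)]; rfl
  rw [this]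
  exact ((hu.enorm.pow_const 6).indicator (meas_lvSj hu k)).lintegral_prod_right'

lemma GK_enorm (K : ℕ) (k : ℤ) (t : ℝ) (x : E3) :
    ‖GK u K k t x‖ₑ = (lvS (u t) k).indicator (fun x => bK u K t * ‖u t x‖ₑ ^ 5) x := by
  unfold GK; simp only [Set.indicator]; split_ifs with h
  · rw [enorm_mul, ← ofReal_norm, Complex.norm_real, norm_mul, Real.norm_of_nonneg ENNReal.toReal_nonneg,
      ENNReal.ofReal_mul ENNReal.toReal_nonneg, ENNReal.ofReal_toReal (bK_ne_top K t), norm_pow, norm_norm,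
      ENNReal.ofReal_pow (norm_nonneg _), ofReal_norm]; ring
  · simp

lemma GK_l1 (hu : Measurable (fun p : ℝ × E3 => u p.1 p.2)) (K : ℕ) (k : ℤ) (t : ℝ) :
    ∫⁻ x, ‖GK u K k t x‖ₑ = bK u K t * ∫⁻ x in lvS (u t) k, ‖u t x‖ₑ ^ 5 := by
  simp only [GK_enorm]
  rw [lintegral_indicator (meas_lvS hu t k), lintegral_const_mul _ ((slice_meas hu t).enorm.pow_const 5)]

lemma GK_l2 (hu : Measurable (fun p : ℝ × E3 => u p.1 p.2)) (K : ℕ) (k : ℤ) (t : ℝ) :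
    n2 (GK u K k t) ^ 2 = bK u K t ^ 2 * ∫⁻ x in lvS (u t) k, ‖u t x‖ₑ ^ 10 := by
  rw [n2_sq, ← lintegral_const_mul _ ((slice_meas hu t).enorm.pow_const 10), ← lintegral_indicator (meas_lvS hu t k)]
  congr 1; ext x; rw [GK_enorm]; simp only [Set.indicator]; split_ifs <;> ring

lemma sq_add_le' (a b : ℝ≥0∞) : (a + b) ^ 2 ≤ 2 * (a ^ 2 + b ^ 2) := by
  by_cases ha : a = ⊤
  · simp [ha]
  by_cases hb : b = ⊤
  · simp [hb]
  lift a to NNReal using ha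
  lift b to NNReal using hb
  norm_cast
  exact add_sq_le

lemma ofReal_two_sq (y : ℝ) : ENNReal.ofReal ((2:ℝ) ^ y) ^ 2 = ENNReal.ofReal ((2:ℝ) ^ (2 * y)) := by
  rw [← ENNReal.ofReal_pow (by positivity), ← Real.rpow_natCast, ← Real.rpow_mul (by norm_num)]
  congr 2; push_cast; ring

lemma ofReal_two_mul_neg {x y : ℝ} (h : x + y = 0) : ENNReal.ofReal ((2:ℝ) ^ x) * ENNReal.ofReal ((2:ℝ) ^ y) = 1 := by
  rw [← ENNReal.ofReal_mul (by positivity), ← Real.rpow_add (by norm_num), h]; simp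

lemma fK_sq_le (hu : Measurable (fun p : ℝ × E3 => u p.1 p.2)) (K : ℕ) (k : ℤ) (t : ℝ) (hB : Bt (u t) ≠ ⊤) :
    fK u K k t ^ 2 ≤ (2 * (32 * Cgeo + 16)) * (bK u K t * YK u k t) := by
  have hg := slice_meas hu t
  unfold fK
  refine (sq_add_le' _ _).trans ?_
  rw [mul_assoc, add_mul]
  refine mul_le_mul_right (add_le_add ?_ ?_) _
  · rw [mul_pow, GK_l1 hu, mul_pow, ofReal_two_sq]
    calc _ ≤ ENNReal.ofReal ((2:ℝ) ^ (2 * -((k:ℝ) / 6))) * (bK u K t ^ 2 * ((∫⁻ x in lvS (u t) k, ‖u t x‖ₑ ^ 6) *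
      (32 * Cgeo * (ENNReal.ofReal ((2:ℝ) ^ ((k:ℝ) / 3)) * Bt (u t) ^ (2/3:ℝ))))) :=
          mul_le_mul_right (mul_le_mul_right (lv_est3 hg hB k) _) _
      _ = (ENNReal.ofReal ((2:ℝ) ^ (2 * -((k:ℝ) / 6))) * ENNReal.ofReal ((2:ℝ) ^ ((k:ℝ) / 3))) *
          (32 * Cgeo * (YK u k t * (bK u K t ^ 2 * Bt (u t) ^ (2/3:ℝ)))) := by rw [YK]; ring
      _ ≤ 1 * (32 * Cgeo * (YK u k t * bK u K t)) := by
          rw [ofReal_two_mul_neg (by ring)]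
          exact mul_le_mul_right (mul_le_mul_right (mul_le_mul_right (bK_sq_le K t hB) _) _) _
      _ = _ := by ring
  · rw [mul_pow, GK_l2 hu, ofReal_two_sq]
    calc _ ≤ ENNReal.ofReal ((2:ℝ) ^ (2 * ((k:ℝ) / 3))) * (bK u K t ^ 2 * ((∫⁻ x in lvS (u t) k, ‖u t x‖ₑ ^ 6) *
      (16 * (ENNReal.ofReal ((2:ℝ) ^ (-(2 * (k:ℝ) / 3))) * Bt (u t) ^ (2/3:ℝ))))) :=
          mul_le_mul_right (mul_le_mul_right (lv_est4 hg hB k (meas_lvS hu t k)) _) _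
      _ = (ENNReal.ofReal ((2:ℝ) ^ (2 * ((k:ℝ) / 3))) * ENNReal.ofReal ((2:ℝ) ^ (-(2 * (k:ℝ) / 3)))) *
          (16 * (YK u k t * (bK u K t ^ 2 * Bt (u t) ^ (2/3:ℝ)))) := by rw [YK]; ring
      _ ≤ 1 * (16 * (YK u k t * bK u K t)) := by
          rw [ofReal_two_mul_neg (by ring)]
          exact mul_le_mul_right (mul_le_mul_right (mul_le_mul_right (bK_sq_le K t hB) _) _) _
      _ = _ := by ring

lemma CC_ne_top : (2 * (32 * Cgeo + 16)) ≠ ⊤ := by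
  have := Cgeo_lt
  finiteness

lemma fK_ne_top (hu : Measurable (fun p : ℝ × E3 => u p.1 p.2)) (K : ℕ) (k : ℤ) (t : ℝ) (hB : Bt (u t) ≠ ⊤) :
    fK u K k t ≠ ⊤ := by
  intro h
  have h1 := fK_sq_le hu K k t hB
  rw [h] at h1
  have h2 : (2 * (32 * Cgeo + 16)) * (bK u K t * YK u k t) ≠ ⊤ :=
    ENNReal.mul_ne_top CC_ne_top (ne_top_of_le_ne_top (cK_ne_top K) (bK_Y_le K k t))
  simp at h1
  exact h2 (by simpa using h1)

lemma GK_int (hu : Measurable (fun p : ℝ × E3 => u p.1 p.2)) (K : ℕ) (k : ℤ) (t : ℝ) (hB : Bt (u t) ≠ ⊤) :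
    Integrable (GK u K k t) ∧ MemLp (GK u K k t) 2 := by
  have h := fK_ne_top hu K k t hB
  unfold fK at h
  rw [ENNReal.add_ne_top] at h
  have hm := slice_meas (meas_GK hu K k) t
  constructor
  · refine ⟨hm.aestronglyMeasurable, ?_⟩
    rw [hasFiniteIntegral_iff_enorm, lt_top_iff_ne_top]
    intro h0
    rw [h0, ENNReal.mul_top (by simp; positivity)] at h
    exact h.1 rfl
  · refine ⟨hm.aestronglyMeasurable, ?_⟩
    rw [lt_top_iff_ne_top, ← n2_eq]
    intro h0
    rw [h0, ENNReal.mul_top (by simp; positivity)] at h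
    exact h.2 rfl

lemma kt_inst (hu : Measurable (fun p : ℝ × E3 => u p.1 p.2)) (K : ℕ) (hB : ∀ t, Bt (u t) ≠ ⊤) :
    KT 1 (fun k t ξ => ph t ξ * 𝓕 (GK u K k t) ξ) (fK u K) where
  hC := zero_le_one
  vm k := ph_cont.measurable.mul (fourier_meas (meas_GK hu K k))
  fm k := by
    unfold fK
    exact (((meas_GK hu K k).enorm.lintegral_prod_right').const_mul _).add ((n2_meas (meas_GK hu K k)).const_mul _)
  l2 k s := by
    obtain ⟨h1, h2⟩ := GK_int hu K k s (hB s)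
    have e : ∫⁻ ξ, ‖ph s ξ * 𝓕 (GK u K k s) ξ‖ₑ ^ 2 = n2 (GK u K k s) ^ 2 := by
      rw [← n2_sq, n2_ph, n2_eq, n2_eq, eLpNorm_fourier h1 h2]
    rw [e]
    calc _ = ENNReal.ofReal ((2:ℝ) ^ (-(2 * (k:ℝ) / 3))) * (ENNReal.ofReal ((2:ℝ) ^ ((k:ℝ) / 3)) * n2 (GK u K k s)) ^ 2 := by
          rw [mul_pow, ofReal_two_sq, ← mul_assoc, ofReal_two_mul_neg (by ring), one_mul]
      _ ≤ _ := by
          refine mul_le_mul_right ?_ _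
          rw [ENNReal.pow_le_pow_left_iff two_ne_zero]; exact le_add_self
  di k m s t hst := by
    obtain ⟨h1, h2⟩ := GK_int hu K k s (hB s)
    obtain ⟨h3, h4⟩ := GK_int hu K m t (hB t)
    refine (kt_disp hst h1 h3 h2 h4).trans ?_
    have e : ∀ (k : ℤ) (s : ℝ), ∫⁻ x, ‖GK u K k s x‖ₑ ≤ ENNReal.ofReal ((2:ℝ) ^ ((k:ℝ) / 6)) * fK u K k s := by
      intro k s
      calc _ = ENNReal.ofReal ((2:ℝ) ^ ((k:ℝ) / 6)) * (ENNReal.ofReal ((2:ℝ) ^ (-((k:ℝ) / 6))) * ∫⁻ x, ‖GK u K k s x‖ₑ) := by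
            rw [← mul_assoc, ofReal_two_mul_neg (by ring), one_mul]
        _ ≤ _ := mul_le_mul_right le_self_add _
    calc _ ≤ ENNReal.ofReal (|s - t| ^ (-(3/2):ℝ)) * ((ENNReal.ofReal ((2:ℝ) ^ ((k:ℝ) / 6)) * fK u K k s) *
            (ENNReal.ofReal ((2:ℝ) ^ ((m:ℝ) / 6)) * fK u K m t)) := mul_le_mul_right (mul_le_mul' (e k s) (e m t)) _
      _ = _ := by
          rw [one_mul, add_div, Real.rpow_add (by norm_num), ENNReal.ofReal_mul (by positivity), ENNReal.ofReal_mul (by positivity)]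
          ring
end

/-- Strichartz constant -/
def CB : ℝ≥0∞ := ENNReal.ofReal (9 + 20 * 1) * (2 * Cgeo) * (2 * (32 * Cgeo + 16))

lemma CB_ne_top : CB ≠ ⊤ := by
  have := Cgeo_lt
  unfold CB; finiteness

lemma CB_ne_zero : CB ≠ 0 := by
  have := Cgeo_pos
  unfold CB; simp [this]; norm_num

lemma absorb {X c Q : ℝ≥0∞} (hX : X ≠ ⊤) (h : X ≤ (c * X) ^ (1/2:ℝ) * Q) : X ≤ c * Q ^ 2 := by
  by_cases h0 : X = 0
  · rw [h0]; exact zero_le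
  have h1 : X ^ 2 ≤ (c * X) * Q ^ 2 := by
    have := (ENNReal.pow_le_pow_left_iff (two_ne_zero)).2 h
    refine this.trans (le_of_eq ?_)
    rw [mul_pow, ← ENNReal.rpow_natCast ((c * X) ^ (1/2:ℝ)), ← ENNReal.rpow_mul]; norm_num
  have h2 : X * X ≤ (c * Q ^ 2) * X := by rw [← sq]; refine h1.trans (le_of_eq ?_); ring
  exact (ENNReal.mul_le_mul_iff_left h0 hX).1 h2

lemma br_sum {S : Finset ℤ} {v : ℤ → E3 → ℂ} {g : E3 → ℂ} (hv : ∀ k ∈ S, MemLp (v k) 2) (hg : MemLp g 2) :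
    br (fun ξ => ∑ k ∈ S, v k ξ) g = ∑ k ∈ S, br (v k) g := by
  unfold br
  rw [← integral_finsetSum S fun k hk => br_integrable (hv k hk) hg]
  congr 1; ext ξ; rw [map_sum, Finset.sum_mul]

lemma br_GK {u : ℝ → E3 → ℂ} (hu : Measurable (fun p : ℝ × E3 => u p.1 p.2)) (K : ℕ) (k : ℤ) (t : ℝ) :
    br (GK u K k t) (u t) = (((bK u K t * YK u k t).toReal : ℝ) : ℂ) := by
  unfold br
  have h1 : ∀ x, (starRingEnd ℂ) (GK u K k t x) * u t x =
      (((lvS (u t) k).indicator (fun x => (bK u K t).toReal * ‖u t x‖ ^ 6) x : ℝ) : ℂ) := by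
    intro x
    unfold GK; simp only [Set.indicator]; split_ifs with h
    · rw [map_mul, Complex.conj_ofReal, mul_assoc, Complex.conj_mul']; push_cast; ring
    · simp
  simp only [h1]
  rw [integral_complex_ofReal]
  congr 1
  rw [integral_indicator (meas_lvS hu t k), integral_const_mul, ENNReal.toReal_mul]
  congr 1
  rw [YK, integral_eq_lintegral_of_nonneg_ae (Filter.Eventually.of_forall fun x => by positivity)
    ((slice_meas hu t).norm.pow_const 6).aestronglyMeasurable]
  congr 2; ext x
  rw [ENNReal.ofReal_pow (norm_nonneg _), ofReal_norm]

lemma strichartz_trunc {u uh gh : ℝ → E3 → ℂ} {t1 t2 : ℝ}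
    (hu : Measurable (fun p : ℝ × E3 => u p.1 p.2))
    (huh1 : ∀ t, Integrable (uh t)) (huh2 : ∀ t, MemLp (uh t) 2)
    (huf : ∀ t, u t = 𝓕⁻ (uh t)) (hB : ∀ t, Bt (u t) ≠ ⊤)
    (hg : Measurable (fun p : ℝ × E3 => gh p.1 p.2)) (hgL : ∀ t, MemLp (gh t) 2)
    (hgfin : ∫⁻ s in Set.Ioc t1 t2, n2 (gh s) ≠ ⊤)
    (hD : ∀ t ∈ Set.Ioc t1 t2, (fun ξ => ph t ξ * uh t ξ) =ᵐ[volume]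
      fun ξ => ph t1 ξ * uh t1 ξ - I * tint (fun s ξ => ph s ξ * gh s ξ) (Set.Ioc t1 t) ξ) (K : ℕ) (S : Finset ℤ) :
    ∫⁻ t in Set.Ioc t1 t2, ∑ k ∈ S, bK u K t * YK u k t ≤
      CB * (n2 (uh t1) + ∫⁻ s in Set.Ioc t1 t2, n2 (gh s)) ^ 2 := by
  have kt := kt_inst hu K hB
  have hmY : ∀ k, Measurable (fun t => bK u K t * YK u k t) := fun k => (meas_bK hu K).mul (meas_YK hu k)
  have hfY : ∀ k t, bK u K t * YK u k t ≠ ⊤ := fun k t => ne_top_of_le_ne_top (cK_ne_top K) (bK_Y_le K k t)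
  have hIY : ∀ k, ∫⁻ t in Set.Ioc t1 t2, bK u K t * YK u k t ≠ ⊤ := by
    intro k
    refine ne_top_of_le_ne_top ?_ (lintegral_mono fun t => bK_Y_le K k t)
    rw [lintegral_const]
    exact ENNReal.mul_ne_top (cK_ne_top K) (by simp)
  have hff : ∀ k, ∫⁻ s in Set.Ioc t1 t2, fK u K k s ^ 2 ≤ (2 * (32 * Cgeo + 16)) * ∫⁻ t in Set.Ioc t1 t2, bK u K t * YK u k t := by
    intro k
    rw [← lintegral_const_mul _ (hmY k)]
    exact lintegral_mono fun t => fK_sq_le hu K k t (hB t)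
  set X := ∫⁻ t in Set.Ioc t1 t2, ∑ k ∈ S, bK u K t * YK u k t with hX
  have hXsum : X = ∑ k ∈ S, ∫⁻ t in Set.Ioc t1 t2, bK u K t * YK u k t :=
    lintegral_finsetSum S fun k _ => hmY k
  have hXtop : X ≠ ⊤ := by rw [hXsum]; exact (ENNReal.sum_lt_top.2 fun k _ => (hIY k).lt_top).ne
  have hpair := kt.pair (fun k s => fK_ne_top hu K k s (hB s)) (t1 := t1) (t2 := t2) S
    (fun k _ => ne_top_of_le_ne_top (ENNReal.mul_ne_top CC_ne_top (hIY k)) (hff k))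
    (g := fun s ξ => ph s ξ * gh s ξ) (U := fun t ξ => ph t ξ * uh t ξ) (a := fun ξ => ph t1 ξ * uh t1 ξ)
    (ph_cont.measurable.mul hg) (fun t => memLp_ph t (hgL t)) (memLp_ph t1 (huh2 t1))
    (fun t => memLp_ph t (huh2 t)) (by simpa only [n2_ph] using hgfin) hD
  simp only [n2_ph] at hpair
  have hbr : ∀ t, br (fun ξ => ∑ k ∈ S, ph t ξ * 𝓕 (GK u K k t) ξ) (fun ξ => ph t ξ * uh t ξ)
      = (((∑ k ∈ S, bK u K t * YK u k t).toReal : ℝ) : ℂ) := by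
    intro t
    rw [br_sum (v := fun k ξ => ph t ξ * 𝓕 (GK u K k t) ξ) (fun k _ => kt.vmem (fK_ne_top hu K k t (hB t))) (memLp_ph t (huh2 t)),
      ENNReal.toReal_sum fun k _ => hfY k t, Complex.ofReal_sum]
    refine Finset.sum_congr rfl fun k _ => ?_
    rw [← br_GK hu, huf t, ← pair_fourier (GK_int hu K k t (hB t)).1 (huh1 t)]
    unfold br; congr 1; ext ξ
    have := ph_conj_mul t t ξ
    rw [sub_self, ph_zero] at this
    rw [map_mul]
    linear_combination ((starRingEnd ℂ) (𝓕 (GK u K k t) ξ) * uh t ξ) * this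
  simp only [hbr] at hpair
  rw [integral_complex_ofReal] at hpair
  have hXl : ‖((∫ t in Set.Ioc t1 t2, (∑ k ∈ S, bK u K t * YK u k t).toReal : ℝ) : ℂ)‖ₑ = X := by
    rw [← ofReal_norm, Complex.norm_real, Real.norm_of_nonneg (integral_nonneg fun _ => ENNReal.toReal_nonneg),
      integral_toReal (Finset.measurable_fun_sum S fun k _ => hmY k).aemeasurable, ENNReal.ofReal_toReal hXtop]
    exact Filter.Eventually.of_forall fun t => ENNReal.sum_lt_top.2 fun k _ => (hfY k t).lt_top
  rw [hXl] at hpair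
  apply absorb hXtop
  refine hpair.trans (mul_le_mul_left (ENNReal.rpow_le_rpow ?_ (by norm_num)) _)
  rw [CB, mul_assoc _ (2 * (32 * Cgeo + 16)) X]
  refine mul_le_mul_right ?_ _
  rw [hXsum, Finset.mul_sum]
  exact Finset.sum_le_sum fun k _ => hff k

lemma lv_tsum {u : ℝ → E3 → ℂ} (hu : Measurable (fun p : ℝ × E3 => u p.1 p.2)) {t : ℝ} (hB : Bt (u t) ≠ ⊤) :
    ∑' k : ℤ, YK u k t = Bt (u t) := by
  unfold YK
  have hd : Pairwise (Function.onFun Disjoint (fun k => lvS (u t) k)) := by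
    intro k m hkm
    rw [Function.onFun, Set.disjoint_left]
    rintro x ⟨_, _, h⟩ ⟨_, _, h'⟩
    exact hkm (h.symm.trans h')
  rw [← lintegral_iUnion (fun k => meas_lvS hu t k) hd, Bt, ← lintegral_indicator (MeasurableSet.iUnion fun k => meas_lvS hu t k)]
  apply lintegral_congr_ae
  filter_upwards [lv_cover (slice_meas hu t) hB] with x hx
  by_cases h0 : u t x = 0
  · simp [Set.indicator, h0]
  · rw [Set.indicator_of_mem]
    exact Set.mem_iUnion.2 ⟨lvk (u t) x, h0, hx h0, rfl⟩

lemma lv_lim {u : ℝ → E3 → ℂ} (hu : Measurable (fun p : ℝ × E3 => u p.1 p.2)) {t : ℝ} (hB : Bt (u t) ≠ ⊤) :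
    Bt (u t) ^ (1/3:ℝ) ≤ liminf (fun K : ℕ => ∑ k ∈ Finset.Icc (-(K:ℤ)) K, bK u K t * YK u k t) atTop := by
  by_cases h0 : Bt (u t) = 0
  · rw [h0]; simp
  have h1 : Tendsto (fun K : ℕ => ∑ k ∈ Finset.Icc (-(K:ℤ)) K, YK u k t) atTop (nhds (Bt (u t))) := by
    have := (ENNReal.summable (f := fun k : ℤ => YK u k t)).hasSum
    rw [lv_tsum hu hB] at this
    have h2 : Tendsto (fun K : ℕ => Finset.Icc (-(K:ℤ)) K) atTop atTop := by
      exact Finset.tendsto_Icc_neg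
    rw [HasSum, SummationFilter.unconditional_filter] at this
    exact this.comp h2
  have hne : Bt (u t) ^ (-(2/3):ℝ) ≠ ⊤ := ENNReal.rpow_ne_top_of_ne_zero h0 hB
  have h3 := ENNReal.Tendsto.const_mul h1 (Or.inr hne)
  rw [show Bt (u t) ^ (-(2/3):ℝ) * Bt (u t) = Bt (u t) ^ (1/3:ℝ) by
    nth_rewrite 2 [← ENNReal.rpow_one (Bt (u t))]
    rw [← ENNReal.rpow_add _ _ h0 hB]; norm_num] at h3
  refine le_of_eq (Eq.symm ?_)
  apply Tendsto.liminf_eq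
  refine h3.congr' ?_
  have e1 : ∀ᶠ K : ℕ in atTop, Bt (u t) < K := by
    exact (ENNReal.tendsto_nat_nhds_top).eventually (lt_mem_nhds hB.lt_top)
  have e2 : ∀ᶠ K : ℕ in atTop, (K:ℝ≥0∞)⁻¹ < Bt (u t) :=
    (ENNReal.tendsto_inv_nat_nhds_zero).eventually (gt_mem_nhds (pos_iff_ne_zero.2 h0))
  filter_upwards [e1, e2] with K h4 h5
  rw [Finset.mul_sum]
  refine Finset.sum_congr rfl fun k _ => ?_
  rw [bK, Set.indicator_of_mem]
  exact ⟨h5.le, h4.le⟩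

/-- endpoint Strichartz estimate -/
theorem strichartz {u uh gh : ℝ → E3 → ℂ} {t1 t2 : ℝ}
    (hu : Measurable (fun p : ℝ × E3 => u p.1 p.2))
    (huh1 : ∀ t, Integrable (uh t)) (huh2 : ∀ t, MemLp (uh t) 2)
    (huf : ∀ t, u t = 𝓕⁻ (uh t))
    (hg : Measurable (fun p : ℝ × E3 => gh p.1 p.2)) (hgL : ∀ t, MemLp (gh t) 2)
    (hD : ∀ t ∈ Set.Ioc t1 t2, (fun ξ => ph t ξ * uh t ξ) =ᵐ[volume]
      fun ξ => ph t1 ξ * uh t1 ξ - I * tint (fun s ξ => ph s ξ * gh s ξ) (Set.Ioc t1 t) ξ) :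
    ∫⁻ t in Set.Ioc t1 t2, Bt (u t) ^ (1/3:ℝ) ≤
      CB * (n2 (uh t1) + ∫⁻ s in Set.Ioc t1 t2, n2 (gh s)) ^ 2 := by
  have hB : ∀ t, Bt (u t) ≠ ⊤ := by
    intro t
    have h2 : ∫⁻ x, ‖u t x‖ₑ ^ 2 ≠ ⊤ := by
      rw [← n2_sq, n2_eq, huf t, eLpNorm_fourierInv (huh1 t) (huh2 t)]
      exact ENNReal.pow_ne_top (huh2 t).2.ne
    have hb : ∀ x, ‖u t x‖ₑ ≤ ENNReal.ofReal (∫ ξ, ‖uh t ξ‖) := by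
      intro x
      rw [huf t, Real.fourierInv_eq_fourier_neg, ← ofReal_norm]
      exact ENNReal.ofReal_le_ofReal (norm_fourier_le _)
    have : Bt (u t) ≤ ENNReal.ofReal (∫ ξ, ‖uh t ξ‖) ^ 4 * ∫⁻ x, ‖u t x‖ₑ ^ 2 := by
      rw [Bt, ← lintegral_const_mul _ ((slice_meas hu t).enorm.pow_const 2)]
      refine lintegral_mono fun x => ?_
      change ‖u t x‖ₑ ^ (4 + 2) ≤ _
      rw [pow_add]
      exact mul_le_mul_left (pow_le_pow_left' (hb x) 4) _
    exact ne_top_of_le_ne_top (ENNReal.mul_ne_top (by finiteness) h2) this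
  by_cases hgfin : ∫⁻ s in Set.Ioc t1 t2, n2 (gh s) = ⊤
  · rw [hgfin]; simp [CB_ne_zero]
  have hT := strichartz_trunc hu huh1 huh2 huf hB hg hgL hgfin hD
  calc _ ≤ ∫⁻ t in Set.Ioc t1 t2, liminf (fun K : ℕ => ∑ k ∈ Finset.Icc (-(K:ℤ)) K, bK u K t * YK u k t) atTop :=
        lintegral_mono fun t => lv_lim hu (hB t)
    _ ≤ liminf (fun K : ℕ => ∫⁻ t in Set.Ioc t1 t2, ∑ k ∈ Finset.Icc (-(K:ℤ)) K, bK u K t * YK u k t) atTop :=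
        lintegral_liminf_le fun K => Finset.measurable_fun_sum _ fun k _ => (meas_bK hu K).mul (meas_YK hu k)
    _ ≤ _ := by
        refine liminf_le_of_frequently_le' (Filter.Frequently.of_forall fun K => hT K _)

/-- energy (L²) estimate -/
lemma duhamel_l2 {uh gh : ℝ → E3 → ℂ} {t1 t : ℝ}
    (huh2 : ∀ t, MemLp (uh t) 2) (hg : Measurable (fun p : ℝ × E3 => gh p.1 p.2))
    (hD : (fun ξ => ph t ξ * uh t ξ) =ᵐ[volume]
      fun ξ => ph t1 ξ * uh t1 ξ - I * tint (fun s ξ => ph s ξ * gh s ξ) (Set.Ioc t1 t) ξ) :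
    n2 (uh t) ≤ n2 (uh t1) + ∫⁻ s in Set.Ioc t1 t, n2 (gh s) := by
  set W := tint (fun s ξ => ph s ξ * gh s ξ) (Set.Ioc t1 t) with hWd
  have hm : Measurable (fun p : ℝ × E3 => ph p.1 p.2 * gh p.1 p.2) := ph_cont.measurable.mul hg
  have hW : MemLp W 2 := by
    have : W =ᵐ[volume] fun ξ => I * (ph t ξ * uh t ξ - ph t1 ξ * uh t1 ξ) := by
      filter_upwards [hD] with ξ hξ
      rw [hξ, sub_sub_cancel_left, mul_neg, ← mul_assoc, I_mul_I]; ring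
    rw [memLp_congr_ae this]
    exact ((memLp_ph t (huh2 t)).sub (memLp_ph t1 (huh2 t1))).const_mul I
  have h1 : n2 (uh t) = n2 (fun ξ => ph t1 ξ * uh t1 ξ + (-I) * W ξ) := by
    rw [← n2_ph t, n2_congr hD]; congr 1; ext ξ; ring
  rw [h1]
  refine (n2_add_le (memLp_ph t1 (huh2 t1)).1 (hW.1.const_mul _)).trans ?_
  rw [n2_ph]
  refine add_le_add_right ?_ _
  have h2 : n2 (fun ξ => (-I) * W ξ) = n2 W := by
    simp only [n2, enorm_mul, show ‖-I‖ₑ = 1 by rw [← ofReal_norm]; simp, one_mul]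
  rw [h2]
  have := n2_tint_le hm hW
  simpa only [n2_ph] using this

lemma ac_mul {α β : ℝ → ℂ} {t1 t : ℝ} (hα : IntegrableOn α (Set.Ioc t1 t)) (hβ : IntegrableOn β (Set.Ioc t1 t)) (a b : ℂ) :
    (a + ∫ s in Set.Ioc t1 t, α s) * (b + ∫ s in Set.Ioc t1 t, β s) =
      a * b + ∫ s in Set.Ioc t1 t, (α s * (b + ∫ r in Set.Ioc t1 s, β r) + (a + ∫ r in Set.Ioc t1 s, α r) * β s) := by
  set A := Set.Ioc t1 t with hA
  set μ := volume.restrict A with hμ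
  have hH : Integrable (fun p : ℝ × ℝ => α p.1 * β p.2) (μ.prod μ) := Integrable.mul_prod hα hβ
  set T : Set (ℝ × ℝ) := {p | p.2 ≤ p.1} with hT
  have hTm : MeasurableSet T := measurableSet_le measurable_snd measurable_fst
  have hAs : ∀ s ∈ A, A ∩ Set.Iic s = Set.Ioc t1 s := by
    intro s hs; ext r; simp only [hA, Set.mem_inter_iff, Set.mem_Ioc, Set.mem_Iic] at hs ⊢
    constructor
    · rintro ⟨⟨h1, _⟩, h2⟩; exact ⟨h1, h2⟩
    · rintro ⟨h1, h2⟩; exact ⟨⟨h1, h2.trans hs.2⟩, h2⟩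
  have hAs' : ∀ s ∈ A, A ∩ Set.Iio s = Set.Ioo t1 s := by
    intro s hs; ext r; simp only [hA, Set.mem_inter_iff, Set.mem_Ioc, Set.mem_Ioo, Set.mem_Iio] at hs ⊢
    constructor
    · rintro ⟨⟨h1, _⟩, h2⟩; exact ⟨h1, h2⟩
    · rintro ⟨h1, h2⟩; exact ⟨⟨h1, h2.le.trans hs.2⟩, h2⟩
  have e1 : ∀ s ∈ A, α s * ∫ r in Set.Ioc t1 s, β r = ∫ r, T.indicator (fun p => α p.1 * β p.2) (s, r) ∂μ := by
    intro s hs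
    rw [← hAs s hs, Set.inter_comm, ← Measure.restrict_restrict measurableSet_Iic,
      ← integral_indicator measurableSet_Iic, ← integral_const_mul]
    congr 1; ext r
    simp only [Set.indicator, T, Set.mem_ofPred_eq, Set.mem_Iic]
    split_ifs <;> simp
  have e2 : ∀ r ∈ A, (∫ s in Set.Ioc t1 r, α s) * β r = ∫ s, Tᶜ.indicator (fun p => α p.1 * β p.2) (s, r) ∂μ := by
    intro r hr
    rw [← setIntegral_congr_set (Ioo_ae_eq_Ioc (μ := volume)), ← hAs' r hr, Set.inter_comm,
      ← Measure.restrict_restrict measurableSet_Iio,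
      ← integral_indicator measurableSet_Iio, ← integral_mul_const]
    congr 1; ext s
    simp only [Set.indicator, T, Set.mem_compl_iff, Set.mem_ofPred_eq, Set.mem_Iio, not_le]
    split_ifs <;> simp
  have i1 := hH.indicator hTm
  have i2 := hH.indicator hTm.compl
  have i1' : IntegrableOn (fun s => α s * ∫ r in Set.Ioc t1 s, β r) A :=
    (i1.integral_prod_left).congr ((ae_restrict_iff' measurableSet_Ioc).2 (Filter.Eventually.of_forall fun s hs => (e1 s hs).symm))
  have i2' : IntegrableOn (fun r => (∫ s in Set.Ioc t1 r, α s) * β r) A :=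
    (i2.integral_prod_right).congr ((ae_restrict_iff' measurableSet_Ioc).2 (Filter.Eventually.of_forall fun s hs => (e2 s hs).symm))
  have key : (∫ s in A, α s) * (∫ r in A, β r) = (∫ s in A, α s * ∫ r in Set.Ioc t1 s, β r) + ∫ r in A, (∫ s in Set.Ioc t1 r, α s) * β r := by
    rw [setIntegral_congr_fun measurableSet_Ioc e1, setIntegral_congr_fun measurableSet_Ioc e2,
      ← integral_prod _ i1, ← integral_prod_symm _ i2, ← integral_add i1 i2, ← integral_prod_mul]
    congr 1; ext p
    simp only [Set.indicator, Set.mem_compl_iff]; split_ifs <;> simp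
  have e3 : ∫ s in A, (α s * (b + ∫ r in Set.Ioc t1 s, β r) + (a + ∫ r in Set.Ioc t1 s, α r) * β s) =
     (∫ s in A, α s) * b + a * (∫ s in A, β s) + ((∫ s in A, α s * ∫ r in Set.Ioc t1 s, β r) + ∫ r in A, (∫ s in Set.Ioc t1 r, α s) * β r) := by
    rw [← integral_mul_const, ← integral_const_mul, ← integral_add (by exact hα.mul_const b) (by exact hβ.const_mul a),
      ← integral_add i1' i2', ← integral_add (by exact (hα.mul_const b).add (hβ.const_mul a)) (by exact i1'.add i2')]
    congr 1; ext s; ring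
  rw [e3, ← key]; ring

/-- evolution identity -/
def Ev (t1 t2 : ℝ) (A α : ℝ → E3 → ℂ) : Prop :=
  ∀ t ∈ Set.Ioc t1 t2, A t =ᵐ[volume] fun ξ => A t1 ξ + tint α (Set.Ioc t1 t) ξ

/-- regularity for evolution identity -/
structure EvR (t1 t2 : ℝ) (A α : ℝ → E3 → ℂ) : Prop where
  am : Measurable (fun p : ℝ × E3 => A p.1 p.2)
  bm : Measurable (fun p : ℝ × E3 => α p.1 p.2)
  int : ∀ᵐ ξ, IntegrableOn (fun s => α s ξ) (Set.Ioc t1 t2)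
  ev : Ev t1 t2 A α

lemma tint_meas2 {v : ℝ → E3 → ℂ} (hv : Measurable (fun p : ℝ × E3 => v p.1 p.2)) (t1 : ℝ) :
    Measurable (fun p : ℝ × E3 => tint v (Set.Ioc t1 p.1) p.2) := by
  have : (fun p : ℝ × E3 => tint v (Set.Ioc t1 p.1) p.2) = fun p =>
      ∫ s, {q : (ℝ × E3) × ℝ | t1 < q.2 ∧ q.2 ≤ q.1.1}.indicator (fun q => v q.2 q.1.2) (p, s) := by
    ext p
    rw [tint, ← integral_indicator measurableSet_Ioc]; rfl
  rw [this]
  have hms : MeasurableSet {q : (ℝ × E3) × ℝ | t1 < q.2 ∧ q.2 ≤ q.1.1} :=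
    (measurableSet_lt measurable_const measurable_snd).inter (measurableSet_le measurable_snd (measurable_fst.comp measurable_fst))
  have hm : Measurable (fun q : (ℝ × E3) × ℝ => v q.2 q.1.2) :=
    hv.comp (measurable_snd.prodMk (measurable_snd.comp measurable_fst))
  exact (hm.indicator hms).stronglyMeasurable.integral_prod_right'.measurable

lemma EvR.ae {t1 t2 : ℝ} {A α : ℝ → E3 → ℂ} (h : EvR t1 t2 A α) :
    ∀ᵐ ξ, ∀ᵐ s ∂(volume.restrict (Set.Ioc t1 t2)), A s ξ = A t1 ξ + tint α (Set.Ioc t1 s) ξ := by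
  have hms : MeasurableSet {p : ℝ × E3 | A p.1 p.2 = A t1 p.2 + tint α (Set.Ioc t1 p.1) p.2} :=
    measurableSet_eq_fun h.am (((slice_meas h.am t1).comp measurable_snd).add (tint_meas2 h.bm t1))
  rw [Measure.ae_ae_comm (p := fun ξ s => A s ξ = A t1 ξ + tint α (Set.Ioc t1 s) ξ) (measurable_swap hms)]
  rw [ae_restrict_iff' measurableSet_Ioc]
  exact Filter.Eventually.of_forall fun s hs => h.ev s hs

lemma EvR.mul {t1 t2 : ℝ} {A α B β : ℝ → E3 → ℂ} (h : EvR t1 t2 A α) (h' : EvR t1 t2 B β) :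
    Ev t1 t2 (fun t ξ => A t ξ * B t ξ) (fun t ξ => α t ξ * B t ξ + A t ξ * β t ξ) := by
  intro t ht
  have hsub : Set.Ioc t1 t ⊆ Set.Ioc t1 t2 := Set.Ioc_subset_Ioc_right ht.2
  filter_upwards [h.ae, h'.ae, h.ev t ht, h'.ev t ht, h.int, h'.int] with ξ h1 h2 h3 h4 h5 h6
  rw [h3, h4]
  have := ac_mul (h5.mono_set hsub) (h6.mono_set hsub) (A t1 ξ) (B t1 ξ)
  rw [tint, tint, this, tint]
  congr 1
  apply integral_congr_ae
  filter_upwards [ae_restrict_of_ae_restrict_of_subset hsub h1, ae_restrict_of_ae_restrict_of_subset hsub h2] with s h7 h8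
  rw [h7, h8]; rfl

lemma ph_deriv (ξ : E3) (t : ℝ) : HasDerivAt (fun t => ph t ξ) (((4 * π ^ 2 * ‖ξ‖ ^ 2 : ℝ) : ℂ) * I * ph t ξ) t := by
  unfold ph
  have h1 : HasDerivAt (fun t : ℝ => (((4 * π ^ 2 * t * ‖ξ‖ ^ 2 : ℝ)) : ℂ) * I) (((4 * π ^ 2 * ‖ξ‖ ^ 2 : ℝ) : ℂ) * I) t := by
    have h0 : HasDerivAt (fun t : ℝ => 4 * π ^ 2 * t * ‖ξ‖ ^ 2) (4 * π ^ 2 * ‖ξ‖ ^ 2) t := by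
      have := ((hasDerivAt_id t).const_mul (4 * π ^ 2)).mul_const (‖ξ‖ ^ 2)
      simpa using this
    exact h0.ofReal_comp.mul_const I
  have := h1.cexp
  convert this using 1; ring

lemma ph_EvR (t1 t2 : ℝ) : EvR t1 t2 ph (fun t ξ => ((4 * π ^ 2 * ‖ξ‖ ^ 2 : ℝ) : ℂ) * I * ph t ξ) where
  am := ph_cont.measurable
  bm := by
    have : Continuous (fun p : ℝ × E3 => ((4 * π ^ 2 * ‖p.2‖ ^ 2 : ℝ) : ℂ) * I * ph p.1 p.2) := by
      have := ph_cont
      fun_prop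
    exact this.measurable
  int := by
    refine Filter.Eventually.of_forall fun ξ => ?_
    have : Continuous (fun s => ((4 * π ^ 2 * ‖ξ‖ ^ 2 : ℝ) : ℂ) * I * ph s ξ) := by unfold ph; fun_prop
    exact this.integrableOn_Ioc
  ev := by
    intro t ht
    refine Filter.Eventually.of_forall fun ξ => ?_
    have hc : Continuous (fun s => ((4 * π ^ 2 * ‖ξ‖ ^ 2 : ℝ) : ℂ) * I * ph s ξ) := by unfold ph; fun_prop
    have := intervalIntegral.integral_eq_sub_of_hasDerivAt (fun s _ => ph_deriv ξ s) (hc.intervalIntegrable t1 t)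
    rw [intervalIntegral.integral_of_le ht.1.le] at this
    change ph t ξ = ph t1 ξ + tint _ _ ξ
    rw [tint, this]; ring

/-- Fourier transform of a differentiable family -/
lemma fd_ev {φ χ : ℝ → E3 → ℂ} {t1 t2 : ℝ} (hd : ∀ t x, HasDerivAt (fun s => φ s x) (χ t x) t)
    (hχc : Continuous (fun p : ℝ × E3 => χ p.1 p.2))
    (h1 : ∀ t, Integrable (φ t)) (h2 : ∀ t, MemLp (φ t) 2)
    (h3 : ∀ t, Integrable (χ t)) (h4 : ∀ t, MemLp (χ t) 2)
    (hfin : ∫⁻ s in Set.Ioc t1 t2, ∫⁻ x, ‖χ s x‖ₑ ^ 2 ≠ ⊤) :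
    Ev t1 t2 (fun t => 𝓕 (φ t)) (fun t => 𝓕 (χ t)) := by
  intro t ht
  have hsub : Set.Ioc t1 t ⊆ Set.Ioc t1 t2 := Set.Ioc_subset_Ioc_right ht.2
  have hv : volume (Set.Ioc t1 t) ≠ ⊤ := by simp
  have hχm := hχc.measurable
  have hm := fourier_meas hχm
  have hfin' : ∫⁻ s in Set.Ioc t1 t, ∫⁻ x, ‖χ s x‖ₑ ^ 2 ≠ ⊤ := ne_top_of_le_ne_top hfin (lintegral_mono_set hsub)
  have hn : ∫⁻ s in Set.Ioc t1 t, n2 (χ s) ≠ ⊤ := by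
    have := lint_sq_le (volume.restrict (Set.Ioc t1 t)) (n2_meas hχm).aemeasurable
    simp only [n2_sq] at this
    rw [Measure.restrict_apply_univ] at this
    have h5 := this.trans_lt (ENNReal.mul_lt_top hv.lt_top hfin'.lt_top)
    intro h; rw [h] at h5; simp at h5
  have hnF : ∀ s, n2 (𝓕 (χ s)) = n2 (χ s) := fun s => by rw [n2_eq, n2_eq, eLpNorm_fourier (h3 s) (h4 s)]
  have hn' : ∫⁻ s in Set.Ioc t1 t, n2 (𝓕 (χ s)) ≠ ⊤ := by simpa only [hnF] using hn
  have hT2 : MemLp (tint (fun s => 𝓕 (χ s)) (Set.Ioc t1 t)) 2 := by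
    refine tint_memLp hm hv ?_
    simp only [← n2_sq, hnF]; simpa only [n2_sq] using hfin'
  have hR : MemLp (fun ξ => 𝓕 (φ t1) ξ + tint (fun s => 𝓕 (χ s)) (Set.Ioc t1 t) ξ) 2 :=
    (fourier_memLp (h1 t1) (h2 t1)).add hT2
  apply ae_eq_of_integral_contDiff_smul_eq
  · exact (fourier_continuous (h1 t)).locallyIntegrable
  · exact hR.locallyIntegrable (by norm_num)
  intro ψ hψ hψc
  have hψC : Continuous (fun ξ => (ψ ξ : ℂ)) := by have := hψ.continuous; fun_prop
  have hψcs : HasCompactSupport (fun ξ => (ψ ξ : ℂ)) := hψc.comp_left (g := fun r : ℝ => (r : ℂ)) (by simp)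
  have hψi : Integrable (fun ξ => (ψ ξ : ℂ)) := hψC.integrable_of_hasCompactSupport hψcs
  have hψ2 : MemLp (fun ξ => (ψ ξ : ℂ)) 2 := hψC.memLp_of_hasCompactSupport hψcs
  set Ψ : E3 → ℂ := fun x => (starRingEnd ℂ) (𝓕 (fun ξ => (ψ ξ : ℂ)) x) with hΨ
  have hΨ2 : MemLp Ψ 2 := by
    refine (fourier_memLp hψi hψ2).of_le ?_ (Filter.Eventually.of_forall fun x => by simp [Ψ])
    exact Complex.continuous_conj.comp_aestronglyMeasurable (fourier_memLp hψi hψ2).1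
  have hbr : ∀ G : E3 → ℂ, Integrable G → br (fun ξ => (ψ ξ : ℂ)) (𝓕 G) = br Ψ G := by
    intro G hG
    unfold br
    simp only [Ψ, Complex.conj_conj, Complex.conj_ofReal]
    rw [fourier_selfadj hψi hG]
  have hsm : ∀ G : E3 → ℂ, ∫ ξ, ψ ξ • G ξ = br (fun ξ => (ψ ξ : ℂ)) G := by
    intro G; unfold br; congr 1; ext ξ; simp
  have hadd : ∀ {P G H : E3 → ℂ}, MemLp P 2 → MemLp G 2 → MemLp H 2 → br P (fun x => G x + H x) = br P G + br P H := by
    intro P G H hP hG hH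
    unfold br
    rw [← integral_add (br_integrable hP hG) (br_integrable hP hH)]
    congr 1; ext x; ring
  rw [hsm, hsm, hadd hψ2 (fourier_memLp (h1 t1) (h2 t1)) hT2, hbr _ (h1 t), hbr _ (h1 t1), br_tint_eq' hm hn' hψ2]
  simp only [hbr _ (h3 _)]
  rw [← br_tint_eq' hχm hn hΨ2, ← hadd hΨ2 (h2 t1) (tint_memLp hχm hv hfin')]
  congr 1; ext x
  have hc : Continuous (fun s => χ s x) := hχc.comp (continuous_id.prodMk continuous_const)
  have := intervalIntegral.integral_eq_sub_of_hasDerivAt (fun s _ => hd s x) (hc.intervalIntegrable t1 t)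
  rw [intervalIntegral.integral_of_le ht.1.le] at this
  rw [tint, this]; ring

/-- `g` is a Schwartz function -/
def Sch (g : E3 → ℂ) : Prop := ∃ S : SchwartzMap E3 ℂ, ∀ x, g x = S x

lemma Sch.eq {g : E3 → ℂ} (h : Sch g) : ∃ S : SchwartzMap E3 ℂ, g = S := by
  obtain ⟨S, hS⟩ := h; exact ⟨S, funext hS⟩

lemma Sch.integrable {g : E3 → ℂ} (h : Sch g) : Integrable g := by
  obtain ⟨S, rfl⟩ := h.eq; exact S.integrable

lemma Sch.memLp {g : E3 → ℂ} (h : Sch g) (p : ℝ≥0∞) : MemLp g p := by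
  obtain ⟨S, rfl⟩ := h.eq; exact S.memLp p

lemma Sch.add {g k : E3 → ℂ} (h : Sch g) (h' : Sch k) : Sch (fun x => g x + k x) := by
  obtain ⟨S, rfl⟩ := h.eq; obtain ⟨S', rfl⟩ := h'.eq; exact ⟨S + S', fun x => rfl⟩

lemma Sch.sub {g k : E3 → ℂ} (h : Sch g) (h' : Sch k) : Sch (fun x => g x - k x) := by
  obtain ⟨S, rfl⟩ := h.eq; obtain ⟨S', rfl⟩ := h'.eq; exact ⟨S - S', fun x => rfl⟩

lemma Sch.const_mul {g : E3 → ℂ} (c : ℂ) (h : Sch g) : Sch (fun x => c * g x) := by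
  obtain ⟨S, rfl⟩ := h.eq; exact ⟨c • S, fun x => rfl⟩

lemma Sch.mul {g k : E3 → ℂ} (h : Sch g) (h' : Sch k) : Sch (fun x => g x * k x) := by
  obtain ⟨S, rfl⟩ := h.eq; obtain ⟨S', rfl⟩ := h'.eq
  exact ⟨SchwartzMap.pairing (ContinuousLinearMap.mul ℂ ℂ) S S', fun x => rfl⟩

lemma Sch.conj {g : E3 → ℂ} (h : Sch g) : Sch (fun x => (starRingEnd ℂ) (g x)) := by
  obtain ⟨S, rfl⟩ := h.eq
  exact ⟨SchwartzMap.postcompCLM (𝕜 := ℝ) (Complex.conjCLE : ℂ →L[ℝ] ℂ) S, fun x => rfl⟩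

lemma Sch.trans {g : E3 → ℂ} (h : Sch g) (y : E3) : Sch (fun x => g (x + y)) := by
  obtain ⟨S, rfl⟩ := h.eq
  exact ⟨SchwartzMap.compSubConstCLM ℂ (-y) S, fun x => by simp⟩

lemma Sch.pd {g : E3 → ℂ} (h : Sch g) (j : Fin 3) : Sch (pd g j) := by
  obtain ⟨S, rfl⟩ := h.eq
  exact ⟨LineDeriv.lineDerivOp (e3 j) S, fun x => (SchwartzMap.lineDerivOp_apply_eq_fderiv (e3 j) S x).symm⟩

lemma Sch.fourier {g : E3 → ℂ} (h : Sch g) : Sch (𝓕 g) := by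
  obtain ⟨S, rfl⟩ := h.eq; exact ⟨𝓕 S, fun x => rfl⟩

lemma Sch.fourierInv {g : E3 → ℂ} (h : Sch g) : Sch (𝓕⁻ g) := by
  obtain ⟨S, rfl⟩ := h.eq
  exact ⟨𝓕⁻ S, fun x => by rw [SchwartzMap.fourierInv_coe]⟩

lemma Sch.fourierInv_fourier {g : E3 → ℂ} (h : Sch g) : 𝓕⁻ (𝓕 g) = g := by
  obtain ⟨S, rfl⟩ := h.eq
  rw [← SchwartzMap.fourier_coe, ← SchwartzMap.fourierInv_coe, FourierTransform.fourierInv_fourier_eq]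

lemma Sch.contDiff {g : E3 → ℂ} (h : Sch g) : ContDiff ℝ ∞ g := by
  obtain ⟨S, rfl⟩ := h.eq; exact S.smooth'

lemma inner_e3 (ξ : E3) (j : Fin 3) : inner ℝ ξ (e3 j) = ξ j := by
  rw [e3, EuclideanSpace.inner_single_right]; simp

lemma Sch.fourier_pd {g : E3 → ℂ} (h : Sch g) (j : Fin 3) (ξ : E3) :
    𝓕 (_root_.pd g j) ξ = 2 * π * I * (ξ j : ℂ) * 𝓕 g ξ := by
  obtain ⟨S, rfl⟩ := h.eq
  have h1 : _root_.pd S j = (LineDeriv.lineDerivOp (e3 j) S : SchwartzMap E3 ℂ) := by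
    ext x; exact (SchwartzMap.lineDerivOp_apply_eq_fderiv (e3 j) S x).symm
  rw [h1, ← SchwartzMap.fourier_coe, SchwartzMap.fourier_lineDerivOp_eq]
  have h2 : (fun x : E3 => inner ℝ x (e3 j)).HasTemperateGrowth := by fun_prop
  rw [IsSMulApply.smul_apply, SchwartzMap.smulLeftCLM_apply_apply h2, inner_e3, smul_eq_mul, Complex.real_smul]
  rw [← SchwartzMap.fourier_coe]
  ring

lemma Sch.lap {g : E3 → ℂ} (h : Sch g) : Sch (lap g) := by
  have : _root_.lap g = fun x => _root_.pd (_root_.pd g 0) 0 x + _root_.pd (_root_.pd g 1) 1 x + _root_.pd (_root_.pd g 2) 2 x := by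
    ext x; simp only [_root_.lap, Fin.sum_univ_three]; rfl
  rw [this]
  exact (((h.pd 0).pd 0).add ((h.pd 1).pd 1)).add ((h.pd 2).pd 2)

lemma norm_sq_e3 (ξ : E3) : ‖ξ‖ ^ 2 = ξ 0 ^ 2 + ξ 1 ^ 2 + ξ 2 ^ 2 := by
  rw [EuclideanSpace.norm_sq_eq]; simp [Fin.sum_univ_three]

lemma Sch.fourier_lap {g : E3 → ℂ} (h : Sch g) (ξ : E3) :
    𝓕 (_root_.lap g) ξ = - ((4 * π ^ 2 * ‖ξ‖ ^ 2 : ℝ) : ℂ) * 𝓕 g ξ := by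
  have h0 : _root_.lap g = (_root_.pd (_root_.pd g 0) 0 + _root_.pd (_root_.pd g 1) 1) + _root_.pd (_root_.pd g 2) 2 := by
    ext x; simp only [_root_.lap, Fin.sum_univ_three]; rfl
  have i := fun j => ((h.pd j).pd j).integrable
  have hadd : ∀ f k : E3 → ℂ, Integrable f → Integrable k → 𝓕 (f + k) ξ = 𝓕 f ξ + 𝓕 k ξ := by
    intro f k hf hk
    rw [Real.fourier_eq, Real.fourier_eq, Real.fourier_eq, ← integral_add]
    · simp
    · exact (Real.fourierIntegral_convergent_iff ξ).2 hf
    · exact (Real.fourierIntegral_convergent_iff ξ).2 hk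
  rw [h0, hadd _ _ ((i 0).add (i 1)) (i 2), hadd _ _ (i 0) (i 1), (h.pd 0).fourier_pd, (h.pd 1).fourier_pd, (h.pd 2).fourier_pd,
    h.fourier_pd, h.fourier_pd, h.fourier_pd, norm_sq_e3]
  push_cast
  linear_combination (4 * π ^ 2 * 𝓕 g ξ * ((ξ 0:ℂ)^2 + (ξ 1:ℂ)^2 + (ξ 2:ℂ)^2)) * Complex.I_sq

lemma fadd' {f k : E3 → ℂ} (hf : Integrable f) (hk : Integrable k) (ξ : E3) :
    𝓕 (fun x => f x + k x) ξ = 𝓕 f ξ + 𝓕 k ξ := by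
  rw [Real.fourier_eq, Real.fourier_eq, Real.fourier_eq, ← integral_add]
  · simp
  · exact (Real.fourierIntegral_convergent_iff ξ).2 hf
  · exact (Real.fourierIntegral_convergent_iff ξ).2 hk

lemma fcmul' (c : ℂ) (f : E3 → ℂ) (ξ : E3) :
    𝓕 (fun x => c * f x) ξ = c * 𝓕 f ξ := by
  rw [Real.fourier_eq, Real.fourier_eq, ← integral_const_mul]
  congr 1; ext x; rw [Circle.smul_def, Circle.smul_def]; simp only [smul_eq_mul]; ring

lemma fsub' {f k : E3 → ℂ} (hf : Integrable f) (hk : Integrable k) (ξ : E3) :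
    𝓕 (fun x => f x - k x) ξ = 𝓕 f ξ - 𝓕 k ξ := by
  have := fadd' hf (hk.const_mul (-1)) ξ
  rw [fcmul'] at this
  rw [show (fun x => f x - k x) = fun x => f x + -1 * k x by ext x; ring, this]; ring

/-- the cubic nonlinearity -/
def cub (g : E3 → ℂ) : E3 → ℂ := fun x => ((‖g x‖ ^ 2 : ℝ) : ℂ) * g x

lemma Sch.cub {g : E3 → ℂ} (h : Sch g) : Sch (cub g) := by
  have : _root_.cub g = fun x => g x * (starRingEnd ℂ) (g x) * g x := by
    ext x; rw [_root_.cub, Complex.mul_conj, Complex.normSq_eq_norm_sq]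
  rw [this]; exact (h.mul h.conj).mul h

/-- time derivative -/
def dt (φ : ℝ → E3 → ℂ) (t : ℝ) : E3 → ℂ := fun x => deriv (fun s => φ s x) t

/-- solutions of cubic NLS -/
structure Sol (t1 t2 : ℝ) (φ : ℝ → E3 → ℂ) : Prop where
  sm : ContDiff ℝ ∞ (fun p : ℝ × E3 => φ p.1 p.2)
  sch : ∀ t, Sch (φ t)
  schd : ∀ t, Sch (dt φ t)
  eqn : ∀ t ∈ Set.Icc t1 t2, ∀ x, I * dt φ t x + lap (φ t) x = cub (φ t) x

lemma IsSolution.sol {T : ℝ} {φ : ℝ → E3 → ℂ} (h : IsSolution 1 1 (fun z => z) T φ) : Sol 0 T φ where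
  sm := h.smooth
  sch := fun t => by simpa [Sch, dt] using h.schwartz 0 t
  schd := fun t => by simpa [Sch, dt] using h.schwartz 1 t
  eqn := fun t ht x => by
    have := h.eqn t ht x
    rw [Complex.normSq_eq_norm_sq] at this
    simpa [cub, dt] using this

lemma l2_int {v : ℝ → E3 → ℂ} (hm : Measurable (fun p : ℝ × E3 => v p.1 p.2)) {t1 t2 : ℝ}
    (hfin : ∫⁻ s in Set.Ioc t1 t2, ∫⁻ x, ‖v s x‖ₑ ^ 2 ≠ ⊤) :
    ∀ᵐ ξ, IntegrableOn (fun s => v s ξ) (Set.Ioc t1 t2) := by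
  have hmm : Measurable (fun p : E3 × ℝ => ‖v p.2 p.1‖ₑ ^ 2) := (hm.comp measurable_swap).enorm.pow_const 2
  have h1 : ∫⁻ ξ, ∫⁻ s in Set.Ioc t1 t2, ‖v s ξ‖ₑ ^ 2 ≠ ⊤ := by
    rw [lintegral_lintegral_swap hmm.aemeasurable]
    exact hfin
  have h2 := ae_lt_top' (hmm.lintegral_prod_right' (ν := volume.restrict (Set.Ioc t1 t2))).aemeasurable h1
  filter_upwards [h2] with ξ hξ
  have hmξ : Measurable (fun s => v s ξ) := hm.comp (measurable_id.prodMk measurable_const)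
  have hL : MemLp (fun s => v s ξ) 2 (volume.restrict (Set.Ioc t1 t2)) := by
    rw [memLp_two_iff_integrable_sq_norm hmξ.aestronglyMeasurable]
    refine ⟨(hmξ.norm.pow_const 2).aestronglyMeasurable, ?_⟩
    rw [hasFiniteIntegral_iff_enorm]
    simpa [enorm_pow] using hξ
  exact hL.integrable (by norm_num)

namespace Sol
variable {t1 t2 : ℝ} {φ : ℝ → E3 → ℂ}

lemma cont (h : Sol t1 t2 φ) : Continuous (fun p : ℝ × E3 => φ p.1 p.2) := h.sm.continuous

lemma meas (h : Sol t1 t2 φ) : Measurable (fun p : ℝ × E3 => φ p.1 p.2) := h.cont.measurable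

lemma hd (h : Sol t1 t2 φ) (t : ℝ) (x : E3) : HasDerivAt (fun s => φ s x) (dt φ t x) t := by
  have : ContDiff ℝ ∞ (fun s : ℝ => φ s x) := h.sm.comp (contDiff_id.prodMk contDiff_const)
  exact (this.differentiable (by norm_num) t).hasDerivAt

lemma dt_eq (h : Sol t1 t2 φ) (t : ℝ) (x : E3) :
    dt φ t x = fderiv ℝ (fun p : ℝ × E3 => φ p.1 p.2) (t, x) (1, 0) := by
  have h1 : HasFDerivAt (fun p : ℝ × E3 => φ p.1 p.2) (fderiv ℝ (fun p : ℝ × E3 => φ p.1 p.2) (t, x)) (t, x) :=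
    (h.sm.differentiable (by norm_num) _).hasFDerivAt
  have h2 : HasDerivAt (fun s : ℝ => (s, x)) ((1 : ℝ), (0 : E3)) t := (hasDerivAt_id t).prodMk (hasDerivAt_const t x)
  exact (HasFDerivAt.comp_hasDerivAt t h1 h2).deriv

lemma dt_cont (h : Sol t1 t2 φ) : Continuous (fun p : ℝ × E3 => dt φ p.1 p.2) := by
  have h1 : Continuous (fderiv ℝ (fun p : ℝ × E3 => φ p.1 p.2)) := h.sm.continuous_fderiv (by norm_num)
  have : (fun p : ℝ × E3 => dt φ p.1 p.2) = fun p => fderiv ℝ (fun p : ℝ × E3 => φ p.1 p.2) p (1, 0) := by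
    ext p; exact h.dt_eq p.1 p.2
  rw [this]; exact h1.clm_apply continuous_const

lemma dt_meas (h : Sol t1 t2 φ) : Measurable (fun p : ℝ × E3 => dt φ p.1 p.2) := h.dt_cont.measurable

lemma pd_eq (h : Sol t1 t2 φ) (t : ℝ) (j : Fin 3) (x : E3) :
    pd (φ t) j x = fderiv ℝ (fun p : ℝ × E3 => φ p.1 p.2) (t, x) (0, e3 j) := by
  have h1 : HasFDerivAt (fun p : ℝ × E3 => φ p.1 p.2) (fderiv ℝ (fun p : ℝ × E3 => φ p.1 p.2) (t, x)) (t, x) :=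
    (h.sm.differentiable (by norm_num) _).hasFDerivAt
  have h2 : HasFDerivAt (fun y : E3 => (t, y)) (ContinuousLinearMap.inr ℝ ℝ E3) x := hasFDerivAt_prodMk_right t x
  have h3 := (HasFDerivAt.comp x h1 h2).fderiv
  have h4 : ((fun p : ℝ × E3 => φ p.1 p.2) ∘ fun y : E3 => (t, y)) = φ t := rfl
  rw [h4] at h3
  rw [pd, h3]; simp

lemma pd_cont (h : Sol t1 t2 φ) (j : Fin 3) : Continuous (fun p : ℝ × E3 => pd (φ p.1) j p.2) := by
  have h1 : Continuous (fderiv ℝ (fun p : ℝ × E3 => φ p.1 p.2)) := h.sm.continuous_fderiv (by norm_num)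
  have : (fun p : ℝ × E3 => pd (φ p.1) j p.2) = fun p => fderiv ℝ (fun p : ℝ × E3 => φ p.1 p.2) p (0, e3 j) := by
    ext p; exact h.pd_eq p.1 j p.2
  rw [this]; exact h1.clm_apply continuous_const

lemma cub_cont (h : Sol t1 t2 φ) : Continuous (fun p : ℝ × E3 => cub (φ p.1) p.2) := by
  have := h.cont
  unfold cub; fun_prop

lemma cub_meas (h : Sol t1 t2 φ) : Measurable (fun p : ℝ × E3 => cub (φ p.1) p.2) := h.cub_cont.measurable

lemma fourier_dt (h : Sol t1 t2 φ) {t : ℝ} (ht : t ∈ Set.Icc t1 t2) (ξ : E3) :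
    𝓕 (dt φ t) ξ = - (((4 * π ^ 2 * ‖ξ‖ ^ 2 : ℝ) : ℂ) * I) * 𝓕 (φ t) ξ - I * 𝓕 (cub (φ t)) ξ := by
  have : dt φ t = fun x => I * lap (φ t) x - I * cub (φ t) x := by
    ext x; have := h.eqn t ht x
    linear_combination -I * this + dt φ t x * Complex.I_sq
  rw [this, fsub' ((h.sch t).lap.const_mul I).integrable ((h.sch t).cub.const_mul I).integrable,
    fcmul', fcmul', (h.sch t).fourier_lap]
  ring

lemma mono (h : Sol t1 t2 φ) {a b : ℝ} (ha : t1 ≤ a) (hb : b ≤ t2) : Sol a b φ :=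
  ⟨h.sm, h.sch, h.schd, fun t ht => h.eqn t ⟨ha.trans ht.1, ht.2.trans hb⟩⟩

lemma ev_int (h : Sol t1 t2 φ) (hfin : ∫⁻ s in Set.Ioc t1 t2, ∫⁻ x, ‖dt φ s x‖ₑ ^ 2 ≠ ⊤) :
    ∀ᵐ ξ, IntegrableOn (fun s => 𝓕 (dt φ s) ξ) (Set.Ioc t1 t2) := by
  refine l2_int (v := fun t => 𝓕 (dt φ t)) (fourier_meas h.dt_meas) ?_
  have : ∀ s, ∫⁻ x, ‖𝓕 (dt φ s) x‖ₑ ^ 2 = ∫⁻ x, ‖dt φ s x‖ₑ ^ 2 := fun s => by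
    rw [← n2_sq, ← n2_sq, n2_eq, n2_eq, eLpNorm_fourier (h.schd s).integrable ((h.schd s).memLp 2)]
  simpa only [this] using hfin

lemma ev (h : Sol t1 t2 φ) (hfin : ∫⁻ s in Set.Ioc t1 t2, ∫⁻ x, ‖dt φ s x‖ₑ ^ 2 ≠ ⊤) :
    EvR t1 t2 (fun t => 𝓕 (φ t)) (fun t => 𝓕 (dt φ t)) :=
  ⟨fourier_meas h.meas, fourier_meas h.dt_meas, h.ev_int hfin,
   fd_ev h.hd h.dt_cont (fun t => (h.sch t).integrable) (fun t => (h.sch t).memLp 2)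
    (fun t => (h.schd t).integrable) (fun t => (h.schd t).memLp 2) hfin⟩

/-- Duhamel -/
lemma duh (h : Sol t1 t2 φ) (hfin : ∫⁻ s in Set.Ioc t1 t2, ∫⁻ x, ‖dt φ s x‖ₑ ^ 2 ≠ ⊤) {t : ℝ} (ht : t ∈ Set.Ioc t1 t2) :
    (fun ξ => ph t ξ * 𝓕 (φ t) ξ) =ᵐ[volume] fun ξ => ph t1 ξ * 𝓕 (φ t1) ξ
      - I * tint (fun s ξ => ph s ξ * 𝓕 (cub (φ s)) ξ) (Set.Ioc t1 t) ξ := by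
  filter_upwards [(ph_EvR t1 t2).mul (h.ev hfin) t ht] with ξ hξ
  rw [hξ, tint, tint, sub_eq_add_neg, ← integral_const_mul, ← integral_neg]
  congr 1
  refine setIntegral_congr_fun measurableSet_Ioc fun s hs => ?_
  simp only [h.fourier_dt ⟨hs.1.le, hs.2.trans ht.2⟩ ξ]
  ring

end Sol

/-- the `L⁶` norm -/
def n6 (g : E3 → ℂ) : ℝ≥0∞ := Bt g ^ (1/6:ℝ)

lemma n6_pow6 (g : E3 → ℂ) : n6 g ^ 6 = Bt g := by
  rw [n6, ← ENNReal.rpow_natCast, ← ENNReal.rpow_mul]; norm_num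

lemma n6_sq (g : E3 → ℂ) : Bt g ^ (1/3:ℝ) = n6 g ^ 2 := by
  rw [n6, ← ENNReal.rpow_natCast, ← ENNReal.rpow_mul]; norm_num

lemma n6_four (g : E3 → ℂ) : Bt g ^ (2/3:ℝ) = n6 g ^ 4 := by
  rw [n6, ← ENNReal.rpow_natCast, ← ENNReal.rpow_mul]; norm_num

lemma n6_eq (g : E3 → ℂ) : n6 g = eLpNorm g 6 volume := by
  rw [eLpNorm_eq_lintegral_rpow_enorm_toReal (by norm_num) (by norm_num), n6, Bt]
  norm_num

lemma n6_meas {v : ℝ → E3 → ℂ} (hv : Measurable (fun p : ℝ × E3 => v p.1 p.2)) :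
    Measurable (fun s => n6 (v s)) := (meas_Bt hv).pow_const _

lemma n6_sub_le {g h : E3 → ℂ} (hg : AEStronglyMeasurable g volume) (hh : AEStronglyMeasurable h volume) :
    n6 (fun ξ => g ξ - h ξ) ≤ n6 g + n6 h := by
  rw [n6_eq, n6_eq, n6_eq]; exact eLpNorm_sub_le hg hh (by norm_num)

lemma n6_add_le {g h : E3 → ℂ} (hg : AEStronglyMeasurable g volume) (hh : AEStronglyMeasurable h volume) :
    n6 (fun ξ => g ξ + h ξ) ≤ n6 g + n6 h := by
  rw [n6_eq, n6_eq, n6_eq]; exact eLpNorm_add_le hg hh (by norm_num)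

lemma holder42 {g h : E3 → ℂ} (hg : AEMeasurable g volume) (hh : AEMeasurable h volume) :
    ∫⁻ x, ‖g x‖ₑ ^ 4 * ‖h x‖ₑ ^ 2 ≤ n6 g ^ 4 * n6 h ^ 2 := by
  have := ENNReal.lintegral_mul_le_Lp_mul_Lq volume (p := 3/2) (q := 3) (by constructor <;> norm_num)
    (f := fun x => ‖g x‖ₑ ^ 4) (g := fun x => ‖h x‖ₑ ^ 2) (hg.enorm.pow_const 4) (hh.enorm.pow_const 2)
  refine this.trans (le_of_eq ?_)
  have e1 : ∀ x, (‖g x‖ₑ ^ 4) ^ (3/2:ℝ) = ‖g x‖ₑ ^ 6 := fun x => by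
    rw [← ENNReal.rpow_natCast, ← ENNReal.rpow_natCast, ← ENNReal.rpow_mul]; norm_num
  have e2 : ∀ x, (‖h x‖ₑ ^ 2) ^ (3:ℝ) = ‖h x‖ₑ ^ 6 := fun x => by
    rw [← ENNReal.rpow_natCast, ← ENNReal.rpow_natCast, ← ENNReal.rpow_mul]; norm_num
  simp only [e1, e2]
  rw [← n6_four, ← n6_sq]; norm_num [Bt]

lemma cub_diff (a b : ℂ) : ‖((‖a‖ ^ 2 : ℝ) : ℂ) * a - ((‖b‖ ^ 2 : ℝ) : ℂ) * b‖ ≤ 2 * (‖a‖ ^ 2 + ‖b‖ ^ 2) * ‖a - b‖ := by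
  have h1 : ((‖a‖ ^ 2 : ℝ) : ℂ) * a - ((‖b‖ ^ 2 : ℝ) : ℂ) * b = ((‖a‖ ^ 2 : ℝ) : ℂ) * (a - b) + ((‖a‖ ^ 2 - ‖b‖ ^ 2 : ℝ) : ℂ) * b := by
    push_cast; ring
  rw [h1]
  refine (norm_add_le _ _).trans ?_
  rw [norm_mul, norm_mul, Complex.norm_real, Complex.norm_real, Real.norm_eq_abs, Real.norm_eq_abs, abs_of_nonneg (by positivity : 0 ≤ ‖a‖ ^ 2)]
  have h2 : |‖a‖ ^ 2 - ‖b‖ ^ 2| ≤ ‖a - b‖ * (‖a‖ + ‖b‖) := by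
    rw [show ‖a‖ ^ 2 - ‖b‖ ^ 2 = (‖a‖ - ‖b‖) * (‖a‖ + ‖b‖) by ring, abs_mul, abs_of_nonneg (by positivity : 0 ≤ ‖a‖ + ‖b‖)]
    gcongr; exact abs_norm_sub_norm_le a b
  have h3 := mul_le_mul_of_nonneg_right h2 (norm_nonneg b)
  have h4 : 0 ≤ ‖a - b‖ * ((‖a‖ - ‖b‖) ^ 2 + ‖a‖ ^ 2) := by positivity
  nlinarith [norm_nonneg (a - b), mul_nonneg (norm_nonneg (a-b)) (sq_nonneg (‖b‖))]

lemma enorm_cub_diff (a b : ℂ) : ‖((‖a‖ ^ 2 : ℝ) : ℂ) * a - ((‖b‖ ^ 2 : ℝ) : ℂ) * b‖ₑ ≤ 2 * (‖a‖ₑ ^ 2 + ‖b‖ₑ ^ 2) * ‖a - b‖ₑ := by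
  have := ENNReal.ofReal_le_ofReal (cub_diff a b)
  rwa [ofReal_norm, ENNReal.ofReal_mul (by positivity), ENNReal.ofReal_mul (by norm_num), ENNReal.ofReal_add (by positivity) (by positivity),
    ENNReal.ofReal_pow (norm_nonneg _), ENNReal.ofReal_pow (norm_nonneg _), ofReal_norm, ofReal_norm, ofReal_norm, ENNReal.ofReal_ofNat] at this

lemma n2_cub_diff {g h : E3 → ℂ} (hg : Measurable g) (hh : Measurable h) :
    n2 (fun x => cub g x - cub h x) ≤ 3 * (n6 g ^ 2 + n6 h ^ 2) * n6 (fun x => g x - h x) := by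
  rw [← ENNReal.pow_le_pow_left_iff two_ne_zero, n2_sq]
  have hw : Measurable (fun x => g x - h x) := hg.sub hh
  calc ∫⁻ x, ‖cub g x - cub h x‖ₑ ^ 2 ≤ ∫⁻ x, (8 * (‖g x‖ₑ ^ 4 * ‖g x - h x‖ₑ ^ 2) + 8 * (‖h x‖ₑ ^ 4 * ‖g x - h x‖ₑ ^ 2)) := by
        refine lintegral_mono fun x => ?_
        have h1 := (ENNReal.pow_le_pow_left_iff two_ne_zero).2 (enorm_cub_diff (g x) (h x))
        refine h1.trans ?_
        rw [mul_pow, mul_pow]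
        have h2 := sq_add_le' (‖g x‖ₑ ^ 2) (‖h x‖ₑ ^ 2)
        calc 2 ^ 2 * (‖g x‖ₑ ^ 2 + ‖h x‖ₑ ^ 2) ^ 2 * ‖g x - h x‖ₑ ^ 2 ≤ 2 ^ 2 * (2 * ((‖g x‖ₑ ^ 2) ^ 2 + (‖h x‖ₑ ^ 2) ^ 2)) * ‖g x - h x‖ₑ ^ 2 := by gcongr
          _ = _ := by ring
    _ = 8 * (∫⁻ x, ‖g x‖ₑ ^ 4 * ‖g x - h x‖ₑ ^ 2) + 8 * ∫⁻ x, ‖h x‖ₑ ^ 4 * ‖g x - h x‖ₑ ^ 2 := by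
        rw [lintegral_add_left (by fun_prop), lintegral_const_mul _ (by fun_prop), lintegral_const_mul _ (by fun_prop)]
    _ ≤ 8 * (n6 g ^ 4 * n6 (fun x => g x - h x) ^ 2) + 8 * (n6 h ^ 4 * n6 (fun x => g x - h x) ^ 2) := by
        gcongr
        · exact holder42 hg.aemeasurable hw.aemeasurable
        · exact holder42 hh.aemeasurable hw.aemeasurable
    _ ≤ 9 * (n6 g ^ 4 + n6 h ^ 4) * n6 (fun x => g x - h x) ^ 2 := by
        rw [← mul_add, ← add_mul, mul_assoc]; gcongr; norm_num
    _ ≤ _ := by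
        rw [mul_pow, mul_pow]; gcongr
        · norm_num
        · rw [add_sq, ← pow_mul, ← pow_mul]
          calc n6 g ^ 4 + n6 h ^ 4 ≤ (n6 g ^ 4 + n6 h ^ 4) + 2 * n6 g ^ 2 * n6 h ^ 2 := le_self_add
            _ = _ := by ring

lemma duh_gen {w χ gh : ℝ → E3 → ℂ} {t1 t2 : ℝ} (hd : ∀ t x, HasDerivAt (fun s => w s x) (χ t x) t)
    (hw : Measurable (fun p : ℝ × E3 => w p.1 p.2))
    (hχc : Continuous (fun p : ℝ × E3 => χ p.1 p.2)) (h1 : ∀ t, Sch (w t)) (h2 : ∀ t, Sch (χ t))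
    (hfin : ∫⁻ s in Set.Ioc t1 t2, ∫⁻ x, ‖χ s x‖ₑ ^ 2 ≠ ⊤)
    (heq : ∀ t ∈ Set.Icc t1 t2, ∀ ξ, 𝓕 (χ t) ξ = - (((4 * π ^ 2 * ‖ξ‖ ^ 2 : ℝ) : ℂ) * I) * 𝓕 (w t) ξ - I * gh t ξ)
    {t : ℝ} (ht : t ∈ Set.Ioc t1 t2) :
    (fun ξ => ph t ξ * 𝓕 (w t) ξ) =ᵐ[volume] fun ξ => ph t1 ξ * 𝓕 (w t1) ξ
      - I * tint (fun s ξ => ph s ξ * gh s ξ) (Set.Ioc t1 t) ξ := by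
  have hi : ∀ᵐ ξ, IntegrableOn (fun s => 𝓕 (χ s) ξ) (Set.Ioc t1 t2) := by
    refine l2_int (v := fun t => 𝓕 (χ t)) (fourier_meas hχc.measurable) ?_
    have : ∀ s, ∫⁻ x, ‖𝓕 (χ s) x‖ₑ ^ 2 = ∫⁻ x, ‖χ s x‖ₑ ^ 2 := fun s => by
      rw [← n2_sq, ← n2_sq, n2_eq, n2_eq, eLpNorm_fourier (h2 s).integrable ((h2 s).memLp 2)]
    simpa only [this] using hfin
  have hev : EvR t1 t2 (fun t => 𝓕 (w t)) (fun t => 𝓕 (χ t)) :=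
    ⟨fourier_meas hw, fourier_meas hχc.measurable, hi,
      fd_ev hd hχc (fun t => (h1 t).integrable) (fun t => (h1 t).memLp 2)
        (fun t => (h2 t).integrable) (fun t => (h2 t).memLp 2) hfin⟩
  filter_upwards [(ph_EvR t1 t2).mul hev t ht] with ξ hξ
  rw [hξ, tint, tint, sub_eq_add_neg, ← integral_const_mul, ← integral_neg]
  congr 1
  refine setIntegral_congr_fun measurableSet_Ioc fun s hs => ?_
  simp only [heq s ⟨hs.1.le, hs.2.trans ht.2⟩ ξ]
  ring

/-- small constants -/
def CS : ℝ≥0∞ := CB ^ (1/2:ℝ)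
/-- small constants -/
def e2 : ℝ≥0∞ := (12 * CS)⁻¹

lemma CS_ne_top : CS ≠ ⊤ := ENNReal.rpow_ne_top_of_nonneg (by norm_num) CB_ne_top
lemma CS_ne_zero : CS ≠ 0 := by
  unfold CS; simp [CB_ne_zero, CB_ne_top]
lemma CS_sq : CS ^ 2 = CB := by
  rw [CS, ← ENNReal.rpow_natCast, ← ENNReal.rpow_mul]; norm_num
lemma e2_ne_zero : e2 ≠ 0 := by
  unfold e2; exact ENNReal.inv_ne_zero.2 (ENNReal.mul_ne_top (by norm_num) CS_ne_top)
lemma e2_ne_top : e2 ≠ ⊤ := by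
  unfold e2; exact ENNReal.inv_ne_top.2 (mul_ne_zero (by norm_num) CS_ne_zero)
lemma e2_mul : 6 * e2 * CS = 1/2 := by
  have h1 : (12 * CS) * e2 = 1 := ENNReal.mul_inv_cancel (mul_ne_zero (by norm_num) CS_ne_zero) (ENNReal.mul_ne_top (by norm_num) CS_ne_top)
  have h2 : 2 * (6 * e2 * CS) = 1 := by rw [← h1]; ring
  rw [ENNReal.eq_div_iff (by norm_num) (by norm_num), h2]

lemma absorb2 {x a : ℝ≥0∞} (hx : x ≠ ⊤) (h : x ≤ a + 1/2 * x) : x ≤ 2 * a := by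
  by_cases ha : a = ⊤
  · rw [ha]; simp
  lift x to NNReal using hx
  lift a to NNReal using ha
  rw [show (1/2 : ℝ≥0∞) = ((1/2 : NNReal) : ℝ≥0∞) by norm_num] at h
  norm_cast at h ⊢
  have h' : (x:ℝ) ≤ a + 1/2 * x := by exact_mod_cast h
  have : (x:ℝ) ≤ 2 * a := by linarith
  exact_mod_cast this

theorem lemmaD {φ ψ : ℝ → E3 → ℂ} {t1 t2 : ℝ} (hφ : Sol t1 t2 φ) (hψ : Sol t1 t2 ψ)
    (fφ : ∫⁻ s in Set.Ioc t1 t2, ∫⁻ x, ‖dt φ s x‖ₑ ^ 2 ≠ ⊤)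
    (fψ : ∫⁻ s in Set.Ioc t1 t2, ∫⁻ x, ‖dt ψ s x‖ₑ ^ 2 ≠ ⊤)
    (Qφ : ∫⁻ s in Set.Ioc t1 t2, n6 (φ s) ^ 4 ≤ e2 ^ 2)
    (Qψ : ∫⁻ s in Set.Ioc t1 t2, n6 (ψ s) ^ 4 ≤ e2 ^ 2) :
    (∫⁻ s in Set.Ioc t1 t2, n6 (fun x => φ s x - ψ s x) ^ 2 ≤ (2 * CS * n2 (fun x => φ t1 x - ψ t1 x)) ^ 2) ∧
    ∀ t ∈ Set.Icc t1 t2, n2 (fun x => φ t x - ψ t x) ≤ 2 * n2 (fun x => φ t1 x - ψ t1 x) := by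
  set w : ℝ → E3 → ℂ := fun t x => φ t x - ψ t x with hwd
  set I12 := Set.Ioc t1 t2 with hI
  have hwm : Measurable (fun p : ℝ × E3 => w p.1 p.2) := hφ.meas.sub hψ.meas
  have hws : ∀ t, Sch (w t) := fun t => (hφ.sch t).sub (hψ.sch t)
  set χ : ℝ → E3 → ℂ := fun t x => dt φ t x - dt ψ t x with hχd
  have hχs : ∀ t, Sch (χ t) := fun t => (hφ.schd t).sub (hψ.schd t)
  have hχc : Continuous (fun p : ℝ × E3 => χ p.1 p.2) := hφ.dt_cont.sub hψ.dt_cont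
  set g : ℝ → E3 → ℂ := fun t x => cub (φ t) x - cub (ψ t) x with hgd
  have hgs : ∀ t, Sch (g t) := fun t => (hφ.sch t).cub.sub (hψ.sch t).cub
  have hgm : Measurable (fun p : ℝ × E3 => g p.1 p.2) := hφ.cub_meas.sub hψ.cub_meas
  have hχfin : ∫⁻ s in I12, ∫⁻ x, ‖χ s x‖ₑ ^ 2 ≠ ⊤ := by
    have hb : ∫⁻ s in I12, ∫⁻ x, ‖χ s x‖ₑ ^ 2 ≤ 2 * ((∫⁻ s in I12, ∫⁻ x, ‖dt φ s x‖ₑ ^ 2) + ∫⁻ s in I12, ∫⁻ x, ‖dt ψ s x‖ₑ ^ 2) := by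
      have m1 : Measurable (fun s => ∫⁻ x, ‖dt φ s x‖ₑ ^ 2) := (hφ.dt_meas.enorm.pow_const 2).lintegral_prod_right'
      rw [← lintegral_add_left m1, ← lintegral_const_mul' _ _ (by norm_num)]
      refine lintegral_mono fun s => ?_
      rw [← lintegral_add_left (by exact (slice_meas hφ.dt_meas s).enorm.pow_const 2), ← lintegral_const_mul' _ _ (by norm_num)]
      refine lintegral_mono fun x => ?_
      refine le_trans ?_ (sq_add_le' _ _)
      gcongr; exact enorm_sub_le
    exact ne_top_of_le_ne_top (by finiteness) hb
  have heq : ∀ t ∈ Set.Icc t1 t2, ∀ ξ, 𝓕 (χ t) ξ = - (((4 * π ^ 2 * ‖ξ‖ ^ 2 : ℝ) : ℂ) * I) * 𝓕 (w t) ξ - I * 𝓕 (g t) ξ := by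
    intro t ht ξ
    rw [hχd, hwd, hgd]; simp only
    rw [fsub' (hφ.schd t).integrable (hψ.schd t).integrable, fsub' (hφ.sch t).integrable (hψ.sch t).integrable,
      fsub' (hφ.sch t).cub.integrable (hψ.sch t).cub.integrable, hφ.fourier_dt ht, hψ.fourier_dt ht]
    ring
  have hD : ∀ t ∈ I12, (fun ξ => ph t ξ * 𝓕 (w t) ξ) =ᵐ[volume] fun ξ => ph t1 ξ * 𝓕 (w t1) ξ
      - I * tint (fun s ξ => ph s ξ * 𝓕 (g s) ξ) (Set.Ioc t1 t) ξ := fun t ht =>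
    duh_gen (gh := fun t => 𝓕 (g t)) (fun t x => (hφ.hd t x).sub (hψ.hd t x)) hwm hχc hws hχs hχfin heq ht
  have n2F : ∀ {k : E3 → ℂ}, Sch k → n2 (𝓕 k) = n2 k := fun hk => by
    rw [n2_eq, n2_eq, eLpNorm_fourier hk.integrable (hk.memLp 2)]
  have hS := strichartz (u := w) (uh := fun t => 𝓕 (w t)) (gh := fun t => 𝓕 (g t)) (t1 := t1) (t2 := t2) hwm
    (fun t => (hws t).fourier.integrable) (fun t => (hws t).fourier.memLp 2) (fun t => ((hws t).fourierInv_fourier).symm)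
    (fourier_meas hgm) (fun t => (hgs t).fourier.memLp 2) hD
  have hL : ∀ t ∈ I12, n2 (w t) ≤ n2 (w t1) + ∫⁻ s in Set.Ioc t1 t, n2 (g s) := by
    intro t ht
    have := duhamel_l2 (uh := fun t => 𝓕 (w t)) (gh := fun t => 𝓕 (g t)) (t1 := t1) (fun t => (hws t).fourier.memLp 2) (fourier_meas hgm) (hD t ht)
    simpa only [n2F (hws _), n2F (hgs _)] using this
  simp only [n2F (hws _), n2F (hgs _), n6_sq] at hS
  set X := ∫⁻ s in I12, n6 (w s) ^ 2 with hX
  have mφ := n6_meas hφ.meas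
  have mψ := n6_meas hψ.meas
  have mw := n6_meas hwm
  have hXfin : X ≠ ⊤ := by
    have fin1 : ∀ {f : ℝ → E3 → ℂ}, Measurable (fun p : ℝ × E3 => f p.1 p.2) → ∫⁻ s in I12, n6 (f s) ^ 4 ≤ e2 ^ 2 → ∫⁻ s in I12, n6 (f s) ^ 2 ≠ ⊤ := by
      intro f hf hQ hcon
      have := lint_sq_le (volume.restrict I12) ((n6_meas hf).pow_const 2).aemeasurable
      simp only [← pow_mul] at this
      rw [hcon] at this
      have h3 := this.trans (mul_le_mul' le_rfl hQ)
      have h4 : (volume.restrict I12) Set.univ * e2 ^ 2 < ⊤ := by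
        have := e2_ne_top
        rw [Measure.restrict_apply_univ, hI, Real.volume_Ioc]; finiteness
      exact absurd (h3.trans_lt h4) (by simp)
    have hb : X ≤ 2 * ((∫⁻ s in I12, n6 (φ s) ^ 2) + ∫⁻ s in I12, n6 (ψ s) ^ 2) := by
      rw [← lintegral_add_left (mφ.pow_const 2), ← lintegral_const_mul' _ _ (by norm_num)]
      refine lintegral_mono fun s => ?_
      refine le_trans ?_ (sq_add_le' _ _)
      gcongr; exact n6_sub_le ((hφ.sch s).memLp 2).1 ((hψ.sch s).memLp 2).1
    have := fin1 hφ.meas Qφ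
    have := fin1 hψ.meas Qψ
    exact ne_top_of_le_ne_top (by finiteness) hb
  set Y := X ^ (1/2:ℝ) with hY
  have hYX : Y ^ 2 = X := by rw [hY, ← ENNReal.rpow_natCast, ← ENNReal.rpow_mul]; norm_num
  have hYfin : Y ≠ ⊤ := ENNReal.rpow_ne_top_of_nonneg (by norm_num) hXfin
  have hN : ∫⁻ s in I12, n2 (g s) ≤ 6 * e2 * Y := by
    have hc : ∀ {f : ℝ → E3 → ℂ}, Measurable (fun p : ℝ × E3 => f p.1 p.2) → ∫⁻ s in I12, n6 (f s) ^ 4 ≤ e2 ^ 2 →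
        ∫⁻ s in I12, n6 (f s) ^ 2 * n6 (w s) ≤ e2 * Y := by
      intro f hf hQ
      rw [← ENNReal.pow_le_pow_left_iff two_ne_zero]
      refine (lint_cs (volume.restrict I12) ((n6_meas hf).pow_const 2).aemeasurable mw.aemeasurable).trans ?_
      simp only [← pow_mul]
      rw [mul_pow, hYX]
      exact mul_le_mul' hQ le_rfl
    calc ∫⁻ s in I12, n2 (g s) ≤ ∫⁻ s in I12, 3 * (n6 (φ s) ^ 2 * n6 (w s) + n6 (ψ s) ^ 2 * n6 (w s)) := by
          refine lintegral_mono fun s => ?_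
          refine (n2_cub_diff (slice_meas hφ.meas s) (slice_meas hψ.meas s)).trans (le_of_eq ?_)
          change 3 * (n6 (φ s) ^ 2 + n6 (ψ s) ^ 2) * n6 (w s) = _
          ring
      _ = 3 * ((∫⁻ s in I12, n6 (φ s) ^ 2 * n6 (w s)) + ∫⁻ s in I12, n6 (ψ s) ^ 2 * n6 (w s)) := by
          rw [lintegral_const_mul' _ _ (by norm_num), lintegral_add_left (by exact (mφ.pow_const 2).mul mw)]
      _ ≤ 3 * (e2 * Y + e2 * Y) := by gcongr; exacts [hc hφ.meas Qφ, hc hψ.meas Qψ]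
      _ = _ := by ring
  have hYb : Y ≤ 2 * (CS * n2 (w t1)) := by
    refine absorb2 hYfin ?_
    rw [← ENNReal.pow_le_pow_left_iff two_ne_zero, hYX]
    refine hS.trans ?_
    rw [← CS_sq, ← mul_pow]
    gcongr
    calc CS * (n2 (w t1) + ∫⁻ s in I12, n2 (g s)) ≤ CS * (n2 (w t1) + 6 * e2 * Y) := by gcongr
      _ = CS * n2 (w t1) + (6 * e2 * CS) * Y := by ring
      _ = _ := by rw [e2_mul]
  refine ⟨?_, fun t ht => ?_⟩
  · rw [← hYX]; gcongr; rw [mul_assoc]; exact hYb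
  · change n2 (w t) ≤ 2 * n2 (w t1)
    rcases eq_or_lt_of_le ht.1 with h | h
    · rw [← h]; exact le_mul_of_one_le_left' (by norm_num)
    refine (hL t ⟨h, ht.2⟩).trans ?_
    rw [two_mul]; gcongr
    calc ∫⁻ s in Set.Ioc t1 t, n2 (g s) ≤ ∫⁻ s in I12, n2 (g s) := lintegral_mono_set (Set.Ioc_subset_Ioc_right ht.2)
      _ ≤ 6 * e2 * (2 * (CS * n2 (w t1))) := hN.trans (by gcongr)
      _ = 2 * (6 * e2 * CS) * n2 (w t1) := by ring
      _ = n2 (w t1) := by rw [e2_mul, ENNReal.mul_div_cancel (by norm_num) (by norm_num), one_mul]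

lemma pd_trans (g : E3 → ℂ) (y : E3) (j : Fin 3) (x : E3) : pd (fun x => g (x + y)) j x = pd g j (x + y) := by
  rw [pd, pd, fderiv_comp_add_right]

lemma lap_trans (g : E3 → ℂ) (y : E3) (x : E3) : lap (fun x => g (x + y)) x = lap g (x + y) := by
  unfold lap
  simp only [pd_trans]
  refine Finset.sum_congr rfl fun j _ => ?_
  exact pd_trans (fun z => pd g j z) y j x

lemma pd_conj (g : E3 → ℂ) (j : Fin 3) (x : E3) : pd (fun x => (starRingEnd ℂ) (g x)) j x = (starRingEnd ℂ) (pd g j x) := by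
  have : fderiv ℝ (fun x => (starRingEnd ℂ) (g x)) x = (Complex.conjCLE : ℂ →L[ℝ] ℂ).comp (fderiv ℝ g x) :=
    Complex.conjCLE.comp_fderiv
  rw [pd, this]; rfl

lemma lap_conj (g : E3 → ℂ) (x : E3) : lap (fun x => (starRingEnd ℂ) (g x)) x = (starRingEnd ℂ) (lap g x) := by
  unfold lap
  rw [map_sum]
  simp only [pd_conj]
  refine Finset.sum_congr rfl fun j _ => ?_
  exact pd_conj (fun z => pd g j z) j x

lemma n2_trans (g : E3 → ℂ) (y : E3) : n2 (fun x => g (x + y)) = n2 g := by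
  unfold n2; rw [lintegral_add_right_eq_self (fun x => ‖g x‖ₑ ^ 2) y]

lemma n6_trans (g : E3 → ℂ) (y : E3) : n6 (fun x => g (x + y)) = n6 g := by
  unfold n6 Bt; rw [lintegral_add_right_eq_self (fun x => ‖g x‖ₑ ^ 6) y]

lemma n2_conj (g : E3 → ℂ) : n2 (fun x => (starRingEnd ℂ) (g x)) = n2 g := by
  unfold n2; simp only [enorm_conj']

lemma n6_conj (g : E3 → ℂ) : n6 (fun x => (starRingEnd ℂ) (g x)) = n6 g := by
  unfold n6 Bt; simp only [enorm_conj']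

namespace Sol
variable {t1 t2 : ℝ} {φ : ℝ → E3 → ℂ}

lemma space (h : Sol t1 t2 φ) (y : E3) : Sol t1 t2 (fun t x => φ t (x + y)) where
  sm := h.sm.comp (contDiff_fst.prodMk (contDiff_snd.add contDiff_const))
  sch := fun t => (h.sch t).trans y
  schd := fun t => (h.schd t).trans y
  eqn := fun t ht x => by
    rw [lap_trans]; exact h.eqn t ht (x + y)

lemma dt_time (τ t : ℝ) (x : E3) : dt (fun t x => φ (t + τ) x) t x = dt φ (t + τ) x := by
  rw [dt, dt]; exact deriv_comp_add_const (f := fun s => φ s x) τ t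

lemma time (h : Sol t1 t2 φ) (τ : ℝ) : Sol (t1 - τ) (t2 - τ) (fun t x => φ (t + τ) x) where
  sm := h.sm.comp ((contDiff_fst.add contDiff_const).prodMk contDiff_snd)
  sch := fun t => h.sch _
  schd := fun t => by
    have : dt (fun t x => φ (t + τ) x) t = dt φ (t + τ) := funext fun x => dt_time τ t x
    rw [this]; exact h.schd _
  eqn := fun t ht x => by
    rw [dt_time]; exact h.eqn (t + τ) ⟨by linarith [ht.1], by linarith [ht.2]⟩ x

lemma dt_rev (t : ℝ) (x : E3) : dt (fun t x => (starRingEnd ℂ) (φ (-t) x)) t x = - (starRingEnd ℂ) (dt φ (-t) x) := by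
  rw [dt, dt]
  have h1 := deriv_comp_neg (f := fun s => (starRingEnd ℂ) (φ s x)) t
  rw [h1]
  congr 1
  have : deriv (fun s => (Complex.conjCLE : ℂ →L[ℝ] ℂ) (φ s x)) (-t) = _ := rfl
  have h2 : fderiv ℝ (fun s => (starRingEnd ℂ) (φ s x)) (-t) = (Complex.conjCLE : ℂ →L[ℝ] ℂ).comp (fderiv ℝ (fun s => φ s x) (-t)) :=
    Complex.conjCLE.comp_fderiv
  rw [← fderiv_apply_one_eq_deriv, h2]; simp

lemma rev (h : Sol t1 t2 φ) : Sol (-t2) (-t1) (fun t x => (starRingEnd ℂ) (φ (-t) x)) where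
  sm := by
    have h1 : ContDiff ℝ ∞ (fun p : ℝ × E3 => φ (-p.1) p.2) := h.sm.comp (contDiff_fst.neg.prodMk contDiff_snd)
    exact Complex.conjCLE.contDiff.comp h1
  sch := fun t => (h.sch _).conj
  schd := fun t => by
    have : dt (fun t x => (starRingEnd ℂ) (φ (-t) x)) t = fun x => (-1) * (starRingEnd ℂ) (dt φ (-t) x) := by
      ext x; rw [dt_rev]; ring
    rw [this]; exact (h.schd _).conj.const_mul _
  eqn := fun t ht x => by
    have h1 := h.eqn (-t) ⟨by linarith [ht.2], by linarith [ht.1]⟩ x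
    rw [dt_rev, lap_conj]
    have h2 := congrArg (starRingEnd ℂ) h1
    simp only [map_add, map_mul, Complex.conj_I, cub, Complex.conj_ofReal, Complex.norm_conj] at h2 ⊢
    linear_combination h2

end Sol

/-- squared gradient norm -/
def gr (g : E3 → ℂ) : ℝ≥0∞ := ∑ j : Fin 3, n2 (pd g j) ^ 2

lemma Sch.n2_fourier {g : E3 → ℂ} (h : Sch g) : n2 (𝓕 g) = n2 g := by
  rw [n2_eq, n2_eq, eLpNorm_fourier h.integrable (h.memLp 2)]

lemma Sch.continuous {g : E3 → ℂ} (h : Sch g) : Continuous g := h.contDiff.continuous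

lemma gr_fourier {g : E3 → ℂ} (h : Sch g) : gr g = ∫⁻ ξ, ENNReal.ofReal (4 * π ^ 2 * ‖ξ‖ ^ 2) * ‖𝓕 g ξ‖ₑ ^ 2 := by
  unfold gr
  have h1 : ∀ j : Fin 3, n2 (pd g j) ^ 2 = ∫⁻ ξ, ENNReal.ofReal (4 * π ^ 2 * ξ j ^ 2) * ‖𝓕 g ξ‖ₑ ^ 2 := by
    intro j
    rw [← (h.pd j).n2_fourier, n2_sq]
    refine lintegral_congr fun ξ => ?_
    rw [h.fourier_pd, enorm_mul, mul_pow]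
    congr 1
    rw [← ofReal_norm, ← ENNReal.ofReal_pow (norm_nonneg _)]
    congr 1
    simp [mul_pow, abs_of_pos Real.pi_pos]
    left; norm_num
  simp only [h1]
  have hc := h.fourier.continuous
  have hm : ∀ j : Fin 3, Measurable (fun ξ : E3 => ENNReal.ofReal (4 * π ^ 2 * ξ j ^ 2) * ‖𝓕 g ξ‖ₑ ^ 2) := fun j => by
    have : Continuous (fun ξ : E3 => ξ j) := by fun_prop
    exact ((this.measurable.pow_const 2).const_mul _).ennreal_ofReal.mul (hc.measurable.enorm.pow_const 2)
  rw [← lintegral_finsetSum _ (fun j _ => hm j)]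
  refine lintegral_congr fun ξ => ?_
  rw [← Finset.sum_mul]
  congr 1
  rw [← ENNReal.ofReal_sum_of_nonneg (fun j _ => by positivity), norm_sq_e3, Fin.sum_univ_three]
  congr 1; ring

lemma fderiv_norm_le (g : E3 → ℂ) (x : E3) : ‖fderiv ℝ g x‖ ≤ ‖pd g 0 x‖ + ‖pd g 1 x‖ + ‖pd g 2 x‖ := by
  refine ContinuousLinearMap.opNorm_le_bound _ (by positivity) fun v => ?_
  have hv : v = v 0 • e3 0 + v 1 • e3 1 + v 2 • e3 2 := by
    ext i; fin_cases i <;> simp [e3]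
  have hc : ∀ j, |v j| ≤ ‖v‖ := fun j => by simpa using PiLp.norm_apply_le v j
  have : fderiv ℝ g x v = (v 0 : ℂ) * pd g 0 x + (v 1 : ℂ) * pd g 1 x + (v 2 : ℂ) * pd g 2 x := by
    conv_lhs => rw [hv]
    simp [pd]
  rw [this]
  refine (norm_add₃_le).trans ?_
  simp only [norm_mul, Complex.norm_real, Real.norm_eq_abs]
  nlinarith [mul_le_mul_of_nonneg_right (hc 0) (norm_nonneg (pd g 0 x)), mul_le_mul_of_nonneg_right (hc 1) (norm_nonneg (pd g 1 x)), mul_le_mul_of_nonneg_right (hc 2) (norm_nonneg (pd g 2 x))]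

/-- Sobolev constant -/
def KS0 : ℝ≥0∞ := (SNormLESNormFDerivOfEqConst ℂ (volume : Measure E3) ((2 : NNReal) : ℝ) : NNReal)

lemma sob_compact {u : E3 → ℂ} (hu : ContDiff ℝ 1 u) (hc : HasCompactSupport u) :
    eLpNorm u 6 volume ≤ KS0 * eLpNorm (fderiv ℝ u) 2 volume := by
  have := eLpNorm_le_eLpNorm_fderiv_of_eq (μ := (volume : Measure E3)) hu hc (p := 2) (p' := 6) (by norm_num) (by simp) (by simp; norm_num)
  simpa [KS0] using this

lemma sob_sch {g : E3 → ℂ} (h : Sch g) : eLpNorm g 6 volume ≤ KS0 * eLpNorm (fderiv ℝ g) 2 volume := by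
  let b : ContDiffBump (0 : E3) := ⟨1, 2, by norm_num, by norm_num⟩
  have hbs : ContDiff ℝ ∞ b := b.contDiff
  have hb1 : ContDiff ℝ 1 b := hbs.of_le (by norm_num)
  obtain ⟨D, hD⟩ : ∃ D, ∀ x, ‖fderiv ℝ b x‖ ≤ D :=
    (hbs.continuous_fderiv (by norm_num)).bounded_above_of_compact_support (b.hasCompactSupport.fderiv (𝕜 := ℝ))
  have hD0 : 0 ≤ D := (norm_nonneg _).trans (hD 0)
  let c : ℕ → ℝ := fun n => ((n:ℝ) + 1)⁻¹
  have hcp : ∀ n, 0 < c n := fun n => by positivity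
  let f : ℕ → E3 → ℂ := fun n x => b (c n • x) • g x
  have hg1 : ContDiff ℝ 1 g := h.contDiff.of_le (by norm_num)
  have hbn : ∀ n, ContDiff ℝ 1 (fun x : E3 => b (c n • x)) := fun n => hb1.comp (contDiff_const_smul (c n))
  have hf1 : ∀ n, ContDiff ℝ 1 (f n) := fun n => (hbn n).smul hg1
  have hfc : ∀ n, HasCompactSupport (f n) := fun n => by
    have : HasCompactSupport (fun x : E3 => b (c n • x)) :=
      b.hasCompactSupport.comp_homeomorph (Homeomorph.smulOfNeZero (c n) (hcp n).ne')
    exact this.smul_right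
  have hder : ∀ n x, ‖fderiv ℝ (f n) x‖ₑ ≤ ‖fderiv ℝ g x‖ₑ + ENNReal.ofReal (c n * D) * ‖g x‖ₑ := by
    intro n x
    have h1 : HasFDerivAt (fun x : E3 => b (c n • x)) (c n • fderiv ℝ b (c n • x)) x := by
      have h2 : HasFDerivAt (fun x : E3 => c n • x) (c n • ContinuousLinearMap.id ℝ E3) x := (hasFDerivAt_id x).const_smul (c n)
      have := (hb1.differentiable (by norm_num) (c n • x)).hasFDerivAt.comp x h2
      have e : c n • fderiv ℝ b (c n • x) = (fderiv ℝ b (c n • x)).comp (c n • ContinuousLinearMap.id ℝ E3) := by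
        ext v; simp
      rw [e]; exact this
    have h3 := (h1.smul (hg1.differentiable (by norm_num) x).hasFDerivAt).fderiv
    have h4 : fderiv ℝ (f n) x = _ := h3
    have hn : ‖fderiv ℝ (f n) x‖ ≤ ‖fderiv ℝ g x‖ + c n * D * ‖g x‖ := by
      rw [h4]
      refine (norm_add_le _ _).trans (add_le_add ?_ ?_)
      · rw [norm_smul]
        have : ‖b (c n • x)‖ ≤ 1 := by rw [Real.norm_of_nonneg b.nonneg]; exact b.le_one
        exact mul_le_of_le_one_left (norm_nonneg _) this
      · refine (ContinuousLinearMap.norm_smulRight_apply _ _).le.trans ?_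
        rw [norm_smul, Real.norm_of_nonneg (hcp n).le]
        gcongr
        exact hD _
    rw [← ofReal_norm, ← ofReal_norm, ← ofReal_norm, ← ENNReal.ofReal_mul (by have := hcp n; positivity), ← ENNReal.ofReal_add (norm_nonneg _) (by have := hcp n; positivity)]
    exact ENNReal.ofReal_le_ofReal hn
  have hg'm : AEStronglyMeasurable (fderiv ℝ g) volume := (hg1.continuous_fderiv (by norm_num)).aestronglyMeasurable
  have hnorm : ∀ n, eLpNorm (f n) 6 volume ≤ KS0 * (eLpNorm (fderiv ℝ g) 2 volume + ENNReal.ofReal (c n * D) * eLpNorm g 2 volume) := by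
    intro n
    refine (sob_compact (hf1 n) (hfc n)).trans ?_
    gcongr
    have e1 : eLpNorm (fderiv ℝ (f n)) 2 volume ≤ eLpNorm (fun x => ‖fderiv ℝ g x‖ + c n * D * ‖g x‖) 2 volume := by
      refine eLpNorm_mono_enorm fun x => ?_
      refine (hder n x).trans_eq ?_
      have := hcp n
      rw [Real.enorm_of_nonneg (by positivity), ENNReal.ofReal_add (by positivity) (by positivity), ofReal_norm, ENNReal.ofReal_mul (p := c n * D) (by positivity), ofReal_norm]
    refine e1.trans ((eLpNorm_add_le hg'm.norm (h.continuous.norm.const_mul _).aestronglyMeasurable (by norm_num)).trans ?_)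
    rw [eLpNorm_norm]
    gcongr
    have := eLpNorm_const_smul (c n * D) (fun x => ‖g x‖) 2 (volume : Measure E3)
    have e : (fun x => c n * D * ‖g x‖) = (c n * D) • fun x => ‖g x‖ := rfl
    rw [e, this, eLpNorm_norm, Real.enorm_of_nonneg (by have := hcp n; positivity)]
  have hc0 : Tendsto c atTop (nhds 0) := by
    simpa [c, one_div] using tendsto_one_div_add_atTop_nhds_zero_nat (𝕜 := ℝ)
  have hlim : ∀ x, Tendsto (fun n => f n x) atTop (nhds (g x)) := by
    intro x
    have h1 : Tendsto (fun n => b (c n • x)) atTop (nhds (b 0)) := by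
      refine (b.continuous.tendsto _).comp ?_
      simpa using hc0.smul_const x
    have hb0 : b 0 = 1 := b.one_of_mem_closedBall (by simp [b])
    rw [hb0] at h1
    simpa [f] using h1.smul_const (g x)
  refine (Lp.eLpNorm_lim_le_liminf_eLpNorm (fun n => (hf1 n).continuous.aestronglyMeasurable) g (.of_forall hlim)).trans ?_
  have hT : Tendsto (fun n => KS0 * (eLpNorm (fderiv ℝ g) 2 volume + ENNReal.ofReal (c n * D) * eLpNorm g 2 volume)) atTop
      (nhds (KS0 * (eLpNorm (fderiv ℝ g) 2 volume + ENNReal.ofReal (0 * D) * eLpNorm g 2 volume))) := by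
    refine ENNReal.Tendsto.const_mul ?_ (Or.inr (by simp [KS0]))
    refine tendsto_const_nhds.add (ENNReal.Tendsto.mul_const ?_ (Or.inr (h.memLp 2).2.ne))
    exact ENNReal.tendsto_ofReal (hc0.mul_const D)
  refine (liminf_le_liminf (.of_forall hnorm)).trans ?_
  rw [hT.liminf_eq]; simp

/-- Sobolev constant -/
def KS : ℝ≥0∞ := KS0 * 3

lemma KS_ne_top : KS ≠ ⊤ := by unfold KS KS0; finiteness

lemma sobolev {g : E3 → ℂ} (h : Sch g) : n6 g ≤ KS * (gr g) ^ (1/2:ℝ) := by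
  rw [n6_eq]
  refine (sob_sch h).trans ?_
  rw [KS, mul_assoc]
  gcongr
  have hj : ∀ j, eLpNorm (pd g j) 2 volume ≤ (gr g) ^ (1/2:ℝ) := by
    intro j
    rw [← n2_eq]
    apply pow_half_le
    exact Finset.single_le_sum (f := fun j => n2 (pd g j) ^ 2) (fun _ _ => zero_le) (Finset.mem_univ j)
  have hm : ∀ j, AEStronglyMeasurable (fun x => ‖pd g j x‖) volume := fun j => (h.pd j).continuous.norm.aestronglyMeasurable
  have e1 : eLpNorm (fderiv ℝ g) 2 volume ≤ eLpNorm ((fun x => ‖pd g 0 x‖) + (fun x => ‖pd g 1 x‖) + (fun x => ‖pd g 2 x‖)) 2 volume := by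
    refine eLpNorm_mono fun x => ?_
    refine (fderiv_norm_le g x).trans (le_abs_self _)
  refine e1.trans ((eLpNorm_add_le ((hm 0).add (hm 1)) (hm 2) (by norm_num)).trans ?_)
  refine (add_le_add_left (eLpNorm_add_le (hm 0) (hm 1) (by norm_num)) _).trans ?_
  simp only [eLpNorm_norm]
  calc _ ≤ gr g ^ (1/2:ℝ) + gr g ^ (1/2:ℝ) + gr g ^ (1/2:ℝ) := by gcongr <;> apply hj
    _ = _ := by ring

/-- fourth power integral -/
def q4 (g : E3 → ℂ) : ℝ≥0∞ := ∫⁻ x, ‖g x‖ₑ ^ 4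

/-- energy -/
def en (g : E3 → ℂ) : ℝ≥0∞ := (1/2) * gr g + (1/4) * q4 g

lemma n2_cub (g : E3 → ℂ) : n2 (cub g) = n6 g ^ 3 := by
  have h1 : ∀ x, ‖cub g x‖ₑ ^ 2 = ‖g x‖ₑ ^ 6 := by
    intro x
    have : ‖cub g x‖ₑ = ‖g x‖ₑ ^ 3 := by
      rw [cub, enorm_mul, ← ofReal_norm, ← ofReal_norm, ← ENNReal.ofReal_mul (by positivity), ← ENNReal.ofReal_pow (by positivity)]
      congr 1; simp; ring
    rw [this]; ring
  unfold n2 n6 Bt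
  simp only [h1]
  rw [← ENNReal.rpow_natCast, ← ENNReal.rpow_mul]; norm_num

lemma q4_ne_top {g : E3 → ℂ} (h : Sch g) : q4 g ≠ ⊤ := by
  have := (h.memLp 4).2.ne
  rw [eLpNorm_eq_lintegral_rpow_enorm_toReal (by norm_num) (by norm_num)] at this
  unfold q4
  intro hh
  apply this
  have e : ∀ x, ‖g x‖ₑ ^ (ENNReal.toReal 4) = ‖g x‖ₑ ^ 4 := fun x => by
    rw [← ENNReal.rpow_natCast]; norm_num
  simp only [e, hh]
  simp

lemma n2_sch_ne_top {g : E3 → ℂ} (h : Sch g) : n2 g ≠ ⊤ := by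
  rw [n2_eq]; exact (h.memLp 2).2.ne

lemma n6_sch_ne_top {g : E3 → ℂ} (h : Sch g) : n6 g ≠ ⊤ := by
  rw [n6_eq]; exact (h.memLp 6).2.ne

lemma gr_ne_top {g : E3 → ℂ} (h : Sch g) : gr g ≠ ⊤ := by
  unfold gr
  exact ENNReal.sum_ne_top.2 fun j _ => ENNReal.pow_ne_top (n2_sch_ne_top (h.pd j))

lemma en_ne_top {g : E3 → ℂ} (h : Sch g) : en g ≠ ⊤ := by
  have := gr_ne_top h; have := q4_ne_top h
  unfold en; finiteness

lemma real_int_aux {f : E3 → ℝ} (hc : Continuous f) (h0 : ∀ x, 0 ≤ f x) (hf : ∫⁻ x, ENNReal.ofReal (f x) ≠ ⊤) :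
    Integrable (fun x => ((f x : ℝ) : ℂ)) ∧ ∫ x, ((f x : ℝ) : ℂ) = (((∫⁻ x, ENNReal.ofReal (f x)).toReal : ℝ) : ℂ) := by
  have hi : Integrable f := by
    refine ⟨hc.aestronglyMeasurable, ?_⟩
    rw [hasFiniteIntegral_iff_ofReal (.of_forall h0)]
    exact hf.lt_top
  refine ⟨hi.ofReal, ?_⟩
  rw [integral_complex_ofReal, integral_eq_lintegral_of_nonneg_ae (.of_forall h0) hc.aestronglyMeasurable]

lemma gr_int {g : E3 → ℂ} (h : Sch g) :
    Integrable (fun ξ => ((4 * π ^ 2 * ‖ξ‖ ^ 2 : ℝ) : ℂ) * ((starRingEnd ℂ) (𝓕 g ξ) * 𝓕 g ξ)) ∧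
    ∫ ξ, ((4 * π ^ 2 * ‖ξ‖ ^ 2 : ℝ) : ℂ) * ((starRingEnd ℂ) (𝓕 g ξ) * 𝓕 g ξ) = ((gr g).toReal : ℂ) := by
  have hc := h.fourier.continuous
  have e : (fun ξ => ((4 * π ^ 2 * ‖ξ‖ ^ 2 : ℝ) : ℂ) * ((starRingEnd ℂ) (𝓕 g ξ) * 𝓕 g ξ)) = fun ξ => (((4 * π ^ 2 * ‖ξ‖ ^ 2) * ‖𝓕 g ξ‖ ^ 2 : ℝ) : ℂ) := by
    ext ξ; rw [mul_comm ((starRingEnd ℂ) _), Complex.mul_conj, Complex.normSq_eq_norm_sq]; push_cast; ring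
  have e2 : ∀ ξ, ENNReal.ofReal (4 * π ^ 2 * ‖ξ‖ ^ 2) * ‖𝓕 g ξ‖ₑ ^ 2 = ENNReal.ofReal ((4 * π ^ 2 * ‖ξ‖ ^ 2) * ‖𝓕 g ξ‖ ^ 2) := fun ξ => by
    rw [← ofReal_norm, ← ENNReal.ofReal_pow (by positivity), ← ENNReal.ofReal_mul (by positivity)]
  have hcont : Continuous (fun ξ => (4 * π ^ 2 * ‖ξ‖ ^ 2) * ‖𝓕 g ξ‖ ^ 2) := by fun_prop
  have hgr := gr_fourier h
  simp only [e2] at hgr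
  rw [e]
  rw [hgr]; exact real_int_aux hcont (fun ξ => by positivity) (by rw [← hgr]; exact gr_ne_top h)

lemma q4_int {g : E3 → ℂ} (h : Sch g) :
    Integrable (fun x => ((starRingEnd ℂ) (g x) * g x) * ((starRingEnd ℂ) (g x) * g x)) ∧
    ∫ x, ((starRingEnd ℂ) (g x) * g x) * ((starRingEnd ℂ) (g x) * g x) = ((q4 g).toReal : ℂ) := by
  have hc := h.continuous
  have e : (fun x => ((starRingEnd ℂ) (g x) * g x) * ((starRingEnd ℂ) (g x) * g x)) = fun x => ((‖g x‖ ^ 4 : ℝ) : ℂ) := by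
    ext ξ; rw [mul_comm ((starRingEnd ℂ) _), Complex.mul_conj, Complex.normSq_eq_norm_sq]; push_cast; ring
  have hcont : Continuous (fun x => ‖g x‖ ^ 4) := by fun_prop
  have hq : q4 g = ∫⁻ x, ENNReal.ofReal (‖g x‖ ^ 4) := by
    unfold q4; refine lintegral_congr fun x => ?_
    rw [← ofReal_norm, ← ENNReal.ofReal_pow (by positivity)]
  rw [e]
  rw [hq]; exact real_int_aux hcont (fun ξ => by positivity) (by rw [← hq]; exact q4_ne_top h)

lemma fub_int {a b : ℝ → E3 → ℂ} (ha : Measurable (fun p : ℝ × E3 => a p.1 p.2)) (hb : Measurable (fun p : ℝ × E3 => b p.1 p.2))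
    {t1 t : ℝ} {K : ℝ≥0∞} (hK : K ≠ ⊤) (h1 : ∀ s ∈ Set.Ioc t1 t, n2 (a s) ≤ K) (h2 : ∀ s ∈ Set.Ioc t1 t, n2 (b s) ≤ K) :
    Integrable (fun p : ℝ × E3 => (starRingEnd ℂ) (a p.1 p.2) * b p.1 p.2) ((volume.restrict (Set.Ioc t1 t)).prod volume) := by
  have hm : Measurable (fun p : ℝ × E3 => (starRingEnd ℂ) (a p.1 p.2) * b p.1 p.2) :=
    (Complex.continuous_conj.measurable.comp ha).mul hb
  refine ⟨hm.aestronglyMeasurable, ?_⟩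
  rw [hasFiniteIntegral_iff_enorm, lintegral_prod _ hm.enorm.aemeasurable]
  refine lt_of_le_of_lt (setLIntegral_mono (g := fun _ => K * K) measurable_const fun s hs => ?_) ?_
  · have := lint_cs volume (slice_meas ha s).enorm.aemeasurable (slice_meas hb s).enorm.aemeasurable
    rw [← n2_sq, ← n2_sq, ← mul_pow, ENNReal.pow_le_pow_left_iff two_ne_zero] at this
    simp only [enorm_mul, enorm_conj']
    exact this.trans (mul_le_mul' (h1 s hs) (h2 s hs))
  · rw [setLIntegral_const]; simp; finiteness

lemma fub {a b : ℝ → E3 → ℂ} (ha : Measurable (fun p : ℝ × E3 => a p.1 p.2)) (hb : Measurable (fun p : ℝ × E3 => b p.1 p.2))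
    {t1 t : ℝ} {K : ℝ≥0∞} (hK : K ≠ ⊤) (h1 : ∀ s ∈ Set.Ioc t1 t, n2 (a s) ≤ K) (h2 : ∀ s ∈ Set.Ioc t1 t, n2 (b s) ≤ K) :
    Integrable (fun x => tint (fun s x => (starRingEnd ℂ) (a s x) * b s x + (starRingEnd ℂ) (b s x) * a s x) (Set.Ioc t1 t) x) ∧
    ∫ x, tint (fun s x => (starRingEnd ℂ) (a s x) * b s x + (starRingEnd ℂ) (b s x) * a s x) (Set.Ioc t1 t) x =
      ∫ s in Set.Ioc t1 t, (br (a s) (b s) + br (b s) (a s)) := by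
  have i1 := fub_int ha hb hK h1 h2
  have i2 := fub_int hb ha hK h2 h1
  have i := i1.add i2
  constructor
  · exact i.integral_prod_right
  · unfold tint
    have := integral_integral_swap (f := fun s x => (starRingEnd ℂ) (a s x) * b s x + (starRingEnd ℂ) (b s x) * a s x) i
    rw [← this]
    refine integral_congr_ae ?_
    filter_upwards [i1.prod_right_ae, i2.prod_right_ae] with s j1 j2
    rw [integral_add j1 j2]; rfl

lemma EvR.conj {t1 t2 : ℝ} {A α : ℝ → E3 → ℂ} (h : EvR t1 t2 A α) :
    EvR t1 t2 (fun t ξ => (starRingEnd ℂ) (A t ξ)) (fun t ξ => (starRingEnd ℂ) (α t ξ)) where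
  am := Complex.continuous_conj.measurable.comp h.am
  bm := Complex.continuous_conj.measurable.comp h.bm
  int := by
    filter_upwards [h.int] with ξ hξ
    exact (Complex.conjCLE : ℂ →L[ℝ] ℂ).integrable_comp hξ
  ev := by
    intro t ht
    filter_upwards [h.ev t ht] with ξ hξ
    rw [hξ, map_add, tint, tint, integral_conj]

lemma fin_of_bd {v : ℝ → E3 → ℂ} {t1 t2 : ℝ} {K : ℝ≥0∞} (hK : K ≠ ⊤) (h1 : ∀ s ∈ Set.Ioc t1 t2, n2 (v s) ≤ K) :
    ∫⁻ s in Set.Ioc t1 t2, ∫⁻ x, ‖v s x‖ₑ ^ 2 ≠ ⊤ := by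
  have : ∫⁻ s in Set.Ioc t1 t2, ∫⁻ x, ‖v s x‖ₑ ^ 2 ≤ ∫⁻ s in Set.Ioc t1 t2, K ^ 2 := by
    refine setLIntegral_mono measurable_const fun s hs => ?_
    rw [← n2_sq]; gcongr; exact h1 s hs
  refine ne_top_of_le_ne_top ?_ this
  rw [setLIntegral_const, Real.volume_Ioc]; finiteness

namespace Sol
variable {t1 t2 : ℝ} {φ : ℝ → E3 → ℂ}

lemma energy_gr (h : Sol t1 t2 φ) {K : ℝ≥0∞} (hK : K ≠ ⊤) (hd : ∀ s ∈ Set.Ioc t1 t2, n2 (dt φ s) ≤ K)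
    (hc : ∀ s ∈ Set.Ioc t1 t2, n2 (cub (φ s)) ≤ K) {t : ℝ} (ht : t ∈ Set.Ioc t1 t2) :
    ((gr (φ t)).toReal : ℂ) = ((gr (φ t1)).toReal : ℂ) -
      ∫ s in Set.Ioc t1 t, (br (dt φ s) (cub (φ s)) + br (cub (φ s)) (dt φ s)) := by
  have hfin := fin_of_bd hK hd
  have hev := (h.ev hfin).conj.mul (h.ev hfin) t ht
  have hda : Measurable (fun p : ℝ × E3 => 𝓕 (dt φ p.1) p.2) := fourier_meas h.dt_meas
  have hcm : Measurable (fun p : ℝ × E3 => 𝓕 (cub (φ p.1)) p.2) := fourier_meas (G := fun s => cub (φ s)) h.cub_meas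
  have hsub : ∀ s ∈ Set.Ioc t1 t, s ∈ Set.Ioc t1 t2 := fun s hs => ⟨hs.1, hs.2.trans ht.2⟩
  have hF := fub (a := fun s => 𝓕 (dt φ s)) (b := fun s => 𝓕 (cub (φ s))) hda hcm (t1 := t1) (t := t) hK
    (fun s hs => by rw [(h.schd s).n2_fourier]; exact hd s (hsub s hs))
    (fun s hs => by rw [(h.sch s).cub.n2_fourier]; exact hc s (hsub s hs))
  have key : (fun ξ => ((4 * π ^ 2 * ‖ξ‖ ^ 2 : ℝ) : ℂ) * ((starRingEnd ℂ) (𝓕 (φ t) ξ) * 𝓕 (φ t) ξ)) =ᵐ[volume]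
      fun ξ => ((4 * π ^ 2 * ‖ξ‖ ^ 2 : ℝ) : ℂ) * ((starRingEnd ℂ) (𝓕 (φ t1) ξ) * 𝓕 (φ t1) ξ) -
        tint (fun s x => (starRingEnd ℂ) (𝓕 (dt φ s) x) * 𝓕 (cub (φ s)) x + (starRingEnd ℂ) (𝓕 (cub (φ s)) x) * 𝓕 (dt φ s) x) (Set.Ioc t1 t) ξ := by
    filter_upwards [hev] with ξ hξ
    rw [hξ, mul_add, sub_eq_add_neg, tint, tint, ← integral_const_mul, ← integral_neg]
    congr 1
    refine setIntegral_congr_fun measurableSet_Ioc fun s hs => ?_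
    have e1 := h.fourier_dt ⟨(hsub s hs).1.le, (hsub s hs).2⟩ ξ
    have e2 := congrArg (starRingEnd ℂ) e1
    simp only [map_sub, map_neg, map_mul, Complex.conj_I, Complex.conj_ofReal] at e2
    generalize 𝓕 (dt φ s) ξ = D at *
    generalize 𝓕 (φ s) ξ = P at *
    generalize 𝓕 (cub (φ s)) ξ = G at *
    generalize (starRingEnd ℂ) D = D' at *
    generalize (starRingEnd ℂ) P = P' at *
    generalize (starRingEnd ℂ) G = G' at *
    generalize (((4 * π ^ 2 * ‖ξ‖ ^ 2 : ℝ) : ℂ)) = θ at *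
    have f1 : θ * P = I * D - G := by linear_combination -I * e1 + (θ * P + G) * Complex.I_sq
    have f2 : θ * P' = -I * D' - G' := by linear_combination I * e2 + (θ * P' + G') * Complex.I_sq
    linear_combination D' * f1 + D * f2
  rw [← (gr_int (h.sch t)).2, integral_congr_ae key, integral_sub (gr_int (h.sch t1)).1 hF.1, (gr_int (h.sch t1)).2, hF.2]
  congr 1
  refine setIntegral_congr_fun measurableSet_Ioc fun s hs => ?_
  have a1 := (h.schd s).integrable; have a2 := (h.schd s).memLp 2
  have b1 := (h.sch s).cub.integrable; have b2 := (h.sch s).cub.memLp 2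
  unfold br
  rw [inner_fourier a1 a2 b1 b2, inner_fourier b1 b2 a1 a2]

lemma energy_q4 (h : Sol t1 t2 φ) {K : ℝ≥0∞} (hK : K ≠ ⊤) (hd : ∀ s ∈ Set.Ioc t1 t2, n2 (dt φ s) ≤ K)
    (hc : ∀ s ∈ Set.Ioc t1 t2, n2 (cub (φ s)) ≤ K) {t : ℝ} (ht : t ∈ Set.Ioc t1 t2) :
    ((q4 (φ t)).toReal : ℂ) = ((q4 (φ t1)).toReal : ℂ) +
      2 * ∫ s in Set.Ioc t1 t, (br (dt φ s) (cub (φ s)) + br (cub (φ s)) (dt φ s)) := by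
  have hsub : ∀ s ∈ Set.Ioc t1 t, s ∈ Set.Ioc t1 t2 := fun s hs => ⟨hs.1, hs.2.trans ht.2⟩
  have hF := fub h.dt_meas h.cub_meas (t1 := t1) (t := t) hK
    (fun s hs => hd s (hsub s hs)) (fun s hs => hc s (hsub s hs))
  have key : ∀ x, ((starRingEnd ℂ) (φ t x) * φ t x) * ((starRingEnd ℂ) (φ t x) * φ t x) =
      ((starRingEnd ℂ) (φ t1 x) * φ t1 x) * ((starRingEnd ℂ) (φ t1 x) * φ t1 x) + 2 *
        tint (fun s x => (starRingEnd ℂ) (dt φ s x) * cub (φ s) x + (starRingEnd ℂ) (cub (φ s) x) * dt φ s x) (Set.Ioc t1 t) x := by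
    intro x
    have hdx : ∀ s, HasDerivAt (fun s => ((starRingEnd ℂ) (φ s x) * φ s x) * ((starRingEnd ℂ) (φ s x) * φ s x))
        (2 * ((starRingEnd ℂ) (dt φ s x) * cub (φ s) x + (starRingEnd ℂ) (cub (φ s) x) * dt φ s x)) s := by
      intro s
      have d1 := h.hd s x
      have d2 : HasDerivAt (fun s => (starRingEnd ℂ) (φ s x)) ((starRingEnd ℂ) (dt φ s x)) s :=
        (Complex.conjCLE : ℂ →L[ℝ] ℂ).hasFDerivAt.comp_hasDerivAt s d1
      have d3 := d2.mul d1
      refine (d3.mul d3).congr_deriv ?_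
      have e : ((‖φ s x‖ ^ 2 : ℝ) : ℂ) = (starRingEnd ℂ) (φ s x) * φ s x := by
        rw [mul_comm, Complex.mul_conj, Complex.normSq_eq_norm_sq]
      simp only [cub, map_mul, e, Complex.conj_conj, Pi.mul_apply]
      ring
    have hcont : Continuous (fun s => 2 * ((starRingEnd ℂ) (dt φ s x) * cub (φ s) x + (starRingEnd ℂ) (cub (φ s) x) * dt φ s x)) := by
      have c1 : Continuous (fun s => dt φ s x) := h.dt_cont.comp (continuous_id.prodMk continuous_const)
      have c2 : Continuous (fun s => cub (φ s) x) := h.cub_cont.comp (continuous_id.prodMk continuous_const)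
      fun_prop
    have := intervalIntegral.integral_eq_sub_of_hasDerivAt (fun s _ => hdx s) (hcont.intervalIntegrable t1 t)
    rw [intervalIntegral.integral_of_le ht.1.le, integral_const_mul] at this
    rw [tint, this]; ring
  rw [← (q4_int (h.sch t)).2]
  simp only [key]
  rw [integral_add (q4_int (h.sch t1)).1 (hF.1.const_mul 2), (q4_int (h.sch t1)).2, integral_const_mul, hF.2]

lemma energy (h : Sol t1 t2 φ) {K : ℝ≥0∞} (hK : K ≠ ⊤) (hd : ∀ s ∈ Set.Ioc t1 t2, n2 (dt φ s) ≤ K)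
    (hc : ∀ s ∈ Set.Ioc t1 t2, n2 (cub (φ s)) ≤ K) {t : ℝ} (ht : t ∈ Set.Icc t1 t2) : en (φ t) = en (φ t1) := by
  rcases eq_or_lt_of_le ht.1 with rfl | h1
  · rfl
  have e1 := h.energy_gr hK hd hc ⟨h1, ht.2⟩
  have e2 := h.energy_q4 hK hd hc ⟨h1, ht.2⟩
  have e3 : ((1/2 : ℝ) * (gr (φ t)).toReal + (1/4 : ℝ) * (q4 (φ t)).toReal : ℂ) = ((1/2 : ℝ) * (gr (φ t1)).toReal + (1/4 : ℝ) * (q4 (φ t1)).toReal : ℂ) := by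
    rw [e1, e2]; push_cast; ring
  have e4 : (1/2 : ℝ) * (gr (φ t)).toReal + (1/4 : ℝ) * (q4 (φ t)).toReal = (1/2 : ℝ) * (gr (φ t1)).toReal + (1/4 : ℝ) * (q4 (φ t1)).toReal := by
    exact_mod_cast e3
  have hr : ∀ t, (en (φ t)).toReal = (1/2 : ℝ) * (gr (φ t)).toReal + (1/4 : ℝ) * (q4 (φ t)).toReal := by
    intro t
    have := gr_ne_top (h.sch t); have := q4_ne_top (h.sch t)
    rw [en, ENNReal.toReal_add (by finiteness) (by finiteness)]; simp
  rw [← ENNReal.toReal_eq_toReal_iff' (en_ne_top (h.sch t)) (en_ne_top (h.sch t1)), hr, hr, e4]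

end Sol

lemma n2_mono {f g : E3 → ℂ} {c : ℝ≥0∞} (hg : Measurable g) (h : ∀ x, ‖f x‖ₑ ≤ c * ‖g x‖ₑ) : n2 f ≤ c * n2 g := by
  rw [← ENNReal.pow_le_pow_left_iff two_ne_zero, mul_pow, n2_sq, n2_sq, ← lintegral_const_mul _ (hg.enorm.pow_const 2)]
  refine lintegral_mono fun x => ?_
  rw [← mul_pow]; gcongr; exact h x

lemma ph_diff (a b : ℝ) (h : a ≤ b) (ξ : E3) : ‖ph a ξ - ph b ξ‖ ≤ (b - a) * (4 * π ^ 2 * ‖ξ‖ ^ 2) := by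
  have e : ph a ξ - ph b ξ = - (ph a ξ * (Complex.exp (I * (((b - a) * (4 * π ^ 2 * ‖ξ‖ ^ 2) : ℝ) : ℂ)) - 1)) := by
    have : ph b ξ = ph a ξ * Complex.exp (I * (((b - a) * (4 * π ^ 2 * ‖ξ‖ ^ 2) : ℝ) : ℂ)) := by
      unfold ph; rw [← Complex.exp_add]; congr 1; push_cast; ring
    rw [this]; ring
  rw [e, norm_neg, norm_mul, ph_norm, one_mul]
  refine (Real.norm_exp_I_mul_ofReal_sub_one_le).trans ?_
  rw [Real.norm_of_nonneg]
  have := sub_nonneg.2 h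
  positivity

namespace Sol
variable {t1 t2 : ℝ} {φ : ℝ → E3 → ℂ}

lemma init_diff (h : Sol t1 t2 φ) {K C : ℝ≥0∞} (hK : K ≠ ⊤) (hC : C ≠ ⊤) (hd : ∀ s ∈ Set.Ioc t1 t2, n2 (dt φ s) ≤ K)
    (hc : ∀ s ∈ Set.Icc t1 t2, n2 (cub (φ s)) ≤ C) {t : ℝ} (ht : t ∈ Set.Ioc t1 t2) :
    n2 (fun x => φ t x - φ t1 x) ≤ ENNReal.ofReal (t - t1) * (n2 (dt φ t1) + 2 * C) := by
  have hfin := fin_of_bd hK hd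
  set v : ℝ → E3 → ℂ := fun s ξ => ph s ξ * 𝓕 (cub (φ s)) ξ with hv
  set V := tint v (Set.Ioc t1 t) with hV
  have hcm : Measurable (fun p : ℝ × E3 => 𝓕 (cub (φ p.1)) p.2) := fourier_meas (G := fun s => cub (φ s)) h.cub_meas
  have hvm : Measurable (fun p : ℝ × E3 => v p.1 p.2) := ph_cont.measurable.mul hcm
  have hvn : ∀ s, n2 (v s) = n2 (cub (φ s)) := fun s => by rw [hv]; simp only; rw [n2_ph, (h.sch s).cub.n2_fourier]
  have hsub : ∀ s ∈ Set.Ioc t1 t, s ∈ Set.Icc t1 t2 := fun s hs => ⟨hs.1.le, hs.2.trans ht.2⟩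
  have hVL : MemLp V 2 := by
    refine tint_memLp hvm ?_ ?_
    · simp
    · exact fin_of_bd hC fun s hs => (hvn s).trans_le (hc s (hsub s hs))
  have hVn : n2 V ≤ ENNReal.ofReal (t - t1) * C := by
    refine (n2_tint_le hvm hVL).trans ?_
    refine (setLIntegral_mono (g := fun _ => C) measurable_const fun s hs => (hvn s).trans_le (hc s (hsub s hs))).trans ?_
    rw [setLIntegral_const, Real.volume_Ioc, mul_comm]
  have hs1 : t1 ∈ Set.Icc t1 t2 := ⟨le_rfl, ht.1.le.trans ht.2⟩
  have hsd : Sch (fun x => φ t x - φ t1 x) := (h.sch t).sub (h.sch t1)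
  have e1 : n2 (fun x => φ t x - φ t1 x) = n2 (fun ξ => (ph t1 ξ - ph t ξ) * 𝓕 (φ t1) ξ + (-I) * V ξ) := by
    rw [← hsd.n2_fourier, ← n2_ph t]
    refine n2_congr ?_
    filter_upwards [h.duh hfin ht] with ξ hξ
    rw [fsub' (h.sch t).integrable (h.sch t1).integrable, mul_sub, hξ]
    ring
  have hphm : ∀ t, Continuous (ph t) := fun t => by unfold ph; fun_prop
  have hc1 := (h.sch t1).fourier.continuous
  have hc2 := (h.schd t1).fourier.continuous
  have hc3 := (h.sch t1).cub.fourier.continuous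
  rw [e1]
  refine (n2_add_le (((hphm t1).sub (hphm t)).mul hc1).aestronglyMeasurable (hVL.1.const_mul _)).trans ?_
  have e2 : n2 (fun ξ => (-I) * V ξ) = n2 V := by
    unfold n2; congr 1; refine lintegral_congr fun ξ => ?_
    rw [enorm_mul]; simp [enorm_eq_nnnorm]
  have e3 : n2 (fun ξ => (ph t1 ξ - ph t ξ) * 𝓕 (φ t1) ξ) ≤ ENNReal.ofReal (t - t1) * n2 (fun ξ => 𝓕 (dt φ t1) ξ + I * 𝓕 (cub (φ t1)) ξ) := by
    refine n2_mono (hc2.add (continuous_const.mul hc3)).measurable fun ξ => ?_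
    rw [h.fourier_dt hs1 ξ, ← ofReal_norm, ← ofReal_norm, ← ENNReal.ofReal_mul (sub_nonneg.2 ht.1.le)]
    refine ENNReal.ofReal_le_ofReal ?_
    rw [norm_mul]
    have : ‖-(((4 * π ^ 2 * ‖ξ‖ ^ 2 : ℝ) : ℂ) * I) * 𝓕 (φ t1) ξ - I * 𝓕 (cub (φ t1)) ξ + I * 𝓕 (cub (φ t1)) ξ‖ = (4 * π ^ 2 * ‖ξ‖ ^ 2) * ‖𝓕 (φ t1) ξ‖ := by
      rw [sub_add_cancel, norm_mul, norm_neg, norm_mul, Complex.norm_real, Complex.norm_I, Real.norm_of_nonneg (by positivity), mul_one]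
    rw [this, ← mul_assoc]
    gcongr
    exact ph_diff _ _ ht.1.le ξ
  have e4 : n2 (fun ξ => 𝓕 (dt φ t1) ξ + I * 𝓕 (cub (φ t1)) ξ) ≤ n2 (dt φ t1) + C := by
    refine (n2_add_le hc2.aestronglyMeasurable (continuous_const.mul hc3).aestronglyMeasurable).trans ?_
    rw [(h.schd t1).n2_fourier]
    gcongr
    refine le_trans (le_of_eq ?_) (hc t1 hs1)
    rw [← (h.sch t1).cub.n2_fourier]
    unfold n2; congr 1; refine lintegral_congr fun ξ => ?_
    rw [Pi.mul_apply, enorm_mul]; simp [enorm_eq_nnnorm]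
  rw [e2]
  calc _ ≤ ENNReal.ofReal (t - t1) * (n2 (dt φ t1) + C) + ENNReal.ofReal (t - t1) * C := by
        gcongr; exact e3.trans (by gcongr)
    _ = _ := by ring

lemma step (h : Sol t1 t2 φ) {K K1 : ℝ≥0∞} (hK : K ≠ ⊤) (hd : ∀ s ∈ Set.Icc t1 t2, n2 (dt φ s) ≤ K)
    (h6 : ∀ s ∈ Set.Icc t1 t2, n6 (φ s) ≤ K1) {τ δ : ℝ} (hτ : ENNReal.ofReal τ * K1 ^ 4 ≤ e2 ^ 2) (hδ : 0 ≤ δ)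
    {a b : ℝ} (ha : t1 ≤ a) (hb : b + δ ≤ t2) (hab : b - a ≤ τ) {t : ℝ} (ht : t ∈ Set.Icc a b) :
    n2 (fun x => φ (t + δ) x - φ t x) ≤ 2 * n2 (fun x => φ (a + δ) x - φ a x) := by
  have hS1 : Sol a b (fun t x => φ (t + δ) x) := (h.time δ).mono (by linarith) (by linarith)
  have hS2 : Sol a b φ := h.mono ha (by linarith)
  have hQ : ∀ c, 0 ≤ c → c ≤ δ → ∫⁻ s in Set.Ioc a b, n6 (φ (s + c)) ^ 4 ≤ e2 ^ 2 := fun c hc0 hc1 => by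
    refine (setLIntegral_mono (g := fun _ => K1 ^ 4) measurable_const fun s hs => ?_).trans ?_
    · gcongr; exact h6 _ ⟨by linarith [hs.1], by linarith [hs.2]⟩
    · rw [setLIntegral_const, Real.volume_Ioc, mul_comm]
      exact le_trans (by gcongr) hτ
  refine (lemmaD hS1 hS2 ?_ ?_ (hQ δ hδ le_rfl) (by simpa using hQ 0 le_rfl hδ)).2 t ht
  · refine fin_of_bd hK fun s hs => ?_
    have : dt (fun t x => φ (t + δ) x) s = dt φ (s + δ) := funext fun x => dt_time δ s x
    rw [this]; exact hd _ ⟨by linarith [hs.1], by linarith [hs.2]⟩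
  · exact fin_of_bd hK fun s hs => hd _ ⟨by linarith [hs.1], by linarith [hs.2]⟩

lemma steps (h : Sol t1 t2 φ) {K K1 : ℝ≥0∞} (hK : K ≠ ⊤) (hd : ∀ s ∈ Set.Icc t1 t2, n2 (dt φ s) ≤ K)
    (h6 : ∀ s ∈ Set.Icc t1 t2, n6 (φ s) ≤ K1) {τ δ : ℝ} (hτ0 : 0 ≤ τ) (hτ : ENNReal.ofReal τ * K1 ^ 4 ≤ e2 ^ 2) (hδ : 0 ≤ δ) (n : ℕ) :
    ∀ t ∈ Set.Icc t1 (t1 + n * τ), t + δ ≤ t2 →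
    n2 (fun x => φ (t + δ) x - φ t x) ≤ 2 ^ n * n2 (fun x => φ (t1 + δ) x - φ t1 x) := by
  induction n with
  | zero =>
    intro t ht _
    have : t = t1 := le_antisymm (by simpa using ht.2) ht.1
    simp [this]
  | succ n ih =>
    intro t ht htδ
    push_cast at ht
    by_cases h1 : t ≤ t1 + n * τ
    · refine (ih t ⟨ht.1, h1⟩ htδ).trans ?_
      gcongr <;> norm_num
    · push Not at h1
      have hn : 0 ≤ n * τ := by positivity
      have s1 := h.step hK hd h6 hτ hδ (a := t1 + n * τ) (b := t) (by linarith) htδ (by linarith [ht.2]) (t := t) ⟨h1.le, le_rfl⟩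
      refine s1.trans ?_
      rw [pow_succ, mul_comm (2 ^ n) 2, mul_assoc]
      gcongr
      exact ih _ ⟨by linarith, le_rfl⟩ (by linarith)

end Sol

lemma n2_fatou {f : ℕ → E3 → ℂ} {g : E3 → ℂ} {C : ℝ≥0∞} (hf : ∀ n, Measurable (f n))
    (hl : ∀ x, Tendsto (fun n => f n x) atTop (nhds (g x))) (hC : ∀ᶠ n in atTop, n2 (f n) ≤ C) : n2 g ≤ C := by
  rw [n2_eq]
  refine (Lp.eLpNorm_lim_le_liminf_eLpNorm (fun n => (hf n).aestronglyMeasurable) g (.of_forall hl)).trans ?_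
  refine (liminf_le_liminf (v := fun _ => C) ?_).trans (by simp)
  filter_upwards [hC] with n hn
  rw [← n2_eq]; exact hn

lemma gr_le_en (g : E3 → ℂ) : gr g ≤ 2 * en g := by
  unfold en
  have : (2:ℝ≥0∞) * (1/2) = 1 := by rw [one_div]; exact ENNReal.mul_inv_cancel (by norm_num) (by norm_num)
  rw [mul_add, ← mul_assoc, this, one_mul]
  exact le_self_add

/-- n6 bound by energy -/
def K6 (E : ℝ≥0∞) : ℝ≥0∞ := KS * (2 * E) ^ (1/2:ℝ)

lemma K6_ne_top {E : ℝ≥0∞} (hE : E ≠ ⊤) : K6 E ≠ ⊤ := by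
  unfold K6; have := KS_ne_top; finiteness

lemma n6_le_K6 {g : E3 → ℂ} (h : Sch g) {E : ℝ≥0∞} (hE : en g ≤ E) : n6 g ≤ K6 E := by
  refine (sobolev h).trans ?_
  unfold K6; gcongr
  exact (gr_le_en g).trans (by gcongr)

namespace Sol

lemma dt_fatou {t1 t2 : ℝ} {φ : ℝ → E3 → ℂ} (h : Sol t1 t2 φ) {t : ℝ} {u : ℕ → ℝ} (hu : Tendsto u atTop (nhds 0)) (hup : ∀ n, 0 < u n)
    {C : ℝ≥0∞} (hC : ∀ᶠ n in atTop, n2 (fun x => φ (t + u n) x - φ t x) ≤ ENNReal.ofReal (u n) * C) : n2 (dt φ t) ≤ C := by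
  refine n2_fatou (f := fun n x => ((u n)⁻¹ : ℝ) • (φ (t + u n) x - φ t x)) (fun n => ?_) (fun x => ?_) ?_
  · exact Measurable.const_smul (g := fun x => φ (t + u n) x - φ t x) ((slice_meas h.meas _).sub (slice_meas h.meas _)) ((u n)⁻¹ : ℝ)
  · have := hasDerivAt_iff_tendsto_slope_zero.1 (h.hd t x)
    refine this.comp ?_
    rw [tendsto_nhdsWithin_iff]
    exact ⟨hu, .of_forall fun n => (hup n).ne'⟩
  · filter_upwards [hC] with n hn
    have hm : Measurable (fun x => φ (t + u n) x - φ t x) := (slice_meas h.meas _).sub (slice_meas h.meas _)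
    have := n2_mono (f := fun x => ((u n)⁻¹ : ℝ) • (φ (t + u n) x - φ t x)) (c := ENNReal.ofReal (u n)⁻¹) hm
      (fun x => by rw [enorm_smul, Real.enorm_of_nonneg (inv_nonneg.2 (hup n).le)])
    refine this.trans ?_
    calc _ ≤ ENNReal.ofReal (u n)⁻¹ * (ENNReal.ofReal (u n) * C) := by gcongr
      _ = C := by
        rw [← mul_assoc, ← ENNReal.ofReal_mul (inv_nonneg.2 (hup n).le), inv_mul_cancel₀ (hup n).ne']; simp

/-- local in time bound -/
lemma bound (E D : ℝ≥0∞) (hE : E ≠ ⊤) (hD : D ≠ ⊤) (L : ℝ) : ∃ M : ℝ≥0∞, M ≠ ⊤ ∧ ∀ (t1 t2 : ℝ) (φ : ℝ → E3 → ℂ) (K : ℝ≥0∞),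
    Sol t1 t2 φ → t2 - t1 ≤ L → K ≠ ⊤ → (∀ s ∈ Set.Icc t1 t2, n2 (dt φ s) ≤ K ∧ en (φ s) ≤ K) →
    en (φ t1) ≤ E → n2 (dt φ t1) ≤ D → ∀ t ∈ Set.Icc t1 t2, n2 (dt φ t) ≤ M ∧ en (φ t) ≤ E := by
  have hK6 := K6_ne_top hE
  obtain ⟨τ, hτ0, hτ⟩ : ∃ τ : ℝ, 0 < τ ∧ ENNReal.ofReal τ * K6 E ^ 4 ≤ e2 ^ 2 := by
    have h1 : Tendsto (fun τ : ℝ => ENNReal.ofReal τ * K6 E ^ 4) (nhdsWithin 0 (Set.Ioi 0)) (nhds (ENNReal.ofReal 0 * K6 E ^ 4)) := by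
      refine ENNReal.Tendsto.mul_const ?_ (Or.inr (by finiteness))
      exact (ENNReal.tendsto_ofReal tendsto_id).mono_left nhdsWithin_le_nhds
    have h2 : ENNReal.ofReal 0 * K6 E ^ 4 < e2 ^ 2 := by
      simp only [ENNReal.ofReal_zero, zero_mul]
      exact pos_iff_ne_zero.2 (pow_ne_zero _ e2_ne_zero)
    have h3 := (h1.eventually (gt_mem_nhds h2)).and self_mem_nhdsWithin
    obtain ⟨τ, h4, h5⟩ := h3.exists
    exact ⟨τ, h5, h4.le⟩
  obtain ⟨n, hn⟩ := exists_nat_ge (L / τ)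
  have hnL : L ≤ n * τ := by rwa [div_le_iff₀ hτ0] at hn
  refine ⟨2 ^ n * (D + 2 * K6 E ^ 3), by finiteness, ?_⟩
  intro t1 t2 φ K h hL hK hb hE1 hD1
  have henK : ∀ s ∈ Set.Icc t1 t2, n2 (cub (φ s)) ≤ K6 K ^ 3 := fun s hs => by
    rw [n2_cub]; gcongr; exact n6_le_K6 (h.sch s) (hb s hs).2
  have hen : ∀ t ∈ Set.Icc t1 t2, en (φ t) ≤ E := by
    intro t ht
    have hK6K := K6_ne_top hK
    rw [h.energy (K := K + K6 K ^ 3) (by finiteness) (fun s hs => (hb s ⟨hs.1.le, hs.2⟩).1.trans le_self_add)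
      (fun s hs => (henK s ⟨hs.1.le, hs.2⟩).trans le_add_self) ht]
    exact hE1
  have h6 : ∀ t ∈ Set.Icc t1 t2, n6 (φ t) ≤ K6 E := fun t ht => n6_le_K6 (h.sch t) (hen t ht)
  have hcE : ∀ s ∈ Set.Icc t1 t2, n2 (cub (φ s)) ≤ K6 E ^ 3 := fun s hs => by
    rw [n2_cub]; gcongr; exact h6 s hs
  have hu : Tendsto (fun m : ℕ => ((m:ℝ) + 1)⁻¹) atTop (nhds 0) := by
    simpa [one_div] using tendsto_one_div_add_atTop_nhds_zero_nat (𝕜 := ℝ)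
  have hlt : ∀ t ∈ Set.Ico t1 t2, n2 (dt φ t) ≤ 2 ^ n * (D + 2 * K6 E ^ 3) := by
    intro t ht
    refine h.dt_fatou hu (fun m => by positivity) ?_
    filter_upwards [hu.eventually (gt_mem_nhds (sub_pos.2 ht.2))] with m hm
    set δ := ((m:ℝ) + 1)⁻¹
    have hδ : 0 < δ := by positivity
    refine (h.steps hK (fun s hs => (hb s hs).1) h6 hτ0.le hτ hδ.le n t ⟨ht.1, by linarith [ht.2]⟩ (by linarith)).trans ?_
    have := h.init_diff hK (by finiteness) (fun s hs => (hb s ⟨hs.1.le, hs.2⟩).1) hcE (t := t1 + δ) ⟨by linarith, by linarith [ht.1]⟩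
    rw [add_sub_cancel_left] at this
    calc _ ≤ 2 ^ n * (ENNReal.ofReal δ * (n2 (dt φ t1) + 2 * K6 E ^ 3)) := by gcongr
      _ ≤ 2 ^ n * (ENNReal.ofReal δ * (D + 2 * K6 E ^ 3)) := by gcongr
      _ = _ := by ring
  intro t ht
  refine ⟨?_, hen t ht⟩
  rcases lt_or_eq_of_le ht.2 with h2 | rfl
  · exact hlt t ⟨ht.1, h2⟩
  rcases eq_or_lt_of_le ht.1 with rfl | h1
  · refine hD1.trans (le_self_add.trans (le_mul_of_one_le_left' (one_le_pow₀ (by norm_num))))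
  · refine n2_fatou (f := fun m : ℕ => dt φ (t - ((m:ℝ) + 1)⁻¹)) (fun m => slice_meas h.dt_meas _) (fun x => ?_) ?_
    · have c1 : Continuous (fun s => dt φ s x) := h.dt_cont.comp (continuous_id.prodMk continuous_const)
      have := (c1.tendsto (t - 0)).comp (tendsto_const_nhds.sub hu)
      simpa [Function.comp_def] using this
    · filter_upwards [hu.eventually (gt_mem_nhds (sub_pos.2 h1))] with m hm
      have hδ : (0:ℝ) < ((m:ℝ) + 1)⁻¹ := by positivity
      exact hlt _ ⟨by linarith, by linarith⟩

end Sol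

lemma lsc_lint {F : ℝ → E3 → ℂ} (hF : Continuous (fun p : ℝ × E3 => F p.1 p.2)) (k : ℕ) :
    LowerSemicontinuous (fun t => ∫⁻ x, ‖F t x‖ₑ ^ k) := by
  rw [lowerSemicontinuous_iff_isClosed_preimage]
  intro C
  refine IsSeqClosed.isClosed ?_
  intro u t hu hl
  have hm : ∀ n, Measurable (fun x => ‖F (u n) x‖ₑ ^ k) := fun n =>
    ((slice_meas (v := F) hF.measurable (u n)).enorm.pow_const _)
  have h1 : ∀ x, Tendsto (fun n => ‖F (u n) x‖ₑ ^ k) atTop (nhds (‖F t x‖ₑ ^ k)) := by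
    intro x
    have c1 : Continuous (fun s => ‖F s x‖ₑ ^ k) :=
      (ENNReal.continuous_pow k).comp (continuous_enorm.comp (hF.comp (continuous_id.prodMk continuous_const)))
    exact (c1.tendsto t).comp hl
  have h2 : ∫⁻ x, ‖F t x‖ₑ ^ k = ∫⁻ x, liminf (fun n => ‖F (u n) x‖ₑ ^ k) atTop := by
    refine lintegral_congr fun x => ((h1 x).liminf_eq).symm
  simp only [Set.mem_preimage, Set.mem_Iic]
  rw [h2]
  refine (lintegral_liminf_le hm).trans ?_
  refine (liminf_le_liminf (v := fun _ => C) (.of_forall fun n => hu n)).trans (by simp)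

/-- abstract bootstrapping by Baire category -/
lemma baire_bound {p : ℝ → ℝ≥0∞} {T : ℝ} (hl : LowerSemicontinuous p) (hf : ∀ t, p t ≠ ⊤)
    (hP : ∀ K : ℝ≥0∞, K ≠ ⊤ → ∃ M : ℝ≥0∞, M ≠ ⊤ ∧ ∀ a ∈ Set.Icc 0 T, ∀ b ∈ Set.Icc 0 T,
      (∃ K' : ℝ≥0∞, K' ≠ ⊤ ∧ ∀ s ∈ Set.uIcc a b, p s ≤ K') → p a ≤ K → p b ≤ M) :
    ∃ K : ℝ≥0∞, K ≠ ⊤ ∧ ∀ t ∈ Set.Icc 0 T, p t ≤ K := by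
  set LB : ℝ → Prop := fun t => ∃ K : ℝ≥0∞, K ≠ ⊤ ∧ ∀ᶠ s in nhds t, s ∈ Set.Icc 0 T → p s ≤ K with hLB
  have hcomp : ∀ S : Set ℝ, IsCompact S → S ⊆ Set.Icc 0 T → (∀ t ∈ S, LB t) → ∃ K : ℝ≥0∞, K ≠ ⊤ ∧ ∀ t ∈ S, p t ≤ K := by
    intro S hS hST hL
    refine hS.induction_on (p := fun S => ∃ K : ℝ≥0∞, K ≠ ⊤ ∧ ∀ t ∈ S, p t ≤ K) ⟨0, by simp, by simp⟩ ?_ ?_ ?_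
    · rintro A B hAB ⟨K, hK, h⟩; exact ⟨K, hK, fun t ht => h t (hAB ht)⟩
    · rintro A B ⟨K, hK, h⟩ ⟨K', hK', h'⟩
      refine ⟨K + K', by finiteness, ?_⟩
      rintro t (ht | ht)
      · exact (h t ht).trans le_self_add
      · exact (h' t ht).trans le_add_self
    · intro x hx
      obtain ⟨K, hK, h⟩ := hL x hx
      refine ⟨{s | s ∈ S ∧ p s ≤ K}, ?_, K, hK, fun t ht => ht.2⟩
      rw [← eventually_mem_set]
      filter_upwards [h.filter_mono nhdsWithin_le_nhds, self_mem_nhdsWithin] with s h1 h2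
      exact ⟨h2, h1 (hST h2)⟩
  refine hcomp _ isCompact_Icc le_rfl ?_
  set F : Set ℝ := {t | t ∈ Set.Icc 0 T ∧ ¬ LB t} with hF
  have hFc : IsClosed F := by
    have h1 : IsOpen {t | LB t} := by
      rw [isOpen_iff_eventually]
      rintro t ⟨K, hK, h⟩
      filter_upwards [eventually_eventually_nhds.2 h] with s hs
      exact ⟨K, hK, hs⟩
    exact isClosed_Icc.inter h1.isClosed_compl
  by_contra hne
  push Not at hne
  obtain ⟨t', ht', hb'⟩ := hne
  haveI : Nonempty F := ⟨⟨t', ht', hb'⟩⟩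
  haveI : CompleteSpace F := hFc.completeSpace_coe
  obtain ⟨n, x0, hx0⟩ := nonempty_interior_of_iUnion_of_closed (X := F) (f := fun n : ℕ => {x : F | p x ≤ n})
    (fun n => (lowerSemicontinuous_iff_isClosed_preimage.1 hl (n : ℝ≥0∞)).preimage continuous_subtype_val)
    (by
      ext x
      simp only [Set.mem_iUnion, Set.mem_setOf_eq, Set.mem_univ, iff_true]
      obtain ⟨n, hn⟩ := ENNReal.exists_nat_gt (hf x)
      exact ⟨n, hn.le⟩)
  obtain ⟨t0, ht0F⟩ := x0
  rw [mem_interior_iff_mem_nhds, Metric.mem_nhds_iff] at hx0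
  obtain ⟨ε, hε, hball⟩ := hx0
  have hK : ∀ t ∈ F, |t - t0| < ε → p t ≤ n := by
    intro t ht h
    exact hball (show (⟨t, ht⟩ : F) ∈ Metric.ball (⟨t0, ht0F⟩ : F) ε by
      rw [Metric.mem_ball, Subtype.dist_eq, Real.dist_eq]; exact h)
  obtain ⟨M, hM, hMP⟩ := hP n (by simp)
  apply ht0F.2
  refine ⟨n + M, by finiteness, ?_⟩
  filter_upwards [Metric.ball_mem_nhds t0 hε] with t htb htT
  rw [Metric.mem_ball, Real.dist_eq] at htb
  by_cases htF : t ∈ F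
  · exact (hK t htF htb).trans le_self_add
  refine le_trans ?_ le_add_self
  obtain ⟨c, hc, hcmin⟩ := ((isCompact_uIcc (a := t0) (b := t)).inter_left hFc).exists_isMinOn (f := fun c => |c - t|)
    ⟨t0, ht0F, Set.left_mem_uIcc⟩ (by fun_prop)
  have hcT : c ∈ Set.Icc 0 T := hc.1.1
  have hsub : ∀ x ∈ Set.Icc 0 T, Set.uIcc x t ⊆ Set.Icc 0 T := fun x hx => Set.uIcc_subset_Icc hx htT
  have hgood : ∀ x ∈ Set.uIcc c t, x ≠ c → x ∉ F := by
    intro x hx hxc hxF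
    have h1 : x ∈ Set.uIcc t0 t := (Set.uIcc_subset_uIcc hc.2 Set.right_mem_uIcc) hx
    have h2 : |c - t| ≤ |x - t| := hcmin ⟨hxF, h1⟩
    rcases Set.mem_uIcc.1 hx with h | h
    · rw [abs_of_nonpos (by linarith), abs_of_nonpos (by linarith)] at h2
      exact hxc (by linarith)
    · rw [abs_of_nonneg (by linarith), abs_of_nonneg (by linarith)] at h2
      exact hxc (by linarith)
  obtain ⟨M', hM', hMP'⟩ := hP (p t) (hf t)
  refine hMP c hcT t htT ⟨p c + M', ?_, ?_⟩ (hK c hc.1 ?_)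
  · have := hf c; finiteness
  · intro x hx
    by_cases hxc : x = c
    · rw [hxc]; exact le_self_add
    · refine le_trans ?_ le_add_self
      have hxT : x ∈ Set.Icc 0 T := hsub c hcT hx
      refine hMP' t htT x hxT ?_ le_rfl
      rw [Set.uIcc_comm]
      refine hcomp _ isCompact_uIcc (hsub x hxT) fun y hy => ?_
      by_contra hyb
      refine hgood y ((Set.uIcc_subset_uIcc hx Set.right_mem_uIcc) hy) ?_ ⟨hsub x hxT hy, hyb⟩
      rintro rfl
      apply hxc
      rcases Set.mem_uIcc.1 hx with h | h <;> rcases Set.mem_uIcc.1 hy with h' | h' <;> linarith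
  · rcases Set.mem_uIcc.1 hc.2 with h | h
    · rw [abs_of_nonneg (by linarith)]; rw [abs_of_nonneg (by linarith)] at htb; linarith
    · rw [abs_of_nonpos (by linarith)]; rw [abs_of_nonpos (by linarith)] at htb; linarith

namespace Sol
variable {t1 t2 : ℝ} {φ : ℝ → E3 → ℂ}

/-- uniform bounds on the whole time interval -/
lemma unif {T : ℝ} (h : Sol 0 T φ) : ∃ K : ℝ≥0∞, K ≠ ⊤ ∧ ∀ t ∈ Set.Icc 0 T, n2 (dt φ t) ≤ K ∧ en (φ t) ≤ K := by
  have hlsc : LowerSemicontinuous (fun t => n2 (dt φ t) + en (φ t)) := by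
    refine LowerSemicontinuous.add ?_ ?_
    · unfold n2
      exact (ENNReal.continuous_rpow_const (y := (1/2:ℝ))).comp_lowerSemicontinuous (lsc_lint h.dt_cont 2)
        (fun a b hab => ENNReal.rpow_le_rpow hab (by norm_num))
    · unfold en
      refine LowerSemicontinuous.add ?_ ?_
      · refine (ENNReal.continuous_const_mul (by norm_num)).comp_lowerSemicontinuous ?_ (fun a b hab => mul_le_mul_right hab _)
        unfold gr
        refine lowerSemicontinuous_sum fun j _ => ?_
        simp only [n2_sq]
        exact lsc_lint (h.pd_cont j) 2
      · refine (ENNReal.continuous_const_mul (by norm_num)).comp_lowerSemicontinuous ?_ (fun a b hab => mul_le_mul_right hab _)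
        exact lsc_lint h.cont 4
  obtain ⟨K, hK, hb⟩ := baire_bound (T := T) hlsc (fun t => ENNReal.add_ne_top.2 ⟨n2_sch_ne_top (h.schd t), en_ne_top (h.sch t)⟩) (by
    intro K hK
    obtain ⟨M, hM, hMb⟩ := bound K K hK hK T
    refine ⟨M + K, by finiteness, ?_⟩
    rintro a ha b hb ⟨K', hK', hK'b⟩ haK
    rcases le_total a b with hab | hab
    · rw [Set.uIcc_of_le hab] at hK'b
      have := hMb a b φ K' (h.mono ha.1 hb.2) (by linarith [ha.1, hb.2]) hK'
        (fun s hs => ⟨le_self_add.trans (hK'b s hs), le_add_self.trans (hK'b s hs)⟩)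
        (le_add_self.trans haK) (le_self_add.trans haK) b ⟨hab, le_rfl⟩
      exact add_le_add this.1 this.2
    · rw [Set.uIcc_of_ge hab] at hK'b
      have e1 : ∀ t, n2 (dt (fun t x => (starRingEnd ℂ) (φ (-t) x)) t) = n2 (dt φ (-t)) := by
        intro t; rw [← n2_conj (dt φ (-t))]; unfold n2; simp only [dt_rev, enorm_neg]
      have e2 : ∀ g : E3 → ℂ, en (fun x => (starRingEnd ℂ) (g x)) = en g := by
        intro g; unfold en gr q4
        congr 2
        · refine Finset.sum_congr rfl fun j _ => ?_
          rw [← n2_conj (pd g j)]; congr 2; ext x; exact pd_conj g j x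
        · simp only [enorm_conj']
      have := hMb (-a) (-b) _ K' (h.mono hb.1 ha.2).rev (by linarith [hb.1, ha.2]) hK'
        (fun s hs => by
          rw [e1, e2]
          have hs' : -s ∈ Set.Icc b a := ⟨by linarith [hs.2], by linarith [hs.1]⟩
          exact ⟨le_self_add.trans (hK'b _ hs'), le_add_self.trans (hK'b _ hs')⟩)
        (by rw [e2, neg_neg]; exact le_add_self.trans haK) (by rw [e1, neg_neg]; exact le_self_add.trans haK)
        (-b) ⟨by linarith, le_rfl⟩
      rw [e1, e2, neg_neg] at this
      exact add_le_add this.1 this.2)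
  exact ⟨K, hK, fun t ht => ⟨le_self_add.trans (hb t ht), le_add_self.trans (hb t ht)⟩⟩

end Sol

lemma lint_jensen {α : Type*} [MeasurableSpace α] (μ : Measure α) {g : α → ℝ≥0∞} (hg : AEMeasurable g μ) {p : ℝ} (hp : 1 < p) :
    (∫⁻ a, g a ∂μ) ^ p ≤ μ Set.univ ^ (p - 1) * ∫⁻ a, g a ^ p ∂μ := by
  have hpq : p.HolderConjugate p.conjExponent := Real.HolderConjugate.conjExponent hp
  have h := ENNReal.lintegral_mul_le_Lp_mul_Lq μ hpq hg (g := fun _ => 1) aemeasurable_const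
  simp only [Pi.mul_apply, mul_one, ENNReal.one_rpow, lintegral_one] at h
  have hp0 : 0 < p := by linarith
  have h2 := ENNReal.rpow_le_rpow h hp0.le
  rw [ENNReal.mul_rpow_of_nonneg _ _ hp0.le, ← ENNReal.rpow_mul, ← ENNReal.rpow_mul] at h2
  have e1 : 1 / p * p = 1 := by field_simp
  have e2 : 1 / p.conjExponent * p = p - 1 := by
    have : p - 1 ≠ 0 := by linarith
    rw [Real.conjExponent]; field_simp
  rw [e1, e2, ENNReal.rpow_one, mul_comm] at h2
  exact h2

lemma lint_jensen3 {α : Type*} [MeasurableSpace α] (μ : Measure α) {g : α → ℝ≥0∞} (hg : AEMeasurable g μ) :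
    (∫⁻ a, g a ∂μ) ^ 3 ≤ μ Set.univ ^ 2 * ∫⁻ a, g a ^ 3 ∂μ := by
  have := lint_jensen μ hg (p := 3) (by norm_num)
  norm_num at this
  exact_mod_cast this

lemma lint_jensen4 {α : Type*} [MeasurableSpace α] (μ : Measure α) {g : α → ℝ≥0∞} (hg : AEMeasurable g μ) :
    (∫⁻ a, g a ∂μ) ^ 4 ≤ μ Set.univ ^ 3 * ∫⁻ a, g a ^ 4 ∂μ := by
  have := lint_jensen μ hg (p := 4) (by norm_num)
  norm_num at this
  exact_mod_cast this

lemma lint_jensen43 {α : Type*} [MeasurableSpace α] (μ : Measure α) {g k : α → ℝ≥0∞} (hg : AEMeasurable g μ)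
    (hk : ∀ a, g a ^ 4 ≤ k a ^ 3) :
    (∫⁻ a, g a ∂μ) ^ 4 ≤ μ Set.univ * (∫⁻ a, k a ∂μ) ^ 3 := by
  have h := lint_jensen μ hg (p := 4/3) (by norm_num)
  have h1 : ∫⁻ a, g a ^ (4/3:ℝ) ∂μ ≤ ∫⁻ a, k a ∂μ := by
    refine lintegral_mono fun a => ?_
    rw [← ENNReal.pow_le_pow_left_iff (n := 3) (by norm_num), ← ENNReal.rpow_natCast, ← ENNReal.rpow_mul]
    norm_num
    exact_mod_cast hk a
  have h2 : (∫⁻ a, g a ∂μ) ^ (4/3:ℝ) ≤ μ Set.univ ^ (4/3 - 1:ℝ) * ∫⁻ a, k a ∂μ := h.trans (by gcongr)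
  have h3 := pow_le_pow_left₀ (by simp) h2 3
  rw [mul_pow, ← ENNReal.rpow_natCast, ← ENNReal.rpow_mul, ← ENNReal.rpow_natCast (μ Set.univ ^ _), ← ENNReal.rpow_mul] at h3
  norm_num at h3
  exact_mod_cast h3

/-- L3 interpolation -/
lemma l3_interp {g : E3 → ℂ} (hg : Measurable g) : (∫⁻ x, ‖g x‖ₑ ^ 3) ^ 4 ≤ (n2 g ^ 2 * n6 g ^ 2) ^ 3 := by
  have h1 := lint_cs volume (f := fun x => ‖g x‖ₑ) (g := fun x => ‖g x‖ₑ ^ 2) hg.enorm.aemeasurable (hg.enorm.pow_const 2).aemeasurable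
  have h2 := lint_cs volume (f := fun x => ‖g x‖ₑ) (g := fun x => ‖g x‖ₑ ^ 3) hg.enorm.aemeasurable (hg.enorm.pow_const 3).aemeasurable
  simp only [← pow_mul, ← pow_succ'] at h1 h2
  norm_num at h1 h2
  have e : (n2 g ^ 2 * n6 g ^ 2) ^ 3 = (∫⁻ x, ‖g x‖ₑ ^ 2) ^ 3 * ∫⁻ x, ‖g x‖ₑ ^ 6 := by
    rw [mul_pow, n2_sq, ← pow_mul, n6_pow6]; rfl
  rw [e]
  calc (∫⁻ x, ‖g x‖ₑ ^ 3) ^ 4 = ((∫⁻ x, ‖g x‖ₑ ^ 3) ^ 2) ^ 2 := by ring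
    _ ≤ ((∫⁻ x, ‖g x‖ₑ ^ 2) * ∫⁻ x, ‖g x‖ₑ ^ 4) ^ 2 := by gcongr
    _ = (∫⁻ x, ‖g x‖ₑ ^ 2) ^ 2 * (∫⁻ x, ‖g x‖ₑ ^ 4) ^ 2 := by ring
    _ ≤ (∫⁻ x, ‖g x‖ₑ ^ 2) ^ 2 * ((∫⁻ x, ‖g x‖ₑ ^ 2) * ∫⁻ x, ‖g x‖ₑ ^ 6) := by gcongr
    _ = _ := by ring

/-- volume of ball -/
def V (r : ℝ) : ℝ≥0∞ := volume (Metric.ball (0:E3) r)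

lemma V_eq {r : ℝ} (hr : 0 < r) : V r = ENNReal.ofReal r ^ 3 * V 1 := by
  rw [V, V, Measure.addHaar_ball _ _ hr.le, ← ENNReal.ofReal_pow hr.le]; simp

lemma V_ne_top (r : ℝ) : V r ≠ ⊤ := measure_ball_lt_top.ne

lemma V_ne_zero {r : ℝ} (hr : 0 < r) : V r ≠ 0 := (Metric.measure_ball_pos _ _ hr).ne'

lemma V_two {r : ℝ} (hr : 0 < r) : V (2 * r) = 8 * V r := by
  rw [V_eq hr, V_eq (by positivity), ENNReal.ofReal_mul (by norm_num)]
  norm_num; ring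

/-- ball average -/
def Mb (r : ℝ) (u : E3 → ℝ≥0∞) (x : E3) : ℝ≥0∞ := (V r)⁻¹ * ∫⁻ y in Metric.ball (0:E3) r, u (x + y)

/-- averaged difference -/
def Db (r : ℝ) (f : E3 → ℂ) (x : E3) : ℝ≥0∞ :=
  (V r)⁻¹ * ((V (2 * r))⁻¹ * ∫⁻ y in Metric.ball (0:E3) r, ∫⁻ h in Metric.ball (0:E3) (4 * r), ‖f (x + y + h) - f (x + y)‖ₑ)

lemma Mb_step {r : ℝ} (hr : 0 < r) {f : E3 → ℂ} (hf : Continuous f) (x : E3) :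
    Mb r (fun x => ‖f x‖ₑ) x ≤ Mb (2 * r) (fun x => ‖f x‖ₑ) x + Db r f x := by
  have hV := V_ne_zero hr
  have hVt := V_ne_top r
  have hV2 := V_ne_zero (show 0 < 2 * r by positivity)
  have hV2t := V_ne_top (2 * r)
  have key : ∀ y ∈ Metric.ball (0:E3) r, ‖f (x + y)‖ₑ ≤ Mb (2 * r) (fun x => ‖f x‖ₑ) x +
      (V (2 * r))⁻¹ * ∫⁻ h in Metric.ball (0:E3) (4 * r), ‖f (x + y + h) - f (x + y)‖ₑ := by
    intro y hy
    have h1 : ‖f (x + y)‖ₑ = (V (2 * r))⁻¹ * ∫⁻ z in Metric.ball (0:E3) (2 * r), ‖f (x + y)‖ₑ := by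
      rw [lintegral_const, Measure.restrict_apply_univ]
      change _ = (V (2 * r))⁻¹ * (_ * V (2 * r))
      rw [mul_comm, mul_assoc, ENNReal.mul_inv_cancel hV2 hV2t, mul_one]
    rw [h1, Mb, ← mul_add]
    refine mul_le_mul_right ?_ _
    calc ∫⁻ z in Metric.ball (0:E3) (2 * r), ‖f (x + y)‖ₑ
        ≤ ∫⁻ z in Metric.ball (0:E3) (2 * r), (‖f (x + z)‖ₑ + ‖f (x + z) - f (x + y)‖ₑ) := by
          refine lintegral_mono fun z => ?_
          have : f (x + y) = f (x + z) - (f (x + z) - f (x + y)) := by ring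
          calc ‖f (x + y)‖ₑ = ‖f (x + z) - (f (x + z) - f (x + y))‖ₑ := by rw [← this]
            _ ≤ _ := enorm_sub_le
      _ = (∫⁻ z in Metric.ball (0:E3) (2 * r), ‖f (x + z)‖ₑ) + ∫⁻ z in Metric.ball (0:E3) (2 * r), ‖f (x + z) - f (x + y)‖ₑ := by
          refine lintegral_add_left ?_ _
          exact (hf.comp (continuous_const.add continuous_id)).enorm.measurable
      _ ≤ _ := by
          refine add_le_add le_rfl ?_
          rw [← lintegral_indicator Metric.isOpen_ball.measurableSet, ← lintegral_indicator Metric.isOpen_ball.measurableSet,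
            ← lintegral_add_left_eq_self _ y]
          refine lintegral_mono fun h => ?_
          by_cases hh : y + h ∈ Metric.ball (0:E3) (2 * r)
          · have h4 : h ∈ Metric.ball (0:E3) (4 * r) := by
              rw [mem_ball_zero_iff] at *
              have : h = (y + h) - y := by abel
              rw [this]
              linarith [norm_sub_le (y + h) y]
            rw [Set.indicator_of_mem hh, Set.indicator_of_mem h4, add_assoc]
          · rw [Set.indicator_of_notMem hh]; simp
  unfold Db
  calc Mb r (fun x => ‖f x‖ₑ) x ≤ (V r)⁻¹ * ∫⁻ y in Metric.ball (0:E3) r, (Mb (2 * r) (fun x => ‖f x‖ₑ) x +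
      (V (2 * r))⁻¹ * ∫⁻ h in Metric.ball (0:E3) (4 * r), ‖f (x + y + h) - f (x + y)‖ₑ) := by
        unfold Mb
        refine mul_le_mul_right ?_ _
        refine setLIntegral_mono' Metric.isOpen_ball.measurableSet fun y hy => key y hy
    _ = _ := by
        rw [lintegral_add_left measurable_const, lintegral_const, Measure.restrict_apply_univ, mul_add, lintegral_const_mul' _ _ (by finiteness)]
        congr 1
        change (V r)⁻¹ * (_ * V r) = _
        rw [mul_comm, mul_assoc, ENNReal.mul_inv_cancel hV hVt, mul_one]

section
variable {f : E3 → ℂ} {r : ℝ}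

/-- averaged cubes of differences -/
def L3 (r : ℝ) (f : E3 → ℂ) : ℝ≥0∞ := ∫⁻ h in Metric.ball (0:E3) (4 * r), ∫⁻ x, ‖f (x + h) - f x‖ₑ ^ 3

lemma diff_meas (hf : Continuous f) (x : E3) : Measurable (fun p : E3 × E3 => ‖f (x + p.1 + p.2) - f (x + p.1)‖ₑ) := by
  apply Continuous.measurable; fun_prop

lemma Db_meas (hf : Continuous f) : Measurable (Db r f) := by
  have h0 : Measurable (fun p : (E3 × E3) × E3 => ‖f (p.1.1 + p.1.2 + p.2) - f (p.1.1 + p.1.2)‖ₑ) := by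
    apply Continuous.measurable; fun_prop
  have h1 : Measurable (fun p : E3 × E3 => ∫⁻ h in Metric.ball (0:E3) (4 * r), ‖f (p.1 + p.2 + h) - f (p.1 + p.2)‖ₑ) :=
    h0.lintegral_prod_right'
  have h2 : Measurable (fun x : E3 => ∫⁻ y in Metric.ball (0:E3) r, ∫⁻ h in Metric.ball (0:E3) (4 * r), ‖f (x + y + h) - f (x + y)‖ₑ) :=
    h1.lintegral_prod_right'
  exact (h2.const_mul _).const_mul _

lemma Db_three (hr : 0 < r) (hf : Continuous f) (x : E3) :
    Db r f x ^ 3 ≤ 8 * (V r)⁻¹ ^ 2 * ∫⁻ y in Metric.ball (0:E3) r, ∫⁻ h in Metric.ball (0:E3) (4 * r), ‖f (x + y + h) - f (x + y)‖ₑ ^ 3 := by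
  have hV := V_ne_zero hr
  have hVt := V_ne_top r
  have hm := diff_meas hf x
  have h1 := lint_jensen3 (volume.restrict (Metric.ball (0:E3) r))
    (g := fun y => ∫⁻ h in Metric.ball (0:E3) (4 * r), ‖f (x + y + h) - f (x + y)‖ₑ) (by
      exact (hm.lintegral_prod_right' (ν := volume.restrict (Metric.ball (0:E3) (4 * r)))).aemeasurable)
  rw [Measure.restrict_apply_univ] at h1
  have h2 : ∀ y, (∫⁻ h in Metric.ball (0:E3) (4 * r), ‖f (x + y + h) - f (x + y)‖ₑ) ^ 3 ≤
      (64 * V r) ^ 2 * ∫⁻ h in Metric.ball (0:E3) (4 * r), ‖f (x + y + h) - f (x + y)‖ₑ ^ 3 := by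
    intro y
    have := lint_jensen3 (volume.restrict (Metric.ball (0:E3) (4 * r))) (g := fun h => ‖f (x + y + h) - f (x + y)‖ₑ)
      (by exact (hm.comp (measurable_const.prodMk measurable_id)).aemeasurable)
    refine this.trans (mul_le_mul_left ?_ _)
    rw [Measure.restrict_apply_univ]
    change V (4 * r) ^ 2 ≤ _
    rw [show 4 * r = 2 * (2 * r) by ring, V_two (by positivity), V_two hr]
    apply le_of_eq; ring
  have h3 : ∫⁻ y in Metric.ball (0:E3) r, (∫⁻ h in Metric.ball (0:E3) (4 * r), ‖f (x + y + h) - f (x + y)‖ₑ) ^ 3 ≤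
      (64 * V r) ^ 2 * ∫⁻ y in Metric.ball (0:E3) r, ∫⁻ h in Metric.ball (0:E3) (4 * r), ‖f (x + y + h) - f (x + y)‖ₑ ^ 3 := by
    rw [← lintegral_const_mul' _ _ (by finiteness)]
    exact lintegral_mono h2
  change _ ≤ V r ^ 2 * _ at h1
  unfold Db
  rw [V_two hr, ENNReal.mul_inv (by simp) (by simp)]
  generalize (∫⁻ y in Metric.ball (0:E3) r, ∫⁻ h in Metric.ball (0:E3) (4 * r), ‖f (x + y + h) - f (x + y)‖ₑ) = I1 at *
  generalize (∫⁻ y in Metric.ball (0:E3) r, (∫⁻ h in Metric.ball (0:E3) (4 * r), ‖f (x + y + h) - f (x + y)‖ₑ) ^ 3) = I2 at *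
  generalize (∫⁻ y in Metric.ball (0:E3) r, ∫⁻ h in Metric.ball (0:E3) (4 * r), ‖f (x + y + h) - f (x + y)‖ₑ ^ 3) = I3 at *
  have e1 : (V r)⁻¹ * V r = 1 := ENNReal.inv_mul_cancel hV hVt
  have e2 : (8:ℝ≥0∞)⁻¹ * 8 = 1 := ENNReal.inv_mul_cancel (by simp) (by simp)
  generalize (V r)⁻¹ = a at *
  generalize (8:ℝ≥0∞)⁻¹ = b at *
  calc (a * (b * a * I1)) ^ 3 = (a * (b * a)) ^ 3 * I1 ^ 3 := by ring
    _ ≤ (a * (b * a)) ^ 3 * (V r ^ 2 * ((64 * V r) ^ 2 * I3)) := by gcongr; exact h1.trans (by gcongr)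
    _ = 8 * (b * 8) ^ 3 * (a * V r) ^ 4 * a ^ 2 * I3 := by ring
    _ = _ := by rw [e1, e2]; ring

lemma Db_sup (hr : 0 < r) (hf : Continuous f) (x : E3) : Db r f x ^ 3 ≤ 8 * (V r)⁻¹ ^ 2 * L3 r f := by
  refine (Db_three hr hf x).trans (mul_le_mul_right ?_ _)
  rw [lintegral_lintegral_swap (by exact ((diff_meas hf x).pow_const 3).aemeasurable)]
  refine lintegral_mono fun h => ?_
  refine (setLIntegral_le_lintegral _ _).trans ?_
  exact (lintegral_add_left_eq_self (fun z => ‖f (z + h) - f z‖ₑ ^ 3) x).le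

lemma Db_int (hr : 0 < r) (hf : Continuous f) : ∫⁻ x, Db r f x ^ 3 ≤ 8 * (V r)⁻¹ * L3 r f := by
  have hV := V_ne_zero hr
  have hVt := V_ne_top r
  have h0 : Measurable (fun p : (E3 × E3) × E3 => ‖f (p.1.1 + p.1.2 + p.2) - f (p.1.1 + p.1.2)‖ₑ ^ 3) := by
    apply Continuous.measurable
    refine (ENNReal.continuous_pow 3).comp ?_
    fun_prop
  have h1 : Measurable (fun p : E3 × E3 => ∫⁻ h in Metric.ball (0:E3) (4 * r), ‖f (p.1 + p.2 + h) - f (p.1 + p.2)‖ₑ ^ 3) :=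
    h0.lintegral_prod_right'
  have h4 : Measurable (fun p : E3 × E3 => ‖f (p.1 + p.2) - f p.1‖ₑ ^ 3) := by
    apply Continuous.measurable
    refine (ENNReal.continuous_pow 3).comp ?_
    fun_prop
  calc ∫⁻ x, Db r f x ^ 3 ≤ ∫⁻ x, 8 * (V r)⁻¹ ^ 2 * ∫⁻ y in Metric.ball (0:E3) r, ∫⁻ h in Metric.ball (0:E3) (4 * r), ‖f (x + y + h) - f (x + y)‖ₑ ^ 3 :=
        lintegral_mono fun x => Db_three hr hf x
    _ = 8 * (V r)⁻¹ ^ 2 * ∫⁻ y in Metric.ball (0:E3) r, ∫⁻ x, ∫⁻ h in Metric.ball (0:E3) (4 * r), ‖f (x + y + h) - f (x + y)‖ₑ ^ 3 := by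
        rw [lintegral_const_mul' _ _ (by finiteness), lintegral_lintegral_swap (by exact h1.aemeasurable)]
    _ = 8 * (V r)⁻¹ ^ 2 * ∫⁻ y in Metric.ball (0:E3) r, L3 r f := by
        congr 1
        refine lintegral_congr fun y => ?_
        rw [lintegral_add_right_eq_self (fun x => ∫⁻ h in Metric.ball (0:E3) (4 * r), ‖f (x + h) - f x‖ₑ ^ 3) y,
          lintegral_lintegral_swap (by exact h4.aemeasurable)]
        rfl
    _ = _ := by
        rw [lintegral_const, Measure.restrict_apply_univ]
        change _ * (_ * V r) = _
        have e1 : (V r)⁻¹ * V r = 1 := ENNReal.inv_mul_cancel hV hVt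
        generalize (V r)⁻¹ = a at *
        calc 8 * a ^ 2 * (L3 r f * V r) = 8 * a * (a * V r) * L3 r f := by ring
          _ = _ := by rw [e1]; ring

/-- key estimate for the averaged differences at fixed time -/
lemma Db_six (hr : 0 < r) (hf : Continuous f) : (∫⁻ x, Db r f x ^ 6) ^ 2 ≤ 2 ^ 18 * (V r)⁻¹ ^ 5 *
    (∫⁻ h in Metric.ball (0:E3) (4 * r), n2 (fun x => f (x + h) - f x) ^ 2 * n6 (fun x => f (x + h) - f x) ^ 2) ^ 3 := by
  have hV := V_ne_zero hr
  have hVt := V_ne_top r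
  have h1 : ∫⁻ x, Db r f x ^ 6 ≤ 64 * (V r)⁻¹ ^ 3 * L3 r f ^ 2 := by
    calc ∫⁻ x, Db r f x ^ 6 = ∫⁻ x, Db r f x ^ 3 * Db r f x ^ 3 := by simp only [← pow_add]
      _ ≤ ∫⁻ x, (8 * (V r)⁻¹ ^ 2 * L3 r f) * Db r f x ^ 3 := by
          refine lintegral_mono fun x => mul_le_mul_left (Db_sup hr hf x) _
      _ = (8 * (V r)⁻¹ ^ 2 * L3 r f) * ∫⁻ x, Db r f x ^ 3 := lintegral_const_mul _ ((Db_meas hf).pow_const 3)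
      _ ≤ (8 * (V r)⁻¹ ^ 2 * L3 r f) * (8 * (V r)⁻¹ * L3 r f) := by gcongr; exact Db_int hr hf
      _ = _ := by ring
  have h4 : Measurable (fun p : E3 × E3 => ‖f (p.2 + p.1) - f p.2‖ₑ ^ 3) := by
    apply Continuous.measurable
    refine (ENNReal.continuous_pow 3).comp ?_
    fun_prop
  have h2 : L3 r f ^ 4 ≤ V (4 * r) * (∫⁻ h in Metric.ball (0:E3) (4 * r), n2 (fun x => f (x + h) - f x) ^ 2 * n6 (fun x => f (x + h) - f x) ^ 2) ^ 3 := by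
    have := lint_jensen43 (volume.restrict (Metric.ball (0:E3) (4 * r))) (g := fun h => ∫⁻ x, ‖f (x + h) - f x‖ₑ ^ 3)
      (k := fun h => n2 (fun x => f (x + h) - f x) ^ 2 * n6 (fun x => f (x + h) - f x) ^ 2)
      (by exact h4.lintegral_prod_right'.aemeasurable)
      (fun h => l3_interp (g := fun x => f (x + h) - f x) (by apply Continuous.measurable; fun_prop))
    rwa [Measure.restrict_apply_univ] at this
  rw [show 4 * r = 2 * (2 * r) by ring, V_two (by positivity), V_two hr, show 2 * (2 * r) = 4 * r by ring] at h2
  have e1 : (V r)⁻¹ * V r = 1 := ENNReal.inv_mul_cancel hV hVt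
  generalize (V r)⁻¹ = a at *
  generalize (∫⁻ h in Metric.ball (0:E3) (4 * r), n2 (fun x => f (x + h) - f x) ^ 2 * n6 (fun x => f (x + h) - f x) ^ 2) = W at *
  calc _ ≤ (64 * a ^ 3 * L3 r f ^ 2) ^ 2 := by gcongr
    _ = 64 ^ 2 * a ^ 6 * L3 r f ^ 4 := by ring
    _ ≤ 64 ^ 2 * a ^ 6 * (8 * (8 * V r) * W ^ 3) := by gcongr
    _ = 2 ^ 18 * (a * V r) * a ^ 5 * W ^ 3 := by ring
    _ = _ := by rw [e1]; ring

end

/-- L6 norm of extended nonnegative functions -/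
def N6 (u : E3 → ℝ≥0∞) : ℝ≥0∞ := (∫⁻ x, u x ^ 6) ^ (1/6:ℝ)

lemma n6_N6 (g : E3 → ℂ) : n6 g = N6 (fun x => ‖g x‖ₑ) := rfl

lemma N6_cube (u : E3 → ℝ≥0∞) : (N6 u ^ 4) ^ 3 = (∫⁻ x, u x ^ 6) ^ 2 := by
  rw [N6, ← pow_mul, ← ENNReal.rpow_natCast, ← ENNReal.rpow_mul]; norm_num

lemma N6_add_le {u v : E3 → ℝ≥0∞} (hu : Measurable u) (hv : Measurable v) : N6 (fun x => u x + v x) ≤ N6 u + N6 v := by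
  have := ENNReal.lintegral_Lp_add_le (p := 6) hu.aemeasurable hv.aemeasurable (by norm_num) (μ := volume)
  unfold N6
  simp only [Pi.add_apply] at this
  exact_mod_cast this

lemma N6_mono {u v : E3 → ℝ≥0∞} (h : ∀ x, u x ≤ v x) : N6 u ≤ N6 v := by
  unfold N6; gcongr; exact h _

lemma le_third {z c w : ℝ≥0∞} (h : z ^ 3 ≤ c * w ^ 3) : z ≤ c ^ (1/3:ℝ) * w := by
  rw [← ENNReal.pow_le_pow_left_iff (n := 3) (by norm_num), mul_pow, ← ENNReal.rpow_natCast (c ^ (1/3:ℝ)), ← ENNReal.rpow_mul]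
  norm_num; exact h

lemma Mb_meas {v : ℝ → E3 → ℂ} (hv : Continuous (fun p : ℝ × E3 => v p.1 p.2)) (r : ℝ) :
    Measurable (fun p : ℝ × E3 => Mb r (fun x => ‖v p.1 x‖ₑ) p.2) := by
  have h0 : Measurable (fun p : (ℝ × E3) × E3 => ‖v p.1.1 (p.1.2 + p.2)‖ₑ) := by
    apply Continuous.measurable
    refine continuous_enorm.comp (hv.comp (f := fun p : (ℝ × E3) × E3 => (p.1.1, p.1.2 + p.2)) ?_)
    fun_prop
  exact (h0.lintegral_prod_right' (ν := volume.restrict (Metric.ball (0:E3) r))).const_mul _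

lemma Db_meas2 {v : ℝ → E3 → ℂ} (hv : Continuous (fun p : ℝ × E3 => v p.1 p.2)) (r : ℝ) :
    Measurable (fun p : ℝ × E3 => Db r (v p.1) p.2) := by
  have h0 : Measurable (fun p : ((ℝ × E3) × E3) × E3 => ‖v p.1.1.1 (p.1.1.2 + p.1.2 + p.2) - v p.1.1.1 (p.1.1.2 + p.1.2)‖ₑ) := by
    apply Continuous.measurable
    refine continuous_enorm.comp ((hv.comp (f := fun p : ((ℝ × E3) × E3) × E3 => (p.1.1.1, p.1.1.2 + p.1.2 + p.2)) ?_).sub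
      (hv.comp (f := fun p : ((ℝ × E3) × E3) × E3 => (p.1.1.1, p.1.1.2 + p.1.2)) ?_)) <;> fun_prop
  have h1 := h0.lintegral_prod_right' (ν := volume.restrict (Metric.ball (0:E3) (4 * r)))
  have h2 := h1.lintegral_prod_right' (ν := volume.restrict (Metric.ball (0:E3) r))
  exact (h2.const_mul _).const_mul _

lemma N6_meas {u : ℝ → E3 → ℝ≥0∞} (hu : Measurable (fun p : ℝ × E3 => u p.1 p.2)) : Measurable (fun t => N6 (u t)) :=
  ((hu.pow_const 6).lintegral_prod_right').pow_const _

lemma Mb_four {R : ℝ} (hR : 0 < R) {f : E3 → ℂ} (hf : Continuous f) (x : E3) :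
    Mb R (fun x => ‖f x‖ₑ) x ^ 4 ≤ (V R)⁻¹ * ∫⁻ y in Metric.ball (0:E3) R, ‖f (x + y)‖ₑ ^ 4 := by
  have hV := V_ne_zero hR
  have hVt := V_ne_top R
  have := lint_jensen4 (volume.restrict (Metric.ball (0:E3) R)) (g := fun y => ‖f (x + y)‖ₑ)
    (by apply Measurable.aemeasurable; apply Continuous.measurable; fun_prop)
  rw [Measure.restrict_apply_univ] at this
  change _ ≤ V R ^ 3 * _ at this
  have e1 : (V R)⁻¹ * V R = 1 := ENNReal.inv_mul_cancel hV hVt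
  unfold Mb
  generalize (V R)⁻¹ = a at *
  rw [mul_pow]
  calc _ ≤ a ^ 4 * (V R ^ 3 * ∫⁻ y in Metric.ball (0:E3) R, ‖f (x + y)‖ₑ ^ 4) := by gcongr
    _ = (a * V R) ^ 3 * a * ∫⁻ y in Metric.ball (0:E3) R, ‖f (x + y)‖ₑ ^ 4 := by ring
    _ = _ := by rw [e1]; ring

lemma Mb_six {R : ℝ} (hR : 0 < R) {f : E3 → ℂ} (hf : Continuous f) :
    N6 (Mb R (fun x => ‖f x‖ₑ)) ^ 4 ≤ (V R)⁻¹ ^ (1/3:ℝ) * q4 f := by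
  have hV := V_ne_zero hR
  have hVt := V_ne_top R
  have e1 : (V R)⁻¹ * V R = 1 := ENNReal.inv_mul_cancel hV hVt
  have hm : Measurable (Mb R (fun x => ‖f x‖ₑ)) := by
    have h0 : Measurable (fun p : E3 × E3 => ‖f (p.1 + p.2)‖ₑ) := by apply Continuous.measurable; fun_prop
    exact (h0.lintegral_prod_right' (ν := volume.restrict (Metric.ball (0:E3) R))).const_mul _
  have hs : ∀ x, Mb R (fun x => ‖f x‖ₑ) x ^ 4 ≤ (V R)⁻¹ * q4 f := fun x => by
    refine (Mb_four hR hf x).trans (mul_le_mul_right ?_ _)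
    refine (setLIntegral_le_lintegral _ _).trans ?_
    exact (lintegral_add_left_eq_self (fun z => ‖f z‖ₑ ^ 4) x).le
  have hi : ∫⁻ x, Mb R (fun x => ‖f x‖ₑ) x ^ 4 ≤ q4 f := by
    have h0 : Measurable (fun p : E3 × E3 => ‖f (p.1 + p.2)‖ₑ ^ 4) := by
      apply Continuous.measurable
      refine (ENNReal.continuous_pow 4).comp ?_
      fun_prop
    calc _ ≤ ∫⁻ x, (V R)⁻¹ * ∫⁻ y in Metric.ball (0:E3) R, ‖f (x + y)‖ₑ ^ 4 := lintegral_mono fun x => Mb_four hR hf x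
      _ = (V R)⁻¹ * ∫⁻ y in Metric.ball (0:E3) R, q4 f := by
        rw [lintegral_const_mul' _ _ (by finiteness), lintegral_lintegral_swap (by exact h0.aemeasurable)]
        congr 1
        refine lintegral_congr fun y => ?_
        rw [lintegral_add_right_eq_self (fun x => ‖f x‖ₑ ^ 4) y]; rfl
      _ = _ := by
        rw [lintegral_const, Measure.restrict_apply_univ]
        change _ * (_ * V R) = _
        rw [mul_left_comm, e1, mul_one]
  apply le_third
  rw [N6_cube]
  have h6 : ∫⁻ x, Mb R (fun x => ‖f x‖ₑ) x ^ 6 ≤ ((V R)⁻¹ * q4 f) ^ (1/2:ℝ) * q4 f := by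
    calc _ = ∫⁻ x, Mb R (fun x => ‖f x‖ₑ) x ^ 2 * Mb R (fun x => ‖f x‖ₑ) x ^ 4 := by simp only [← pow_add]
      _ ≤ ∫⁻ x, ((V R)⁻¹ * q4 f) ^ (1/2:ℝ) * Mb R (fun x => ‖f x‖ₑ) x ^ 4 := by
        refine lintegral_mono fun x => mul_le_mul_left (pow_half_le ?_) _
        rw [← pow_mul]; exact hs x
      _ = ((V R)⁻¹ * q4 f) ^ (1/2:ℝ) * ∫⁻ x, Mb R (fun x => ‖f x‖ₑ) x ^ 4 := lintegral_const_mul _ (hm.pow_const 4)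
      _ ≤ _ := by gcongr
  calc _ ≤ (((V R)⁻¹ * q4 f) ^ (1/2:ℝ) * q4 f) ^ 2 := by gcongr
    _ = (((V R)⁻¹ * q4 f) ^ (1/2:ℝ)) ^ 2 * q4 f ^ 2 := by ring
    _ = (V R)⁻¹ * q4 f * q4 f ^ 2 := by
      congr 1
      rw [← ENNReal.rpow_natCast, ← ENNReal.rpow_mul]; norm_num
    _ = _ := by ring

/-- constant for averaged differences -/
def C1 : ℝ≥0∞ := (2 ^ 18 * (V 1)⁻¹ ^ 5) ^ (1/3:ℝ) * (64 * 4 ^ 4 * V 1)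

lemma C1_ne_top : C1 ≠ ⊤ := by
  have h := V_ne_zero one_pos
  have h' := V_ne_top 1
  unfold C1; finiteness

lemma Db_N6 {r : ℝ} (hr : 0 < r) {f : E3 → ℂ} (hf : Continuous f) : N6 (Db r f) ^ 4 ≤ (2 ^ 18 * (V 1)⁻¹ ^ 5) ^ (1/3:ℝ) *
    (ENNReal.ofReal r⁻¹ ^ 5 * ∫⁻ h in Metric.ball (0:E3) (4 * r), n2 (fun x => f (x + h) - f x) ^ 2 * n6 (fun x => f (x + h) - f x) ^ 2) := by
  apply le_third
  rw [N6_cube]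
  refine (Db_six hr hf).trans (le_of_eq ?_)
  rw [V_eq hr, ENNReal.mul_inv (by right; exact V_ne_top 1) (by left; finiteness), ENNReal.inv_pow,
    ENNReal.ofReal_inv_of_pos hr]
  ring

lemma Db_time {t s r : ℝ} {v : ℝ → E3 → ℂ} (hv : Continuous (fun p : ℝ × E3 => v p.1 p.2)) (hs : 0 < s) (hs1 : s < 1)
    (hr : 0 < r) (hr4 : 4 * r ≤ 1) {B : ℝ≥0∞}
    (h2 : ∀ h : E3, ‖h‖ ≤ 1 → ∀ τ ∈ Set.Ioc 0 t, n2 (fun x => v τ (x + h) - v τ x) ≤ B * ENNReal.ofReal (‖h‖ ^ s))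
    (h6 : ∀ h : E3, ‖h‖ ≤ 1 → ∫⁻ τ in Set.Ioc 0 t, n6 (fun x => v τ (x + h) - v τ x) ^ 2 ≤ (B * ENNReal.ofReal (‖h‖ ^ s)) ^ 2) :
    ∫⁻ τ in Set.Ioc 0 t, N6 (Db r (v τ)) ^ 4 ≤ C1 * B ^ 4 * ENNReal.ofReal (r ^ (4 * s - 2)) := by
  have hd : Measurable (fun p : (ℝ × E3) × E3 => v p.1.1 (p.2 + p.1.2) - v p.1.1 p.2) := by
    apply Continuous.measurable
    refine (hv.comp (f := fun p : (ℝ × E3) × E3 => (p.1.1, p.2 + p.1.2)) ?_).sub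
      (hv.comp (f := fun p : (ℝ × E3) × E3 => (p.1.1, p.2)) ?_) <;> fun_prop
  have m2 : Measurable (fun p : ℝ × E3 => n2 (fun x => v p.1 (x + p.2) - v p.1 x)) :=
    (hd.enorm.pow_const 2).lintegral_prod_right'.pow_const _
  have m6 : Measurable (fun p : ℝ × E3 => n6 (fun x => v p.1 (x + p.2) - v p.1 x)) :=
    (hd.enorm.pow_const 6).lintegral_prod_right'.pow_const _
  have hmW : Measurable (fun p : ℝ × E3 => n2 (fun x => v p.1 (x + p.2) - v p.1 x) ^ 2 * n6 (fun x => v p.1 (x + p.2) - v p.1 x) ^ 2) :=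
    (m2.pow_const 2).mul (m6.pow_const 2)
  have hV1 := V_ne_zero one_pos
  have hV1t := V_ne_top 1
  have hW : ∫⁻ τ in Set.Ioc 0 t, ∫⁻ h in Metric.ball (0:E3) (4 * r), n2 (fun x => v τ (x + h) - v τ x) ^ 2 * n6 (fun x => v τ (x + h) - v τ x) ^ 2
      ≤ V (4 * r) * (B * ENNReal.ofReal ((4 * r) ^ s)) ^ 4 := by
    rw [lintegral_lintegral_swap (by exact hmW.aemeasurable)]
    calc _ ≤ ∫⁻ h in Metric.ball (0:E3) (4 * r), (B * ENNReal.ofReal ((4 * r) ^ s)) ^ 4 := by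
          refine setLIntegral_mono' Metric.isOpen_ball.measurableSet fun h hh => ?_
          rw [mem_ball_zero_iff] at hh
          have hh1 : ‖h‖ ≤ 1 := by linarith
          have hle : B * ENNReal.ofReal (‖h‖ ^ s) ≤ B * ENNReal.ofReal ((4 * r) ^ s) := by gcongr
          calc _ ≤ ∫⁻ τ in Set.Ioc 0 t, (B * ENNReal.ofReal ((4 * r) ^ s)) ^ 2 * n6 (fun x => v τ (x + h) - v τ x) ^ 2 := by
                refine setLIntegral_mono' measurableSet_Ioc fun τ hτ => ?_
                gcongr
                exact (h2 h hh1 τ hτ).trans hle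
            _ = (B * ENNReal.ofReal ((4 * r) ^ s)) ^ 2 * ∫⁻ τ in Set.Ioc 0 t, n6 (fun x => v τ (x + h) - v τ x) ^ 2 :=
                lintegral_const_mul _ ((m6.comp (measurable_id.prodMk measurable_const)).pow_const 2)
            _ ≤ (B * ENNReal.ofReal ((4 * r) ^ s)) ^ 2 * (B * ENNReal.ofReal ((4 * r) ^ s)) ^ 2 := by
                gcongr
                exact (h6 h hh1).trans (by gcongr)
            _ = _ := by ring
      _ = _ := by
          rw [lintegral_const, Measure.restrict_apply_univ, mul_comm]; rfl
  have hmW2 : Measurable (fun τ => ∫⁻ h in Metric.ball (0:E3) (4 * r), n2 (fun x => v τ (x + h) - v τ x) ^ 2 * n6 (fun x => v τ (x + h) - v τ x) ^ 2) :=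
    hmW.lintegral_prod_right'
  calc _ ≤ ∫⁻ τ in Set.Ioc 0 t, (2 ^ 18 * (V 1)⁻¹ ^ 5) ^ (1/3:ℝ) *
        (ENNReal.ofReal r⁻¹ ^ 5 * ∫⁻ h in Metric.ball (0:E3) (4 * r), n2 (fun x => v τ (x + h) - v τ x) ^ 2 * n6 (fun x => v τ (x + h) - v τ x) ^ 2) :=
        lintegral_mono fun τ => Db_N6 hr (hv.comp (continuous_const.prodMk continuous_id))
    _ = (2 ^ 18 * (V 1)⁻¹ ^ 5) ^ (1/3:ℝ) * (ENNReal.ofReal r⁻¹ ^ 5 *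
        ∫⁻ τ in Set.Ioc 0 t, ∫⁻ h in Metric.ball (0:E3) (4 * r), n2 (fun x => v τ (x + h) - v τ x) ^ 2 * n6 (fun x => v τ (x + h) - v τ x) ^ 2) := by
        rw [lintegral_const_mul _ (hmW2.const_mul _), lintegral_const_mul _ hmW2]
    _ ≤ (2 ^ 18 * (V 1)⁻¹ ^ 5) ^ (1/3:ℝ) * (ENNReal.ofReal r⁻¹ ^ 5 * (V (4 * r) * (B * ENNReal.ofReal ((4 * r) ^ s)) ^ 4)) := by gcongr
    _ = (2 ^ 18 * (V 1)⁻¹ ^ 5) ^ (1/3:ℝ) * (V 1 * B ^ 4 * ENNReal.ofReal (r⁻¹ ^ 5 * (4 * r) ^ 3 * ((4 * r) ^ s) ^ 4)) := by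
        rw [ENNReal.ofReal_mul (by positivity), ENNReal.ofReal_mul (by positivity), ENNReal.ofReal_pow (by positivity),
          ENNReal.ofReal_pow (by positivity), ENNReal.ofReal_pow (by positivity), V_eq (r := 4 * r) (by positivity)]
        ring
    _ ≤ (2 ^ 18 * (V 1)⁻¹ ^ 5) ^ (1/3:ℝ) * (V 1 * B ^ 4 * ENNReal.ofReal (64 * 4 ^ 4 * r ^ (4 * s - 2))) := by
        refine mul_le_mul_right (mul_le_mul_right (ENNReal.ofReal_le_ofReal ?_) _) _
        have e1 : ((4 * r) ^ s) ^ 4 = (4 ^ s) ^ 4 * r ^ (4 * s) := by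
          rw [Real.mul_rpow (by norm_num) hr.le, mul_pow, ← Real.rpow_natCast (r ^ s), ← Real.rpow_mul hr.le]
          congr 2; push_cast; ring
        have e2 : r ^ (4 * s - 2) = r ^ (4 * s) * (r ^ 2)⁻¹ := by
          rw [Real.rpow_sub hr, Real.rpow_two, div_eq_mul_inv]
        have e3 : (4:ℝ) ^ s ≤ 4 := by
          calc (4:ℝ) ^ s ≤ 4 ^ (1:ℝ) := Real.rpow_le_rpow_of_exponent_le (by norm_num) hs1.le
            _ = 4 := by norm_num
        rw [e1, e2]
        have e4 : r⁻¹ ^ 5 * (4 * r) ^ 3 = 64 * (r ^ 2)⁻¹ := by field_simp; norm_num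
        rw [e4]
        calc _ ≤ 64 * (r ^ 2)⁻¹ * (4 ^ 4 * r ^ (4 * s)) := by gcongr
          _ = _ := by ring
    _ = _ := by
        rw [ENNReal.ofReal_mul (by norm_num), C1]
        have : ENNReal.ofReal (64 * 4 ^ 4) = 64 * 4 ^ 4 := by norm_num
        rw [this]; ring

lemma Mb_liminf {f : E3 → ℂ} (hf : Continuous f) {u : ℕ → ℝ} (hu : Tendsto u atTop (nhds 0)) (hup : ∀ n, 0 < u n) (x : E3) :
    ‖f x‖ₑ ≤ liminf (fun n => Mb (u n) (fun x => ‖f x‖ₑ) x) atTop := by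
  refine le_of_forall_lt fun c hc => ?_
  obtain ⟨d, hcd, hd⟩ := exists_between hc
  refine hcd.trans_le ?_
  have hcont : Continuous (fun y => ‖f (x + y)‖ₑ) := by fun_prop
  have h0 : ∀ᶠ y in nhds (0:E3), d < ‖f (x + y)‖ₑ :=
    hcont.continuousAt.eventually (lt_mem_nhds (by simpa using hd))
  obtain ⟨ρ, hρ, hb⟩ := Metric.eventually_nhds_iff_ball.1 h0
  refine le_liminf_of_le (by isBoundedDefault) ?_
  filter_upwards [hu.eventually (gt_mem_nhds hρ)] with n hn
  unfold Mb
  calc d = (V (u n))⁻¹ * ∫⁻ y in Metric.ball (0:E3) (u n), d := by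
        rw [lintegral_const, Measure.restrict_apply_univ]
        change _ = (V (u n))⁻¹ * (_ * V (u n))
        rw [mul_left_comm, ENNReal.inv_mul_cancel (V_ne_zero (hup n)) (V_ne_top _), mul_one]
    _ ≤ _ := by
        refine mul_le_mul_right (setLIntegral_mono' Metric.isOpen_ball.measurableSet fun y hy => ?_) _
        exact (hb y (Metric.ball_subset_ball hn.le hy)).le

lemma liminf_map {a : ℕ → ℝ≥0∞} {F : ℝ≥0∞ → ℝ≥0∞} (hF : Continuous F) (hm : Monotone F) :
    F (liminf a atTop) = liminf (fun n => F (a n)) atTop :=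
  hm.map_liminf_of_continuousAt a hF.continuousAt

lemma N6_liminf {f : E3 → ℂ} (hf : Continuous f) {u : ℕ → ℝ} (hu : Tendsto u atTop (nhds 0)) (hup : ∀ n, 0 < u n) :
    n6 f ^ 4 ≤ liminf (fun n => N6 (Mb (u n) (fun x => ‖f x‖ₑ)) ^ 4) atTop := by
  have hm : ∀ n, Measurable (Mb (u n) (fun x => ‖f x‖ₑ)) := fun n => by
    have h0 : Measurable (fun p : E3 × E3 => ‖f (p.1 + p.2)‖ₑ) := by apply Continuous.measurable; fun_prop
    exact (h0.lintegral_prod_right' (ν := volume.restrict (Metric.ball (0:E3) (u n)))).const_mul _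
  have h1 : ∫⁻ x, ‖f x‖ₑ ^ 6 ≤ liminf (fun n => ∫⁻ x, Mb (u n) (fun x => ‖f x‖ₑ) x ^ 6) atTop := by
    refine le_trans (lintegral_mono fun x => ?_) (lintegral_liminf_le fun n => (hm n).pow_const 6)
    rw [← liminf_map (ENNReal.continuous_pow 6) (pow_left_mono 6)]
    exact pow_le_pow_left₀ (by simp) (Mb_liminf hf hu hup x) 6
  have hF : Continuous (fun z : ℝ≥0∞ => (z ^ (1/6:ℝ)) ^ 4) := (ENNReal.continuous_pow 4).comp ENNReal.continuous_rpow_const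
  have hFm : Monotone (fun z : ℝ≥0∞ => (z ^ (1/6:ℝ)) ^ 4) := fun a b hab => by dsimp only; gcongr
  have := liminf_map (a := fun n => ∫⁻ x, Mb (u n) (fun x => ‖f x‖ₑ) x ^ 6) hF hFm
  unfold N6
  rw [← this, n6]
  exact hFm h1

/-- spacetime telescoping bound -/
lemma tele {t s R : ℝ} {v : ℝ → E3 → ℂ} (hv : Continuous (fun p : ℝ × E3 => v p.1 p.2)) (hs : 1/2 < s) (hs1 : s < 1)
    (hR : 0 < R) (hR2 : 2 * R ≤ 1) {B : ℝ≥0∞}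
    (h2 : ∀ h : E3, ‖h‖ ≤ 1 → ∀ τ ∈ Set.Ioc 0 t, n2 (fun x => v τ (x + h) - v τ x) ≤ B * ENNReal.ofReal (‖h‖ ^ s))
    (h6 : ∀ h : E3, ‖h‖ ≤ 1 → ∫⁻ τ in Set.Ioc 0 t, n6 (fun x => v τ (x + h) - v τ x) ^ 2 ≤ (B * ENNReal.ofReal (‖h‖ ^ s)) ^ 2) :
    ∫⁻ τ in Set.Ioc 0 t, n6 (v τ) ^ 4 ≤ (((V R)⁻¹ ^ (1/3:ℝ) * ∫⁻ τ in Set.Ioc 0 t, q4 (v τ)) ^ (1/4:ℝ) +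
      C1 ^ (1/4:ℝ) * B * ENNReal.ofReal (R ^ (s - 1/2)) * (1 - ENNReal.ofReal ((1/2) ^ (s - 1/2)))⁻¹) ^ 4 := by
  set σ := s - 1/2 with hσ
  have hσ0 : 0 < σ := by rw [hσ]; linarith
  set μ := volume.restrict (Set.Ioc 0 t) with hμ
  set P : ℕ → ℝ≥0∞ := fun k => (∫⁻ τ, N6 (Mb ((1/2) ^ k * R) (fun x => ‖v τ x‖ₑ)) ^ 4 ∂μ) ^ (1/4:ℝ) with hP
  have hvt : ∀ τ, Continuous (v τ) := fun τ => hv.comp (continuous_const.prodMk continuous_id)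
  have mM : ∀ r, Measurable (fun τ => N6 (Mb r (fun x => ‖v τ x‖ₑ))) := fun r => N6_meas (u := fun τ => Mb r (fun x => ‖v τ x‖ₑ)) (Mb_meas hv r)
  have mD : ∀ r, Measurable (fun τ => N6 (Db r (v τ))) := fun r => N6_meas (u := fun τ => Db r (v τ)) (Db_meas2 hv r)
  have hP0 : P 0 ≤ ((V R)⁻¹ ^ (1/3:ℝ) * ∫⁻ τ, q4 (v τ) ∂μ) ^ (1/4:ℝ) := by
    simp only [hP, pow_zero, one_mul]
    gcongr
    have hq : Measurable (fun τ => q4 (v τ)) := (hv.measurable.enorm.pow_const 4).lintegral_prod_right'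
    rw [← lintegral_const_mul _ hq]
    exact lintegral_mono fun τ => Mb_six hR (hvt τ)
  have hstep : ∀ k, P (k + 1) ≤ P k + C1 ^ (1/4:ℝ) * B * ENNReal.ofReal (R ^ σ) * ENNReal.ofReal ((1/2) ^ σ) ^ k := by
    intro k
    set r : ℝ := (1/2) ^ (k + 1) * R with hr
    have hr0 : 0 < r := by positivity
    have e2r : (1/2) ^ k * R = 2 * r := by rw [hr, pow_succ]; ring
    have hk1 : ((1:ℝ)/2) ^ k ≤ 1 := pow_le_one₀ (by norm_num) (by norm_num)
    have hr4 : 4 * r ≤ 1 := by nlinarith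
    have h1 : P (k + 1) ≤ (∫⁻ τ, (N6 (Mb (2 * r) (fun x => ‖v τ x‖ₑ)) + N6 (Db r (v τ))) ^ 4 ∂μ) ^ (1/4:ℝ) := by
      simp only [hP]
      gcongr with τ
      refine (N6_mono (fun x => Mb_step hr0 (hvt τ) x)).trans (N6_add_le ?_ (Db_meas (hvt τ)))
      exact (Mb_meas hv (2 * r)).comp (measurable_const.prodMk measurable_id)
    have h3 := ENNReal.lintegral_Lp_add_le (μ := μ) (p := 4) (mM (2 * r)).aemeasurable (mD r).aemeasurable (by norm_num)
    simp only [Pi.add_apply] at h3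
    have h3' : (∫⁻ τ, (N6 (Mb (2 * r) (fun x => ‖v τ x‖ₑ)) + N6 (Db r (v τ))) ^ 4 ∂μ) ^ (1/4:ℝ) ≤
      (∫⁻ τ, N6 (Mb (2 * r) (fun x => ‖v τ x‖ₑ)) ^ 4 ∂μ) ^ (1/4:ℝ) + (∫⁻ τ, N6 (Db r (v τ)) ^ 4 ∂μ) ^ (1/4:ℝ) := by exact_mod_cast h3
    refine h1.trans (h3'.trans ?_)
    simp only [hP, e2r]
    refine add_le_add le_rfl ?_
    have h4 := Db_time hv (by linarith) hs1 hr0 hr4 h2 h6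
    have h5 := ENNReal.rpow_le_rpow h4 (z := (1/4:ℝ)) (by norm_num)
    refine h5.trans ?_
    rw [ENNReal.mul_rpow_of_nonneg _ _ (by norm_num), ENNReal.mul_rpow_of_nonneg _ _ (by norm_num),
      ENNReal.ofReal_rpow_of_nonneg (by positivity) (by norm_num), ← Real.rpow_mul hr0.le]
    have e1 : (B ^ 4) ^ (1/4:ℝ) = B := by rw [← ENNReal.rpow_natCast, ← ENNReal.rpow_mul]; norm_num
    have e2 : (4 * s - 2) * (1/4) = σ := by rw [hσ]; ring
    rw [e1, e2, mul_assoc (C1 ^ (1/4:ℝ) * B)]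
    gcongr
    rw [← ENNReal.ofReal_pow (by positivity), ← ENNReal.ofReal_mul (by positivity)]
    refine ENNReal.ofReal_le_ofReal ?_
    rw [hr, Real.mul_rpow (by positivity) hR.le, mul_comm]
    gcongr
    rw [← Real.rpow_natCast (((1:ℝ)/2) ^ σ), ← Real.rpow_mul (by norm_num), mul_comm σ, Real.rpow_mul (by norm_num), Real.rpow_natCast]
    refine Real.rpow_le_rpow (by positivity) ?_ hσ0.le
    exact pow_le_pow_of_le_one (by norm_num) (by norm_num) (Nat.le_succ k)
  have hall : ∀ k, P k ≤ P 0 + ∑ i ∈ Finset.range k, C1 ^ (1/4:ℝ) * B * ENNReal.ofReal (R ^ σ) * ENNReal.ofReal ((1/2) ^ σ) ^ i := by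
    intro k
    induction k with
    | zero => simp
    | succ k ih =>
      rw [Finset.sum_range_succ, ← add_assoc]
      exact (hstep k).trans (by gcongr)
  set Q : ℝ≥0∞ := ((V R)⁻¹ ^ (1/3:ℝ) * ∫⁻ τ, q4 (v τ) ∂μ) ^ (1/4:ℝ) +
      C1 ^ (1/4:ℝ) * B * ENNReal.ofReal (R ^ σ) * (1 - ENNReal.ofReal ((1/2) ^ σ))⁻¹ with hQ
  have hPQ : ∀ k, P k ≤ Q := by
    intro k
    refine (hall k).trans (add_le_add hP0 ?_)
    rw [← Finset.mul_sum]
    gcongr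
    rw [← ENNReal.tsum_geometric]
    exact ENNReal.sum_le_tsum _
  have hu : Tendsto (fun k : ℕ => ((1:ℝ)/2) ^ k * R) atTop (nhds 0) := by
    simpa using (tendsto_pow_atTop_nhds_zero_of_lt_one (r := (1:ℝ)/2) (by norm_num) (by norm_num)).mul_const R
  calc ∫⁻ τ, n6 (v τ) ^ 4 ∂μ ≤ ∫⁻ τ, liminf (fun k : ℕ => N6 (Mb ((1/2) ^ k * R) (fun x => ‖v τ x‖ₑ)) ^ 4) atTop ∂μ :=
        lintegral_mono fun τ => N6_liminf (hvt τ) hu (fun k => by positivity)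
    _ ≤ liminf (fun k : ℕ => ∫⁻ τ, N6 (Mb ((1/2) ^ k * R) (fun x => ‖v τ x‖ₑ)) ^ 4 ∂μ) atTop :=
        lintegral_liminf_le fun k => (mM _).pow_const 4
    _ ≤ liminf (fun _ : ℕ => Q ^ 4) atTop := by
        refine liminf_le_liminf (.of_forall fun k => ?_)
        have := pow_le_pow_left₀ (by simp) (hPQ k) 4
        simp only [hP] at this
        rw [← ENNReal.rpow_natCast, ← ENNReal.rpow_mul] at this
        norm_num at this ⊢
        exact this
    _ = Q ^ 4 := by simp

/-- size of the symbol of a difference operator -/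
def Ed (θ : ℝ) : ℝ := ‖cexp (I * ((2 * π * θ : ℝ) : ℂ)) - 1‖

lemma Ed_nonneg (θ : ℝ) : 0 ≤ Ed θ := norm_nonneg _

lemma Ed_le (θ : ℝ) : Ed θ ≤ 2 * π * |θ| := by
  have h := Real.norm_exp_I_mul_ofReal_sub_one_le (x := 2 * π * θ)
  rw [Real.norm_eq_abs, abs_mul, abs_of_pos (by positivity : (0:ℝ) < 2 * π)] at h
  exact h

lemma Ed_le_two (θ : ℝ) : Ed θ ≤ 2 := by
  unfold Ed
  rw [Complex.norm_exp_I_mul_ofReal_sub_one, Real.norm_eq_abs, abs_mul]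
  have := Real.abs_sin_le_one (2 * π * θ / 2)
  simp only [Nat.abs_ofNat]; linarith

lemma Ed_ge {θ : ℝ} (h : |θ| ≤ 1 / 2) : 4 * |θ| ≤ Ed θ := by
  unfold Ed
  rw [Complex.norm_exp_I_mul_ofReal_sub_one, Real.norm_eq_abs, abs_mul]
  have e : 2 * π * θ / 2 = π * θ := by ring
  rw [e]
  have h1 : |Real.sin (π * θ)| = Real.sin (π * |θ|) := by
    rcases abs_cases θ with ⟨h1, h2⟩ | ⟨h1, h2⟩
    · rw [h1] at h ⊢
      exact abs_of_nonneg (Real.sin_nonneg_of_nonneg_of_le_pi (by positivity) (by nlinarith [Real.pi_pos]))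
    · rw [h1] at h ⊢
      rw [show π * θ = - (π * (-θ)) by ring, Real.sin_neg, abs_neg]
      exact abs_of_nonneg (Real.sin_nonneg_of_nonneg_of_le_pi (by nlinarith [Real.pi_pos]) (by nlinarith [Real.pi_pos]))
  rw [h1]
  have := Real.mul_le_sin (x := π * |θ|) (by positivity) (by nlinarith [Real.pi_pos])
  have e2 : 2 / π * (π * |θ|) = 2 * |θ| := by field_simp
  rw [e2] at this
  simp only [Nat.abs_ofNat]; linarith

/-- the symbol `ρ η(ρ)` -/
def mu (η : ℝ → ℝ) (ρ : ℝ) : ℝ := ρ * η ρ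

section cut
variable {s : ℝ} {η : ℝ → ℝ}

lemma IsCutoff.pos (h : IsCutoff s η) {ρ : ℝ} (hρ : 0 ≤ ρ) : 0 < η ρ := (h.2.2.1 ρ hρ).1
lemma IsCutoff.le_one (h : IsCutoff s η) {ρ : ℝ} (hρ : 0 ≤ ρ) : η ρ ≤ 1 := (h.2.2.1 ρ hρ).2

lemma mu_nonneg (h : IsCutoff s η) {ρ : ℝ} (hρ : 0 ≤ ρ) : 0 ≤ mu η ρ :=
  mul_nonneg hρ (h.pos hρ).le

lemma mu_le (h : IsCutoff s η) {ρ : ℝ} (hρ : 0 ≤ ρ) : mu η ρ ≤ ρ :=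
  mul_le_of_le_one_right hρ (h.le_one hρ)

lemma mu_le_pow (h : IsCutoff s η) (hs : 1 / 2 < s) (hs1 : s < 1) {ρ : ℝ} (hρ : 0 ≤ ρ) :
    mu η ρ ≤ 2 * ρ ^ s := by
  have h0 : 0 ≤ ρ ^ s := Real.rpow_nonneg hρ s
  rcases le_total ρ 1 with h1 | h1
  · rcases hρ.eq_or_lt with h2 | h2
    · have := mu_le h hρ
      rw [← h2] at this ⊢; linarith [Real.rpow_nonneg (le_refl (0:ℝ)) s]
    · have : ρ ^ (1:ℝ) ≤ ρ ^ s := Real.rpow_le_rpow_of_exponent_ge h2 h1 hs1.le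
      rw [Real.rpow_one] at this
      linarith [mu_le h hρ]
  · rcases le_total ρ 2 with h2 | h2
    · have : (1:ℝ) ≤ ρ ^ s := Real.one_le_rpow h1 (by linarith)
      linarith [mu_le h hρ]
    · unfold mu
      rw [h.2.2.2.2 ρ h2]
      have : ρ * ρ ^ (s - 1) = ρ ^ s := by
        rw [Real.rpow_sub_one (by linarith)]; field_simp
      linarith

lemma mu_ge_pow (h : IsCutoff s η) (hs : 1 / 2 < s) (hs1 : s < 1) {ρ : ℝ} (hρ : 1 ≤ ρ) :
    ρ ^ s ≤ 2 * mu η ρ := by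
  have h0 : 0 ≤ ρ ^ s := Real.rpow_nonneg (by linarith) s
  rcases le_total ρ 2 with h2 | h2
  · have h3 : η 2 ≤ η ρ := h.2.1 (by simp; linarith) (by simp) h2
    rw [h.2.2.2.2 2 le_rfl] at h3
    have h4 : (1:ℝ)/2 ≤ 2 ^ (s - 1) := by
      rw [Real.rpow_sub_one (by norm_num)]
      have : (1:ℝ) ≤ 2 ^ s := Real.one_le_rpow (by norm_num) (by linarith)
      linarith
    have h5 : ρ ^ s ≤ ρ ^ (1:ℝ) := Real.rpow_le_rpow_of_exponent_le hρ hs1.le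
    rw [Real.rpow_one] at h5
    unfold mu
    nlinarith
  · unfold mu
    rw [h.2.2.2.2 ρ h2]
    have : ρ * ρ ^ (s - 1) = ρ ^ s := by
      rw [Real.rpow_sub_one (by linarith)]; field_simp
    linarith

lemma pow_w (s : ℝ) (k : ℕ) : ((4:ℝ) ^ s) ^ k = ((2:ℝ) ^ k) ^ (2 * s) := by
  rw [← Real.rpow_natCast ((4:ℝ) ^ s), ← Real.rpow_natCast (2:ℝ), ← Real.rpow_mul (by norm_num),
    ← Real.rpow_mul (by norm_num), show (4:ℝ) = 2 ^ (2:ℝ) by norm_num, ← Real.rpow_mul (by norm_num)]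
  ring_nf

lemma rpow_two_mul' {a : ℝ} (ha : 0 ≤ a) (s : ℝ) : a ^ (2 * s) = (a ^ s) ^ 2 := by
  rw [mul_comm, Real.rpow_mul ha]; norm_num

lemma multL (h : IsCutoff s η) (hs : 1 / 2 < s) (hs1 : s < 1) {ρ a : ℝ} (hρ : 0 ≤ ρ)
    (hρa : ρ ^ 2 ≤ 3 * a ^ 2) : ∃ k : ℕ, (mu η ρ) ^ 2 ≤ 4 * (((4:ℝ) ^ s) ^ k * Ed ((1/2) ^ k * a) ^ 2) := by
  have hmu := mu_nonneg h hρ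
  have ha2 : |a| ^ 2 = a ^ 2 := sq_abs a
  rcases le_or_gt |a| (1/2) with h1 | h1
  · refine ⟨0, ?_⟩
    have h2 := Ed_ge h1
    simp only [pow_zero, one_mul]
    have h3 := mu_le h hρ
    have := abs_nonneg a
    nlinarith
  · obtain ⟨n, hn1, hn2⟩ := exists_nat_pow_near (x := 2 * |a|) (y := (2:ℝ)) (by linarith) (by norm_num)
    refine ⟨n + 1, ?_⟩
    have h3 : |(1/2) ^ (n+1) * a| = (1/2) ^ (n+1) * |a| := by
      rw [abs_mul, abs_of_nonneg (by positivity)]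
    have h4 : ((1:ℝ)/2) ^ (n+1) * 2 ^ (n+1) = 1 := by rw [← mul_pow]; norm_num
    have h5 : (0:ℝ) < (1/2) ^ (n+1) := by positivity
    have h6 : (1/2) ^ (n+1) * |a| ≤ 1 / 2 := by nlinarith
    have h7 : 1 / 4 ≤ (1/2) ^ (n+1) * |a| := by
      rw [pow_succ 2] at h4
      nlinarith
    have h8 : 1 ≤ Ed ((1/2) ^ (n+1) * a) := by
      have := Ed_ge (θ := (1/2) ^ (n+1) * a) (by rw [h3]; exact h6)
      rw [h3] at this; linarith
    have h9 : (2 * |a|) ^ (2 * s) ≤ ((4:ℝ) ^ s) ^ (n+1) := by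
      rw [pow_w]
      exact Real.rpow_le_rpow (by positivity) hn2.le (by linarith)
    have h10 : ρ ≤ 2 * |a| := by
      apply le_of_sq_le_sq _ (by positivity)
      nlinarith
    have h11 : ρ ^ s ≤ (2 * |a|) ^ s := Real.rpow_le_rpow hρ h10 (by linarith)
    have h12 := mu_le_pow h hs hs1 hρ
    rw [rpow_two_mul' (by positivity)] at h9
    have h13 : (mu η ρ) ^ 2 ≤ 4 * ((2 * |a|) ^ s) ^ 2 := by
      have : mu η ρ ≤ 2 * (2 * |a|) ^ s := by linarith
      nlinarith
    have h14 : (1:ℝ) ≤ Ed ((1/2) ^ (n+1) * a) ^ 2 := by nlinarith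
    have h15 : (0:ℝ) ≤ ((4:ℝ) ^ s) ^ (n+1) := by positivity
    nlinarith

/-- constant in the upper bound -/
def CU (s : ℝ) : ℝ≥0∞ := ENNReal.ofReal 16 + ENNReal.ofReal (64 * π ^ 2) * (1 - ENNReal.ofReal ((4:ℝ) ^ s / 4))⁻¹

lemma four_lt (hs1 : s < 1) : (4:ℝ) ^ s / 4 < 1 := by
  have : (4:ℝ) ^ s < 4 ^ (1:ℝ) := Real.rpow_lt_rpow_of_exponent_lt (by norm_num) hs1
  rw [Real.rpow_one] at this; linarith

lemma CU_ne_top (hs1 : s < 1) : CU s ≠ ⊤ := by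
  have h : ENNReal.ofReal ((4:ℝ) ^ s / 4) < 1 := by
    rw [ENNReal.ofReal_lt_one]; exact four_lt hs1
  have : (1 - ENNReal.ofReal ((4:ℝ) ^ s / 4))⁻¹ ≠ ⊤ := by
    rw [ENNReal.inv_ne_top]; exact (tsub_pos_of_lt h).ne'
  unfold CU
  exact ENNReal.add_ne_top.2 ⟨ENNReal.ofReal_ne_top, ENNReal.mul_ne_top ENNReal.ofReal_ne_top this⟩

lemma tsum_geo {A y : ℝ} (hA : 0 ≤ A) (hy : 0 ≤ y) :
    ∑' m : ℕ, ENNReal.ofReal (A * y ^ m) = ENNReal.ofReal A * (1 - ENNReal.ofReal y)⁻¹ := by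
  rw [← ENNReal.tsum_geometric, ← ENNReal.tsum_mul_left]
  refine tsum_congr fun m => ?_
  rw [ENNReal.ofReal_mul hA, ENNReal.ofReal_pow hy]

lemma Ed_sq_le {a ρ : ℝ} (k : ℕ) (ha : |a| ≤ ρ) :
    Ed ((1/2) ^ k * a) ^ 2 ≤ 4 * π ^ 2 * (1/4) ^ k * ρ ^ 2 := by
  have h1 := Ed_le ((1/2) ^ k * a)
  rw [abs_mul, abs_of_nonneg (by positivity)] at h1
  have h2 : Ed ((1/2) ^ k * a) ≤ 2 * π * ((1/2) ^ k * ρ) := h1.trans (by gcongr)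
  calc Ed ((1/2) ^ k * a) ^ 2 ≤ (2 * π * ((1/2) ^ k * ρ)) ^ 2 :=
        pow_le_pow_left₀ (Ed_nonneg _) h2 2
    _ = 4 * π ^ 2 * (1/4) ^ k * ρ ^ 2 := by
        have e : (1/4:ℝ) ^ k = ((1/2) ^ k) ^ 2 := by rw [← pow_mul, mul_comm, pow_mul]; norm_num
        rw [e]; ring

lemma geo_partial (hs : 1 / 2 < s) (K : ℕ) : ∑ k ∈ Finset.range K, ((4:ℝ) ^ s) ^ k ≤ ((4:ℝ) ^ s) ^ K := by
  have hx : 2 ≤ (4:ℝ) ^ s := by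
    have : (4:ℝ) ^ (1/2:ℝ) ≤ 4 ^ s := Real.rpow_le_rpow_of_exponent_le (by norm_num) hs.le
    rw [← Real.sqrt_eq_rpow, show (4:ℝ) = 2 ^ 2 by norm_num, Real.sqrt_sq (by norm_num)] at this
    norm_num at this ⊢; exact this
  induction K with
  | zero => simp
  | succ n ih =>
    rw [Finset.sum_range_succ, pow_succ]
    have : 0 ≤ ((4:ℝ) ^ s) ^ n := by positivity
    nlinarith

lemma multU (h : IsCutoff s η) (hs : 1 / 2 < s) (hs1 : s < 1) {ρ a : ℝ} (hρ : 0 ≤ ρ)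
    (ha : |a| ≤ ρ) : ∑' k : ℕ, ENNReal.ofReal (((4:ℝ) ^ s) ^ k * Ed ((1/2) ^ k * a) ^ 2)
      ≤ CU s * ENNReal.ofReal (mu η ρ ^ 2) := by
  have hx0 : (0:ℝ) ≤ 4 ^ s := by positivity
  have hx1 : (0:ℝ) ≤ (4:ℝ) ^ s / 4 := by positivity
  have hpi := Real.pi_pos
  rcases le_or_gt ρ 1 with h1 | h1
  · have hm : mu η ρ = ρ := by unfold mu; rw [h.2.2.2.1 ρ h1, mul_one]
    rw [hm]
    calc ∑' k : ℕ, ENNReal.ofReal (((4:ℝ) ^ s) ^ k * Ed ((1/2) ^ k * a) ^ 2)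
        ≤ ∑' k : ℕ, ENNReal.ofReal ((64 * π ^ 2 * ρ ^ 2) * ((4:ℝ) ^ s / 4) ^ k) := by
          refine ENNReal.tsum_le_tsum fun k => ENNReal.ofReal_le_ofReal ?_
          have h2 := Ed_sq_le k ha
          have h3 : 0 ≤ 4 * π ^ 2 * (1/4:ℝ) ^ k * ρ ^ 2 := by positivity
          calc _ ≤ ((4:ℝ) ^ s) ^ k * (16 * (4 * π ^ 2 * (1/4) ^ k * ρ ^ 2)) := by gcongr; linarith
            _ = (64 * π ^ 2 * ρ ^ 2) * ((4:ℝ) ^ s * (1/4)) ^ k := by rw [mul_pow]; ring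
            _ = _ := by rw [mul_one_div]
      _ = ENNReal.ofReal (64 * π ^ 2) * (1 - ENNReal.ofReal ((4:ℝ) ^ s / 4))⁻¹ * ENNReal.ofReal (ρ ^ 2) := by
          rw [tsum_geo (by positivity) hx1, ENNReal.ofReal_mul (by positivity)]; ring
      _ ≤ _ := by
          apply mul_le_mul_left
          unfold CU
          exact le_add_self
  · obtain ⟨K, hK1, hK2⟩ := exists_nat_pow_near h1.le (by norm_num : (1:ℝ) < 2)
    have hxK : ((4:ℝ) ^ s) ^ K ≤ (ρ ^ s) ^ 2 := by
      rw [pow_w, ← rpow_two_mul' hρ]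
      exact Real.rpow_le_rpow (by positivity) hK1 (by linarith)
    have hmu : (ρ ^ s) ^ 2 ≤ 4 * mu η ρ ^ 2 := by
      have := mu_ge_pow h hs hs1 h1.le
      have h0 : 0 ≤ ρ ^ s := Real.rpow_nonneg hρ s
      nlinarith
    have hxm := hxK.trans hmu
    rw [← Summable.sum_add_tsum_nat_add' (k := K) ENNReal.summable]
    unfold CU
    rw [add_mul]
    apply add_le_add
    · rw [← ENNReal.ofReal_sum_of_nonneg (fun k _ => by have := Ed_nonneg ((1/2) ^ k * a); positivity),
        ← ENNReal.ofReal_mul (by norm_num)]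
      apply ENNReal.ofReal_le_ofReal
      calc ∑ k ∈ Finset.range K, ((4:ℝ) ^ s) ^ k * Ed ((1/2) ^ k * a) ^ 2
          ≤ ∑ k ∈ Finset.range K, ((4:ℝ) ^ s) ^ k * 4 := by
            apply Finset.sum_le_sum; intro k _
            gcongr
            have := Ed_le_two ((1/2) ^ k * a)
            have := Ed_nonneg ((1/2) ^ k * a)
            nlinarith
        _ = (∑ k ∈ Finset.range K, ((4:ℝ) ^ s) ^ k) * 4 := by rw [Finset.sum_mul]
        _ ≤ _ := by linarith [geo_partial hs K]
    · calc ∑' m : ℕ, ENNReal.ofReal (((4:ℝ) ^ s) ^ (m + K) * Ed ((1/2) ^ (m + K) * a) ^ 2)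
          ≤ ∑' m : ℕ, ENNReal.ofReal ((64 * π ^ 2 * mu η ρ ^ 2) * ((4:ℝ) ^ s / 4) ^ m) := by
            refine ENNReal.tsum_le_tsum fun k => ENNReal.ofReal_le_ofReal ?_
            have h2 := Ed_sq_le (k + K) ha
            have h3 : (1/4:ℝ) ^ K * ρ ^ 2 ≤ 4 := by
              have e1 : (1/4:ℝ) ^ K * (2 ^ (K+1)) ^ 2 = 4 := by
                rw [← pow_mul, add_mul, pow_add, mul_comm K 2, pow_mul, ← mul_assoc, ← mul_pow]; norm_num
              have : ρ ^ 2 ≤ (2 ^ (K+1)) ^ 2 := pow_le_pow_left₀ hρ hK2.le 2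
              have h4 : (0:ℝ) ≤ (1/4) ^ K := by positivity
              nlinarith
            calc _ ≤ ((4:ℝ) ^ s) ^ (k+K) * (4 * π ^ 2 * (1/4) ^ (k+K) * ρ ^ 2) := by gcongr
              _ = 4 * π ^ 2 * ((4:ℝ) ^ s) ^ K * ((1/4) ^ K * ρ ^ 2) * ((4:ℝ) ^ s * (1/4)) ^ k := by
                rw [mul_pow, pow_add, pow_add]; ring
              _ ≤ 4 * π ^ 2 * (4 * mu η ρ ^ 2) * 4 * ((4:ℝ) ^ s * (1/4)) ^ k := by gcongr
              _ = _ := by rw [mul_one_div]; ring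
        _ = _ := by
            rw [tsum_geo (by positivity) hx1, ENNReal.ofReal_mul (by positivity)]; ring

lemma multI (h : IsCutoff s η) (hs : 1 / 2 < s) (hs1 : s < 1) {N r b a : ℝ} (hN : 1 ≤ N) (hr : 0 ≤ r)
    (hb : 0 ≤ b) (hb1 : b ≤ 1) (ha : |a| ≤ b * r) : Ed a ≤ 4 * π * b ^ s * (r * η (r / N)) := by
  have hpi := Real.pi_gt_three
  have hN0 : 0 < N := by linarith
  have hbs : 0 ≤ b ^ s := Real.rpow_nonneg hb s
  have hbb : b ≤ b ^ s := by
    rcases hb.eq_or_lt with h2 | h2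
    · rw [← h2]; exact Real.rpow_nonneg le_rfl s
    · have : b ^ (1:ℝ) ≤ b ^ s := Real.rpow_le_rpow_of_exponent_ge h2 hb1 hs1.le
      rwa [Real.rpow_one] at this
  have hE := Ed_le a
  rcases le_total r 1 with h1 | h1
  · have : η (r / N) = 1 := h.2.2.2.1 _ (by rw [div_le_one hN0]; linarith)
    rw [this, mul_one]
    have : b * r ≤ b ^ s * r := by gcongr
    nlinarith [mul_nonneg hbs hr]
  · have h3 : η r ≤ η (r / N) := h.2.1 (by simp; positivity) (by simp; linarith) (div_le_self hr hN)
    have h4 : r ^ s ≤ 2 * (r * η (r / N)) := by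
      have := mu_ge_pow h hs hs1 h1
      unfold mu at this
      nlinarith
    have h5 : Ed a ≤ 2 * π * (b * r) ^ s := by
      rcases le_total (b * r) 1 with h6 | h6
      · have h7 : b * r ≤ (b * r) ^ s := by
          have h0 : 0 ≤ b * r := by positivity
          rcases h0.eq_or_lt with h2 | h2
          · rw [← h2]; exact Real.rpow_nonneg le_rfl s
          · have : (b*r) ^ (1:ℝ) ≤ (b*r) ^ s := Real.rpow_le_rpow_of_exponent_ge h2 h6 hs1.le
            rwa [Real.rpow_one] at this
        nlinarith
      · have h7 : 1 ≤ (b * r) ^ s := Real.one_le_rpow h6 (by linarith)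
        have := Ed_le_two a
        nlinarith
    rw [Real.mul_rpow hb hr] at h5
    calc Ed a ≤ 2 * π * (b ^ s * r ^ s) := h5
      _ ≤ 2 * π * (b ^ s * (2 * (r * η (r / N)))) := by gcongr
      _ = _ := by ring

end cut

lemma fourier_trans (f : E3 → ℂ) (h ξ : E3) :
    𝓕 (fun x => f (x + h)) ξ = cexp (I * ((2 * π * inner ℝ ξ h : ℝ) : ℂ)) * 𝓕 f ξ := by
  have h1 := congrFun (VectorFourier.fourierIntegral_comp_add_right Real.fourierChar (volume : Measure E3)
    (innerₗ E3) f h) ξ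
  have h2 : 𝓕 (fun x => f (x + h)) ξ = VectorFourier.fourierIntegral Real.fourierChar (volume : Measure E3)
    (innerₗ E3) (f ∘ fun v ↦ v + h) ξ := rfl
  rw [h2, h1, Circle.smul_def, smul_eq_mul, Real.fourierChar_apply, innerₗ_apply_apply, real_inner_comm]
  congr 2
  push_cast; ring

lemma n2_dl {f : E3 → ℂ} (hf : Sch f) (h : E3) :
    n2 (fun x => f (x + h) - f x) ^ 2 = ∫⁻ ξ, ENNReal.ofReal (Ed (inner ℝ ξ h) ^ 2) * ‖𝓕 f ξ‖ₑ ^ 2 := by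
  rw [← ((hf.trans h).sub hf).n2_fourier, n2_sq]
  refine lintegral_congr fun ξ => ?_
  rw [fsub' (hf.trans h).integrable hf.integrable, fourier_trans]
  rw [show ∀ a b : ℂ, a * b - b = (a - 1) * b by intro a b; ring, enorm_mul, mul_pow,
    ENNReal.ofReal_pow (Ed_nonneg _), Ed, ofReal_norm]

/-- `L²` size of the gradient of the smoothed function -/
def GI (η : ℝ → ℝ) (N : ℝ) (f : E3 → ℂ) : ℝ≥0∞ :=
  ∫⁻ ξ, ENNReal.ofReal (mu η (‖ξ‖ / N) ^ 2) * ‖𝓕 f ξ‖ₑ ^ 2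

/-- dyadic shifts -/
def hk (N : ℝ) (k : ℕ) (j : Fin 3) : E3 := ((1/2) ^ k / N) • e3 j

lemma inner_hk (N : ℝ) (k : ℕ) (j : Fin 3) (ξ : E3) : inner ℝ ξ (hk N k j) = (1/2) ^ k * (ξ j / N) := by
  rw [hk, inner_smul_right, inner_e3]; ring

lemma norm_hk_le {N : ℝ} (hN : 1 ≤ N) (k : ℕ) (j : Fin 3) : ‖hk N k j‖ ≤ 1 := by
  rw [hk, norm_smul, e3, EuclideanSpace.norm_single, Real.norm_of_nonneg (by positivity)]
  simp only [norm_one, mul_one]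
  exact div_le_one_of_le₀ ((pow_le_one₀ (by norm_num) (by norm_num)).trans hN) (by linarith)

/-- the square-function form of the norm -/
def Ns (s N : ℝ) (f : E3 → ℂ) : ℝ≥0∞ :=
  ∑ j : Fin 3, ∑' k : ℕ, ENNReal.ofReal (((4:ℝ) ^ s) ^ k) * n2 (fun x => f (x + hk N k j) - f x) ^ 2

lemma Ed_cont : Continuous Ed := by unfold Ed; fun_prop

lemma Ns_eq (s N : ℝ) {f : E3 → ℂ} (hf : Sch f) : Ns s N f = ∫⁻ ξ, (∑ j : Fin 3, ∑' k : ℕ,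
    ENNReal.ofReal (((4:ℝ) ^ s) ^ k * Ed ((1/2) ^ k * (ξ j / N)) ^ 2)) * ‖𝓕 f ξ‖ₑ ^ 2 := by
  have hm : Measurable (fun ξ => ‖𝓕 f ξ‖ₑ ^ 2) := (hf.fourier.continuous.measurable.enorm.pow_const 2)
  have hE : ∀ (k : ℕ) (j : Fin 3), Measurable (fun ξ : E3 => ENNReal.ofReal (Ed ((1/2) ^ k * (ξ j / N)) ^ 2)) := by
    intro k j
    have : Continuous (fun ξ : E3 => ENNReal.ofReal (Ed ((1/2) ^ k * (ξ j / N)) ^ 2)) := by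
      have := Ed_cont
      exact ENNReal.continuous_ofReal.comp (by fun_prop)
    exact this.measurable
  unfold Ns
  simp only [Finset.sum_mul, ← ENNReal.tsum_mul_right]
  have hE' : ∀ (k : ℕ) (j : Fin 3), Measurable (fun ξ : E3 => ENNReal.ofReal (((4:ℝ) ^ s) ^ k * Ed ((1/2) ^ k * (ξ j / N)) ^ 2) * ‖𝓕 f ξ‖ₑ ^ 2) := by
    intro k j
    simp only [ENNReal.ofReal_mul (by positivity : (0:ℝ) ≤ ((4:ℝ) ^ s) ^ k)]
    exact ((hE k j).const_mul _).mul hm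
  rw [lintegral_finsetSum _ (fun j _ => Measurable.tsum (fun k => hE' k j))]
  refine Finset.sum_congr rfl fun j _ => ?_
  rw [lintegral_tsum (fun k => (hE' k j).aemeasurable)]
  refine tsum_congr fun k => ?_
  rw [n2_dl hf, ← lintegral_const_mul _ (by simp only [inner_hk]; exact (hE k j).mul hm)]
  refine lintegral_congr fun ξ => ?_
  rw [ENNReal.ofReal_mul (by positivity), inner_hk]; ring

section cut
variable {s : ℝ} {η : ℝ → ℝ}

lemma GI_le (h : IsCutoff s η) (hs : 1 / 2 < s) (hs1 : s < 1) {N : ℝ} (hN : 1 ≤ N) {f : E3 → ℂ} (hf : Sch f) :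
    GI η N f ≤ 4 * Ns s N f := by
  have hN0 : 0 < N := by linarith
  rw [Ns_eq s N hf, GI, ← lintegral_const_mul' _ _ (by simp)]
  refine lintegral_mono fun ξ => ?_
  rw [← mul_assoc]
  apply mul_le_mul_left
  obtain ⟨j, hj⟩ : ∃ j : Fin 3, (‖ξ‖ / N) ^ 2 ≤ 3 * (ξ j / N) ^ 2 := by
    by_contra hc
    push Not at hc
    have h0 := hc 0
    have h1 := hc 1
    have h2 := hc 2
    have h3 : (‖ξ‖ / N) ^ 2 = (ξ 0 / N) ^ 2 + (ξ 1 / N) ^ 2 + (ξ 2 / N) ^ 2 := by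
      rw [div_pow, norm_sq_e3]; ring
    linarith
  obtain ⟨k, hk⟩ := multL h hs hs1 (by positivity : 0 ≤ ‖ξ‖ / N) hj
  calc ENNReal.ofReal (mu η (‖ξ‖ / N) ^ 2)
      ≤ 4 * ENNReal.ofReal (((4:ℝ) ^ s) ^ k * Ed ((1/2) ^ k * (ξ j / N)) ^ 2) := by
        rw [show (4:ℝ≥0∞) = ENNReal.ofReal 4 by simp, ← ENNReal.ofReal_mul (by norm_num)]
        exact ENNReal.ofReal_le_ofReal hk
    _ ≤ _ := by
        apply mul_le_mul_right
        exact (ENNReal.le_tsum k).trans (Finset.single_le_sum (f := fun j : Fin 3 => ∑' k : ℕ,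
          ENNReal.ofReal (((4:ℝ) ^ s) ^ k * Ed ((1/2) ^ k * (ξ j / N)) ^ 2)) (fun _ _ => zero_le) (Finset.mem_univ j))

lemma abs_coord_le (ξ : E3) (j : Fin 3) : |ξ j| ≤ ‖ξ‖ := by
  simpa using PiLp.norm_apply_le ξ j

lemma Ns_le (h : IsCutoff s η) (hs : 1 / 2 < s) (hs1 : s < 1) {N : ℝ} (hN : 1 ≤ N) {f : E3 → ℂ} (hf : Sch f) :
    Ns s N f ≤ 3 * CU s * GI η N f := by
  have hN0 : 0 < N := by linarith
  rw [Ns_eq s N hf, GI, ← lintegral_const_mul' _ _ (ENNReal.mul_ne_top (by simp) (CU_ne_top hs1))]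
  refine lintegral_mono fun ξ => ?_
  dsimp only
  rw [← mul_assoc]
  apply mul_le_mul_left
  calc ∑ j : Fin 3, ∑' k : ℕ, ENNReal.ofReal (((4:ℝ) ^ s) ^ k * Ed ((1/2) ^ k * (ξ j / N)) ^ 2)
      ≤ ∑ j : Fin 3, CU s * ENNReal.ofReal (mu η (‖ξ‖ / N) ^ 2) := by
        refine Finset.sum_le_sum fun j _ => multU h hs hs1 (by positivity) ?_
        rw [abs_div, abs_of_pos hN0]
        have := abs_coord_le ξ j
        gcongr
    _ = _ := by simp; ring

lemma n2_dl_le (h : IsCutoff s η) (hs : 1 / 2 < s) (hs1 : s < 1) {N : ℝ} (hN : 1 ≤ N) {f : E3 → ℂ} (hf : Sch f)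
    {b : E3} (hb : ‖b‖ ≤ 1) :
    n2 (fun x => f (x + b) - f x) ^ 2 ≤ ENNReal.ofReal (4 * (‖b‖ ^ s) ^ 2) * (ENNReal.ofReal ((2 * π * N) ^ 2) * GI η N f) := by
  have hN0 : 0 < N := by linarith
  rw [n2_dl hf, GI, ← mul_assoc, ← ENNReal.ofReal_mul (by positivity), ← lintegral_const_mul' _ _ (by simp)]
  refine lintegral_mono fun ξ => ?_
  dsimp only
  rw [← mul_assoc]
  apply mul_le_mul_left
  rw [← ENNReal.ofReal_mul (by positivity)]
  apply ENNReal.ofReal_le_ofReal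
  have h1 := multI h hs hs1 hN (norm_nonneg ξ) (norm_nonneg b) hb (a := inner ℝ ξ b)
    (by rw [mul_comm]; exact abs_real_inner_le_norm ξ b)
  calc Ed (inner ℝ ξ b) ^ 2 ≤ (4 * π * ‖b‖ ^ s * (‖ξ‖ * η (‖ξ‖ / N))) ^ 2 :=
        pow_le_pow_left₀ (Ed_nonneg _) h1 2
    _ = _ := by unfold mu; field_simp; ring

end cut

section cut
variable {s : ℝ} {η : ℝ → ℝ}

/-- the symbol times the Fourier transform -/
def If (η : ℝ → ℝ) (N : ℝ) (g : E3 → ℂ) : E3 → ℂ := fun ξ => (η (‖ξ‖ / N) : ℂ) * 𝓕 g ξ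

lemma Iop_eq (η : ℝ → ℝ) (N : ℝ) (g : E3 → ℂ) : Iop η N g = 𝓕⁻ (If η N g) := rfl

lemma IsCutoff.cont (h : IsCutoff s η) : Continuous η := h.1.continuous

lemma IsCutoff.symb_cont (h : IsCutoff s η) (N : ℝ) : Continuous (fun ξ : E3 => (η (‖ξ‖ / N) : ℂ)) := by
  have := h.cont
  fun_prop

lemma If_cont (h : IsCutoff s η) (N : ℝ) {g : E3 → ℂ} (hg : Sch g) : Continuous (If η N g) :=
  (h.symb_cont N).mul hg.fourier.continuous

lemma If_norm (h : IsCutoff s η) {N : ℝ} (hN : 1 ≤ N) (g : E3 → ℂ) (ξ : E3) : ‖If η N g ξ‖ ≤ ‖𝓕 g ξ‖ := by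
  have h0 : 0 ≤ ‖ξ‖ / N := by positivity
  rw [If, norm_mul, Complex.norm_real, Real.norm_of_nonneg (h.pos h0).le]
  exact mul_le_of_le_one_left (norm_nonneg _) (h.le_one h0)

lemma If_int (h : IsCutoff s η) {N : ℝ} (hN : 1 ≤ N) {g : E3 → ℂ} (hg : Sch g) : Integrable (If η N g) :=
  hg.fourier.integrable.mono (If_cont h N hg).aestronglyMeasurable (Eventually.of_forall (If_norm h hN g))

lemma If_memLp (h : IsCutoff s η) {N : ℝ} (hN : 1 ≤ N) {g : E3 → ℂ} (hg : Sch g) : MemLp (If η N g) 2 :=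
  (hg.fourier.memLp 2).mono (If_cont h N hg).aestronglyMeasurable (Eventually.of_forall (If_norm h hN g))

lemma Iop_cont (h : IsCutoff s η) {N : ℝ} (hN : 1 ≤ N) {g : E3 → ℂ} (hg : Sch g) : Continuous (Iop η N g) :=
  fourierInv_continuous (If_int h hN hg)

lemma n2_Iop (h : IsCutoff s η) {N : ℝ} (hN : 1 ≤ N) {g : E3 → ℂ} (hg : Sch g) : n2 (Iop η N g) = n2 (If η N g) := by
  rw [n2_eq, n2_eq, Iop_eq, eLpNorm_fourierInv (If_int h hN hg) (If_memLp h hN hg)]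

lemma Iop_memLp (h : IsCutoff s η) {N : ℝ} (hN : 1 ≤ N) {g : E3 → ℂ} (hg : Sch g) : MemLp (Iop η N g) 2 := by
  refine ⟨(Iop_cont h hN hg).aestronglyMeasurable, ?_⟩
  rw [Iop_eq, eLpNorm_fourierInv (If_int h hN hg) (If_memLp h hN hg)]
  exact (If_memLp h hN hg).2

lemma Iop_bdd (η : ℝ → ℝ) (N : ℝ) (g : E3 → ℂ) (x : E3) : ‖Iop η N g x‖ ≤ ∫ ξ, ‖If η N g ξ‖ := by
  rw [Iop_eq, Real.fourierInv_eq_fourier_neg]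
  exact norm_fourier_le _

lemma pd_Iop (h : IsCutoff s η) {N : ℝ} (hN : 1 ≤ N) {g : E3 → ℂ} (hg : Sch g) (j : Fin 3) :
    pd (Iop η N g) j = Iop η N (pd g j) := by
  ext x
  have hi := If_int h hN hg
  have hvi : Integrable (fun v => ‖v‖ * ‖If η N g v‖) := by
    obtain ⟨S, hS⟩ := hg.fourier.eq
    have h1 := S.integrable_pow_mul volume 1
    refine h1.mono (by have := If_cont h N hg; fun_prop) (Eventually.of_forall fun v => ?_)
    have := If_norm h hN g v
    rw [hS] at this
    rw [norm_mul, norm_norm, norm_norm, norm_mul, norm_norm, pow_one, norm_norm]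
    gcongr
  have h1 := Real.hasFDerivAt_fourier hi hvi (-x)
  have h2 : HasFDerivAt (fun y : E3 => -y) (-(ContinuousLinearMap.id ℝ E3)) x := (hasFDerivAt_id x).neg
  have h3 := h1.comp x h2
  have e1 : (𝓕 (If η N g) ∘ fun y : E3 => -y) = Iop η N g := by
    ext y; rw [Iop_eq, Real.fourierInv_eq_fourier_neg]; rfl
  rw [e1] at h3
  rw [pd, h3.fderiv]
  simp only [ContinuousLinearMap.comp_neg, ContinuousLinearMap.comp_id, neg_apply]
  have hI : Integrable (fun v : E3 => Real.fourierChar (-(inner ℝ v (-x))) • VectorFourier.fourierSMulRight (innerSL ℝ) (If η N g) v) := by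
    have h5 : Integrable (fun v : E3 => VectorFourier.fourierSMulRight (innerSL ℝ) (If η N g) v) := by
      refine (hvi.const_mul (2 * π * ‖(innerSL ℝ : E3 →L[ℝ] E3 →L[ℝ] ℝ)‖)).mono' hi.1.fourierSMulRight
        (Eventually.of_forall fun v => ?_)
      rw [← mul_assoc]
      exact VectorFourier.norm_fourierSMulRight_le _ _ v
    exact (Real.fourierIntegral_convergent_iff (-x)).2 h5
  rw [Real.fourier_eq, ContinuousLinearMap.integral_apply hI, ← integral_neg, Iop_eq, Real.fourierInv_eq]
  refine integral_congr_ae (Eventually.of_forall fun v => ?_)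
  simp only [inner_neg_right, neg_neg]
  rw [If, hg.fourier_pd]
  simp only [Circle.smul_def, smul_apply, VectorFourier.fourierSMulRight_apply, If,
    smul_eq_mul, Complex.real_smul]
  have e5 : (innerSL ℝ v) (e3 j) = v j := inner_e3 v j
  rw [e5]
  ring

lemma gr_Iop (h : IsCutoff s η) {N : ℝ} (hN : 1 ≤ N) {g : E3 → ℂ} (hg : Sch g) :
    gr (Iop η N g) = ENNReal.ofReal ((2 * π * N) ^ 2) * GI η N g := by
  unfold gr
  have h1 : ∀ j : Fin 3, n2 (pd (Iop η N g) j) ^ 2 = ∫⁻ ξ, ENNReal.ofReal (4 * π ^ 2 * ξ j ^ 2 * η (‖ξ‖ / N) ^ 2) * ‖𝓕 g ξ‖ₑ ^ 2 := by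
    intro j
    rw [pd_Iop h hN hg, n2_Iop h hN (hg.pd j), n2_sq]
    refine lintegral_congr fun ξ => ?_
    rw [If, hg.fourier_pd, ← mul_assoc, enorm_mul, mul_pow]
    congr 1
    rw [← ofReal_norm, ← ENNReal.ofReal_pow (norm_nonneg _)]
    congr 1
    simp only [norm_mul, Complex.norm_real, Complex.norm_I, Complex.norm_ofNat, mul_pow, Real.norm_eq_abs, sq_abs]
    ring
  simp only [h1]
  have hc := hg.fourier.continuous
  have hm : ∀ j : Fin 3, Measurable (fun ξ : E3 => ENNReal.ofReal (4 * π ^ 2 * ξ j ^ 2 * η (‖ξ‖ / N) ^ 2) * ‖𝓕 g ξ‖ₑ ^ 2) := fun j => by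
    have : Continuous (fun ξ : E3 => 4 * π ^ 2 * ξ j ^ 2 * η (‖ξ‖ / N) ^ 2) := by
      have := h.cont
      fun_prop
    exact this.measurable.ennreal_ofReal.mul (hc.measurable.enorm.pow_const 2)
  rw [← lintegral_finsetSum _ (fun j _ => hm j), GI, ← lintegral_const_mul' _ _ (by simp)]
  refine lintegral_congr fun ξ => ?_
  rw [← Finset.sum_mul, ← mul_assoc]
  congr 1
  rw [← ENNReal.ofReal_sum_of_nonneg (fun j _ => by positivity), Fin.sum_univ_three, ← ENNReal.ofReal_mul (by positivity)]
  congr 1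
  have e : (2 * π * N) ^ 2 * mu η (‖ξ‖ / N) ^ 2 = 4 * π ^ 2 * ‖ξ‖ ^ 2 * η (‖ξ‖ / N) ^ 2 := by
    unfold mu
    have : N ≠ 0 := by linarith
    field_simp; ring
  rw [e, norm_sq_e3]; ring

lemma energy_GI (h : IsCutoff s η) {N : ℝ} (hN : 1 ≤ N) {g : E3 → ℂ} (hg : Sch g)
    (hE : energyE (Iop η N g) ≤ 1) : gr (Iop η N g) ≤ 2 := by
  have hw := Iop_cont h hN hg
  have hp : ∀ j, Continuous (pd (Iop η N g) j) := fun j => by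
    rw [pd_Iop h hN hg]; exact Iop_cont h hN (hg.pd j)
  have i1 : Integrable (fun x => ‖Iop η N g x‖ ^ 4) := by
    have i0 := (memLp_two_iff_integrable_sq_norm hw.aestronglyMeasurable).1 (Iop_memLp h hN hg)
    refine (i0.const_mul ((∫ ξ, ‖If η N g ξ‖) ^ 2)).mono' (by fun_prop) (Eventually.of_forall fun x => ?_)
    rw [Real.norm_of_nonneg (by positivity)]
    have := Iop_bdd η N g x
    calc ‖Iop η N g x‖ ^ 4 = ‖Iop η N g x‖ ^ 2 * ‖Iop η N g x‖ ^ 2 := by ring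
      _ ≤ _ := by gcongr
  have i2 : ∀ j, Integrable (fun x => Complex.normSq (pd (Iop η N g) j x)) := fun j => by
    simp only [Complex.normSq_eq_norm_sq]
    rw [← memLp_two_iff_integrable_sq_norm (hp j).aestronglyMeasurable, pd_Iop h hN hg]
    exact Iop_memLp h hN (hg.pd j)
  have i3 : Integrable (fun x => (1/2) * (∑ i : Fin 3, Complex.normSq (pd (Iop η N g) i x)) + (1/4) * ‖Iop η N g x‖ ^ 4) :=
    ((integrable_finsetSum _ fun j _ => i2 j).const_mul _).add (i1.const_mul _)
  unfold energyE at hE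
  have h1 : ENNReal.ofReal (∫ x, (1/2) * (∑ i : Fin 3, Complex.normSq (pd (Iop η N g) i x)) + (1/4) * ‖Iop η N g x‖ ^ 4) ≤ 1 := by
    rw [← ENNReal.ofReal_one]; exact ENNReal.ofReal_le_ofReal hE
  rw [ofReal_integral_eq_lintegral_ofReal i3 (Eventually.of_forall fun x => by
    have : ∀ i, 0 ≤ Complex.normSq (pd (Iop η N g) i x) := fun i => Complex.normSq_nonneg _
    have := Finset.sum_nonneg fun i (_ : i ∈ Finset.univ) => this i
    show (0:ℝ) ≤ _
    positivity)] at h1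
  calc gr (Iop η N g) = ∫⁻ x, ∑ j : Fin 3, ‖pd (Iop η N g) j x‖ₑ ^ 2 := by
        rw [lintegral_finsetSum _ (fun j _ => by have := hp j; exact this.measurable.enorm.pow_const 2), gr]
        simp only [n2_sq]
    _ ≤ ∫⁻ x, 2 * ENNReal.ofReal ((1/2) * (∑ i : Fin 3, Complex.normSq (pd (Iop η N g) i x)) + (1/4) * ‖Iop η N g x‖ ^ 4) := by
        refine lintegral_mono fun x => ?_
        have e : ∀ j, ‖pd (Iop η N g) j x‖ₑ ^ 2 = ENNReal.ofReal (Complex.normSq (pd (Iop η N g) j x)) := fun j => by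
          rw [← ofReal_norm, ← ENNReal.ofReal_pow (norm_nonneg _), Complex.normSq_eq_norm_sq]
        simp only [e]
        rw [← ENNReal.ofReal_sum_of_nonneg (fun j _ => Complex.normSq_nonneg _), show (2:ℝ≥0∞) = ENNReal.ofReal 2 by simp, ← ENNReal.ofReal_mul (by norm_num)]
        apply ENNReal.ofReal_le_ofReal
        have : 0 ≤ ‖Iop η N g x‖ ^ 4 := by positivity
        linarith
    _ ≤ 2 := by
        rw [lintegral_const_mul' _ _ (by simp)]
        calc _ ≤ 2 * (1:ℝ≥0∞) := mul_le_mul_right h1 2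
          _ = 2 := by simp

end cut

lemma Sol.dl {T t : ℝ} {φ : ℝ → E3 → ℂ} (h : Sol 0 T φ) (ht : t ≤ T)
    (ha : ∫⁻ τ in Set.Ioc 0 t, n6 (φ τ) ^ 4 ≤ e2 ^ 2) (b : E3) :
    (∫⁻ τ in Set.Ioc 0 t, n6 (fun x => φ τ (x + b) - φ τ x) ^ 2 ≤ (2 * CS * n2 (fun x => φ 0 (x + b) - φ 0 x)) ^ 2) ∧
    ∀ τ ∈ Set.Icc 0 t, n2 (fun x => φ τ (x + b) - φ τ x) ≤ 2 * n2 (fun x => φ 0 (x + b) - φ 0 x) := by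
  obtain ⟨K, hK, hb⟩ := h.unif
  have h' := h.mono le_rfl ht
  have f1 : ∫⁻ s in Set.Ioc 0 t, ∫⁻ x, ‖dt φ s x‖ₑ ^ 2 ≠ ⊤ :=
    fin_of_bd hK fun s hs => (hb s ⟨hs.1.le, hs.2.trans ht⟩).1
  have f2 : ∫⁻ s in Set.Ioc 0 t, ∫⁻ x, ‖dt (fun t x => φ t (x + b)) s x‖ₑ ^ 2 ≠ ⊤ := by
    refine fin_of_bd hK fun s hs => ?_
    have := (hb s ⟨hs.1.le, hs.2.trans ht⟩).1
    rw [← n2_trans (dt φ s) b] at this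
    exact this
  exact lemmaD (h'.space b) h' f2 f1 (by simp only [n6_trans]; exact ha) ha

lemma n2_start {s : ℝ} {η : ℝ → ℝ} (hη : IsCutoff s η) (hs : 1 / 2 < s) (hs1 : s < 1) {N : ℝ} (hN : 1 ≤ N)
    {f : E3 → ℂ} (hf : Sch f) (hG : gr (Iop η N f) ≤ 2) {b : E3} (hb : ‖b‖ ≤ 1) :
    n2 (fun x => f (x + b) - f x) ≤ 3 * ENNReal.ofReal (‖b‖ ^ s) := by
  rw [← ENNReal.pow_le_pow_left_iff two_ne_zero]
  have h0 : 0 ≤ ‖b‖ ^ s := Real.rpow_nonneg (norm_nonneg _) _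
  refine (n2_dl_le hη hs hs1 hN hf hb).trans ?_
  rw [← gr_Iop hη hN hf]
  calc ENNReal.ofReal (4 * (‖b‖ ^ s) ^ 2) * gr (Iop η N f) ≤ ENNReal.ofReal (4 * (‖b‖ ^ s) ^ 2) * ENNReal.ofReal 2 := by
        apply mul_le_mul_right; simpa using hG
    _ ≤ ENNReal.ofReal ((3 * (‖b‖ ^ s)) ^ 2) := by
        rw [← ENNReal.ofReal_mul (by positivity)]
        apply ENNReal.ofReal_le_ofReal; nlinarith [sq_nonneg (‖b‖ ^ s)]
    _ = _ := by
        rw [ENNReal.ofReal_pow (by positivity), ENNReal.ofReal_mul (by norm_num)]; simp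

/-- constant in the difference bounds -/
def Bc : ℝ≥0∞ := 6 * (1 + CS)

lemma Bc_ne_top : Bc ≠ ⊤ := by unfold Bc; have := CS_ne_top; finiteness

lemma exists_params {s : ℝ} (hs : 1 / 2 < s) : ∃ R : ℝ, 0 < R ∧ 2 * R ≤ 1 ∧ ∃ D : ℝ≥0∞, D ≠ 0 ∧
    (((V R)⁻¹ ^ (1/3:ℝ) * D) ^ (1/4:ℝ) + C1 ^ (1/4:ℝ) * Bc * ENNReal.ofReal (R ^ (s-1/2)) * (1 - ENNReal.ofReal ((1/2) ^ (s-1/2)))⁻¹) ^ 4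
      ≤ e2 ^ 2 / 2 := by
  set z : ℝ≥0∞ := (e2 ^ 2 / 2) ^ (1/4:ℝ) / 2 with hz
  have he0 := e2_ne_zero
  have het := e2_ne_top
  have hE0 : e2 ^ 2 / 2 ≠ 0 := (ENNReal.div_pos (pow_ne_zero 2 he0) (by simp)).ne'
  have hEt : e2 ^ 2 / 2 ≠ ⊤ := by finiteness
  have hz1 : (e2 ^ 2 / 2) ^ (1/4:ℝ) ≠ 0 := by
    rw [Ne, ENNReal.rpow_eq_zero_iff]; push Not; exact ⟨fun h => absurd h hE0, fun h => absurd h hEt⟩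
  have hzt1 : (e2 ^ 2 / 2) ^ (1/4:ℝ) ≠ ⊤ := by finiteness
  have hz0 : z ≠ 0 := (ENNReal.div_pos hz1 (by simp)).ne'
  have hzt : z ≠ ⊤ := by rw [hz]; finiteness
  have hzz : (z + z) ^ 4 = e2 ^ 2 / 2 := by
    rw [hz, ENNReal.add_halves, ← ENNReal.rpow_natCast, ← ENNReal.rpow_mul]; norm_num
  set K : ℝ≥0∞ := C1 ^ (1/4:ℝ) * Bc * (1 - ENNReal.ofReal ((1/2) ^ (s-1/2)))⁻¹ with hKd
  have hK : K ≠ ⊤ := by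
    have h1 : ENNReal.ofReal ((1/2:ℝ) ^ (s-1/2)) < 1 := by
      rw [ENNReal.ofReal_lt_one]
      exact Real.rpow_lt_one (by norm_num) (by norm_num) (by linarith)
    have h2 : (1 - ENNReal.ofReal ((1/2:ℝ) ^ (s-1/2)))⁻¹ ≠ ⊤ := by
      rw [ENNReal.inv_ne_top]; exact (tsub_pos_of_lt h1).ne'
    have := C1_ne_top
    have := Bc_ne_top
    rw [hKd]
    exact ENNReal.mul_ne_top (by finiteness) h2
  have hlim : Tendsto (fun R : ℝ => K * ENNReal.ofReal (R ^ (s-1/2))) (nhdsWithin 0 (Set.Ioi 0)) (nhds 0) := by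
    have h1 : Tendsto (fun R : ℝ => R ^ (s-1/2)) (nhdsWithin 0 (Set.Ioi 0)) (nhds 0) := by
      have := (Real.continuousAt_rpow_const (0:ℝ) (s-1/2) (Or.inr (by linarith))).tendsto
      rw [Real.zero_rpow (by linarith)] at this
      exact this.mono_left nhdsWithin_le_nhds
    have h2 := ENNReal.Tendsto.const_mul (ENNReal.tendsto_ofReal h1) (Or.inr hK)
    simpa using h2
  have hev := (hlim.eventually (ge_mem_nhds (pos_iff_ne_zero.2 hz0))).and
    (Ioc_mem_nhdsGT (show (0:ℝ) < 1/2 by norm_num))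
  obtain ⟨R, hR1, hR2⟩ := hev.exists
  refine ⟨R, hR2.1, by linarith [hR2.2], ?_⟩
  set c : ℝ≥0∞ := (V R)⁻¹ ^ (1/3:ℝ) with hc
  have hV0 := V_ne_zero hR2.1
  have hVt := V_ne_top R
  have hc0 : c ≠ 0 := by
    rw [hc, Ne, ENNReal.rpow_eq_zero_iff]; push Not
    exact ⟨fun h => absurd h (ENNReal.inv_ne_zero.2 hVt), fun h => absurd h (ENNReal.inv_ne_top.2 hV0)⟩
  have hct : c ≠ ⊤ := by rw [hc]; finiteness
  refine ⟨z ^ 4 * c⁻¹, mul_ne_zero (pow_ne_zero _ hz0) (ENNReal.inv_ne_zero.2 hct), ?_⟩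
  rw [← hzz]
  gcongr
  · have : c * (z ^ 4 * c⁻¹) = z ^ 4 := by
      rw [mul_comm, mul_assoc, ENNReal.inv_mul_cancel hc0 hct, mul_one]
    rw [this, ← ENNReal.rpow_natCast, ← ENNReal.rpow_mul]; norm_num
  · refine le_trans (le_of_eq ?_) hR1
    rw [hKd]; ring

lemma exists_boot {s : ℝ} (hs : 1 / 2 < s) (hs1 : s < 1) : ∃ D : ℝ≥0∞, D ≠ 0 ∧
    ∀ η : ℝ → ℝ, IsCutoff s η → ∀ N : ℝ, 1 ≤ N → ∀ T > 0, ∀ φ : ℝ → E3 → ℂ, Sol 0 T φ →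
      gr (Iop η N (φ 0)) ≤ 2 → ∫⁻ τ in Set.Ioc 0 T, q4 (φ τ) ≤ D →
      ∫⁻ τ in Set.Ioc 0 T, n6 (φ τ) ^ 4 ≤ e2 ^ 2 := by
  obtain ⟨R, hR, hR2, D, hD0, hD⟩ := exists_params hs
  refine ⟨D, hD0, ?_⟩
  intro η hη N hN T hT φ h hG hq
  have key : ∀ t ≤ T, ∫⁻ τ in Set.Ioc 0 t, n6 (φ τ) ^ 4 ≤ e2 ^ 2 →
      ∫⁻ τ in Set.Ioc 0 t, n6 (φ τ) ^ 4 ≤ e2 ^ 2 / 2 := by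
    intro t ht ha
    refine le_trans (tele h.cont hs hs1 hR hR2 (B := Bc) ?_ ?_) (le_trans ?_ hD)
    · intro b hb τ hτ
      refine ((h.dl ht ha b).2 τ ⟨hτ.1.le, hτ.2⟩).trans ?_
      calc _ ≤ 2 * (3 * ENNReal.ofReal (‖b‖ ^ s)) := mul_le_mul_right (n2_start hη hs hs1 hN (h.sch 0) hG hb) 2
        _ = 6 * 1 * ENNReal.ofReal (‖b‖ ^ s) := by ring
        _ ≤ _ := by
          unfold Bc; gcongr; exact le_self_add
    · intro b hb
      refine ((h.dl ht ha b).1).trans ?_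
      apply pow_le_pow_left'
      calc _ ≤ 2 * CS * (3 * ENNReal.ofReal (‖b‖ ^ s)) := mul_le_mul_right (n2_start hη hs hs1 hN (h.sch 0) hG hb) _
        _ = 6 * CS * ENNReal.ofReal (‖b‖ ^ s) := by ring
        _ ≤ _ := by
          unfold Bc; gcongr; exact le_add_self
    · have : ∫⁻ τ in Set.Ioc 0 t, q4 (φ τ) ≤ D :=
        (lintegral_mono_set (Set.Ioc_subset_Ioc le_rfl ht)).trans hq
      gcongr
  obtain ⟨K, hK, hb⟩ := h.unif
  have hL : K6 K ^ 4 ≠ ⊤ := by have := K6_ne_top hK; finiteness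
  obtain ⟨τ, hτ0, hτ⟩ : ∃ τ : ℝ, 0 < τ ∧ ENNReal.ofReal τ * K6 K ^ 4 ≤ e2 ^ 2 / 2 := by
    have h1 : Tendsto (fun τ : ℝ => ENNReal.ofReal τ * K6 K ^ 4) (nhdsWithin 0 (Set.Ioi 0)) (nhds 0) := by
      have := ENNReal.Tendsto.mul_const (ENNReal.tendsto_ofReal (tendsto_id (α := ℝ) (x := nhds 0))) (b := K6 K ^ 4) (Or.inr hL)
      simp only [ENNReal.ofReal_zero, zero_mul] at this
      exact this.mono_left nhdsWithin_le_nhds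
    have he0 := e2_ne_zero
    have h2 : 0 < e2 ^ 2 / 2 := ENNReal.div_pos (pow_ne_zero 2 he0) (by simp)
    obtain ⟨τ, h3, h4⟩ := ((h1.eventually (ge_mem_nhds h2)).and self_mem_nhdsWithin).exists
    exact ⟨τ, h4, h3⟩
  have ind : ∀ n : ℕ, ∫⁻ τ in Set.Ioc 0 (min (n * τ) T), n6 (φ τ) ^ 4 ≤ e2 ^ 2 := by
    intro n
    induction n with
    | zero => simp [hT.le]
    | succ n ih =>
      have h1 := key _ (min_le_right _ _) ih
      have hsub : Set.Ioc 0 (min ((n+1 : ℕ) * τ) T) ⊆ Set.Ioc 0 (min (n * τ) T) ∪ Set.Ioc (min (n * τ) T) (min ((n+1:ℕ) * τ) T) := by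
        intro x hx
        rcases le_or_gt x (min (n * τ) T) with h2 | h2
        · exact Or.inl ⟨hx.1, h2⟩
        · exact Or.inr ⟨h2, hx.2⟩
      refine (lintegral_mono_set hsub).trans ((lintegral_union_le _ _ _).trans ?_)
      have h0 : 0 ≤ min (n * τ) T := le_min (by positivity) hT.le
      have h2 : ∫⁻ τ in Set.Ioc (min (n * τ) T) (min ((n+1:ℕ) * τ) T), n6 (φ τ) ^ 4 ≤ e2 ^ 2 / 2 := by
        calc _ ≤ ∫⁻ τ in Set.Ioc (min (n * τ) T) (min ((n+1:ℕ) * τ) T), K6 K ^ 4 := by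
              refine setLIntegral_mono measurable_const fun r hr => ?_
              gcongr
              exact n6_le_K6 (h.sch r) (hb r ⟨h0.trans hr.1.le, hr.2.trans (min_le_right _ _)⟩).2
          _ = K6 K ^ 4 * ENNReal.ofReal (min ((n+1:ℕ) * τ) T - min (n * τ) T) := by
              rw [lintegral_const, Measure.restrict_apply_univ, Real.volume_Ioc]
          _ ≤ K6 K ^ 4 * ENNReal.ofReal τ := by
              gcongr
              push_cast
              rcases le_total (n * τ) T with h3 | h3
              · rw [min_eq_left h3]; have := min_le_left ((n + 1) * τ) T; linarith
              · rw [min_eq_right h3]; have := min_le_right ((n + 1) * τ) T; linarith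
          _ ≤ _ := by rw [mul_comm]; exact hτ
      calc _ ≤ e2 ^ 2 / 2 + e2 ^ 2 / 2 := add_le_add h1 h2
        _ = _ := ENNReal.add_halves _
  obtain ⟨n, hn⟩ := exists_nat_ge (T / τ)
  have := ind n
  rwa [min_eq_right (by rwa [div_le_iff₀ hτ0] at hn)] at this

/-- square function of sixth-power norms of differences -/
def MM (s N : ℝ) (f : E3 → ℂ) : ℝ≥0∞ :=
  ∑ j : Fin 3, ∑' k : ℕ, ENNReal.ofReal (((4:ℝ)^s)^k) * n6 (fun x => f (x + hk N k j) - f x) ^ 2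

lemma n2_cub_dl {f : E3 → ℂ} (hf : Sch f) (b : E3) :
    n2 (fun x => cub f (x + b) - cub f x) ≤ 6 * n6 f ^ 2 * n6 (fun x => f (x + b) - f x) := by
  have hm := hf.continuous.measurable
  have h1 := n2_cub_diff (hm.comp (measurable_id.add_const b)) hm
  have h2 := n6_trans f b
  have e : n6 (f ∘ fun x => id x + b) = n6 f := h2
  rw [e] at h1
  refine le_trans (le_of_eq rfl) (h1.trans (le_of_eq ?_))
  change 3 * (n6 f ^ 2 + n6 f ^ 2) * n6 (fun x => f (x + b) - f x) = _
  ring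

lemma Ns_cub {s N : ℝ} {f : E3 → ℂ} (hf : Sch f) : Ns s N (cub f) ≤ 36 * n6 f ^ 4 * MM s N f := by
  unfold Ns MM
  rw [Finset.mul_sum]
  refine Finset.sum_le_sum fun j _ => ?_
  rw [← ENNReal.tsum_mul_left]
  refine ENNReal.tsum_le_tsum fun k => ?_
  calc _ ≤ ENNReal.ofReal (((4:ℝ)^s)^k) * (6 * n6 f ^ 2 * n6 (fun x => f (x + hk N k j) - f x)) ^ 2 :=
        mul_le_mul_right (pow_le_pow_left' (n2_cub_dl hf _) 2) _
    _ = _ := by ring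

lemma force_pt {s N : ℝ} {η : ℝ → ℝ} (h : IsCutoff s η) (hs : 1 / 2 < s) (hs1 : s < 1) (hN : 1 ≤ N) {f : E3 → ℂ}
    (hf : Sch f) (j : Fin 3) : n2 (If η N (pd (cub f) j)) ≤
      n6 f ^ 2 * (144 * ENNReal.ofReal ((2 * π * N) ^ 2) * MM s N f) ^ (1/2:ℝ) := by
  have hc := hf.cub
  have h1 : n2 (If η N (pd (cub f) j)) ^ 2 ≤ n6 f ^ 4 * (144 * ENNReal.ofReal ((2 * π * N) ^ 2) * MM s N f) := by
    calc _ = n2 (pd (Iop η N (cub f)) j) ^ 2 := by rw [pd_Iop h hN hc, n2_Iop h hN (hc.pd j)]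
      _ ≤ gr (Iop η N (cub f)) := by
          unfold gr
          exact Finset.single_le_sum (f := fun j => n2 (pd (Iop η N (cub f)) j) ^ 2) (fun i _ => zero_le) (Finset.mem_univ j)
      _ ≤ ENNReal.ofReal ((2 * π * N) ^ 2) * (4 * (36 * n6 f ^ 4 * MM s N f)) := by
          rw [gr_Iop h hN hc]
          refine mul_le_mul_right ((GI_le h hs hs1 hN hc).trans (mul_le_mul_right (Ns_cub hf) _)) _
      _ = _ := by ring
  refine (pow_half_le h1).trans (le_of_eq ?_)
  rw [ENNReal.mul_rpow_of_nonneg _ _ (by norm_num), ← ENNReal.rpow_natCast, ← ENNReal.rpow_mul, ← ENNReal.rpow_natCast]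
  norm_num

/-- forcing constant -/
def CF (s : ℝ) : ℝ≥0∞ := e2 ^ 2 * (576 * CS ^ 2 * (3 * CU s) * 2)

lemma CF_ne_top {s : ℝ} (hs1 : s < 1) : CF s ≠ ⊤ := by
  have := CU_ne_top hs1
  have := e2_ne_top
  have := CS_ne_top
  unfold CF; finiteness

lemma dl_meas {φ : ℝ → E3 → ℂ} (hφ : Continuous (fun p : ℝ × E3 => φ p.1 p.2)) (b : E3) :
    Measurable (fun τ => n6 (fun x => φ τ (x + b) - φ τ x)) := by
  apply n6_meas (v := fun τ x => φ τ (x + b) - φ τ x)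
  have h1 : Continuous (fun p : ℝ × E3 => φ p.1 (p.2 + b)) :=
    hφ.comp (continuous_fst.prodMk (continuous_snd.add_const b))
  exact (h1.sub hφ).measurable

lemma MM_meas {s N : ℝ} {φ : ℝ → E3 → ℂ} (hφ : Continuous (fun p : ℝ × E3 => φ p.1 p.2)) :
    Measurable (fun τ => MM s N (φ τ)) := by
  unfold MM
  refine Finset.measurable_fun_sum _ fun j _ => Measurable.tsum fun k => ?_
  exact ((dl_meas hφ _).pow_const 2).const_mul _

lemma MM_int {s N T : ℝ} {φ : ℝ → E3 → ℂ} (h : Sol 0 T φ)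
    (ha : ∫⁻ τ in Set.Ioc 0 T, n6 (φ τ) ^ 4 ≤ e2 ^ 2) :
    ∫⁻ τ in Set.Ioc 0 T, MM s N (φ τ) ≤ 4 * CS ^ 2 * Ns s N (φ 0) := by
  unfold MM Ns
  have hm : ∀ (j : Fin 3) (k : ℕ), Measurable fun τ => ENNReal.ofReal (((4:ℝ)^s)^k) * n6 (fun x => φ τ (x + hk N k j) - φ τ x) ^ 2 :=
    fun j k => ((dl_meas h.cont _).pow_const 2).const_mul _
  rw [lintegral_finsetSum _ fun j _ => Measurable.tsum fun k => hm j k, Finset.mul_sum]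
  refine Finset.sum_le_sum fun j _ => ?_
  rw [lintegral_tsum fun k => (hm j k).aemeasurable, ← ENNReal.tsum_mul_left]
  refine ENNReal.tsum_le_tsum fun k => ?_
  rw [lintegral_const_mul' _ _ (by simp)]
  calc _ ≤ ENNReal.ofReal (((4:ℝ)^s)^k) * (2 * CS * n2 (fun x => φ 0 (x + hk N k j) - φ 0 x)) ^ 2 :=
        mul_le_mul_right (h.dl le_rfl ha _).1 _
    _ = _ := by ring

lemma force {s N T : ℝ} {η : ℝ → ℝ} (hη : IsCutoff s η) (hs : 1 / 2 < s) (hs1 : s < 1) (hN : 1 ≤ N)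
    {φ : ℝ → E3 → ℂ} (h : Sol 0 T φ) (ha : ∫⁻ τ in Set.Ioc 0 T, n6 (φ τ) ^ 4 ≤ e2 ^ 2)
    (hG : gr (Iop η N (φ 0)) ≤ 2) (j : Fin 3) :
    ∫⁻ τ in Set.Ioc 0 T, n2 (If η N (pd (cub (φ τ)) j)) ≤ CF s ^ (1/2:ℝ) := by
  apply pow_half_le
  set c := ENNReal.ofReal ((2 * π * N) ^ 2) with hc
  have hm6 : Measurable fun τ => n6 (φ τ) := n6_meas h.meas
  calc _ ≤ (∫⁻ τ in Set.Ioc 0 T, n6 (φ τ) ^ 2 * (144 * c * MM s N (φ τ)) ^ (1/2:ℝ)) ^ 2 := by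
        apply pow_le_pow_left'
        exact lintegral_mono fun τ => force_pt hη hs hs1 hN (h.sch τ) j
    _ ≤ (∫⁻ τ in Set.Ioc 0 T, (n6 (φ τ) ^ 2) ^ 2) * ∫⁻ τ in Set.Ioc 0 T, ((144 * c * MM s N (φ τ)) ^ (1/2:ℝ)) ^ 2 :=
        lint_cs _ (hm6.pow_const 2).aemeasurable (((MM_meas h.cont).const_mul _).pow_const _).aemeasurable
    _ = (∫⁻ τ in Set.Ioc 0 T, n6 (φ τ) ^ 4) * (144 * c * ∫⁻ τ in Set.Ioc 0 T, MM s N (φ τ)) := by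
        congr 1
        · refine lintegral_congr fun τ => by ring
        · rw [← lintegral_const_mul' (144 * c) _ (by rw [hc]; finiteness)]
          refine lintegral_congr fun τ => ?_
          rw [← ENNReal.rpow_natCast, ← ENNReal.rpow_mul]; norm_num
    _ ≤ e2 ^ 2 * (144 * c * (4 * CS ^ 2 * (3 * CU s * GI η N (φ 0)))) := by
        gcongr
        refine (MM_int h ha).trans ?_
        gcongr
        exact Ns_le hη hs hs1 hN (h.sch 0)
    _ = e2 ^ 2 * (576 * CS ^ 2 * (3 * CU s) * (c * GI η N (φ 0))) := by ring
    _ ≤ _ := by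
        rw [hc, ← gr_Iop hη hN (h.sch 0)]
        unfold CF
        gcongr

lemma If_pd (η : ℝ → ℝ) (N : ℝ) {g : E3 → ℂ} (hg : Sch g) (j : Fin 3) (ξ : E3) :
    If η N (pd g j) ξ = ((η (‖ξ‖ / N) : ℂ) * (2 * π * I * (ξ j))) * 𝓕 g ξ := by
  rw [If, hg.fourier_pd]; ring

lemma mult_cont {s : ℝ} {η : ℝ → ℝ} (h : IsCutoff s η) (N : ℝ) (j : Fin 3) :
    Continuous (fun ξ : E3 => (η (‖ξ‖ / N) : ℂ) * (2 * π * I * (ξ j))) := by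
  refine (h.symb_cont N).mul ?_
  fun_prop

lemma If_pd_meas {s : ℝ} {η : ℝ → ℝ} (h : IsCutoff s η) (N : ℝ) (j : Fin 3) {v : ℝ → E3 → ℂ} (hs : ∀ t, Sch (v t))
    (hv : Measurable (fun p : ℝ × E3 => v p.1 p.2)) :
    Measurable (fun p : ℝ × E3 => If η N (pd (v p.1) j) p.2) := by
  simp only [If_pd η N (hs _) j]
  exact ((mult_cont h N j).measurable.comp measurable_snd).mul (fourier_meas hv)

lemma comp_neg_meas {H : ℝ → E3 → ℂ} (h : Measurable (fun p : ℝ × E3 => H p.1 p.2)) :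
    Measurable (fun p : ℝ × E3 => H p.1 (-p.2)) := by
  have h2 : Measurable (fun p : ℝ × E3 => (p.1, -p.2)) := measurable_fst.prodMk measurable_snd.neg
  exact h.comp h2

lemma fourierInv_meas {G : ℝ → E3 → ℂ} (hG : Measurable (fun p : ℝ × E3 => G p.1 p.2)) :
    Measurable (fun p : ℝ × E3 => 𝓕⁻ (G p.1) p.2) := by
  simp only [Real.fourierInv_eq_fourier_neg]
  have h1 := fourier_meas hG
  exact comp_neg_meas (H := fun t => 𝓕 (G t)) h1

lemma duh_mult {t : ℝ} {v w : ℝ → E3 → ℂ} {m : E3 → ℂ}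
    (hD : (fun ξ => ph t ξ * v t ξ) =ᵐ[volume] fun ξ => ph 0 ξ * v 0 ξ - I * tint (fun s ξ => ph s ξ * w s ξ) (Set.Ioc 0 t) ξ) :
    (fun ξ => ph t ξ * (m ξ * v t ξ)) =ᵐ[volume] fun ξ => ph 0 ξ * (m ξ * v 0 ξ)
      - I * tint (fun s ξ => ph s ξ * (m ξ * w s ξ)) (Set.Ioc 0 t) ξ := by
  filter_upwards [hD] with ξ h1
  have e : tint (fun s ξ => ph s ξ * (m ξ * w s ξ)) (Set.Ioc 0 t) ξ = m ξ * tint (fun s ξ => ph s ξ * w s ξ) (Set.Ioc 0 t) ξ := by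
    unfold tint
    rw [← integral_const_mul]
    congr 1; ext s; ring
  rw [e]
  calc ph t ξ * (m ξ * v t ξ) = m ξ * (ph t ξ * v t ξ) := by ring
    _ = _ := by rw [h1]; ring

lemma If_duh {η : ℝ → ℝ} {N T : ℝ} {φ : ℝ → E3 → ℂ} (h : Sol 0 T φ) (j : Fin 3) {t : ℝ} (ht : t ∈ Set.Ioc 0 T) :
    (fun ξ => ph t ξ * If η N (pd (φ t) j) ξ) =ᵐ[volume] fun ξ => ph 0 ξ * If η N (pd (φ 0) j) ξ
      - I * tint (fun s ξ => ph s ξ * If η N (pd (cub (φ s)) j) ξ) (Set.Ioc 0 t) ξ := by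
  obtain ⟨K, hK, hb⟩ := h.unif
  have f1 : ∫⁻ s in Set.Ioc 0 T, ∫⁻ x, ‖dt φ s x‖ₑ ^ 2 ≠ ⊤ :=
    fin_of_bd hK fun s hs => (hb s ⟨hs.1.le, hs.2⟩).1
  have h1 := duh_mult (v := fun t => 𝓕 (φ t)) (w := fun s => 𝓕 (cub (φ s)))
    (m := fun ξ => (η (‖ξ‖ / N) : ℂ) * (2 * π * I * (ξ j))) (h.duh f1 ht)
  simp only [If_pd η N (h.sch _) j, If_pd η N (h.sch _).cub j]
  exact h1

/-- final size constant -/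
def ZZ (s : ℝ) : ℝ≥0∞ := 2 + CF s ^ (1/2:ℝ)

lemma ZZ_ne_top {s : ℝ} (hs1 : s < 1) : ZZ s ≠ ⊤ := by
  have := CF_ne_top hs1
  unfold ZZ; finiteness

section
variable {s N T : ℝ} {η : ℝ → ℝ} {φ : ℝ → E3 → ℂ}

lemma u_meas (hη : IsCutoff s η) (h : Sol 0 T φ) (j : Fin 3) :
    Measurable (fun p : ℝ × E3 => Iop η N (pd (φ p.1) j) p.2) := by
  simp only [Iop_eq]
  exact fourierInv_meas (G := fun t => If η N (pd (φ t) j)) (If_pd_meas hη N j h.sch h.meas)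

lemma If_cub_meas (hη : IsCutoff s η) (h : Sol 0 T φ) (j : Fin 3) :
    Measurable (fun p : ℝ × E3 => If η N (pd (cub (φ p.1)) j) p.2) :=
  If_pd_meas hη N j (v := fun t => cub (φ t)) (fun t => (h.sch t).cub) h.cub_meas

lemma init_le (hη : IsCutoff s η) (hN : 1 ≤ N) (h : Sol 0 T φ)
    (hG : gr (Iop η N (φ 0)) ≤ 2) (j : Fin 3) : n2 (If η N (pd (φ 0) j)) ≤ 2 := by
  rw [← ENNReal.pow_le_pow_left_iff two_ne_zero]
  calc _ = n2 (pd (Iop η N (φ 0)) j) ^ 2 := by rw [pd_Iop hη hN (h.sch 0), n2_Iop hη hN ((h.sch 0).pd j)]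
    _ ≤ gr (Iop η N (φ 0)) := by
        unfold gr
        exact Finset.single_le_sum (f := fun j => n2 (pd (Iop η N (φ 0)) j) ^ 2) (fun i _ => zero_le) (Finset.mem_univ j)
    _ ≤ 2 := hG
    _ ≤ 2 ^ 2 := by norm_num

lemma u_n2 (hη : IsCutoff s η) (hs : 1 / 2 < s) (hs1 : s < 1) (hN : 1 ≤ N) (h : Sol 0 T φ)
    (ha : ∫⁻ τ in Set.Ioc 0 T, n6 (φ τ) ^ 4 ≤ e2 ^ 2) (hG : gr (Iop η N (φ 0)) ≤ 2) (j : Fin 3)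
    {t : ℝ} (ht : t ∈ Set.Ioc 0 T) : n2 (Iop η N (pd (φ t) j)) ≤ ZZ s := by
  rw [n2_Iop hη hN ((h.sch t).pd j)]
  have h1 := duhamel_l2 (uh := fun t => If η N (pd (φ t) j)) (gh := fun s => If η N (pd (cub (φ s)) j))
    (fun t => If_memLp hη hN ((h.sch t).pd j)) (If_cub_meas hη h j)
    (If_duh h j ht)
  refine h1.trans (add_le_add (init_le hη hN h hG j) ?_)
  exact (lintegral_mono_set (Set.Ioc_subset_Ioc le_rfl ht.2)).trans (force hη hs hs1 hN h ha hG j)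

lemma u_n6 (hη : IsCutoff s η) (hs : 1 / 2 < s) (hs1 : s < 1) (hN : 1 ≤ N) (h : Sol 0 T φ)
    (ha : ∫⁻ τ in Set.Ioc 0 T, n6 (φ τ) ^ 4 ≤ e2 ^ 2) (hG : gr (Iop η N (φ 0)) ≤ 2) (j : Fin 3) :
    ∫⁻ t in Set.Ioc 0 T, n6 (Iop η N (pd (φ t) j)) ^ 2 ≤ CB * ZZ s ^ 2 := by
  have h1 := strichartz (t1 := 0) (t2 := T) (u := fun t => Iop η N (pd (φ t) j))
    (uh := fun t => If η N (pd (φ t) j)) (gh := fun s => If η N (pd (cub (φ s)) j))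
    (u_meas hη h j) (fun t => If_int hη hN ((h.sch t).pd j))
    (fun t => If_memLp hη hN ((h.sch t).pd j)) (fun t => rfl)
    (If_cub_meas hη h j)
    (fun t => If_memLp hη hN ((h.sch t).cub.pd j)) (fun t ht => If_duh h j ht)
  simp only [n6_sq] at h1
  refine h1.trans (mul_le_mul_right (pow_le_pow_left' (add_le_add (init_le hη hN h hG j) ?_) 2) _)
  exact force hη hs hs1 hN h ha hG j
end

lemma adm_cases {q r : ℝ≥0∞} (h : SAdmissible q r) : (q = ⊤ ∧ r = 2) ∨
    (q ≠ ⊤ ∧ r ≠ ⊤ ∧ 2 ≤ q.toReal ∧ 2 < r.toReal ∧ r.toReal ≤ 6 ∧ q.toReal * (3 * (r.toReal - 2)) = 4 * r.toReal) := by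
  obtain ⟨h1, h2, h3⟩ := h
  have hr : r ≠ ⊤ := by
    rintro rfl
    have : (1:ℝ≥0∞) / q ≤ 1 / 2 := ENNReal.div_le_div_left h1 1
    simp only [ENNReal.mul_top (two_ne_zero : (2:ℝ≥0∞) ≠ 0), ENNReal.div_top, add_zero] at h3
    rw [h3] at this
    have h4 := ENNReal.toReal_mono (by finiteness) this
    norm_num [ENNReal.toReal_div] at h4
  have hr2 : 2 ≤ r.toReal := by simpa using ENNReal.toReal_mono hr h2
  have hr0 : r ≠ 0 := by rintro rfl; simp at h2
  have hq0 : q ≠ 0 := by rintro rfl; simp at h1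
  have h4 := congrArg ENNReal.toReal h3
  have f1 : (1:ℝ≥0∞) / q ≠ ⊤ := ENNReal.div_ne_top (by simp) hq0
  have f2 : (3:ℝ≥0∞) / (2 * r) ≠ ⊤ := ENNReal.div_ne_top (by simp) (mul_ne_zero two_ne_zero hr0)
  rw [ENNReal.toReal_add f1 f2] at h4
  simp only [ENNReal.toReal_div, ENNReal.toReal_mul, ENNReal.toReal_one, ENNReal.toReal_ofNat] at h4
  by_cases hq : q = ⊤
  · left
    refine ⟨hq, ?_⟩
    subst hq
    simp only [ENNReal.toReal_top, div_zero, zero_add] at h4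
    rw [← ENNReal.ofReal_toReal hr]
    have : r.toReal = 2 := by
      field_simp at h4; linarith
    rw [this]; simp
  · right
    have hq2 : 2 ≤ q.toReal := by simpa using ENNReal.toReal_mono hq h1
    refine ⟨hq, hr, hq2, ?_⟩
    generalize q.toReal = a at *
    generalize r.toReal = b at *
    have e : a * (3 * (b - 2)) = 4 * b := by field_simp at h4; linarith
    refine ⟨?_, ?_, e⟩
    · by_contra hb
      have : b = 2 := by linarith
      subst this; linarith
    · nlinarith

lemma interp {q r : ℝ≥0∞} {G : E3 → ℝ} (hG : AEStronglyMeasurable G volume) (hr : r ≠ ⊤)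
    (hq2 : 2 ≤ q.toReal) (hr2 : 2 < r.toReal) (hr6 : r.toReal ≤ 6) (e : q.toReal * (3 * (r.toReal - 2)) = 4 * r.toReal) :
    eLpNorm G r volume ^ q.toReal ≤ eLpNorm G 2 volume ^ (q.toReal - 2) * eLpNorm G 6 volume ^ 2 := by
  have hr0 : r ≠ 0 := by rintro rfl; simp at hr2; linarith
  rw [eLpNorm_eq_lintegral_rpow_enorm_toReal hr0 hr, eLpNorm_eq_lintegral_rpow_enorm_toReal two_ne_zero (by simp),
    eLpNorm_eq_lintegral_rpow_enorm_toReal (by norm_num) (by simp)]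
  simp only [ENNReal.toReal_ofNat]
  generalize q.toReal = a at *
  generalize r.toReal = b at *
  have hb0 : b ≠ 0 := by linarith
  have hm : AEMeasurable (fun x => ‖G x‖ₑ) volume := hG.enorm
  have h1 := ENNReal.lintegral_mul_norm_pow_le (μ := volume) (hm.pow_const (2:ℝ)) (hm.pow_const (6:ℝ))
    (p := (6 - b) / 4) (q := (b - 2) / 4) (by linarith) (by linarith) (by ring)
  have h2 : ∀ x, (‖G x‖ₑ ^ (2:ℝ)) ^ ((6 - b) / 4) * (‖G x‖ₑ ^ (6:ℝ)) ^ ((b - 2) / 4) = ‖G x‖ₑ ^ b := by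
    intro x
    rw [← ENNReal.rpow_mul, ← ENNReal.rpow_mul, ← ENNReal.rpow_add_of_nonneg _ _ (by linarith) (by linarith)]
    congr 1; ring
  simp only [h2] at h1
  rw [← ENNReal.rpow_mul]
  have ha : 1 / b * a = 4 / (3 * (b - 2)) := by
    have : b - 2 ≠ 0 := by linarith
    field_simp; linarith
  refine (ENNReal.rpow_le_rpow h1 (by positivity)).trans (le_of_eq ?_)
  rw [ENNReal.mul_rpow_of_nonneg _ _ (by positivity), ← ENNReal.rpow_natCast, ← ENNReal.rpow_mul, ← ENNReal.rpow_mul,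
    ← ENNReal.rpow_mul, ← ENNReal.rpow_mul]
  have e1 : (6 - b) / 4 * (1 / b * a) = 1 / 2 * (a - 2) := by
    have h3 : b - 2 ≠ 0 := by linarith
    have : a = 4 * b / (3 * (b - 2)) := by field_simp; linarith
    rw [ha, this]; field_simp; ring
  have e2 : (b - 2) / 4 * (1 / b * a) = 1 / 6 * ((2:ℕ):ℝ) := by
    have h3 : b - 2 ≠ 0 := by linarith
    rw [ha]; push_cast; field_simp; norm_num
  rw [e1, e2]

lemma gradNorm_le {g : E3 → ℂ} (hc : ∀ j, Continuous (pd g j)) {p : ℝ≥0∞} (hp : 1 ≤ p) :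
    eLpNorm (gradNorm g) p volume ≤ ∑ j : Fin 3, eLpNorm (pd g j) p volume := by
  calc _ ≤ eLpNorm (∑ j : Fin 3, fun x => ‖pd g j x‖) p volume := by
        apply eLpNorm_mono_real
        intro x
        rw [gradNorm, Real.norm_of_nonneg (Real.sqrt_nonneg _), Finset.sum_apply]
        apply Real.sqrt_le_iff.2
        refine ⟨Finset.sum_nonneg fun i _ => norm_nonneg _, ?_⟩
        simp only [Complex.normSq_eq_norm_sq]
        exact Finset.sum_sq_le_sq_sum_of_nonneg fun i _ => norm_nonneg _
    _ ≤ ∑ j : Fin 3, eLpNorm (fun x => ‖pd g j x‖) p volume :=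
        eLpNorm_sum_le (fun j _ => (hc j).norm.aestronglyMeasurable) hp
    _ = _ := by simp only [eLpNorm_norm]

lemma gradNorm_meas {g : E3 → ℂ} (hc : ∀ j, Continuous (pd g j)) : AEStronglyMeasurable (gradNorm g) volume := by
  have : Continuous (gradNorm g) := by
    unfold gradNorm
    refine Real.continuous_sqrt.comp (continuous_finsetSum _ fun j _ => ?_)
    exact Complex.continuous_normSq.comp (hc j)
  exact this.aestronglyMeasurable

lemma enorm_toReal_le' (a : ℝ≥0∞) : ‖a.toReal‖ₑ ≤ a := by
  rw [Real.enorm_eq_ofReal ENNReal.toReal_nonneg]; exact ENNReal.ofReal_toReal_le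

/-- abstract interpolation of the mixed norms -/
lemma LqLr_le {q r : ℝ≥0∞} (h : SAdmissible q r) {T : ℝ} {G : ℝ → E3 → ℝ} {a b W : ℝ≥0∞} {B : ℝ → ℝ≥0∞}
    (hG : ∀ t, AEStronglyMeasurable (G t) volume)
    (h2 : ∀ t ∈ Set.Ioc 0 T, eLpNorm (G t) 2 volume ≤ a)
    (h6 : ∀ t, eLpNorm (G t) 6 volume ≤ B t) (hB : ∫⁻ t in Set.Ioc 0 T, B t ^ 2 ≤ b)
    (hW1 : 1 ≤ W) (ha : a ≤ W) (hb : b ≤ W) (hWt : W ≠ ⊤) : LqLr q r T G ≤ W := by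
  unfold LqLr
  rw [Measure.restrict_congr_set (Ioc_ae_eq_Icc (a := (0:ℝ)) (b := T) (μ := volume)).symm]
  rcases adm_cases h with ⟨rfl, rfl⟩ | ⟨hq, hr, hq2, hr2, hr6, e⟩
  · rw [eLpNorm_exponent_top]
    refine eLpNormEssSup_le_of_ae_enorm_bound ?_
    filter_upwards [ae_restrict_mem measurableSet_Ioc] with t ht
    exact (enorm_toReal_le' _).trans ((h2 t ht).trans ha)
  · have hq0 : q ≠ 0 := by rintro rfl; simp at hq2; linarith
    have hW0 : W ≠ 0 := (lt_of_lt_of_le zero_lt_one hW1).ne'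
    rw [eLpNorm_eq_lintegral_rpow_enorm_toReal hq0 hq]
    have key : ∫⁻ t in Set.Ioc 0 T, ‖(eLpNorm (G t) r volume).toReal‖ₑ ^ q.toReal ≤ W ^ q.toReal := by
      calc _ ≤ ∫⁻ t in Set.Ioc 0 T, W ^ (q.toReal - 2) * B t ^ 2 := by
            refine lintegral_mono_ae ?_
            filter_upwards [ae_restrict_mem measurableSet_Ioc] with t ht
            refine (ENNReal.rpow_le_rpow (enorm_toReal_le' _) (by linarith)).trans ((interp (hG t) hr hq2 hr2 hr6 e).trans ?_)
            exact mul_le_mul' (ENNReal.rpow_le_rpow ((h2 t ht).trans ha) (by linarith)) (pow_le_pow_left' (h6 t) 2)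
        _ = W ^ (q.toReal - 2) * ∫⁻ t in Set.Ioc 0 T, B t ^ 2 :=
            lintegral_const_mul' _ _ (ENNReal.rpow_ne_top_of_nonneg (by linarith) hWt)
        _ ≤ W ^ (q.toReal - 2) * W ^ (2:ℝ) := by
            refine mul_le_mul_right ((hB.trans hb).trans ?_) _
            calc W = W * 1 := (mul_one _).symm
              _ ≤ W * W := mul_le_mul_right hW1 _
              _ = _ := by rw [ENNReal.rpow_two, sq]
        _ = _ := by rw [← ENNReal.rpow_add _ _ hW0 hWt]; congr 1; ring
    calc _ ≤ (W ^ q.toReal) ^ (1 / q.toReal) := ENNReal.rpow_le_rpow key (by positivity)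
      _ = W := by
        rw [← ENNReal.rpow_mul, mul_one_div_cancel (by linarith), ENNReal.rpow_one]

/-- final constant -/
def WW (s : ℝ) : ℝ≥0∞ := 1 + (3 * ZZ s + 10 * (CB * ZZ s ^ 2))

lemma WW_ne_top {s : ℝ} (hs1 : s < 1) : WW s ≠ ⊤ := by
  have := ZZ_ne_top hs1
  have := CB_ne_top
  unfold WW; finiteness

section
variable {s N T : ℝ} {η : ℝ → ℝ} {φ : ℝ → E3 → ℂ}

lemma final_bd (hη : IsCutoff s η) (hs : 1 / 2 < s) (hs1 : s < 1) (hN : 1 ≤ N) (h : Sol 0 T φ)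
    (ha : ∫⁻ τ in Set.Ioc 0 T, n6 (φ τ) ^ 4 ≤ e2 ^ 2) (hG : gr (Iop η N (φ 0)) ≤ 2)
    {q r : ℝ≥0∞} (hadm : SAdmissible q r) :
    LqLr q r T (fun t x => gradNorm (Iop η N (φ t)) x) ≤ WW s := by
  have hc : ∀ t j, Continuous (pd (Iop η N (φ t)) j) := fun t j => by
    rw [pd_Iop hη hN (h.sch t)]; exact Iop_cont hη hN ((h.sch t).pd j)
  have hm : ∀ j, Measurable fun t => n6 (Iop η N (pd (φ t) j)) := fun j =>
    n6_meas (v := fun t => Iop η N (pd (φ t) j)) (u_meas hη h j)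
  have hI := u_n6 hη hs hs1 hN h ha hG
  refine LqLr_le (a := 3 * ZZ s) (b := 10 * (CB * ZZ s ^ 2)) (B := fun t => ∑ j : Fin 3, n6 (Iop η N (pd (φ t) j))) hadm
    (fun t => gradNorm_meas (hc t)) ?_ ?_ ?_ le_self_add ?_ ?_ (WW_ne_top hs1)
  · intro t ht
    refine (gradNorm_le (hc t) (by norm_num)).trans ?_
    calc _ ≤ ∑ j : Fin 3, ZZ s := by
          refine Finset.sum_le_sum fun j _ => ?_
          rw [pd_Iop hη hN (h.sch t), ← n2_eq]
          exact u_n2 hη hs hs1 hN h ha hG j ht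
      _ = _ := by simp
  · intro t
    refine (gradNorm_le (hc t) (by norm_num)).trans (le_of_eq ?_)
    refine Finset.sum_congr rfl fun j _ => ?_
    rw [pd_Iop hη hN (h.sch t), ← n6_eq]
  · calc _ ≤ ∫⁻ t in Set.Ioc 0 T, (4 * n6 (Iop η N (pd (φ t) 0)) ^ 2 + (4 * n6 (Iop η N (pd (φ t) 1)) ^ 2
            + 2 * n6 (Iop η N (pd (φ t) 2)) ^ 2)) := by
          refine lintegral_mono fun t => ?_
          dsimp only
          rw [Fin.sum_univ_three]
          refine (sq_add_le' _ _).trans ?_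
          calc _ ≤ 2 * (2 * (n6 (Iop η N (pd (φ t) 0)) ^ 2 + n6 (Iop η N (pd (φ t) 1)) ^ 2) + n6 (Iop η N (pd (φ t) 2)) ^ 2) :=
                mul_le_mul_right (add_le_add_left (sq_add_le' _ _) _) _
            _ = _ := by ring
      _ = 4 * (∫⁻ t in Set.Ioc 0 T, n6 (Iop η N (pd (φ t) 0)) ^ 2) + (4 * (∫⁻ t in Set.Ioc 0 T, n6 (Iop η N (pd (φ t) 1)) ^ 2)
            + 2 * ∫⁻ t in Set.Ioc 0 T, n6 (Iop η N (pd (φ t) 2)) ^ 2) := by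
          rw [lintegral_add_left (((hm 0).pow_const 2).const_mul _), lintegral_add_left (((hm 1).pow_const 2).const_mul _),
            lintegral_const_mul' _ _ (by simp), lintegral_const_mul' _ _ (by simp), lintegral_const_mul' _ _ (by simp)]
      _ ≤ 4 * (CB * ZZ s ^ 2) + (4 * (CB * ZZ s ^ 2) + 2 * (CB * ZZ s ^ 2)) :=
          add_le_add (mul_le_mul_right (hI 0) _) (add_le_add (mul_le_mul_right (hI 1) _) (mul_le_mul_right (hI 2) _))
      _ = _ := by ring
  · unfold WW; exact le_add_left le_self_add
  · unfold WW; exact le_add_left le_add_self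
end

lemma q4_toReal {g : E3 → ℂ} (h : Sch g) : ∫ x, ‖g x‖ ^ 4 = (q4 g).toReal := by
  have hc := h.continuous
  rw [integral_eq_lintegral_of_nonneg_ae (Eventually.of_forall fun x => by positivity)
    (by fun_prop : Continuous fun x => ‖g x‖ ^ 4).aestronglyMeasurable, q4]
  congr 1
  refine lintegral_congr fun x => ?_
  rw [ENNReal.ofReal_pow (norm_nonneg _), ofReal_norm]

lemma q4_time {T : ℝ} (hT : 0 < T) {φ : ℝ → E3 → ℂ} (h : Sol 0 T φ) :
    ∫⁻ τ in Set.Ioc 0 T, q4 (φ τ) = ENNReal.ofReal (∫ t in (0:ℝ)..T, ∫ x : E3, ‖φ t x‖ ^ 4) := by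
  obtain ⟨K, hK, hb⟩ := h.unif
  have hm : Measurable fun τ => q4 (φ τ) := by
    unfold q4
    exact (h.meas.enorm.pow_const 4).lintegral_prod_right'
  have hle : ∀ t ∈ Set.Ioc 0 T, q4 (φ t) ≤ 4 * K := by
    intro t ht
    have h1 : (1/4) * q4 (φ t) ≤ K := le_trans le_add_self (hb t ⟨ht.1.le, ht.2⟩).2
    calc q4 (φ t) = 4 * ((1/4) * q4 (φ t)) := by
          rw [← mul_assoc, one_div, ENNReal.mul_inv_cancel (by norm_num) (by norm_num), one_mul]
      _ ≤ _ := mul_le_mul_right h1 _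
  have hfin : ∫⁻ τ in Set.Ioc 0 T, q4 (φ τ) ≠ ⊤ := by
    refine ne_top_of_le_ne_top ?_ (setLIntegral_mono measurable_const hle)
    rw [lintegral_const, Measure.restrict_apply_univ, Real.volume_Ioc]
    finiteness
  rw [intervalIntegral.integral_of_le hT.le]
  simp only [q4_toReal (h.sch _)]
  rw [integral_toReal hm.aemeasurable (Eventually.of_forall fun t => (q4_ne_top (h.sch t)).lt_top), ENNReal.ofReal_toReal hfin]

theorem modified_local_theory
    (s : ℝ) (hs : 1/2 < s) (hs1 : s < 1) (η : ℝ → ℝ) (hη : IsCutoff s η) :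
    ∃ δ > (0:ℝ), ∃ N₀ ≥ (1:ℝ), ∃ C > (0:ℝ), ∀ N ≥ N₀, ∀ T > (0:ℝ),
      ∀ φ : ℝ → E3 → ℂ, IsSolution 1 1 (fun z => z) T φ →
      energyE (Iop η N (φ 0)) ≤ 1 →
      (∫ t in (0:ℝ)..T, ∫ x : E3, ‖φ t x‖ ^ 4) ^ ((1:ℝ)/4) ≤ δ →
      ∀ q r : ℝ≥0∞, SAdmissible q r →
        LqLr q r T (fun t x => gradNorm (Iop η N (φ t)) x) ≤ ENNReal.ofReal C := by
  obtain ⟨D, hD0, hD⟩ := exists_boot hs hs1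
  obtain ⟨δ, hδ0, hδ⟩ : ∃ δ : ℝ, 0 < δ ∧ ENNReal.ofReal (δ ^ 4) ≤ D := by
    have h1 : Tendsto (fun δ : ℝ => ENNReal.ofReal (δ ^ 4)) (nhdsWithin 0 (Set.Ioi 0)) (nhds 0) := by
      have h2 : Continuous fun δ : ℝ => ENNReal.ofReal (δ ^ 4) :=
        ENNReal.continuous_ofReal.comp (continuous_pow 4)
      have h3 := h2.tendsto 0
      simp only [ne_eq, OfNat.ofNat_ne_zero, not_false_eq_true, zero_pow, ENNReal.ofReal_zero] at h3
      exact h3.mono_left nhdsWithin_le_nhds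
    obtain ⟨δ, h3, h4⟩ := ((h1.eventually (ge_mem_nhds (pos_iff_ne_zero.2 hD0))).and self_mem_nhdsWithin).exists
    exact ⟨δ, h4, h3⟩
  have hW := WW_ne_top hs1
  have hW1 : 1 ≤ WW s := le_self_add
  refine ⟨δ, hδ0, 1, le_rfl, (WW s).toReal, ENNReal.toReal_pos (lt_of_lt_of_le zero_lt_one hW1).ne' hW, ?_⟩
  intro N hN T hT φ hφ hE h4 q r hadm
  rw [ENNReal.ofReal_toReal hW]
  have h := hφ.sol
  have hG := energy_GI hη hN (h.sch 0) hE
  refine final_bd hη hs hs1 hN h (hD η hη N hN T hT φ h hG ?_) hG hadm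
  rw [q4_time hT h]
  refine le_trans (ENNReal.ofReal_le_ofReal ?_) hδ
  have hnn : 0 ≤ ∫ t in (0:ℝ)..T, ∫ x : E3, ‖φ t x‖ ^ 4 :=
    intervalIntegral.integral_nonneg hT.le fun t _ => integral_nonneg fun x => by positivity
  generalize (∫ t in (0:ℝ)..T, ∫ x : E3, ‖φ t x‖ ^ 4) = J at *
  calc J = (J ^ ((1:ℝ)/4)) ^ 4 := by rw [← Real.rpow_natCast, ← Real.rpow_mul hnn]; norm_num
    _ ≤ δ ^ 4 := pow_le_pow_left₀ (Real.rpow_nonneg hnn _) h4 4
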